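/- Let ℝ_+=(0,∞) and let a=(a_ij) be a continuous map from [0,T]×ℝ_+^d into the symmetric positive definite d×d matrices such that each a_ij is bounded and locally Hölder continuous on [0,T)×ℝ_+^d. Let f∈C(ℝ_+^d) satisfy |f(x)| ≤ c₀(1+|x|^p) for some constants c₀,p>0. Then the terminal-value problem (TVP^+) — v∈C^{1,2}([0,T)×ℝ_+^d)∩C([0,T]×ℝ_+^d), ∂v/∂t + ℒ^+v = 0 on [0,T)×ℝ_+^d, v(T,x)=f(x) for x∈ℝ_+^d — admits a unique solution v within the class of functions of at most polynomial growth uniformly in t (i.e., |v(t,x)| ≤ C(1+|x|^q) for some C,q>0 and all (t,x)). -/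

import Mathlib

open Finset Filter Topology Set

noncomputable section

/-- The successor `s'` of `s` in the partition `P` of `[0,T]` (equal to `T` if there is none). -/
def succOf (T : ℝ) (P : Finset ℝ) (s : ℝ) : ℝ :=
  if h : (P.filter (fun u => s < u)).Nonempty then (P.filter (fun u => s < u)).min' h else T

/-- A refining sequence of partitions of `[0,T]` whose meshes tend to zero. -/
structure PartitionSeq (T : ℝ) where
  part : ℕ → Finset ℝ
  subset_Icc : ∀ n, ↑(part n) ⊆ Set.Icc (0 : ℝ) T
  zero_mem : ∀ n, (0 : ℝ) ∈ part n
  top_mem : ∀ n, T ∈ part n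
  refining : ∀ n, part n ⊆ part (n + 1)
  mesh_to_zero : ∀ ε > 0, ∃ N, ∀ n ≥ N, ∀ s ∈ part n, succOf T (part n) s - s < ε
/-- Approximating sums for the covariation `⟨S_i,S_j⟩(t)` along the `n`-th partition. -/
def covSum (T : ℝ) (𝕋 : PartitionSeq T) {d : ℕ} (S : ℝ → Fin d → ℝ) (i j : Fin d)
    (t : ℝ) (n : ℕ) : ℝ :=
  ∑ s ∈ (𝕋.part n).filter (fun s => s ≤ t),
    (S (succOf T (𝕋.part n) s) i - S s i) * (S (succOf T (𝕋.part n) s) j - S s j)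

/-- The Föllmer integral `∫_r^t ξ(s)·dS(s)` exists along `(𝕋_n)` with value `I`. -/
def HasFollmerIntegral (T : ℝ) (𝕋 : PartitionSeq T) {d : ℕ} (ξ S : ℝ → Fin d → ℝ)
    (r t I : ℝ) : Prop :=
  Tendsto (fun n => ∑ s ∈ (𝕋.part n).filter (fun s => r ≤ s ∧ s ≤ t),
    ∑ k, ξ s k * (S (succOf T (𝕋.part n) s) k - S s k)) atTop (𝓝 I)

/-- The open positive orthant `ℝ_+^d`. -/
def posOrth (d : ℕ) : Set (Fin d → ℝ) := {x | ∀ i, 0 < x i}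

/-- The class `𝒮_a`: continuous trajectories whose covariations are `∫_0^t a_ij(s,S(s)) ds`. -/
def SclassA (T : ℝ) (𝕋 : PartitionSeq T) {d : ℕ}
    (a : ℝ → (Fin d → ℝ) → Fin d → Fin d → ℝ) : Set (ℝ → Fin d → ℝ) :=
  {S | ContinuousOn S (Set.Icc 0 T) ∧
    ∀ i j : Fin d, ∀ t ∈ Set.Icc (0 : ℝ) T,
      Tendsto (fun n => covSum T 𝕋 S i j t n) atTop (𝓝 (∫ s in (0 : ℝ)..t, a s (S s) i j))}

/-- The class `𝒮_a^+`: positive continuous trajectories whose covariations are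
`∫_0^t a_ij(s,S(s)) S_i(s) S_j(s) ds`. -/
def SclassAPos (T : ℝ) (𝕋 : PartitionSeq T) {d : ℕ}
    (a : ℝ → (Fin d → ℝ) → Fin d → Fin d → ℝ) : Set (ℝ → Fin d → ℝ) :=
  {S | ContinuousOn S (Set.Icc 0 T) ∧ (∀ t ∈ Set.Icc (0 : ℝ) T, ∀ i, 0 < S t i) ∧
    ∀ i j : Fin d, ∀ t ∈ Set.Icc (0 : ℝ) T,
      Tendsto (fun n => covSum T 𝕋 S i j t n) atTop
        (𝓝 (∫ s in (0 : ℝ)..t, a s (S s) i j * S s i * S s j))}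

/-- First partial derivative in the `i`-th space direction. -/
def pd1 {d : ℕ} (f : (Fin d → ℝ) → ℝ) (i : Fin d) (x : Fin d → ℝ) : ℝ :=
  fderiv ℝ f x (Pi.single i 1)

/-- Second partial derivative in the space directions `i, j`. -/
def pd2 {d : ℕ} (f : (Fin d → ℝ) → ℝ) (i j : Fin d) (x : Fin d → ℝ) : ℝ :=
  fderiv ℝ (fun y => pd1 f j y) x (Pi.single i 1)

/-- Time derivative (within the time interval `I`). -/
def tderiv {d : ℕ} (I : Set ℝ) (v : ℝ → (Fin d → ℝ) → ℝ) (t : ℝ) (x : Fin d → ℝ) : ℝ :=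
  derivWithin (fun τ => v τ x) I t

/-- `v` is of class `C^{1,2}(I × D)`: continuous on `I × D`, continuously differentiable in
`(t,x)` and twice continuously differentiable in `x` on `(int I) × D`, with all derivatives
admitting continuous extensions to `I × D`. -/
structure IsC12 {d : ℕ} (I : Set ℝ) (D : Set (Fin d → ℝ)) (v : ℝ → (Fin d → ℝ) → ℝ) : Prop where
  cont : ContinuousOn (fun p : ℝ × (Fin d → ℝ) => v p.1 p.2) (I ×ˢ D)
  diff : ∀ t ∈ interior I, ∀ x ∈ D,
    DifferentiableAt ℝ (fun p : ℝ × (Fin d → ℝ) => v p.1 p.2) (t, x)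
  diff2 : ∀ t ∈ interior I, ∀ x ∈ D, ∀ j : Fin d, DifferentiableAt ℝ (pd1 (v t) j) x
  derivs_extend : ∃ (gt : ℝ × (Fin d → ℝ) → ℝ) (gx : Fin d → ℝ × (Fin d → ℝ) → ℝ)
      (gxx : Fin d → Fin d → ℝ × (Fin d → ℝ) → ℝ),
    ContinuousOn gt (I ×ˢ D) ∧ (∀ i, ContinuousOn (gx i) (I ×ˢ D)) ∧
    (∀ i j, ContinuousOn (gxx i j) (I ×ˢ D)) ∧
    ∀ t ∈ interior I, ∀ x ∈ D,
      gt (t, x) = deriv (fun τ => v τ x) t ∧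
      (∀ i, gx i (t, x) = pd1 (v t) i x) ∧
      ∀ i j, gxx i j (t, x) = pd2 (v t) i j x

/-- Local Hölder continuity on a set. -/
def LocallyHolderOn {E : Type*} [PseudoMetricSpace E] (f : E → ℝ) (s : Set E) : Prop :=
  ∀ p ∈ s, ∃ U ∈ 𝓝[s] p, ∃ α C : ℝ, 0 < α ∧ α ≤ 1 ∧ 0 ≤ C ∧
    ∀ q ∈ U, ∀ q' ∈ U, |f q - f q'| ≤ C * dist q q' ^ α

section Calculus

/-- Space-time `ℝ × ℝ^d`. -/
abbrev TX (d : ℕ) := ℝ × (Fin d → ℝ)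

/-- The unit time direction. -/
def et {d : ℕ} : TX d := (1, 0)

/-- The `i`-th unit space direction. -/
def ex {d : ℕ} (i : Fin d) : TX d := (0, Pi.single i 1)

/-- Continuous functions on space-time, bounded by `M` and `α`-Hölder in space with constant `M`. -/
structure HB {d : ℕ} (α M : ℝ) (g : TX d → ℝ) : Prop where
  cont : Continuous g
  bdd : ∀ z, |g z| ≤ M
  hol : ∀ t x y, |g (t, x) - g (t, y)| ≤ M * ‖x - y‖ ^ α

namespace HB

variable {d : ℕ} {α M N : ℝ} {g h : TX d → ℝ}

lemma nonneg (hg : HB α M g) : 0 ≤ M := (abs_nonneg _).trans (hg.bdd 0)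

lemma mono (hg : HB α M g) (hMN : M ≤ N) : HB α N g :=
  ⟨hg.cont, fun z => (hg.bdd z).trans hMN, fun t x y => (hg.hol t x y).trans (by gcongr)⟩

lemma add (hg : HB α M g) (hh : HB α N h) : HB α (M + N) (fun z => g z + h z) := by
  refine ⟨hg.cont.add hh.cont, fun z => (abs_add_le _ _).trans (add_le_add (hg.bdd z) (hh.bdd z)),
    fun t x y => ?_⟩
  have := abs_add_le (g (t, x) - g (t, y)) (h (t, x) - h (t, y))
  have h1 := hg.hol t x y
  have h2 := hh.hol t x y
  rw [show g (t, x) + h (t, x) - (g (t, y) + h (t, y))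
    = (g (t, x) - g (t, y)) + (h (t, x) - h (t, y)) by ring]
  linarith

lemma const_mul (c : ℝ) (hg : HB α M g) : HB α (|c| * M) (fun z => c * g z) := by
  refine ⟨continuous_const.mul hg.cont, fun z => ?_, fun t x y => ?_⟩
  · rw [abs_mul]; exact mul_le_mul_of_nonneg_left (hg.bdd z) (abs_nonneg _)
  · rw [← mul_sub, abs_mul, mul_assoc]
    exact mul_le_mul_of_nonneg_left (hg.hol t x y) (abs_nonneg _)

lemma neg (hg : HB α M g) : HB α M (fun z => - g z) := by
  simpa using hg.const_mul (-1)

lemma sub (hg : HB α M g) (hh : HB α N h) : HB α (M + N) (fun z => g z - h z) := by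
  simpa [sub_eq_add_neg] using hg.add hh.neg

lemma mul (hg : HB α M g) (hh : HB α N h) : HB α (2 * M * N) (fun z => g z * h z) := by
  have hM := hg.nonneg
  have hN := hh.nonneg
  refine ⟨hg.cont.mul hh.cont, fun z => ?_, fun t x y => ?_⟩
  · rw [abs_mul]
    have := mul_le_mul (hg.bdd z) (hh.bdd z) (abs_nonneg _) hM
    nlinarith [mul_nonneg hM hN]
  · rw [show g (t, x) * h (t, x) - g (t, y) * h (t, y)
      = g (t, x) * (h (t, x) - h (t, y)) + (g (t, x) - g (t, y)) * h (t, y) by ring]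
    refine (abs_add_le _ _).trans ?_
    rw [abs_mul, abs_mul]
    have hp : 0 ≤ ‖x - y‖ ^ α := by positivity
    have h1 := mul_le_mul (hg.bdd (t, x)) (hh.hol t x y) (abs_nonneg _) hM
    have h2 := mul_le_mul (hg.hol t x y) (hh.bdd (t, y)) (abs_nonneg _) (by positivity)
    nlinarith

lemma const (c : ℝ) : HB (d := d) α |c| (fun _ => c) :=
  ⟨continuous_const, fun _ => le_rfl, fun t x y => by simp; positivity⟩

lemma sum {ι : Type*} (s : Finset ι) {M : ι → ℝ} {g : ι → TX d → ℝ}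
    (hg : ∀ i ∈ s, HB α (M i) (g i)) : HB α (∑ i ∈ s, M i) (fun z => ∑ i ∈ s, g i z) := by
  classical
  induction s using Finset.induction_on with
  | empty => simpa using HB.const (d := d) 0
  | insert a s ha ih =>
    simp only [Finset.sum_insert ha]
    exact (hg a (by simp)).add (ih fun i hi => hg i (by simp [hi]))

lemma of_lip {ν : ℝ} (hα : 0 < α) (hα' : α ≤ 1 / 2) (hν : 0 < ν) (hν1 : ν ≤ 1)
    (hc : Continuous g) (hM : ∀ z, |g z| ≤ M)
    (hN : ∀ t x y, |g (t, x) - g (t, y)| ≤ N * ‖x - y‖) :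
    HB α (M + |N| * ν + 2 * M / ν) g := by
  have hM0 : 0 ≤ M := (abs_nonneg _).trans (hM 0)
  have hN0 := abs_nonneg N
  refine ⟨hc, fun z => (hM z).trans ?_, fun t x y => ?_⟩
  · have : 0 ≤ |N| * ν + 2 * M / ν := by positivity
    linarith
  set δ := ‖x - y‖ with hδ
  have hδ0 : 0 ≤ δ := norm_nonneg _
  have hp : 0 ≤ δ ^ α := by positivity
  by_cases hle : δ ≤ ν ^ 2
  · have h1 : |g (t, x) - g (t, y)| ≤ |N| * δ := (hN t x y).trans (by gcongr; exact le_abs_self N)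
    have h2 : δ ≤ ν * δ ^ α := by
      rcases hδ0.eq_or_lt with h0 | h0
      · rw [← h0]; positivity
      · have : δ = δ ^ (1 - α) * δ ^ α := by
          rw [← Real.rpow_add h0]; simp
        nth_rewrite 1 [this]
        gcongr
        calc δ ^ (1 - α) ≤ (ν ^ 2) ^ (1 - α) := by
              apply Real.rpow_le_rpow hδ0 hle; linarith
          _ = ν ^ (2 * (1 - α)) := by
              rw [← Real.rpow_natCast, ← Real.rpow_mul hν.le]; norm_num
          _ ≤ ν ^ (1 : ℝ) := Real.rpow_le_rpow_of_exponent_ge hν hν1 (by linarith)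
          _ = ν := Real.rpow_one _
    calc _ ≤ |N| * δ := h1
      _ ≤ |N| * (ν * δ ^ α) := by gcongr
      _ = (|N| * ν) * δ ^ α := by ring
      _ ≤ _ := by
        gcongr
        have : 0 ≤ 2 * M / ν := by positivity
        linarith
  · push Not at hle
    have h1 : |g (t, x) - g (t, y)| ≤ 2 * M := by
      have := abs_sub (g (t, x)) (g (t, y))
      linarith [hM (t, x), hM (t, y)]
    have h2 : ν ≤ δ ^ α := by
      calc ν = ν ^ (1 : ℝ) := (Real.rpow_one _).symm
        _ ≤ ν ^ (2 * α) := Real.rpow_le_rpow_of_exponent_ge hν hν1 (by linarith)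
        _ = (ν ^ 2) ^ α := by rw [← Real.rpow_natCast, ← Real.rpow_mul hν.le]; norm_num
        _ ≤ δ ^ α := by gcongr
    calc _ ≤ 2 * M := h1
      _ = (2 * M / ν) * ν := by field_simp
      _ ≤ (2 * M / ν) * δ ^ α := by gcongr
      _ ≤ _ := by
        gcongr
        have : 0 ≤ |N| * ν := by positivity
        linarith

lemma comp_lip {Θ : ℝ → ℝ} {C β : ℝ} (hg : HB α M g) (hC : ∀ s, |Θ s| ≤ C)
    (hL : ∀ s s', |Θ s - Θ s'| ≤ C * |s - s'|) (hΘ : Continuous Θ) (hβ : 0 ≤ β) (c : ℝ) :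
    HB α (C * (1 + β * M)) (fun z => Θ (β * g z + c)) := by
  have hC0 : 0 ≤ C := (abs_nonneg _).trans (hC 0)
  have hM := hg.nonneg
  refine ⟨hΘ.comp ((continuous_const.mul hg.cont).add continuous_const),
    fun z => (hC _).trans ?_, fun t x y => (hL _ _).trans ?_⟩
  · nlinarith [mul_nonneg hβ hM]
  · have h1 := hg.hol t x y
    have hp : 0 ≤ ‖x - y‖ ^ α := by positivity
    rw [show β * g (t, x) + c - (β * g (t, y) + c) = β * (g (t, x) - g (t, y)) by ring, abs_mul,
      abs_of_nonneg hβ, mul_assoc]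
    refine mul_le_mul_of_nonneg_left ?_ hC0
    nlinarith [mul_le_mul_of_nonneg_left h1 hβ]

lemma of_tendsto {ι : Type*} {l : Filter ι} [l.NeBot] {f : ι → ℝ} (hf : Tendsto f l (𝓝 M))
    (hg : ∀ i, HB α (f i) g) : HB α M g := by
  obtain ⟨i0⟩ : Nonempty ι := l.nonempty_of_neBot
  exact ⟨(hg i0).cont, fun z => ge_of_tendsto' hf fun i => (hg i).bdd z,
    fun t x y => ge_of_tendsto' (hf.mul_const _) fun i => (hg i).hol t x y⟩

end HB

/-- A bounded operator on Hölder functions, with norm at most `K`, compatible with differences. -/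
structure BOp {d : ℕ} (α K : ℝ) (T : (TX d → ℝ) → TX d → ℝ) : Prop where
  bound : ∀ M g, HB α M g → HB α (K * M) (T g)
  sub : ∀ M N g h, HB α M g → HB α N h → T (fun z => g z - h z) = fun z => T g z - T h z

namespace BOp

variable {d : ℕ} {α K K' M : ℝ} {T T' : (TX d → ℝ) → TX d → ℝ}

lemma nonneg (hT : BOp α K T) : 0 ≤ K := by
  have h := (hT.bound _ _ (HB.const (d := d) 1)).nonneg
  simpa using h

lemma mono (hT : BOp α K T) (h : K ≤ K') : BOp α K' T :=
  ⟨fun M g hg => (hT.bound M g hg).mono (mul_le_mul_of_nonneg_right h hg.nonneg), hT.sub⟩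

lemma comp (hT : BOp α K T) (hT' : BOp α K' T') : BOp α (K * K') (fun g => T (T' g)) := by
  refine ⟨fun M g hg => ?_, fun M N g h hg hh => ?_⟩
  · rw [mul_assoc]; exact hT.bound _ _ (hT'.bound _ _ hg)
  · simp only [hT'.sub M N g h hg hh]
    exact hT.sub _ _ _ _ (hT'.bound _ _ hg) (hT'.bound _ _ hh)

lemma add (hT : BOp α K T) (hT' : BOp α K' T') : BOp α (K + K') (fun g z => T g z + T' g z) := by
  refine ⟨fun M g hg => ?_, fun M N g h hg hh => ?_⟩
  · rw [add_mul]; exact (hT.bound _ _ hg).add (hT'.bound _ _ hg)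
  · funext z
    simp only [hT.sub M N g h hg hh, hT'.sub M N g h hg hh]
    ring

lemma mul_left {m : TX d → ℝ} (hm : HB α M m) (hT : BOp α K T) :
    BOp α (2 * M * K) (fun g z => m z * T g z) := by
  refine ⟨fun N g hg => ?_, fun M N g h hg hh => ?_⟩
  · have := hm.mul (hT.bound _ _ hg)
    rwa [← mul_assoc] at this
  · funext z
    simp only [hT.sub M N g h hg hh]
    ring

lemma ident : BOp (d := d) α 1 (fun g => g) :=
  ⟨fun M g hg => by rwa [one_mul], fun M N g h hg hh => rfl⟩

lemma const_mul (c : ℝ) (hT : BOp α K T) : BOp α (|c| * K) (fun g z => c * T g z) := by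
  refine ⟨fun N g hg => ?_, fun M N g h hg hh => ?_⟩
  · have := (hT.bound _ _ hg).const_mul c
    rwa [← mul_assoc] at this
  · funext z
    simp only [hT.sub M N g h hg hh]
    ring

lemma sum {ι : Type*} (s : Finset ι) {K : ι → ℝ} {T : ι → (TX d → ℝ) → TX d → ℝ}
    (hT : ∀ i ∈ s, BOp α (K i) (T i)) :
    BOp α (∑ i ∈ s, K i) (fun g z => ∑ i ∈ s, T i g z) := by
  classical
  induction s using Finset.induction_on with
  | empty =>
    refine ⟨fun M g hg => ?_, fun M N g h hg hh => by simp⟩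
    simpa using HB.const (d := d) 0
  | insert a s ha ih =>
    simp only [Finset.sum_insert ha]
    exact (hT a (by simp)).add (ih fun i hi => hT i (by simp [hi]))

/-- Neumann series: `1 - T` is invertible on Hölder functions when `T` has norm at most `1/2`. -/
lemma exists_inverse (hT : BOp α (1 / 2) T) :
    ∃ R : (TX d → ℝ) → TX d → ℝ, BOp α 2 R ∧
      ∀ M g, HB α M g → ∀ z, R g z - T (R g) z = g z := by
  have hiter : ∀ n : ℕ, ∀ M g, HB α M g → HB α (M * (1 / 2) ^ n) (T^[n] g) := by
    intro n
    induction n with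
    | zero => intro M g hg; simpa using hg
    | succ n ih =>
      intro M g hg
      rw [Function.iterate_succ_apply']
      exact (hT.bound _ _ (ih M g hg)).mono (by rw [pow_succ]; linarith)
  have hzero : ∀ M N g h, HB α M g → HB α N h → (∀ z, g z - T g z = h z - T h z) → g = h := by
    intro M N g h hg hh he
    set k : TX d → ℝ := fun z => g z - h z with hk
    have hkb : HB α (M + N) k := hg.sub hh
    have hTk : T k = k := by
      rw [hk, hT.sub M N g h hg hh]
      funext z
      have := he z
      linarith
    have hfix : ∀ n : ℕ, T^[n] k = k := fun n => Function.iterate_fixed hTk n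
    funext z
    have hlim : Tendsto (fun n : ℕ => (M + N) * (1 / 2 : ℝ) ^ n) atTop (𝓝 ((M + N) * 0)) :=
      (tendsto_pow_atTop_nhds_zero_of_lt_one (by norm_num) (by norm_num)).const_mul _
    have h0 : |k z| ≤ (M + N) * 0 := ge_of_tendsto' hlim fun n => by
      have := (hiter n _ _ hkb).bdd z
      rwa [hfix n] at this
    have : k z = 0 := by
      rw [mul_zero] at h0
      exact abs_nonpos_iff.mp h0
    simp only [hk] at this
    linarith
  have hsum2 : Summable (fun n : ℕ => (1 / 2 : ℝ) ^ n) :=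
    summable_geometric_of_lt_one (by norm_num) (by norm_num)
  have hts : ∑' n : ℕ, (1 / 2 : ℝ) ^ n = 2 := tsum_geometric_two
  have hex : ∀ M g, HB α M g → ∃ h, HB α (2 * M) h ∧ ∀ z, h z - T h z = g z := by
    intro M g hg
    have hM := hg.nonneg
    have hs : Summable (fun n : ℕ => M * (1 / 2 : ℝ) ^ n) := hsum2.mul_left M
    have hS : ∀ z, Summable (fun n => T^[n] g z) := fun z =>
      Summable.of_norm_bounded hs fun n => (hiter n M g hg).bdd z
    set h : TX d → ℝ := fun z => ∑' n, T^[n] g z with hh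
    have tail : ∀ m : ℕ, HB α (2 * (M * (1 / 2) ^ m)) (fun z => ∑' n, T^[n + m] g z) := by
      intro m
      have hb : ∀ n, HB α (M * (1 / 2) ^ m * (1 / 2) ^ n) (T^[n + m] g) := fun n =>
        (hiter (n + m) M g hg).mono (by rw [pow_add]; linarith)
      have hsm : Summable (fun n : ℕ => M * (1 / 2) ^ m * (1 / 2 : ℝ) ^ n) := hsum2.mul_left _
      have hval : ∑' n : ℕ, M * (1 / 2) ^ m * (1 / 2 : ℝ) ^ n = 2 * (M * (1 / 2) ^ m) := by
        rw [tsum_mul_left, hts]; ring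
      have hSm : ∀ z, Summable (fun n => T^[n + m] g z) := fun z =>
        Summable.of_norm_bounded hsm fun n => (hb n).bdd z
      refine ⟨continuous_tsum (fun n => (hb n).cont) hsm fun n z => (hb n).bdd z, fun z => ?_,
        fun t x y => ?_⟩
      · rw [← hval]
        rw [← Real.norm_eq_abs]
        exact tsum_of_norm_bounded hsm.hasSum fun n => (hb n).bdd z
      · rw [← (hSm _).tsum_sub (hSm _), ← hval, ← Real.norm_eq_abs]
        exact tsum_of_norm_bounded (hsm.hasSum.mul_right _) fun n => (hb n).hol t x y
    have h0 : HB α (2 * M) h := by simpa [hh] using tail 0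
    have hpart : ∀ m : ℕ, ∃ N, HB α N (fun z => ∑ n ∈ Finset.range m, T^[n] g z) ∧
        T (fun z => ∑ n ∈ Finset.range m, T^[n] g z)
          = fun z => ∑ n ∈ Finset.range m, T^[n + 1] g z := by
      intro m
      induction m with
      | zero =>
        refine ⟨_, by simpa using HB.const (d := d) 0, ?_⟩
        have := hT.sub M M g g hg hg
        simpa using this
      | succ m ih =>
        obtain ⟨N, hN, hTN⟩ := ih
        have hm := hiter m M g hg
        refine ⟨_, by simpa only [Finset.sum_range_succ] using hN.add hm, ?_⟩
        have hz : T (fun _ => 0) = fun _ => 0 := by simpa using hT.sub M M g g hg hg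
        have hneg : T (fun z => 0 - T^[m] g z) = fun z => 0 - T (T^[m] g) z := by
          have := hT.sub _ _ _ _ (HB.const (d := d) 0) hm
          rw [hz] at this
          exact this
        have := hT.sub _ _ _ _ hN (((HB.const (d := d) 0)).sub hm)
        rw [hneg, hTN] at this
        simp only [Finset.sum_range_succ]
        simp only [zero_sub, sub_neg_eq_add] at this
        rw [this]
        funext z
        rw [Function.iterate_succ_apply']
    refine ⟨h, h0, fun z => ?_⟩
    have hlim : Tendsto (fun m : ℕ => ∑ n ∈ Finset.range m, T^[n + 1] g z) atTop (𝓝 (h z - g z)) := by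
      have h1 := (hS z).hasSum.tendsto_sum_nat
      have h2 := (h1.comp (tendsto_add_atTop_nat 1)).sub_const (g z)
      refine h2.congr fun m => ?_
      simp [Finset.sum_range_succ']
    have hlim2 : Tendsto (fun m : ℕ => ∑ n ∈ Finset.range m, T^[n + 1] g z) atTop (𝓝 (T h z)) := by
      rw [tendsto_iff_norm_sub_tendsto_zero]
      have hb : Tendsto (fun m : ℕ => M * (1 / 2 : ℝ) ^ m) atTop (𝓝 0) := by
        simpa using (tendsto_pow_atTop_nhds_zero_of_lt_one (r := (1 / 2 : ℝ))
          (by norm_num) (by norm_num)).const_mul M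
      refine squeeze_zero (fun _ => norm_nonneg _) (fun m => ?_) hb
      obtain ⟨N, hN, hTN⟩ := hpart m
      have hd := hT.sub _ _ _ _ h0 hN
      have htl : (fun z => h z - ∑ n ∈ Finset.range m, T^[n] g z)
          = fun z => ∑' n, T^[n + m] g z := by
        funext z
        rw [hh]
        simp only
        rw [← (hS z).sum_add_tsum_nat_add m]
        ring
      rw [htl, hTN] at hd
      have hbd := (hT.bound _ _ (tail m)).bdd z
      rw [hd] at hbd
      rw [Real.norm_eq_abs, abs_sub_comm]
      refine hbd.trans (le_of_eq ?_)
      ring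
    linarith [tendsto_nhds_unique hlim hlim2]
  classical
  refine ⟨fun g => if hg : ∃ M, HB α M g then (hex hg.choose g hg.choose_spec).choose else 0,
    ⟨fun M g hg => ?_, fun M N g h hg hh => ?_⟩, fun M g hg z => ?_⟩
  · have hgM : ∃ M, HB α M g := ⟨M, hg⟩
    simp only [hgM, dif_pos]
    have h1 := (hex hgM.choose g hgM.choose_spec).choose_spec
    obtain ⟨h', h2, h3⟩ := hex M g hg
    rw [hzero _ _ _ _ h1.1 h2 fun z => by rw [h1.2, h3]]
    exact h2
  · have hgM : ∃ M, HB α M g := ⟨M, hg⟩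
    have hhM : ∃ M, HB α M h := ⟨N, hh⟩
    have hdM : ∃ M, HB α M (fun z => g z - h z) := ⟨_, hg.sub hh⟩
    simp only [hgM, hhM, hdM, dif_pos]
    have h1 := (hex hgM.choose g hgM.choose_spec).choose_spec
    have h2 := (hex hhM.choose h hhM.choose_spec).choose_spec
    have h3 := (hex hdM.choose _ hdM.choose_spec).choose_spec
    refine hzero _ _ _ _ h3.1 (h1.1.sub h2.1) fun z => ?_
    rw [h3.2, hT.sub _ _ _ _ h1.1 h2.1]
    simp only
    rw [← h1.2 z, ← h2.2 z]
    ring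
  · have hgM : ∃ M, HB α M g := ⟨M, hg⟩
    simp only [hgM, dif_pos]
    exact (hex hgM.choose g hgM.choose_spec).choose_spec.2 z

end BOp

/-- `u` has continuous first order time derivative `ut`, first order space derivatives `ux` and
second order space derivatives `uxx` on the open set `U`. -/
structure C12 {d : ℕ} (U : Set (TX d)) (u ut : TX d → ℝ) (ux : Fin d → TX d → ℝ)
    (uxx : Fin d → Fin d → TX d → ℝ) : Prop where
  cu : ContinuousOn u U
  ct : ContinuousOn ut U
  cx : ∀ i, ContinuousOn (ux i) U
  cxx : ∀ i j, ContinuousOn (uxx i j) U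
  dt : ∀ z ∈ U, HasLineDerivAt ℝ u (ut z) z et
  dx : ∀ i, ∀ z ∈ U, HasLineDerivAt ℝ u (ux i z) z (ex i)
  dxx : ∀ i j, ∀ z ∈ U, HasLineDerivAt ℝ (ux j) (uxx i j z) z (ex i)

lemma HasLineDerivAt.mul' {E : Type*} [AddCommGroup E] [Module ℝ E] {u v : E → ℝ} {u' v' : ℝ}
    {z e : E} (hu : HasLineDerivAt ℝ u u' z e) (hv : HasLineDerivAt ℝ v v' z e) :
    HasLineDerivAt ℝ (fun z => u z * v z) (u' * v z + u z * v') z e := by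
  have := HasDerivAt.fun_mul hu hv
  simpa [HasLineDerivAt] using this

lemma HasLineDerivAt.add' {E : Type*} [AddCommGroup E] [Module ℝ E] {u v : E → ℝ} {u' v' : ℝ}
    {z e : E} (hu : HasLineDerivAt ℝ u u' z e) (hv : HasLineDerivAt ℝ v v' z e) :
    HasLineDerivAt ℝ (fun z => u z + v z) (u' + v') z e :=
  HasDerivAt.add hu hv

lemma HasLineDerivAt.shift {E : Type*} [AddCommGroup E] [Module ℝ E] {u u' : E → ℝ}
    {z e : E} {τ : ℝ} (hu : HasLineDerivAt ℝ u (u' (z + τ • e)) (z + τ • e) e) :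
    HasDerivAt (fun s : ℝ => u (z + s • e)) (u' (z + τ • e)) τ := by
  have h1 : HasDerivAt (fun s : ℝ => s - τ) 1 τ := (hasDerivAt_id τ).sub_const τ
  have h2 : HasDerivAt (fun t : ℝ => u (z + τ • e + t • e)) (u' (z + τ • e)) (τ - τ) := by
    rw [sub_self]; exact hu
  have := HasDerivAt.scomp (h := fun s : ℝ => s - τ) τ h2 h1
  simp only [one_smul] at this
  refine this.congr_of_eventuallyEq (Eventually.of_forall fun s => ?_)
  simp only [Function.comp]
  congr 1
  rw [add_assoc, ← add_smul]
  congr 2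
  ring

namespace C12

variable {d : ℕ} {U V : Set (TX d)} {u ut v vt : TX d → ℝ} {ux vx : Fin d → TX d → ℝ}
  {uxx vxx : Fin d → Fin d → TX d → ℝ}

lemma mono (hu : C12 V u ut ux uxx) (h : U ⊆ V) : C12 U u ut ux uxx :=
  ⟨hu.cu.mono h, hu.ct.mono h, fun i => (hu.cx i).mono h, fun i j => (hu.cxx i j).mono h,
    fun z hz => hu.dt z (h hz), fun i z hz => hu.dx i z (h hz),
    fun i j z hz => hu.dxx i j z (h hz)⟩

lemma congr (hU : IsOpen U) (hu : C12 U u ut ux uxx) (h : ∀ z ∈ U, v z = u z)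
    (ht : ∀ z ∈ U, vt z = ut z) (hx : ∀ i, ∀ z ∈ U, vx i z = ux i z)
    (hxx : ∀ i j, ∀ z ∈ U, vxx i j z = uxx i j z) : C12 U v vt vx vxx := by
  refine ⟨hu.cu.congr h, hu.ct.congr ht, fun i => (hu.cx i).congr (hx i),
    fun i j => (hu.cxx i j).congr (hxx i j), fun z hz => ?_, fun i z hz => ?_,
    fun i j z hz => ?_⟩
  · rw [ht z hz]
    exact (hu.dt z hz).congr_of_eventuallyEq (Filter.mem_of_superset (hU.mem_nhds hz) h)
  · rw [hx i z hz]
    exact (hu.dx i z hz).congr_of_eventuallyEq (Filter.mem_of_superset (hU.mem_nhds hz) h)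
  · rw [hxx i j z hz]
    exact (hu.dxx i j z hz).congr_of_eventuallyEq (Filter.mem_of_superset (hU.mem_nhds hz) (hx j))

lemma mul (hu : C12 U u ut ux uxx) (hv : C12 U v vt vx vxx) :
    C12 U (fun z => u z * v z) (fun z => ut z * v z + u z * vt z)
      (fun i z => ux i z * v z + u z * vx i z)
      (fun i j z => (uxx i j z * v z + ux j z * vx i z) + (ux i z * vx j z + u z * vxx i j z)) :=
  ⟨hu.cu.mul hv.cu, (hu.ct.mul hv.cu).add (hu.cu.mul hv.ct),
    fun i => ((hu.cx i).mul hv.cu).add (hu.cu.mul (hv.cx i)),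
    fun i j => (((hu.cxx i j).mul hv.cu).add ((hu.cx j).mul (hv.cx i))).add
      (((hu.cx i).mul (hv.cx j)).add (hu.cu.mul (hv.cxx i j))),
    fun z hz => (hu.dt z hz).mul' (hv.dt z hz),
    fun i z hz => (hu.dx i z hz).mul' (hv.dx i z hz),
    fun i j z hz => ((hu.dxx i j z hz).mul' (hv.dx i z hz)).add'
      ((hu.dx i z hz).mul' (hv.dxx i j z hz))⟩

lemma add (hu : C12 U u ut ux uxx) (hv : C12 U v vt vx vxx) :
    C12 U (fun z => u z + v z) (fun z => ut z + vt z)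
      (fun i z => ux i z + vx i z) (fun i j z => uxx i j z + vxx i j z) :=
  ⟨hu.cu.add hv.cu, hu.ct.add hv.ct, fun i => (hu.cx i).add (hv.cx i),
    fun i j => (hu.cxx i j).add (hv.cxx i j),
    fun z hz => (hu.dt z hz).add' (hv.dt z hz),
    fun i z hz => (hu.dx i z hz).add' (hv.dx i z hz),
    fun i j z hz => (hu.dxx i j z hz).add' (hv.dxx i j z hz)⟩

lemma zero : C12 (d := d) U (fun _ => 0) (fun _ => 0) (fun _ _ => 0) (fun _ _ _ => 0) := by
  constructor <;> intros <;> first | exact continuousOn_const | exact hasDerivAt_const _ _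

lemma const (c : ℝ) : C12 (d := d) U (fun _ => c) (fun _ => 0) (fun _ _ => 0) (fun _ _ _ => 0) := by
  constructor <;> intros <;> first | exact continuousOn_const | exact hasDerivAt_const _ _

lemma const_mul (c : ℝ) (hu : C12 U u ut ux uxx) :
    C12 U (fun z => c * u z) (fun z => c * ut z)
      (fun i z => c * ux i z) (fun i j z => c * uxx i j z) := by
  have := (const c).mul hu
  simpa using this

lemma sub (hu : C12 U u ut ux uxx) (hv : C12 U v vt vx vxx) :
    C12 U (fun z => u z - v z) (fun z => ut z - vt z)
      (fun i z => ux i z - vx i z) (fun i j z => uxx i j z - vxx i j z) := by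
  simpa [sub_eq_add_neg] using hu.add (hv.const_mul (-1))

lemma of_forall (h : ∀ z ∈ U, ∃ W ∈ 𝓝 z, C12 W u ut ux uxx) : C12 U u ut ux uxx := by
  choose! W hW hC using h
  refine ⟨fun z hz => ?_, fun z hz => ?_, fun i z hz => ?_, fun i j z hz => ?_,
    fun z hz => (hC z hz).dt z (mem_of_mem_nhds (hW z hz)),
    fun i z hz => (hC z hz).dx i z (mem_of_mem_nhds (hW z hz)),
    fun i j z hz => (hC z hz).dxx i j z (mem_of_mem_nhds (hW z hz))⟩
  · exact ((hC z hz).cu.continuousAt (hW z hz)).continuousWithinAt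
  · exact ((hC z hz).ct.continuousAt (hW z hz)).continuousWithinAt
  · exact (((hC z hz).cx i).continuousAt (hW z hz)).continuousWithinAt
  · exact (((hC z hz).cxx i j).continuousAt (hW z hz)).continuousWithinAt

lemma lineDeriv_of_tendsto {E : Type*} [NormedAddCommGroup E] [NormedSpace ℝ E] {U : Set E}
    (hU : IsOpen U) {f f' : ℕ → E → ℝ} {g g' : E → ℝ} {e : E}
    (hf : TendstoLocallyUniformlyOn f' g' atTop U)
    (hd : ∀ n, ∀ z ∈ U, HasLineDerivAt ℝ (f n) (f' n z) z e)
    (hg : ∀ z ∈ U, Tendsto (fun n => f n z) atTop (𝓝 (g z))) :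
    ∀ z ∈ U, HasLineDerivAt ℝ g (g' z) z e := by
  intro z hz
  have hc : Continuous (fun τ : ℝ => z + τ • e) := by fun_prop
  set s : Set ℝ := (fun τ : ℝ => z + τ • e) ⁻¹' U with hs
  have hso : IsOpen s := hU.preimage hc
  have h0 : (0 : ℝ) ∈ s := by simp [hs, hz]
  have h1 : TendstoLocallyUniformlyOn (fun n τ => f' n (z + τ • e)) (fun τ => g' (z + τ • e))
      atTop s := hf.comp (fun τ : ℝ => z + τ • e) (fun τ hτ => hτ) hc.continuousOn
  have := hasDerivAt_of_tendstoLocallyUniformlyOn hso h1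
    (Eventually.of_forall fun n τ hτ => (hd n _ hτ).shift) (fun τ hτ => hg _ hτ) h0
  simpa [HasLineDerivAt] using this

lemma of_tendsto (hU : IsOpen U) {u ut : ℕ → TX d → ℝ} {ux : ℕ → Fin d → TX d → ℝ}
    {uxx : ℕ → Fin d → Fin d → TX d → ℝ} (h : ∀ n, C12 U (u n) (ut n) (ux n) (uxx n))
    (hu : TendstoLocallyUniformlyOn u v atTop U)
    (ht : TendstoLocallyUniformlyOn ut vt atTop U)
    (hx : ∀ i, TendstoLocallyUniformlyOn (fun n => ux n i) (vx i) atTop U)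
    (hxx : ∀ i j, TendstoLocallyUniformlyOn (fun n => uxx n i j) (vxx i j) atTop U) :
    C12 U v vt vx vxx :=
  ⟨hu.continuousOn (Frequently.of_forall fun n => (h n).cu),
    ht.continuousOn (Frequently.of_forall fun n => (h n).ct),
    fun i => (hx i).continuousOn (Frequently.of_forall fun n => (h n).cx i),
    fun i j => (hxx i j).continuousOn (Frequently.of_forall fun n => (h n).cxx i j),
    lineDeriv_of_tendsto hU ht (fun n => (h n).dt) fun _ hz => hu.tendsto_at hz,
    fun i => lineDeriv_of_tendsto hU (hx i) (fun n => (h n).dx i) fun _ hz => hu.tendsto_at hz,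
    fun i j => lineDeriv_of_tendsto hU (hxx i j) (fun n => (h n).dxx i j)
      fun _ hz => (hx j).tendsto_at hz⟩

lemma unique_x (hu : C12 U u ut ux uxx) (hv : C12 U u vt vx vxx) {z : TX d} (hz : z ∈ U)
    (i : Fin d) : ux i z = vx i z := (hu.dx i z hz).unique (hv.dx i z hz)

lemma unique_xx (hU : IsOpen U) (hu : C12 U u ut ux uxx) (hv : C12 U u vt vx vxx) {z : TX d}
    (hz : z ∈ U) (i j : Fin d) : uxx i j z = vxx i j z :=
  (hu.dxx i j z hz).unique ((hv.dxx i j z hz).congr_of_eventuallyEq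
    (Filter.mem_of_superset (hU.mem_nhds hz) fun _ hy => hu.unique_x hv hy j))

end C12

/-- A function with partial derivatives that are continuous at a point is differentiable there. -/
lemma hasFDerivAt_of_lineDeriv {E ι : Type*} [NormedAddCommGroup E] [NormedSpace ℝ E] [Fintype ι]
    (b : ι → E) (c : ι → E →L[ℝ] ℝ) (hbc : ∀ h, ∑ i, c i h • b i = h) {f : E → ℝ}
    {f' : ι → E → ℝ} {z : E} (hd : ∀ i, ∀ᶠ w in 𝓝 z, HasLineDerivAt ℝ f (f' i w) w (b i))
    (hc : ∀ i, ContinuousAt (f' i) z) : HasFDerivAt f (∑ i, f' i z • c i) z := by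
  classical
  rw [hasFDerivAt_iff_isLittleO_nhds_zero, Asymptotics.isLittleO_iff]
  intro ε hε
  set Cc : ℝ := ∑ i, ‖c i‖ with hCc
  have hCc0 : 0 ≤ Cc := by positivity
  set ε' := ε / (Cc + 1) with hε'
  have hε'0 : 0 < ε' := by positivity
  have hev : ∀ᶠ w in 𝓝 z, ∀ i, HasLineDerivAt ℝ f (f' i w) w (b i) ∧ |f' i w - f' i z| ≤ ε' := by
    rw [eventually_all]
    intro i
    refine (hd i).and ?_
    have := Metric.continuousAt_iff'.1 (hc i) ε' hε'0
    filter_upwards [this] with w hw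
    exact (by simpa [Real.dist_eq] using hw.le)
  obtain ⟨r, hr, hball⟩ := Metric.eventually_nhds_iff_ball.1 hev
  have key : ∀ (s : Finset ι) (a : ι → ℝ), ∑ i ∈ s, |a i| * ‖b i‖ < r →
      |f (z + ∑ i ∈ s, a i • b i) - f z - ∑ i ∈ s, a i * f' i z| ≤ ε' * ∑ i ∈ s, |a i| := by
    intro s a
    induction s using Finset.induction_on with
    | empty => intro; simp
    | insert k s hk ih =>
      rw [Finset.sum_insert hk, Finset.sum_insert hk, Finset.sum_insert hk, Finset.sum_insert hk]
      intro hlt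
      have hk0 : 0 ≤ |a k| * ‖b k‖ := by positivity
      have ih' := ih (by linarith)
      set w := z + ∑ i ∈ s, a i • b i with hw
      have hwz : ‖w - z‖ ≤ ∑ i ∈ s, |a i| * ‖b i‖ := by
        rw [hw, add_sub_cancel_left]
        refine (norm_sum_le _ _).trans (le_of_eq ?_)
        simp [norm_smul]
      have hin : ∀ τ ∈ Icc (0 : ℝ) 1, w + (τ * a k) • b k ∈ Metric.ball z r := by
        intro τ hτ
        rw [Metric.mem_ball, dist_eq_norm]
        have h1 : ‖(τ * a k) • b k‖ ≤ |a k| * ‖b k‖ := by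
          rw [norm_smul, Real.norm_eq_abs, abs_mul, abs_of_nonneg hτ.1]
          have := mul_le_mul_of_nonneg_right hτ.2 hk0
          linarith
        calc ‖w + (τ * a k) • b k - z‖ = ‖(w - z) + (τ * a k) • b k‖ := by congr 1; abel
          _ ≤ ‖w - z‖ + ‖(τ * a k) • b k‖ := norm_add_le _ _
          _ < r := by linarith
      have hder : ∀ τ ∈ Icc (0 : ℝ) 1, HasDerivWithinAt
          (fun τ : ℝ => f (w + (τ * a k) • b k) - τ * a k * f' k z)
          (a k * f' k (w + (τ * a k) • b k) - a k * f' k z) (Icc 0 1) τ := by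
        intro τ hτ
        have h1 := ((hball _ (hin τ hτ)) k).1.shift
        have h2 : HasDerivAt (fun τ : ℝ => τ * a k) (a k) τ := by
          simpa using (hasDerivAt_id τ).mul_const (a k)
        have h3 := h1.scomp τ h2
        have h4 := h3.fun_sub (h2.mul_const (f' k z))
        simpa [Function.comp_def] using h4.hasDerivWithinAt
      have hmv := (convex_Icc (0 : ℝ) 1).norm_image_sub_le_of_norm_hasDerivWithin_le
        (C := ε' * |a k|) hder (fun τ hτ => by
          rw [← mul_sub, Real.norm_eq_abs, abs_mul, mul_comm]
          exact mul_le_mul_of_nonneg_right ((hball _ (hin τ hτ)) k).2 (abs_nonneg _))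
        (left_mem_Icc.2 zero_le_one) (right_mem_Icc.2 zero_le_one)
      simp only [one_mul, zero_mul, zero_smul, add_zero, sub_zero, norm_one, mul_one,
        Real.norm_eq_abs] at hmv
      have e1 : z + (a k • b k + ∑ i ∈ s, a i • b i) = w + a k • b k := by rw [hw]; abel
      rw [e1]
      have := abs_add_le (f (w + a k • b k) - a k * f' k z - f w)
        (f w - f z - ∑ i ∈ s, a i * f' i z)
      rw [show f (w + a k • b k) - f z - (a k * f' k z + ∑ i ∈ s, a i * f' i z)
        = (f (w + a k • b k) - a k * f' k z - f w) + (f w - f z - ∑ i ∈ s, a i * f' i z) by ring]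
      linarith
  have hsm : ∀ᶠ h : E in 𝓝 0, ∑ i, |c i h| * ‖b i‖ < r := by
    have hcont : Continuous fun h : E => ∑ i, |c i h| * ‖b i‖ := by fun_prop
    have := hcont.tendsto 0
    simp only [map_zero, abs_zero, zero_mul, Finset.sum_const_zero] at this
    exact this.eventually_lt_const hr
  filter_upwards [hsm] with h hh
  have h1 := key Finset.univ (fun i => c i h) hh
  rw [hbc] at h1
  have h2 : (∑ i, f' i z • c i) h = ∑ i, c i h * f' i z := by
    simp [mul_comm]
  rw [h2, Real.norm_eq_abs]
  refine h1.trans ?_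
  have h3 : ∑ i, |c i h| ≤ Cc * ‖h‖ := by
    rw [hCc, Finset.sum_mul]
    exact Finset.sum_le_sum fun i _ => (c i).le_opNorm h
  calc ε' * ∑ i, |c i h| ≤ ε' * (Cc * ‖h‖) := by gcongr
    _ = (ε' * Cc) * ‖h‖ := by ring
    _ ≤ ε * ‖h‖ := by
      gcongr
      rw [hε', div_mul_eq_mul_div, div_le_iff₀ (by positivity)]
      nlinarith

lemma hasFDerivAt_space {d : ℕ} {U : Set (TX d)} (hU : IsOpen U) {u : TX d → ℝ}
    {ux : Fin d → TX d → ℝ} (hx : ∀ i, ContinuousOn (ux i) U)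
    (hd : ∀ i, ∀ z ∈ U, HasLineDerivAt ℝ u (ux i z) z (ex i)) {z : TX d} (hz : z ∈ U) :
    HasFDerivAt (fun w => u (z.1, w))
      (∑ i, ux i z • (ContinuousLinearMap.proj i : (Fin d → ℝ) →L[ℝ] ℝ)) z.2 := by
  have hcont : Continuous fun w : Fin d → ℝ => ((z.1, w) : TX d) := by fun_prop
  have hmem : (fun w : Fin d → ℝ => ((z.1, w) : TX d)) ⁻¹' U ∈ 𝓝 z.2 :=
    hcont.continuousAt.preimage_mem_nhds (hU.mem_nhds hz)
  refine hasFDerivAt_of_lineDeriv (fun i : Fin d => (Pi.single i 1 : Fin d → ℝ))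
    (fun i => ContinuousLinearMap.proj i) (fun h => by
      simp only [ContinuousLinearMap.proj_apply]
      exact (pi_eq_sum_univ' h).symm) (f := fun w => u (z.1, w))
    (f' := fun i w => ux i (z.1, w)) (z := z.2)
    (fun i => by
      filter_upwards [hmem] with w hw
      have := hd i _ hw
      simpa [HasLineDerivAt, ex] using this)
    (fun i => ((hx i).continuousAt (hU.mem_nhds hz)).comp_of_eq hcont.continuousAt rfl)

/-- The derivative in an arbitrary space direction. -/
lemma hasDerivAt_space {d : ℕ} {U : Set (TX d)} (hU : IsOpen U) {u : TX d → ℝ}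
    {ux : Fin d → TX d → ℝ} (hx : ∀ i, ContinuousOn (ux i) U)
    (hd : ∀ i, ∀ z ∈ U, HasLineDerivAt ℝ u (ux i z) z (ex i)) {z : TX d} (hz : z ∈ U)
    (y : Fin d → ℝ) : HasLineDerivAt ℝ u (∑ i, y i * ux i z) z (0, y) := by
  have h := hasFDerivAt_space hU hx hd hz
  have h2 := h.hasLineDerivAt y
  have e : ∀ t : ℝ, z + t • ((0, y) : TX d) = (z.1, z.2 + t • y) := fun t => by
    ext <;> simp
  simp only [HasLineDerivAt, e] at h2 ⊢
  simpa [mul_comm] using h2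

lemma C12.hasFDerivAt {d : ℕ} {U : Set (TX d)} (hU : IsOpen U) {u ut : TX d → ℝ}
    {ux : Fin d → TX d → ℝ} {uxx : Fin d → Fin d → TX d → ℝ} (hu : C12 U u ut ux uxx)
    {z : TX d} (hz : z ∈ U) : DifferentiableAt ℝ u z := by
  have h := hasFDerivAt_of_lineDeriv (E := TX d) (ι := Option (Fin d))
    (fun i => i.elim et ex)
    (fun i => i.elim (ContinuousLinearMap.fst ℝ ℝ (Fin d → ℝ))
      (fun i => (ContinuousLinearMap.proj i).comp (ContinuousLinearMap.snd ℝ ℝ (Fin d → ℝ))))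
    (fun h => by
      rw [Fintype.sum_option]
      ext i
      · simp [et, ex, Prod.fst_sum]
      · simp [et, ex, Prod.snd_sum, Finset.sum_apply, Pi.single_apply]) (f := u)
    (f' := fun i => i.elim ut ux) (z := z)
    (fun i => by
      cases i with
      | none => exact Filter.mem_of_superset (hU.mem_nhds hz) fun w hw => hu.dt w hw
      | some i => exact Filter.mem_of_superset (hU.mem_nhds hz) fun w hw => hu.dx i w hw)
    (fun i => by
      cases i with
      | none => exact hu.ct.continuousAt (hU.mem_nhds hz)
      | some i => exact (hu.cx i).continuousAt (hU.mem_nhds hz))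
  exact h.differentiableAt

/-- Symmetric positive semidefinite coefficient arrays. -/
def SPSD {d : ℕ} (A : Fin d → Fin d → ℝ) : Prop :=
  (∀ i j, A i j = A j i) ∧ ∀ y : Fin d → ℝ, 0 ≤ ∑ i, ∑ j, A i j * y i * y j

lemma SPSD.posSemidef {d : ℕ} {A : Fin d → Fin d → ℝ} (hA : SPSD A) :
    (Matrix.of A).PosSemidef := by
  refine Matrix.PosSemidef.of_dotProduct_mulVec_nonneg ?_ fun x => ?_
  · ext i j
    simp [Matrix.conjTranspose_apply, hA.1 i j]
  · have := hA.2 x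
    simp only [dotProduct, Matrix.mulVec, Matrix.of_apply, star_trivial, Finset.mul_sum]
    refine this.trans (le_of_eq ?_)
    refine Finset.sum_congr rfl fun i _ => Finset.sum_congr rfl fun j _ => ?_
    ring

lemma SPSD.exists_sum {d : ℕ} {A : Fin d → Fin d → ℝ} (hA : SPSD A) :
    ∃ (m : ℕ) (c : Fin m → Fin d → ℝ), ∀ i j, A i j = ∑ k, c k i * c k j := by
  obtain ⟨m, c, hc⟩ := Matrix.posSemidef_iff_eq_sum_vecMulVec.1 hA.posSemidef
  refine ⟨m, c, fun i j => ?_⟩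
  have := congrFun (congrFun hc i) j
  simpa [Matrix.sum_apply, Matrix.vecMulVec_apply] using this

lemma SPSD.diag_nonneg {d : ℕ} {A : Fin d → Fin d → ℝ} (hA : SPSD A) (i : Fin d) : 0 ≤ A i i := by
  obtain ⟨m, c, hc⟩ := hA.exists_sum
  rw [hc]
  exact Finset.sum_nonneg fun k _ => mul_self_nonneg _

lemma SPSD.trace_nonpos {d : ℕ} {A : Fin d → Fin d → ℝ} (hA : SPSD A) {H : Fin d → Fin d → ℝ}
    (hH : ∀ y : Fin d → ℝ, ∑ i, y i * ∑ j, y j * H i j ≤ 0) : ∑ i, ∑ j, A i j * H i j ≤ 0 := by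
  obtain ⟨m, c, hc⟩ := hA.exists_sum
  have : ∑ i, ∑ j, A i j * H i j = ∑ k, ∑ i, c k i * ∑ j, c k j * H i j := by
    simp only [hc, Finset.sum_mul, Finset.mul_sum]
    conv_rhs => rw [Finset.sum_comm]
    refine Finset.sum_congr rfl fun i _ => ?_
    rw [Finset.sum_comm]
    refine Finset.sum_congr rfl fun k _ => Finset.sum_congr rfl fun j _ => ?_
    ring
  rw [this]
  exact Finset.sum_nonpos fun k _ => hH _

lemma second_deriv_nonpos_of_isLocalMax {f p : ℝ → ℝ} {c : ℝ} (hmax : IsLocalMax f 0)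
    (hf : ∀ᶠ τ in 𝓝 (0 : ℝ), HasDerivAt f (p τ) τ) (hp : HasDerivAt p c 0) : c ≤ 0 := by
  by_contra! hc
  have hf0 := hf.self_of_nhds
  have e1 : deriv f =ᶠ[𝓝 0] p := hf.mono fun τ h => h.deriv
  have h1 : deriv (deriv f) 0 = c := by rw [e1.deriv_eq]; exact hp.deriv
  have h2 : deriv f 0 = 0 := hmax.deriv_eq_zero
  have hmin := isLocalMin_of_deriv_deriv_pos (by rw [h1]; exact hc) h2 hf0.continuousAt
  have hconst : f =ᶠ[𝓝 0] fun _ => f 0 := by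
    filter_upwards [hmin, hmax] with x hx hx' using le_antisymm hx' hx
  have e2 : deriv f =ᶠ[𝓝 0] fun _ => 0 := by
    filter_upwards [hconst.deriv] with x hx
    rw [hx]; simp
  have h3 : deriv (deriv f) 0 = 0 := by rw [e2.deriv_eq]; simp
  rw [h1] at h3
  exact hc.ne' h3

variable {d : ℕ}

/-- Weak maximum principle. -/
lemma max_principle {Ω K : Set (TX d)} (hΩ : IsOpen Ω) {w wt : TX d → ℝ} {wx : Fin d → TX d → ℝ}
    {wxx : Fin d → Fin d → TX d → ℝ} (hw : C12 Ω w wt wx wxx) {A : TX d → Fin d → Fin d → ℝ}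
    (hA : ∀ z ∈ Ω, SPSD (A z)) {S : ℝ}
    (hlt : ∀ z ∈ Ω, z.1 ≤ S → 0 ≤ w z → wt z < 1 / 2 * ∑ i, ∑ j, A z i j * wxx i j z)
    (hK : IsCompact K) (hKΩ : K ⊆ Ω) (hwK : ∀ z ∈ Ω, z.1 ≤ S → 0 ≤ w z → z ∈ K) :
    ∀ z ∈ Ω, z.1 ≤ S → w z < 0 := by
  intro z0 hz0 hS0
  by_contra! h0
  set K' := K ∩ {z | z.1 ≤ S} with hK'
  have hK'c : IsCompact K' := hK.inter_right (isClosed_le continuous_fst continuous_const)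
  obtain ⟨zm, hzm, hmax⟩ := hK'c.exists_isMaxOn ⟨z0, hwK z0 hz0 hS0 h0, hS0⟩
    (hw.cu.mono (inter_subset_left.trans hKΩ))
  have hzΩ : zm ∈ Ω := hKΩ hzm.1
  have hzS : zm.1 ≤ S := hzm.2
  have hge : 0 ≤ w zm := h0.trans (hmax ⟨hwK z0 hz0 hS0 h0, hS0⟩)
  have hall : ∀ z ∈ Ω, z.1 ≤ S → w z ≤ w zm := by
    intro z hz hzS
    by_contra! h
    exact absurd (hmax ⟨hwK z hz hzS (hge.trans h.le), hzS⟩) (not_le.2 h)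
  have hline : ∀ v : TX d, ∀ᶠ τ : ℝ in 𝓝 0, zm + τ • v ∈ Ω := fun v => by
    have hc : Continuous (fun τ : ℝ => zm + τ • v) := by fun_prop
    exact hc.continuousAt.preimage_mem_nhds (by simpa using hΩ.mem_nhds hzΩ)
  have htime : 0 ≤ wt zm := by
    have hd : HasDerivWithinAt (fun τ : ℝ => w (zm + τ • et)) (wt zm) (Iio 0) 0 :=
      HasDerivAt.hasDerivWithinAt (hw.dt zm hzΩ)
    have := hasDerivWithinAt_iff_tendsto_slope.1 hd
    rw [sdiff_singleton_eq_self (by simp)] at this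
    refine ge_of_tendsto this ?_
    filter_upwards [self_mem_nhdsWithin, nhdsWithin_le_nhds (hline et)] with τ hτ hτΩ
    have hτ' : τ < 0 := hτ
    have h1 := hall _ hτΩ (by simp [et]; linarith)
    rw [slope_def_field]
    refine div_nonneg_of_nonpos ?_ ?_
    · simpa using h1
    · linarith
  have hspace : ∑ i, ∑ j, A zm i j * wxx i j zm ≤ 0 := by
    refine (hA zm hzΩ).trace_nonpos fun y => ?_
    have hsec : HasDerivAt (fun τ : ℝ => ∑ j, y j * wx j (zm + τ • ((0, y) : TX d)))
        (∑ j, y j * ∑ i, y i * wxx i j zm) 0 := by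
      refine HasDerivAt.fun_sum fun j _ => HasDerivAt.const_mul (y j) ?_
      exact hasDerivAt_space hΩ (fun i => hw.cxx i j) (fun i => hw.dxx i j) hzΩ y
    have hle := second_deriv_nonpos_of_isLocalMax
      (f := fun τ : ℝ => w (zm + τ • ((0, y) : TX d))) ?_ ?_ hsec
    · refine le_trans (le_of_eq ?_) hle
      simp only [Finset.mul_sum]
      rw [Finset.sum_comm]
      refine Finset.sum_congr rfl fun j _ => Finset.sum_congr rfl fun i _ => ?_
      ring
    · filter_upwards [hline (0, y)] with τ hτ
      have := hall _ hτ (by simpa using hzS)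
      simpa using this
    · filter_upwards [hline (0, y)] with τ hτ
      exact HasLineDerivAt.shift (u' := fun z => ∑ j, y j * wx j z)
        (hasDerivAt_space hΩ hw.cx hw.dx hτ y)
  have := hlt zm hzΩ hzS hge
  linarith

lemma norm_sq_le_sum_sq (x : Fin d → ℝ) : ‖x‖ ^ 2 ≤ ∑ i, x i ^ 2 := by
  have h0 : 0 ≤ ∑ i, x i ^ 2 := Finset.sum_nonneg fun i _ => sq_nonneg _
  have : ‖x‖ ≤ √(∑ i, x i ^ 2) := by
    rw [pi_norm_le_iff_of_nonneg (Real.sqrt_nonneg _)]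
    intro i
    rw [Real.norm_eq_abs, ← Real.sqrt_sq_eq_abs]
    exact Real.sqrt_le_sqrt (Finset.single_le_sum (f := fun i => x i ^ 2)
      (fun i _ => sq_nonneg _) (Finset.mem_univ i))
  calc ‖x‖ ^ 2 ≤ (√(∑ i, x i ^ 2)) ^ 2 := by gcongr
    _ = _ := Real.sq_sqrt h0

lemma hasDerivAt_sqrt_add_sq {δ : ℝ} (hδ : 0 < δ) (s : ℝ) :
    HasDerivAt (fun s : ℝ => √(δ + s ^ 2)) (s / √(δ + s ^ 2)) s := by
  have hpos : 0 < δ + s ^ 2 := by positivity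
  have h1 : HasDerivAt (fun s : ℝ => δ + s ^ 2) (2 * s) s := by
    simpa using (hasDerivAt_pow 2 s).const_add δ
  have := h1.sqrt hpos.ne'
  convert this using 1
  field_simp

/-- The penalty function used for comparison on the whole space. -/
lemma C12.penalty : C12 (d := d) univ (fun z => √(1 + z.1 ^ 2) + ∑ i, z.2 i ^ 2)
    (fun z => z.1 / √(1 + z.1 ^ 2)) (fun i z => 2 * z.2 i) (fun i j _ => if i = j then 2 else 0) := by
  have hs : ∀ z : TX d, √(1 + z.1 ^ 2) ≠ 0 := fun z => by positivity
  refine ⟨by fun_prop, ?_, by fun_prop, by fun_prop, fun z _ => ?_, fun i z _ => ?_,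
    fun i j z _ => ?_⟩
  · exact (Continuous.div (by fun_prop) (by fun_prop) hs).continuousOn
  · have h := hasDerivAt_sqrt_add_sq one_pos z.1
    have h1 : HasDerivAt (fun τ : ℝ => z.1 + τ) 1 0 := (hasDerivAt_id 0).const_add z.1
    have h2 := HasDerivAt.scomp (h := fun τ : ℝ => z.1 + τ) (0 : ℝ) (by simpa using h) h1
    have := h2.add_const (∑ i, z.2 i ^ 2)
    simpa [HasLineDerivAt, et, Function.comp_def] using this
  · have h1 : ∀ k : Fin d, HasDerivAt
        (fun τ : ℝ => (z.2 k + τ * (Pi.single i (1 : ℝ) : Fin d → ℝ) k) ^ 2)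
        (2 * z.2 k * (Pi.single i (1 : ℝ) : Fin d → ℝ) k) 0 := fun k => by
      have := (((hasDerivAt_id (0 : ℝ)).mul_const
        ((Pi.single i (1 : ℝ) : Fin d → ℝ) k)).const_add (z.2 k)).fun_pow 2
      simpa using this
    have h2 := (HasDerivAt.fun_sum fun k (_ : k ∈ Finset.univ) => h1 k).const_add (√(1 + z.1 ^ 2))
    have e : ∑ k, 2 * z.2 k * (Pi.single i (1 : ℝ) : Fin d → ℝ) k = 2 * z.2 i := by
      simp [Pi.single_apply]
    rw [e] at h2
    simpa [HasLineDerivAt, ex] using h2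
  · have := (((hasDerivAt_id (0 : ℝ)).mul_const
        ((Pi.single i (1 : ℝ) : Fin d → ℝ) j)).const_add (z.2 j)).const_mul 2
    simpa [HasLineDerivAt, ex, Pi.single_apply, eq_comm] using this

/-- Comparison principle on the whole space for functions bounded above. -/
lemma nonpos_of_subsolution {A : TX d → Fin d → Fin d → ℝ} (hA : ∀ z, SPSD (A z)) {Λ : ℝ}
    (hΛ : ∀ z i j, |A z i j| ≤ Λ) {l N S : ℝ} (hl : 0 < l) {v vt : TX d → ℝ}
    {vx : Fin d → TX d → ℝ} {vxx : Fin d → Fin d → TX d → ℝ} (hv : C12 univ v vt vx vxx)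
    (hN : ∀ z, z.1 ≤ S → v z ≤ N)
    (hsub : ∀ z, z.1 ≤ S → 0 < v z → vt z ≤ 1 / 2 * ∑ i, ∑ j, A z i j * vxx i j z - l * v z) :
    ∀ z, z.1 ≤ S → v z ≤ 0 := by
  set c : ℝ := (d * |Λ| + 2) / l with hc
  have hc0 : 0 < c := by positivity
  have key : ∀ ε : ℝ, 0 < ε → ∀ z : TX d, z.1 ≤ S →
      v z ≤ ε * (c + (√(1 + z.1 ^ 2) + ∑ i, z.2 i ^ 2)) := by
    intro ε hε
    have hq := ((C12.const (d := d) (U := univ) c).add C12.penalty).const_mul ε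
    have hw := hv.sub hq
    have hsum0 : ∀ z : TX d, 0 ≤ ∑ i, z.2 i ^ 2 := fun z =>
      Finset.sum_nonneg fun i _ => sq_nonneg _
    have htr : ∀ z, ∑ i, ∑ j, A z i j * (if i = j then (2 : ℝ) else 0) ≤ 2 * (d * |Λ|) := by
      intro z
      simp only [mul_ite, mul_zero, Finset.sum_ite_eq, Finset.mem_univ, if_true]
      calc ∑ i, A z i i * 2 ≤ ∑ i : Fin d, 2 * |Λ| := by
            refine Finset.sum_le_sum fun i _ => ?_
            have := (le_abs_self _).trans ((hΛ z i i).trans (le_abs_self Λ))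
            linarith
        _ = 2 * (d * |Λ|) := by simp; ring
    have hlt := max_principle (K := Metric.closedBall 0 (|N| / ε + 1)) (S := S)
      (A := A) isOpen_univ hw (fun z _ => hA z) ?_ (isCompact_closedBall _ _)
      (subset_univ _) ?_
    · intro z hz
      have := hlt z (mem_univ z) hz
      linarith
    · intro z _ hzS hwz
      have hs1 : 0 < √(1 + z.1 ^ 2) := by positivity
      have hpos : 0 < ε * (c + (√(1 + z.1 ^ 2) + ∑ i, z.2 i ^ 2)) :=
        mul_pos hε (by linarith [hsum0 z])
      have hvz := hsub z hzS (by linarith)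
      have e1 : ∑ i, ∑ j, A z i j * (vxx i j z - ε * (0 + if i = j then (2 : ℝ) else 0))
          = ∑ i, ∑ j, A z i j * vxx i j z
            - ε * ∑ i, ∑ j, A z i j * (if i = j then (2 : ℝ) else 0) := by
        simp only [Finset.mul_sum, ← Finset.sum_sub_distrib]
        refine Finset.sum_congr rfl fun i _ => Finset.sum_congr rfl fun j _ => ?_
        ring
      rw [e1]
      have h1 := htr z
      have h2 : -1 ≤ z.1 / √(1 + z.1 ^ 2) := by
        rw [le_div_iff₀ hs1]
        have : |z.1| ≤ √(1 + z.1 ^ 2) := by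
          rw [← Real.sqrt_sq_eq_abs]
          exact Real.sqrt_le_sqrt (by linarith)
        linarith [neg_abs_le z.1]
      have h3 : l * (ε * c) = ε * (d * |Λ| + 2) := by
        rw [hc]; field_simp
      have h4 : l * (ε * c) ≤ l * v z := by
        refine mul_le_mul_of_nonneg_left ?_ hl.le
        have : ε * c ≤ ε * (c + (√(1 + z.1 ^ 2) + ∑ i, z.2 i ^ 2)) :=
          mul_le_mul_of_nonneg_left (by linarith [hsum0 z]) hε.le
        linarith
      nlinarith
    · intro z _ hzS hwz
      have hb : ε * (c + (√(1 + z.1 ^ 2) + ∑ i, z.2 i ^ 2)) ≤ |N| := by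
        have := hN z hzS
        linarith [le_abs_self N]
      have hb2 : c + (√(1 + z.1 ^ 2) + ∑ i, z.2 i ^ 2) ≤ |N| / ε := by
        rw [le_div_iff₀ hε]; linarith
      rw [mem_closedBall_zero_iff, Prod.norm_def, max_le_iff]
      have h1 : |z.1| ≤ √(1 + z.1 ^ 2) := by
        rw [← Real.sqrt_sq_eq_abs]
        exact Real.sqrt_le_sqrt (by linarith)
      have h2 := norm_sq_le_sum_sq z.2
      have h3 : 0 ≤ √(1 + z.1 ^ 2) := Real.sqrt_nonneg _
      constructor
      · rw [Real.norm_eq_abs]; linarith [hsum0 z]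
      · nlinarith [sq_nonneg (‖z.2‖ - 1)]
  intro z hz
  have hlim : Tendsto (fun ε : ℝ => ε * (c + (√(1 + z.1 ^ 2) + ∑ i, z.2 i ^ 2))) (𝓝[>] 0) (𝓝 0) := by
    have : Tendsto (fun ε : ℝ => ε * (c + (√(1 + z.1 ^ 2) + ∑ i, z.2 i ^ 2))) (𝓝 0)
      (𝓝 (0 * (c + (√(1 + z.1 ^ 2) + ∑ i, z.2 i ^ 2)))) := tendsto_id.mul_const _
    rw [zero_mul] at this
    exact this.mono_left nhdsWithin_le_nhds
  refine ge_of_tendsto hlim ?_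
  filter_upwards [self_mem_nhdsWithin] with ε hε using key ε hε z hz

/-- Uniqueness of bounded solutions on the whole space. -/
lemma eq_zero_of_solution {A : TX d → Fin d → Fin d → ℝ} (hA : ∀ z, SPSD (A z)) {Λ : ℝ}
    (hΛ : ∀ z i j, |A z i j| ≤ Λ) {l N : ℝ} (hl : 0 < l) {v vt : TX d → ℝ}
    {vx : Fin d → TX d → ℝ} {vxx : Fin d → Fin d → TX d → ℝ} (hv : C12 univ v vt vx vxx)
    (hN : ∀ z, |v z| ≤ N)
    (heq : ∀ z, vt z = 1 / 2 * ∑ i, ∑ j, A z i j * vxx i j z - l * v z) :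
    ∀ z, v z = 0 := by
  intro z
  refine le_antisymm ?_ ?_
  · exact nonpos_of_subsolution hA hΛ hl hv (N := N) (S := z.1)
      (fun z _ => (le_abs_self _).trans (hN z)) (fun z _ _ => (heq z).le) z le_rfl
  · have := nonpos_of_subsolution hA hΛ hl (hv.const_mul (-1)) (N := N) (S := z.1)
      (fun z _ => by simpa using (neg_le_abs _).trans (hN z)) (fun z _ _ => by
        rw [heq z]
        have : ∑ i, ∑ j, A z i j * (-1 * vxx i j z) = - ∑ i, ∑ j, A z i j * vxx i j z := by
          simp [Finset.sum_neg_distrib]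
        rw [this]
        linarith) z le_rfl
    linarith

end Calculus

section Gaussian

open MeasureTheory ProbabilityTheory

/-- The standard Gaussian measure on `ℝ^d`. -/
def stdG (d : ℕ) : Measure (Fin d → ℝ) := Measure.pi fun _ => gaussianReal 0 1

instance (d : ℕ) : IsProbabilityMeasure (stdG d) := by
  unfold stdG; infer_instance

namespace stdG

variable {d : ℕ}

lemma charFunDual_eq (L : StrongDual ℝ (Fin d → ℝ)) :
    charFunDual (stdG d) L = Complex.exp (-((∑ i, (L (Pi.single i 1)) ^ 2 : ℝ) : ℂ) / 2) := by
  rw [stdG, charFunDual_pi]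
  have : ∀ i : Fin d, charFunDual (gaussianReal 0 1)
      (L ∘SL ContinuousLinearMap.single ℝ (fun _ : Fin d => ℝ) i)
      = Complex.exp (-(((L (Pi.single i 1)) ^ 2 : ℝ) : ℂ) / 2) := by
    intro i
    rw [charFunDual_eq_charFun_map_one, gaussianReal_map_continuousLinearMap, charFun_gaussianReal]
    congr 1
    simp [Real.coe_toNNReal _ (sq_nonneg (L (Pi.single i 1)))]
    ring
  simp only [this]
  rw [← Complex.exp_sum]
  congr 1
  push_cast
  rw [← Finset.sum_div, ← Finset.sum_neg_distrib]

lemma conv_map {r s : ℝ} (hr : 0 ≤ r) (hs : 0 ≤ s) :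
    (stdG d).map (fun y => √r • y) ∗ (stdG d).map (fun y => √s • y)
      = (stdG d).map (fun y => √(r + s) • y) := by
  have hm : ∀ c : ℝ, (stdG d).map (fun y => c • y)
      = (stdG d).map (c • ContinuousLinearMap.id ℝ (Fin d → ℝ)) := fun c => rfl
  have hp : ∀ c : ℝ, IsProbabilityMeasure ((stdG d).map (fun y => c • y)) := fun c =>
    Measure.isProbabilityMeasure_map (by fun_prop)
  have := hp √r
  have := hp √s
  have := hp √(r + s)
  refine Measure.ext_of_charFunDual ?_
  funext L
  rw [charFunDual_conv, hm, hm, hm, charFunDual_map, charFunDual_map, charFunDual_map,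
    charFunDual_eq, charFunDual_eq, charFunDual_eq, ← Complex.exp_add]
  congr 1
  simp only [ContinuousLinearMap.comp_smul, ContinuousLinearMap.comp_id,
    _root_.smul_apply, smul_eq_mul, mul_pow, ← Finset.mul_sum, Real.sq_sqrt hr,
    Real.sq_sqrt hs, Real.sq_sqrt (add_nonneg hr hs)]
  push_cast
  ring

lemma integral_add_scaled {r s : ℝ} (hr : 0 ≤ r) (hs : 0 ≤ s) {h : (Fin d → ℝ) → ℝ}
    (hc : Continuous h) {M : ℝ} (hM : ∀ x, |h x| ≤ M) :
    ∫ y, ∫ y', h (√r • y + √s • y') ∂(stdG d) ∂(stdG d) = ∫ y, h (√(r + s) • y) ∂(stdG d) := by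
  have hp : ∀ c : ℝ, IsProbabilityMeasure ((stdG d).map (fun y => c • y)) := fun c =>
    Measure.isProbabilityMeasure_map (by fun_prop)
  have := hp √r
  have := hp √s
  have := hp √(r + s)
  have h1 : ∫ y, h (√(r + s) • y) ∂(stdG d)
      = ∫ y, h y ∂((stdG d).map (fun y => √(r + s) • y)) :=
    (integral_map (by fun_prop) hc.aestronglyMeasurable).symm
  have hi : Integrable h ((stdG d).map (fun y => √r • y) ∗ (stdG d).map (fun y => √s • y)) := by
    refine Integrable.of_bound hc.aestronglyMeasurable M (ae_of_all _ fun x => hM x)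
  rw [h1, ← conv_map hr hs, integral_conv hi, integral_map (by fun_prop)]
  · refine integral_congr_ae (ae_of_all _ fun y => ?_)
    simp only
    exact (integral_map (φ := fun y' => √s • y') (f := fun y' => h (√r • y + y'))
      (by fun_prop) (Continuous.aestronglyMeasurable (by fun_prop))).symm
  · refine StronglyMeasurable.aestronglyMeasurable ?_
    have h2 : Continuous (Function.uncurry fun x y : Fin d → ℝ => h (x + y)) := by
      simp only [Function.uncurry_def]
      fun_prop
    exact h2.stronglyMeasurable.integral_prod_right

lemma gaussianReal_shift (c : ℝ) {s : Set ℝ} (hs : MeasurableSet s) :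
    gaussianReal c 1 s
      = ∫⁻ x in s, ENNReal.ofReal (Real.exp (c * x - c ^ 2 / 2)) ∂(gaussianReal 0 1) := by
  rw [gaussianReal_apply _ one_ne_zero, gaussianReal_of_var_ne_zero 0 one_ne_zero,
    setLIntegral_withDensity_eq_setLIntegral_mul _ (measurable_gaussianPDF 0 1)
      (by fun_prop) hs]
  refine setLIntegral_congr_fun hs fun x _ => ?_
  simp only [Pi.mul_apply, gaussianPDF]
  rw [← ENNReal.ofReal_mul (gaussianPDFReal_nonneg _ _ _)]
  congr 1
  simp only [gaussianPDFReal, NNReal.coe_one, mul_one, sub_zero]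
  rw [mul_assoc, ← Real.exp_add]
  congr 2
  ring

/-- The Cameron–Martin formula. -/
lemma integral_shift (c : Fin d → ℝ) {h : (Fin d → ℝ) → ℝ} (hc : Continuous h) :
    ∫ y, h (y + c) ∂(stdG d)
      = ∫ y, h y * Real.exp (∑ i, c i * y i - ∑ i, c i ^ 2 / 2) ∂(stdG d) := by
  set E : (Fin d → ℝ) → ENNReal := fun y => ∏ i, ENNReal.ofReal (Real.exp (c i * y i - c i ^ 2 / 2))
    with hE
  have hEm : Measurable E := by
    rw [hE]
    fun_prop
  have hmap : (stdG d).map (fun y => y + c) = (stdG d).withDensity E := by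
    have h1 : (stdG d).map (fun y => y + c) = Measure.pi fun i => gaussianReal (c i) 1 := by
      have hg : ∀ i, (gaussianReal 0 1).map (fun x => x + c i) = gaussianReal (c i) 1 := fun i => by
        rw [gaussianReal_map_add_const, zero_add]
      have hsf : ∀ i, SigmaFinite ((gaussianReal 0 1).map (fun x => x + c i)) := fun i => by
        rw [hg]; infer_instance
      have := Measure.pi_map_pi (μ := fun _ : Fin d => gaussianReal 0 1)
        (f := fun i x => x + c i) (fun i => by fun_prop)
      rw [stdG]
      simp only [hg] at this
      exact this
    rw [h1]
    refine Measure.pi_eq fun s hs => ?_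
    rw [withDensity_apply _ (MeasurableSet.univ_pi hs), ← lintegral_indicator
      (MeasurableSet.univ_pi hs)]
    have h2 : ∀ y : Fin d → ℝ, (Set.univ.pi s).indicator E y
        = ∏ i, (s i).indicator (fun x => ENNReal.ofReal (Real.exp (c i * x - c i ^ 2 / 2))) (y i) := by
      intro y
      by_cases hy : y ∈ Set.univ.pi s
      · rw [indicator_of_mem hy]
        refine Finset.prod_congr rfl fun i _ => ?_
        rw [indicator_of_mem (hy i (mem_univ i))]
      · rw [indicator_of_notMem hy]
        simp only [Set.mem_pi, Set.mem_univ, true_imp_iff, not_forall] at hy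
        obtain ⟨i, hi⟩ := hy
        rw [eq_comm, Finset.prod_eq_zero (Finset.mem_univ i)]
        rw [indicator_of_notMem hi]
    simp only [h2]
    have hmeas : ∀ i, Measurable ((s i).indicator
        (fun x => ENNReal.ofReal (Real.exp (c i * x - c i ^ 2 / 2)))) := fun i =>
      Measurable.indicator (by fun_prop) (hs i)
    have hind := iIndepFun_pi (μ := fun _ : Fin d => gaussianReal 0 1)
      (X := fun i => (s i).indicator
        (fun x => ENNReal.ofReal (Real.exp (c i * x - c i ^ 2 / 2))))
      (fun i => (hmeas i).aemeasurable)
    rw [stdG, lintegral_prod_eq_prod_lintegral_of_indepFun Finset.univ _ hind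
      (fun i => (hmeas i).comp (measurable_pi_apply i))]
    refine Finset.prod_congr rfl fun i _ => ?_
    rw [gaussianReal_shift _ (hs i), ← lintegral_indicator (hs i)]
    have hmp := measurePreserving_eval (μ := fun _ : Fin d => gaussianReal 0 1) i
    exact hmp.lintegral_comp (hmeas i)
  have h3 : ∫ y, h (y + c) ∂(stdG d) = ∫ y, h y ∂((stdG d).map (fun y => y + c)) :=
    (integral_map (by fun_prop) hc.aestronglyMeasurable).symm
  rw [h3, hmap, integral_withDensity_eq_integral_toReal_smul hEm
    (ae_of_all _ fun y => ENNReal.prod_lt_top fun i _ => ENNReal.ofReal_lt_top)]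
  refine integral_congr_ae (ae_of_all _ fun y => ?_)
  simp only [hE, ENNReal.toReal_prod, smul_eq_mul]
  rw [mul_comm]
  congr 1
  rw [← Finset.sum_sub_distrib, Real.exp_sum]
  refine Finset.prod_congr rfl fun i _ => ?_
  rw [ENNReal.toReal_ofReal (Real.exp_pos _).le]

lemma integrable_exp_linear (c : Fin d → ℝ) :
    Integrable (fun y => Real.exp (∑ i, c i * y i)) (stdG d) := by
  simp only [Real.exp_sum]
  exact Integrable.fintype_prod (f := fun i x => Real.exp (c i * x)) fun i =>
    integrable_exp_mul_gaussianReal (c i)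

lemma exp_norm_le (k : ℝ) (y : Fin d → ℝ) :
    Real.exp (k * ‖y‖) ≤ 1 + ∑ i, (Real.exp (k * y i) + Real.exp (-k * y i)) := by
  have hpos : ∀ i, 0 ≤ Real.exp (k * y i) + Real.exp (-k * y i) := fun i => by positivity
  rcases isEmpty_or_nonempty (Fin d) with h | h
  · have : y = 0 := Subsingleton.elim _ _
    simp [this]
  · obtain ⟨i, hi⟩ : ∃ i, ‖y‖ = |y i| := by
      obtain ⟨i, -, hi⟩ := Finset.exists_mem_eq_sup' Finset.univ_nonempty (fun i => ‖y i‖₊)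
      refine ⟨i, ?_⟩
      rw [Pi.norm_def, ← Finset.sup'_eq_sup Finset.univ_nonempty, hi]
      rfl
    have h1 := Finset.single_le_sum (f := fun i => Real.exp (k * y i) + Real.exp (-k * y i))
      (fun i _ => hpos i) (Finset.mem_univ i)
    have h2 : Real.exp (k * ‖y‖) ≤ Real.exp (k * y i) + Real.exp (-k * y i) := by
      rw [hi]
      rcases abs_cases (y i) with h | h
      · rw [h.1]; linarith [Real.exp_pos (-k * y i)]
      · rw [h.1, mul_neg, ← neg_mul]; linarith [Real.exp_pos (k * y i)]
    linarith

lemma integrable_exp_norm (k : ℝ) :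
    Integrable (fun y : Fin d → ℝ => Real.exp (k * ‖y‖)) (stdG d) := by
  have hs : ∀ (k : ℝ) (i : Fin d), Integrable (fun y : Fin d → ℝ => Real.exp (k * y i)) (stdG d) :=
    fun k i => by
      have := integrable_exp_linear (Pi.single i k : Fin d → ℝ)
      simpa [Pi.single_apply, ite_mul] using this
  refine Integrable.mono' (g := fun y => 1 + ∑ i, (Real.exp (k * y i) + Real.exp (-k * y i)))
    ?_ (by fun_prop) (ae_of_all _ fun y => ?_)
  · exact (integrable_const _).add (integrable_finsetSum _ fun i _ => (hs k i).add (hs (-k) i))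
  · rw [Real.norm_eq_abs, abs_of_pos (Real.exp_pos _)]
    exact exp_norm_le k y

lemma integrable_of_le {h : (Fin d → ℝ) → ℝ} (hc : Continuous h) {C k : ℝ}
    (hb : ∀ y, |h y| ≤ C * Real.exp (k * ‖y‖)) : Integrable h (stdG d) :=
  Integrable.mono' ((integrable_exp_norm k).const_mul C) hc.aestronglyMeasurable
    (ae_of_all _ hb)

lemma norm_le_exp (y : Fin d → ℝ) : ‖y‖ ≤ Real.exp (1 * ‖y‖) := by
  rw [one_mul]; linarith [Real.add_one_le_exp ‖y‖]

lemma integrable_eval (i : Fin d) : Integrable (fun y : Fin d → ℝ => y i) (stdG d) :=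
  integrable_of_le (continuous_apply i) (C := 1) (k := 1) fun y => by
    rw [one_mul]; exact (norm_le_pi_norm y i).trans (norm_le_exp y)

lemma integrable_eval_mul (i j : Fin d) :
    Integrable (fun y : Fin d → ℝ => y i * y j) (stdG d) :=
  integrable_of_le (by fun_prop) (C := 1) (k := 2) fun y => by
    rw [one_mul, abs_mul, show (2:ℝ) * ‖y‖ = 1 * ‖y‖ + 1 * ‖y‖ by ring, Real.exp_add]
    exact mul_le_mul ((norm_le_pi_norm y i).trans (norm_le_exp y))
      ((norm_le_pi_norm y j).trans (norm_le_exp y)) (abs_nonneg _) (Real.exp_pos _).le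

lemma integral_eval (i : Fin d) : ∫ y, y i ∂(stdG d) = 0 := by
  have hmp := measurePreserving_eval (μ := fun _ : Fin d => gaussianReal 0 1) i
  have : ∫ y, Function.eval i y ∂(stdG d) = ∫ x, x ∂(gaussianReal 0 1) := by
    rw [← hmp.map_eq, integral_map (measurable_pi_apply i).aemeasurable (by fun_prop)]
    rfl
  rw [integral_id_gaussianReal] at this
  exact this

lemma integral_eval_mul (i j : Fin d) : ∫ y, y i * y j ∂(stdG d) = if i = j then 1 else 0 := by
  split_ifs with h
  · subst h
    have hmp := measurePreserving_eval (μ := fun _ : Fin d => gaussianReal 0 1) i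
    have h1 : ∫ y, y i * y i ∂(stdG d) = ∫ x, x ^ 2 ∂(gaussianReal 0 1) := by
      rw [← hmp.map_eq, integral_map (measurable_pi_apply i).aemeasurable (by fun_prop)]
      simp only [sq]
      rfl
    have h2 := variance_fun_id_gaussianReal (μ := 0) (v := 1)
    rw [variance_eq_integral (by fun_prop)] at h2
    simp only [integral_id_gaussianReal, sub_zero, NNReal.coe_one] at h2
    rw [h1, h2]
  · have hind := iIndepFun_pi (μ := fun _ : Fin d => gaussianReal 0 1)
      (X := fun i x => x) (fun i => by fun_prop)
    have := (hind.indepFun h).integral_mul_eq_mul_integral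
      (measurable_pi_apply i).aestronglyMeasurable (measurable_pi_apply j).aestronglyMeasurable
    have e := integral_eval (d := d) i
    rw [stdG] at e ⊢
    rw [e, zero_mul] at this
    exact this

end stdG

/-- Continuous functions of at most exponential growth. -/
def GW {d : ℕ} (W : (Fin d → ℝ) → ℝ) : Prop :=
  Continuous W ∧ ∃ C k : ℝ, 0 ≤ k ∧ ∀ y, |W y| ≤ C * Real.exp (k * ‖y‖)

namespace GW

variable {d : ℕ} {W W' : (Fin d → ℝ) → ℝ}

lemma const (c : ℝ) : GW (fun _ : Fin d → ℝ => c) :=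
  ⟨continuous_const, |c|, 0, le_rfl, fun y => by simp⟩

lemma mul (h : GW W) (h' : GW W') : GW (fun y => W y * W' y) := by
  obtain ⟨hc, C, k, hk, hb⟩ := h
  obtain ⟨hc', C', k', hk', hb'⟩ := h'
  refine ⟨hc.mul hc', C * C', k + k', add_nonneg hk hk', fun y => ?_⟩
  rw [abs_mul, add_mul, Real.exp_add, mul_mul_mul_comm]
  exact mul_le_mul (hb y) (hb' y) (abs_nonneg _) ((abs_nonneg _).trans (hb y))

lemma abs (h : GW W) : GW (fun y => |W y|) := by
  obtain ⟨hc, C, k, hk, hb⟩ := h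
  exact ⟨hc.abs, C, k, hk, fun y => by rw [abs_abs]; exact hb y⟩

lemma integrable (h : GW W) : Integrable W (stdG d) := by
  obtain ⟨hc, C, k, hk, hb⟩ := h
  exact stdG.integrable_of_le hc hb

lemma of_le (hc : Continuous W) (C k : ℝ) (hk : 0 ≤ k) (hb : ∀ y, |W y| ≤ C * Real.exp (k * ‖y‖)) :
    GW W := ⟨hc, C, k, hk, hb⟩

lemma of_affine (hc : Continuous W) (a b : ℝ) (ha : 0 ≤ a) (hb : 0 ≤ b)
    (h : ∀ y, |W y| ≤ a + b * ‖y‖) : GW W := by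
  refine ⟨hc, a + b, 1, zero_le_one, fun y => (h y).trans ?_⟩
  have h1 := stdG.norm_le_exp y
  have h2 : 1 ≤ Real.exp (1 * ‖y‖) := Real.one_le_exp (by positivity)
  nlinarith

end GW

namespace GS

variable {d : ℕ} (σ : (Fin d → ℝ) ≃L[ℝ] (Fin d → ℝ))

/-- The linear functional appearing as the weight of the derivative of the Gaussian semigroup. -/
def ell (v y : Fin d → ℝ) : ℝ := ∑ k, σ.symm v k * y k

/-- Gaussian averages with weight `W`. -/
def PW (W : (Fin d → ℝ) → ℝ) (r : ℝ) (g : TX d → ℝ) (z : TX d) : ℝ :=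
  ∫ y, g (z.1, z.2 + √r • σ y) * W y ∂(stdG d)

/-- The Gaussian semigroup. -/
def P (r : ℝ) (g : TX d → ℝ) (z : TX d) : ℝ := PW σ (fun _ => 1) r g z

/-- The derivative of the Gaussian semigroup in direction `v`. -/
def Q (v : Fin d → ℝ) (r : ℝ) (g : TX d → ℝ) (z : TX d) : ℝ := (√r)⁻¹ * PW σ (ell σ v) r g z

/-- A constant for the weight bounds. -/
def ellC : ℝ := d * ‖(σ.symm : (Fin d → ℝ) →L[ℝ] (Fin d → ℝ))‖

lemma ellC_nonneg : 0 ≤ ellC σ := by unfold ellC; positivity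

/-- A constant for the semigroup bounds. -/
def cst : ℝ := 1 + ∫ y, (1 + ‖σ y‖) * (ellC σ * ‖y‖) ∂(stdG d)

lemma one_le_cst : 1 ≤ cst σ := by
  have : 0 ≤ ∫ y, (1 + ‖σ y‖) * (ellC σ * ‖y‖) ∂(stdG d) := integral_nonneg fun y => by
    have := ellC_nonneg σ
    positivity
  unfold cst; linarith

lemma abs_ell_le (v y : Fin d → ℝ) : |ell σ v y| ≤ ellC σ * ‖v‖ * ‖y‖ := by
  unfold ell ellC
  calc |∑ k, σ.symm v k * y k| ≤ ∑ k, |σ.symm v k * y k| := Finset.abs_sum_le_sum_abs _ _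
    _ ≤ ∑ k : Fin d, (‖(σ.symm : (Fin d → ℝ) →L[ℝ] (Fin d → ℝ))‖ * ‖v‖) * ‖y‖ := by
        refine Finset.sum_le_sum fun k _ => ?_
        rw [abs_mul]
        refine mul_le_mul ?_ (norm_le_pi_norm y k) (abs_nonneg _) (by positivity)
        exact (norm_le_pi_norm (σ.symm v) k).trans
          ((σ.symm : (Fin d → ℝ) →L[ℝ] (Fin d → ℝ)).le_opNorm v)
    _ = _ := by simp; ring

lemma ell_continuous (v : Fin d → ℝ) : Continuous (ell σ v) := by
  unfold ell; fun_prop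

lemma GW_ell (v : Fin d → ℝ) : GW (ell σ v) :=
  GW.of_affine (ell_continuous σ v) 0 (ellC σ * ‖v‖) le_rfl
    (mul_nonneg (ellC_nonneg σ) (norm_nonneg _)) fun y => by
      rw [zero_add]; exact abs_ell_le σ v y

lemma GW_norm : GW (fun y => 1 + ‖σ y‖) := by
  refine GW.of_affine (by fun_prop) 1 ‖(σ : (Fin d → ℝ) →L[ℝ] (Fin d → ℝ))‖ zero_le_one
    (norm_nonneg _) fun y => ?_
  rw [abs_of_nonneg (by positivity)]
  have h : ‖σ y‖ ≤ ‖(σ : (Fin d → ℝ) →L[ℝ] (Fin d → ℝ))‖ * ‖y‖ :=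
    (σ : (Fin d → ℝ) →L[ℝ] (Fin d → ℝ)).le_opNorm y
  linarith

lemma integral_norm_mul_abs_ell_le (v : Fin d → ℝ) :
    ∫ y, (1 + ‖σ y‖) * |ell σ v y| ∂(stdG d) ≤ cst σ * ‖v‖ := by
  have h1 : GW (fun y : Fin d → ℝ => ellC σ * ‖y‖) :=
    GW.of_affine (by fun_prop) 0 (ellC σ) le_rfl (ellC_nonneg σ) fun y => by
      rw [abs_of_nonneg (mul_nonneg (ellC_nonneg σ) (norm_nonneg _)), zero_add]
  have h2 : ∫ y, (1 + ‖σ y‖) * |ell σ v y| ∂(stdG d)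
      ≤ ∫ y, ((1 + ‖σ y‖) * (ellC σ * ‖y‖)) * ‖v‖ ∂(stdG d) := by
    refine integral_mono ((GW_norm σ).mul (GW_ell σ v).abs).integrable
      (((GW_norm σ).mul h1).integrable.mul_const _) fun y => ?_
    simp only
    rw [mul_assoc]
    refine mul_le_mul_of_nonneg_left ?_ (by positivity)
    linarith [abs_ell_le σ v y]
  rw [integral_mul_const] at h2
  unfold cst
  nlinarith [norm_nonneg v]

lemma integral_ell (v : Fin d → ℝ) : ∫ y, ell σ v y ∂(stdG d) = 0 := by
  unfold ell
  rw [integral_finsetSum _ fun k _ => (stdG.integrable_eval k).const_mul _]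
  simp [integral_const_mul, stdG.integral_eval]

variable {W W' : (Fin d → ℝ) → ℝ} {g h : TX d → ℝ} {M : ℝ}

lemma integrable_PW (hW : GW W) (hg : Continuous g) (hM : ∀ z, |g z| ≤ M) (r : ℝ) (z : TX d) :
    Integrable (fun y => g (z.1, z.2 + √r • σ y) * W y) (stdG d) := by
  have hWc := hW.1
  refine Integrable.mono' (hW.abs.integrable.const_mul M)
    (Continuous.aestronglyMeasurable (by fun_prop)) (ae_of_all _ fun y => ?_)
  rw [norm_mul]
  exact mul_le_mul_of_nonneg_right (hM _) (abs_nonneg _)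

lemma PW_continuous (hW : GW W) (hg : Continuous g) (hM : ∀ z, |g z| ≤ M) :
    Continuous fun p : ℝ × TX d => PW σ W p.1 g p.2 := by
  have hWc := hW.1
  unfold PW
  refine continuous_of_dominated (bound := fun y => M * |W y|)
    (fun p => Continuous.aestronglyMeasurable (by fun_prop))
    (fun p => ae_of_all _ fun y => ?_) (hW.abs.integrable.const_mul M)
    (ae_of_all _ fun y => by fun_prop)
  rw [norm_mul]
  exact mul_le_mul_of_nonneg_right (hM _) (abs_nonneg _)

lemma PW_sub (hW : GW W) {N : ℝ} (hg : Continuous g) (hM : ∀ z, |g z| ≤ M)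
    (hh : Continuous h) (hN : ∀ z, |h z| ≤ N) (r : ℝ) (z : TX d) :
    PW σ W r (fun z => g z - h z) z = PW σ W r g z - PW σ W r h z := by
  unfold PW
  rw [← integral_sub (integrable_PW σ hW hg hM r z) (integrable_PW σ hW hh hN r z)]
  simp only [sub_mul]

lemma PW_bound (hW : GW W) (hM : ∀ z, |g z| ≤ M) (r : ℝ) (z : TX d) :
    |PW σ W r g z| ≤ M * ∫ y, |W y| ∂(stdG d) := by
  rw [← integral_const_mul, ← Real.norm_eq_abs]
  refine norm_integral_le_of_norm_le (hW.abs.integrable.const_mul M) (ae_of_all _ fun y => ?_)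
  rw [norm_mul]
  exact mul_le_mul_of_nonneg_right (hM _) (abs_nonneg _)

lemma PW_bound_holder (hW : GW W) (hW0 : ∫ y, W y ∂(stdG d) = 0) (hg : Continuous g)
    (hM : ∀ z, |g z| ≤ M) {α N : ℝ} (hα : 0 < α) (hα1 : α ≤ 1)
    (hN : ∀ t x y, |g (t, x) - g (t, y)| ≤ N * ‖x - y‖ ^ α) (r : ℝ) (z : TX d) (hN0 : 0 ≤ N) :
    |PW σ W r g z| ≤ N * √r ^ α * ∫ y, (1 + ‖σ y‖) * |W y| ∂(stdG d) := by
  have h1 : PW σ W r g z = ∫ y, (g (z.1, z.2 + √r • σ y) - g (z.1, z.2)) * W y ∂(stdG d) := by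
    simp only [sub_mul]
    rw [integral_sub (integrable_PW σ hW hg hM r z) (hW.integrable.const_mul _),
      integral_const_mul, hW0, mul_zero, sub_zero]
    rfl
  rw [h1, ← integral_const_mul, ← Real.norm_eq_abs]
  refine norm_integral_le_of_norm_le (((GW_norm σ).mul hW.abs).integrable.const_mul _)
    (ae_of_all _ fun y => ?_)
  rw [norm_mul, ← mul_assoc]
  refine mul_le_mul_of_nonneg_right ((hN _ _ _).trans ?_) (abs_nonneg _)
  rw [mul_assoc]
  refine mul_le_mul_of_nonneg_left ?_ hN0
  rw [add_sub_cancel_left, norm_smul, Real.norm_of_nonneg (Real.sqrt_nonneg _),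
    Real.mul_rpow (Real.sqrt_nonneg _) (norm_nonneg _)]
  refine mul_le_mul_of_nonneg_left ?_ (by positivity)
  calc ‖σ y‖ ^ α ≤ (1 + ‖σ y‖) ^ α := by gcongr; linarith
    _ ≤ (1 + ‖σ y‖) ^ (1 : ℝ) := Real.rpow_le_rpow_of_exponent_le (by linarith [norm_nonneg (σ y)]) hα1
    _ = 1 + ‖σ y‖ := Real.rpow_one _

lemma PW_translate (v : Fin d → ℝ) (r : ℝ) (z : TX d) :
    PW σ W r (fun z => g (z.1, z.2 + v)) z = PW σ W r g (z.1, z.2 + v) := by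
  unfold PW
  congr 1; ext y; simp only; congr 3; abel

lemma PW_comm (hW : GW W) (hW' : GW W') (hg : Continuous g) (hM : ∀ z, |g z| ≤ M) (r s : ℝ)
    (z : TX d) : PW σ W r (PW σ W' s g) z = PW σ W' s (PW σ W r g) z := by
  have hWc := hW.1
  have hWc' := hW'.1
  unfold PW
  simp only [← integral_mul_const]
  rw [integral_integral_swap]
  · congr 1; ext y; congr 1; ext y'
    rw [mul_right_comm]
    congr 4
    abel
  · refine Integrable.mono' ((hW.abs.integrable.mul_prod hW'.abs.integrable).const_mul M)
      (Continuous.aestronglyMeasurable (by simp only [Function.uncurry_def]; fun_prop))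
      (ae_of_all _ fun p => ?_)
    simp only [Function.uncurry_def]
    rw [norm_mul, norm_mul, mul_assoc, mul_comm ‖W' p.2‖]
    exact mul_le_mul_of_nonneg_right (hM _) (by positivity)

lemma P_continuous (hg : Continuous g) (hM : ∀ z, |g z| ≤ M) :
    Continuous fun p : ℝ × TX d => P σ p.1 g p.2 := PW_continuous σ (GW.const 1) hg hM

lemma P_bound (hM : ∀ z, |g z| ≤ M) (r : ℝ) (z : TX d) : |P σ r g z| ≤ M := by
  have := PW_bound σ (GW.const 1) hM r z
  simpa [P] using this

lemma P_add (hg : Continuous g) (hM : ∀ z, |g z| ≤ M) {r s : ℝ} (hr : 0 ≤ r) (hs : 0 ≤ s)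
    (z : TX d) : P σ r (P σ s g) z = P σ (r + s) g z := by
  have := stdG.integral_add_scaled (h := fun y => g (z.1, z.2 + σ y)) hr hs (by fun_prop)
    (fun x => hM _)
  simp only [map_add, map_smul] at this
  unfold P PW
  simp only [mul_one]
  rw [← this]
  simp only [add_assoc]

lemma P_zero (z : TX d) : P σ 0 g z = g z := by
  simp [P, PW]

lemma Q_bound (v : Fin d → ℝ) (hM : ∀ z, |g z| ≤ M) (r : ℝ) (z : TX d) :
    |Q σ v r g z| ≤ cst σ * ‖v‖ * (√r)⁻¹ * M := by
  have h0 : 0 ≤ M := (abs_nonneg _).trans (hM z)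
  have h1 := PW_bound σ (GW_ell σ v) hM r z
  have h2 : ∫ y, |ell σ v y| ∂(stdG d) ≤ cst σ * ‖v‖ := by
    refine le_trans ?_ (integral_norm_mul_abs_ell_le σ v)
    refine integral_mono (GW_ell σ v).abs.integrable ((GW_norm σ).mul (GW_ell σ v).abs).integrable
      fun y => ?_
    simp only
    nlinarith [abs_nonneg (ell σ v y), norm_nonneg (σ y),
      mul_nonneg (norm_nonneg (σ y)) (abs_nonneg (ell σ v y))]
  unfold Q
  rw [abs_mul, abs_of_nonneg (by positivity : 0 ≤ (√r)⁻¹)]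
  calc (√r)⁻¹ * |PW σ (ell σ v) r g z| ≤ (√r)⁻¹ * (M * (cst σ * ‖v‖)) := by
        gcongr; exact h1.trans (by gcongr)
    _ = _ := by ring

lemma Q_bound_holder (v : Fin d → ℝ) (hg : Continuous g) (hM : ∀ z, |g z| ≤ M) {α N : ℝ}
    (hα : 0 < α) (hα1 : α ≤ 1) (hN : ∀ t x y, |g (t, x) - g (t, y)| ≤ N * ‖x - y‖ ^ α)
    (hN0 : 0 ≤ N) (r : ℝ) (z : TX d) :
    |Q σ v r g z| ≤ cst σ * ‖v‖ * N * ((√r)⁻¹ * √r ^ α) := by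
  have h1 := PW_bound_holder σ (GW_ell σ v) (integral_ell σ v) hg hM hα hα1 hN r z hN0
  have h2 := integral_norm_mul_abs_ell_le σ v
  unfold Q
  rw [abs_mul, abs_of_nonneg (by positivity : 0 ≤ (√r)⁻¹)]
  calc (√r)⁻¹ * |PW σ (ell σ v) r g z| ≤ (√r)⁻¹ * (N * √r ^ α * (cst σ * ‖v‖)) := by
        gcongr; exact h1.trans (by gcongr)
    _ = _ := by ring

lemma Q_continuousOn (v : Fin d → ℝ) (hg : Continuous g) (hM : ∀ z, |g z| ≤ M) :
    ContinuousOn (fun p : ℝ × TX d => Q σ v p.1 g p.2) (Set.Ioi 0 ×ˢ Set.univ) := by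
  unfold Q
  refine ContinuousOn.mul (ContinuousOn.inv₀ (by fun_prop) fun p hp => ?_)
    (PW_continuous σ (GW_ell σ v) hg hM).continuousOn
  exact (Real.sqrt_pos.2 hp.1).ne'

lemma Q_continuous (v : Fin d → ℝ) (hg : Continuous g) (hM : ∀ z, |g z| ≤ M) (r : ℝ) :
    Continuous (Q σ v r g) := by
  unfold Q
  have := (PW_continuous σ (GW_ell σ v) hg hM).comp (Continuous.prodMk_right r)
  exact continuous_const.mul this

lemma Q_sub (v : Fin d → ℝ) {N : ℝ} (hg : Continuous g) (hM : ∀ z, |g z| ≤ M)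
    (hh : Continuous h) (hN : ∀ z, |h z| ≤ N) (r : ℝ) (z : TX d) :
    Q σ v r (fun z => g z - h z) z = Q σ v r g z - Q σ v r h z := by
  unfold Q
  rw [PW_sub σ (GW_ell σ v) hg hM hh hN, mul_sub]

lemma Q_translate (v w : Fin d → ℝ) (r : ℝ) (z : TX d) :
    Q σ v r (fun z => g (z.1, z.2 + w)) z = Q σ v r g (z.1, z.2 + w) := by
  unfold Q
  rw [PW_translate]

lemma PW_shift (v : Fin d → ℝ) (hg : Continuous g) {r : ℝ} (hr : 0 < r) (z : TX d) (τ : ℝ) :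
    P σ r g (z + τ • ((0, v) : TX d)) = ∫ y, g (z.1, z.2 + √r • σ y) *
      Real.exp (τ * ((√r)⁻¹ * ell σ v y) - τ ^ 2 * ∑ k, ((√r)⁻¹ * σ.symm v k) ^ 2 / 2) ∂(stdG d) := by
  have h1 := stdG.integral_shift (fun k => τ * ((√r)⁻¹ * σ.symm v k))
    (h := fun y => g (z.1, z.2 + √r • σ y)) (by fun_prop)
  have h2 : ∀ y, √r • σ (y + fun k => τ * ((√r)⁻¹ * σ.symm v k)) = √r • σ y + τ • v := by
    intro y
    have : (fun k => τ * ((√r)⁻¹ * σ.symm v k)) = (τ * (√r)⁻¹) • σ.symm v := by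
      ext k; simp [mul_assoc]
    rw [this, map_add, map_smul, σ.apply_symm_apply, smul_add, smul_smul]
    congr 2
    field_simp
  simp only [h2] at h1
  unfold P PW
  simp only [mul_one]
  convert h1 using 1
  · congr 1; ext y
    congr 1
    simp only [Prod.fst_add, Prod.smul_fst, smul_zero, add_zero, Prod.snd_add, Prod.smul_snd]
    rw [add_assoc, add_comm (τ • v)]
  · congr 1; ext y
    congr 3
    · simp only [ell, Finset.mul_sum]
      refine Finset.sum_congr rfl fun k _ => by ring
    · simp only [Finset.mul_sum]
      refine Finset.sum_congr rfl fun k _ => by ring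

lemma P_hasLineDerivAt (v : Fin d → ℝ) (hg : Continuous g) (hM : ∀ z, |g z| ≤ M) {r : ℝ}
    (hr : 0 < r) (z : TX d) : HasLineDerivAt ℝ (P σ r g) (Q σ v r g z) z (0, v) := by
  unfold HasLineDerivAt
  simp only [PW_shift σ v hg hr z]
  set S := ∑ k, ((√r)⁻¹ * σ.symm v k) ^ 2 / 2 with hS
  have hS0 : 0 ≤ S := Finset.sum_nonneg fun k _ => by positivity
  set L : (Fin d → ℝ) → ℝ := fun y => (√r)⁻¹ * ell σ v y with hL
  have hLG : GW L := (GW.const _).mul (GW_ell σ v)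
  have hLc := hLG.1
  have hLb : ∀ y, |L y| ≤ (√r)⁻¹ * (ellC σ * ‖v‖) * ‖y‖ := fun y => by
    rw [hL]; simp only
    rw [abs_mul, abs_of_nonneg (by positivity : 0 ≤ (√r)⁻¹), mul_assoc]
    gcongr; exact abs_ell_le σ v y
  have hb0 : 0 ≤ (√r)⁻¹ * (ellC σ * ‖v‖) := by
    have := ellC_nonneg σ
    positivity
  have hE : GW fun y => Real.exp |L y| := GW.of_le (by fun_prop) 1 _ hb0 fun y => by
    rw [abs_of_pos (Real.exp_pos _), one_mul]
    exact Real.exp_le_exp.2 (hLb y)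
  have hS' : GW fun y => |L y| + 2 * S := by
    refine GW.of_affine (by fun_prop) (2 * S) _ (by positivity) hb0 fun y => ?_
    rw [abs_of_nonneg (by positivity)]
    linarith [hLb y]
  have key := hasDerivAt_integral_of_dominated_loc_of_deriv_le (μ := stdG d) (𝕜 := ℝ)
    (F := fun τ y => g (z.1, z.2 + √r • σ y) * Real.exp (τ * L y - τ ^ 2 * S))
    (F' := fun τ y => g (z.1, z.2 + √r • σ y) *
      (Real.exp (τ * L y - τ ^ 2 * S) * (L y - 2 * τ * S)))
    (x₀ := 0) (s := Metric.ball 0 1) (bound := fun y => M * (Real.exp |L y| * (|L y| + 2 * S)))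
    (Metric.ball_mem_nhds _ one_pos)
    (Eventually.of_forall fun τ => Continuous.aestronglyMeasurable (by fun_prop))
    (by
      simp only [zero_mul, ne_eq, OfNat.ofNat_ne_zero, not_false_eq_true, zero_pow, sub_zero,
        Real.exp_zero]
      exact integrable_PW σ (GW.const 1) hg hM r z)
    (Continuous.aestronglyMeasurable (by fun_prop))
    (ae_of_all _ fun y τ hτ => by
      rw [Metric.mem_ball, dist_zero_right, Real.norm_eq_abs] at hτ
      rw [norm_mul, norm_mul, Real.norm_of_nonneg (Real.exp_pos _).le]
      have h1 : τ * L y ≤ |L y| := by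
        calc τ * L y ≤ |τ * L y| := le_abs_self _
          _ ≤ 1 * |L y| := by rw [abs_mul]; gcongr
          _ = |L y| := one_mul _
      refine mul_le_mul (hM _) (mul_le_mul (Real.exp_le_exp.2 ?_) ?_ (norm_nonneg _)
        (Real.exp_pos _).le) (by positivity) ((abs_nonneg _).trans (hM z))
      · nlinarith [sq_nonneg τ]
      · calc ‖L y - 2 * τ * S‖ ≤ |L y| + |2 * τ * S| := norm_sub_le _ _
          _ ≤ |L y| + 2 * S := by
            gcongr
            rw [abs_mul, abs_mul, abs_of_nonneg hS0, abs_two]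
            nlinarith)
    ((hE.mul hS').integrable.const_mul M)
    (ae_of_all _ fun y τ _ => by
      refine HasDerivAt.const_mul _ ?_
      refine HasDerivAt.exp ?_
      have h1 := (hasDerivAt_id τ).mul_const (L y)
      have h2 := ((hasDerivAt_id τ).pow 2).mul_const S
      refine (h1.sub h2).congr_deriv ?_
      simp)
  refine key.2.congr_deriv ?_
  simp only [Q, PW]
  rw [← integral_const_mul]
  congr 1; ext y
  simp [hL]
  ring

lemma P_hasLineDerivAt' (i : Fin d) (hg : Continuous g) (hM : ∀ z, |g z| ≤ M) {r : ℝ}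
    (hr : 0 < r) (z : TX d) :
    HasLineDerivAt ℝ (P σ r g) (Q σ (Pi.single i 1) r g z) z (ex i) :=
  P_hasLineDerivAt σ _ hg hM hr z

lemma P_sub_le (hg : Continuous g) (hM : ∀ z, |g z| ≤ M) {r : ℝ}
    (hr : 0 < r) (t : ℝ) (x y : Fin d → ℝ) :
    |P σ r g (t, x) - P σ r g (t, y)| ≤ cst σ * (√r)⁻¹ * M * ‖x - y‖ := by
  have h1 : ∀ s : ℝ, HasDerivAt (fun s : ℝ => P σ r g ((t, y) + s • ((0, x - y) : TX d)))
      (Q σ (x - y) r g ((t, y) + s • ((0, x - y) : TX d))) s := fun s =>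
    (P_hasLineDerivAt σ (x - y) hg hM hr _).shift
  have h2 := norm_image_sub_le_of_norm_deriv_le_segment_01' (fun s _ => (h1 s).hasDerivWithinAt)
    (C := cst σ * ‖x - y‖ * (√r)⁻¹ * M) fun s _ => Q_bound σ (x - y) hM r _
  simp only [one_smul, zero_smul, add_zero, Prod.mk_add_mk, add_sub_cancel] at h2
  refine h2.trans (le_of_eq (by ring))

lemma PQ_comm (v : Fin d → ℝ) (hg : Continuous g) (hM : ∀ z, |g z| ≤ M) (r s : ℝ) (z : TX d) :
    P σ s (Q σ v r g) z = Q σ v r (P σ s g) z := by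
  have := PW_comm σ (GW.const 1) (GW_ell σ v) hg hM s r z
  unfold P Q
  rw [show PW σ (ell σ v) r (fun z => PW σ (fun _ => 1) s g z) z
    = PW σ (ell σ v) r (PW σ (fun _ => 1) s g) z from rfl, ← this]
  unfold PW
  rw [← integral_const_mul]
  simp only [mul_assoc]

lemma Q_add (v : Fin d → ℝ) (hg : Continuous g) (hM : ∀ z, |g z| ≤ M) {r s : ℝ} (hr : 0 < r)
    (hs : 0 ≤ s) (z : TX d) : Q σ v (r + s) g z = P σ s (Q σ v r g) z := by
  rw [PQ_comm σ v hg hM]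
  have h1 := P_hasLineDerivAt σ v hg hM (add_pos_of_pos_of_nonneg hr hs) z
  have h2 := P_hasLineDerivAt σ v ((P_continuous σ hg hM).comp (Continuous.prodMk_right s))
    (fun z => P_bound σ hM s z) hr z
  have h3 : P σ r ((fun p : ℝ × TX d => P σ p.1 g p.2) ∘ Prod.mk s) = P σ (r + s) g := by
    funext z; exact P_add σ hg hM hr.le hs z
  rw [h3] at h2
  exact h1.unique h2

end GS

lemma integrableOn_rpow_mul_exp {l a : ℝ} (hl : 0 < l) (ha : 0 < a) :
    IntegrableOn (fun r : ℝ => r ^ (a - 1) * Real.exp (-(l * r))) (Set.Ioi 0) := by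
  by_contra h
  have h1 := Real.integral_rpow_mul_exp_neg_mul_Ioi ha hl
  rw [integral_undef h] at h1
  have : 0 < (1 / l) ^ a * Real.Gamma a := mul_pos (by positivity) (Real.Gamma_pos_of_pos ha)
  linarith

lemma exists_holder_majorant {α δ : ℝ} (hα : 0 < α) (hα1 : α < 1) (hδ : 0 < δ) (A B : ℝ) :
    ∃ b : ℝ → ℝ, IntegrableOn b (Set.Ioi 0) ∧
      (∀ r, r ≤ δ ^ 2 → b r = A * r ^ (α / 2 - 1)) ∧
      (∀ r, δ ^ 2 < r → b r = B * δ * r ^ ((α - 3) / 2)) ∧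
      ∫ r in Set.Ioi 0, b r = (A * (2 / α) + B * (2 / (1 - α))) * δ ^ α := by
  have hδ2 : 0 < δ ^ 2 := by positivity
  have hU : Set.Ioc 0 (δ ^ 2) ∪ Set.Ioi (δ ^ 2) = Set.Ioi (0 : ℝ) := Set.Ioc_union_Ioi_eq_Ioi hδ2.le
  set b : ℝ → ℝ := fun r => if r ≤ δ ^ 2 then A * r ^ (α / 2 - 1) else B * δ * r ^ ((α - 3) / 2)
    with hb
  have e1 : EqOn (fun r => A * r ^ (α / 2 - 1)) b (Set.Ioc 0 (δ ^ 2)) := fun r hr => by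
    simp [hb, hr.2]
  have e2 : EqOn (fun r => B * δ * r ^ ((α - 3) / 2)) b (Set.Ioi (δ ^ 2)) := fun r hr => by
    simp only [hb, if_neg (not_le.2 (Set.mem_Ioi.1 hr))]
  have j1 : IntegrableOn (fun r : ℝ => A * r ^ (α / 2 - 1)) (Set.Ioc 0 (δ ^ 2)) := by
    have := intervalIntegral.intervalIntegrable_rpow' (a := 0) (b := δ ^ 2) (r := α / 2 - 1)
      (by linarith)
    rw [intervalIntegrable_iff_integrableOn_Ioc_of_le hδ2.le] at this
    exact this.const_mul A
  have j2 : IntegrableOn (fun r : ℝ => B * δ * r ^ ((α - 3) / 2)) (Set.Ioi (δ ^ 2)) :=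
    (integrableOn_Ioi_rpow_of_lt (by linarith) hδ2).const_mul _
  have i1 := j1.congr_fun e1 measurableSet_Ioc
  have i2 := j2.congr_fun e2 measurableSet_Ioi
  refine ⟨b, by rw [← hU]; exact i1.union i2, fun r hr => by simp [hb, hr],
    fun r hr => by simp [hb, not_le.2 hr], ?_⟩
  rw [← hU, setIntegral_union (Set.Ioc_disjoint_Ioi le_rfl) measurableSet_Ioi i1 i2,
    ← setIntegral_congr_fun measurableSet_Ioc e1, ← setIntegral_congr_fun measurableSet_Ioi e2,
    integral_const_mul, integral_const_mul, ← intervalIntegral.integral_of_le hδ2.le,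
    integral_rpow (Or.inl (by linarith)), integral_Ioi_rpow_of_lt (by linarith) hδ2]
  have p1 : (δ ^ 2) ^ (α / 2 - 1 + 1) = δ ^ α := by
    rw [← Real.rpow_natCast, ← Real.rpow_mul hδ.le]; congr 1; push_cast; ring
  have p2 : δ * (δ ^ 2) ^ ((α - 3) / 2 + 1) = δ ^ α := by
    rw [← Real.rpow_natCast, ← Real.rpow_mul hδ.le]
    nth_rw 1 [← Real.rpow_one δ]
    rw [← Real.rpow_add hδ]; congr 1; push_cast; ring
  rw [p1, Real.zero_rpow (by linarith), add_mul, ← p2]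
  have h4 : 1 - α ≠ 0 := by linarith
  generalize (δ ^ 2) ^ ((α - 3) / 2 + 1) = X
  rw [show (α - 3) / 2 + 1 = -((1 - α) / 2) by ring, neg_div_neg_eq,
    show α / 2 - 1 + 1 = α / 2 by ring]
  field_simp
  ring

/-- Integration of a family of functions against the backward time shift. -/
def J {d : ℕ} (F : ℝ → TX d → ℝ) (z : TX d) : ℝ := ∫ r in Set.Ioi 0, F r (z.1 - r, z.2)

namespace J

variable {d : ℕ} {F F' : ℝ → TX d → ℝ} {b b' : ℝ → ℝ}

lemma aesm (hF : ContinuousOn (fun p : ℝ × TX d => F p.1 p.2) (Set.Ioi 0 ×ˢ Set.univ)) (z : TX d) :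
    AEStronglyMeasurable (fun r => F r (z.1 - r, z.2)) (volume.restrict (Set.Ioi 0)) := by
  refine ContinuousOn.aestronglyMeasurable ?_ measurableSet_Ioi
  exact hF.comp (f := fun r : ℝ => (r, ((z.1 - r, z.2) : TX d))) (by fun_prop)
    fun r hr => ⟨hr, trivial⟩

lemma integrableOn (hF : ContinuousOn (fun p : ℝ × TX d => F p.1 p.2) (Set.Ioi 0 ×ˢ Set.univ))
    (hb : ∀ r, 0 < r → ∀ z, |F r z| ≤ b r) (hbi : IntegrableOn b (Set.Ioi 0)) (z : TX d) :
    IntegrableOn (fun r => F r (z.1 - r, z.2)) (Set.Ioi 0) :=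
  Integrable.mono' hbi (aesm hF z) ((ae_restrict_iff' measurableSet_Ioi).2
    (ae_of_all _ fun r hr => hb r hr _))

lemma continuous (hF : ContinuousOn (fun p : ℝ × TX d => F p.1 p.2) (Set.Ioi 0 ×ˢ Set.univ))
    (hb : ∀ r, 0 < r → ∀ z, |F r z| ≤ b r) (hbi : IntegrableOn b (Set.Ioi 0)) :
    Continuous (J F) := by
  refine continuous_of_dominated (fun z => aesm hF z)
    (fun z => (ae_restrict_iff' measurableSet_Ioi).2 (ae_of_all _ fun r hr => hb r hr _)) hbi
    ((ae_restrict_iff' measurableSet_Ioi).2 (ae_of_all _ fun r hr => ?_))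
  exact hF.comp_continuous (f := fun z : TX d => (r, ((z.1 - r, z.2) : TX d))) (by fun_prop)
    fun z => ⟨hr, trivial⟩

lemma bound (hb : ∀ r, 0 < r → ∀ z, |F r z| ≤ b r) (hbi : IntegrableOn b (Set.Ioi 0)) (z : TX d) :
    |J F z| ≤ ∫ r in Set.Ioi 0, b r := by
  rw [← Real.norm_eq_abs]
  exact norm_integral_le_of_norm_le hbi ((ae_restrict_iff' measurableSet_Ioi).2
    (ae_of_all _ fun r hr => hb r hr _))

lemma sub_bound (hF : ContinuousOn (fun p : ℝ × TX d => F p.1 p.2) (Set.Ioi 0 ×ˢ Set.univ))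
    (hb : ∀ r, 0 < r → ∀ z, |F r z| ≤ b r) (hbi : IntegrableOn b (Set.Ioi 0))
    {x y : Fin d → ℝ} (hb' : ∀ r, 0 < r → ∀ t, |F r (t, x) - F r (t, y)| ≤ b' r)
    (hbi' : IntegrableOn b' (Set.Ioi 0)) (t : ℝ) :
    |J F (t, x) - J F (t, y)| ≤ ∫ r in Set.Ioi 0, b' r := by
  unfold J
  rw [← integral_sub (integrableOn hF hb hbi (t, x)) (integrableOn hF hb hbi (t, y)),
    ← Real.norm_eq_abs]
  exact norm_integral_le_of_norm_le hbi' ((ae_restrict_iff' measurableSet_Ioi).2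
    (ae_of_all _ fun r hr => hb' r hr _))

lemma hasLineDerivAt (hF : ContinuousOn (fun p : ℝ × TX d => F p.1 p.2) (Set.Ioi 0 ×ˢ Set.univ))
    (hb : ∀ r, 0 < r → ∀ z, |F r z| ≤ b r) (hbi : IntegrableOn b (Set.Ioi 0))
    (hF' : ContinuousOn (fun p : ℝ × TX d => F' p.1 p.2) (Set.Ioi 0 ×ˢ Set.univ))
    (hb' : ∀ r, 0 < r → ∀ z, |F' r z| ≤ b' r) (hbi' : IntegrableOn b' (Set.Ioi 0)) {i : Fin d}
    (hd : ∀ r, 0 < r → ∀ z, HasLineDerivAt ℝ (F r) (F' r z) z (ex i)) (z : TX d) :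
    HasLineDerivAt ℝ (J F) (J F' z) z (ex i) := by
  unfold HasLineDerivAt
  have key := hasDerivAt_integral_of_dominated_loc_of_deriv_le (𝕜 := ℝ)
    (μ := volume.restrict (Set.Ioi 0))
    (F := fun τ r => F r ((z + τ • (ex i : TX d)).1 - r, (z + τ • (ex i : TX d)).2))
    (F' := fun τ r => F' r ((z + τ • (ex i : TX d)).1 - r, (z + τ • (ex i : TX d)).2))
    (x₀ := 0) (s := Set.univ) (bound := b') univ_mem
    (Eventually.of_forall fun τ => aesm hF _) (integrableOn hF hb hbi _) (aesm hF' _)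
    ((ae_restrict_iff' measurableSet_Ioi).2 (ae_of_all _ fun r hr τ _ => hb' r hr _)) hbi'
    ((ae_restrict_iff' measurableSet_Ioi).2 (ae_of_all _ fun r hr τ _ => by
      have e : ∀ τ : ℝ, ((z + τ • (ex i : TX d)).1 - r, (z + τ • (ex i : TX d)).2)
          = ((z.1 - r, z.2) : TX d) + τ • (ex i : TX d) := fun τ => by
        ext <;> simp [ex]
      simp only [e]
      exact (hd r hr _).shift))
  simpa [J] using key.2

end J

namespace GS

variable {d : ℕ} (σ : (Fin d → ℝ) ≃L[ℝ] (Fin d → ℝ)) {g h : TX d → ℝ} {M N α l : ℝ}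

lemma PW_continuous_param {W : (Fin d → ℝ) → ℝ} (hW : GW W) {G : ℝ → TX d → ℝ}
    (hG : Continuous fun p : ℝ × TX d => G p.1 p.2) (hM : ∀ r z, |G r z| ≤ M) :
    Continuous fun p : ℝ × TX d => PW σ W p.1 (G p.1) p.2 := by
  have hWc := hW.1
  unfold PW
  refine continuous_of_dominated (bound := fun y => M * |W y|)
    (fun p => Continuous.aestronglyMeasurable ?_)
    (fun p => ae_of_all _ fun y => ?_) (hW.abs.integrable.const_mul M)
    (ae_of_all _ fun y => ?_)
  · exact (hG.comp (f := fun y => (p.1, ((p.2.1, p.2.2 + √p.1 • σ y) : TX d)))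
      (by fun_prop)).mul hWc
  · rw [norm_mul]
    exact mul_le_mul_of_nonneg_right (hM _ _) (abs_nonneg _)
  · exact (hG.comp (f := fun p : ℝ × TX d => (p.1, ((p.2.1, p.2.2 + √p.1 • σ y) : TX d)))
      (by fun_prop)).mul continuous_const

lemma QQ_continuousOn (v w : Fin d → ℝ) (hg : Continuous g) (hM : ∀ z, |g z| ≤ M) :
    ContinuousOn (fun p : ℝ × TX d => Q σ v (p.1 / 2) (Q σ w (p.1 / 2) g) p.2)
      (Set.Ioi 0 ×ˢ Set.univ) := by
  have h1 := PW_continuous_param σ (GW_ell σ v) (PW_continuous σ (GW_ell σ w) hg hM)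
    (fun r z => PW_bound σ (GW_ell σ w) hM r z)
  have h2 : Continuous fun p : ℝ × TX d => ((p.1 / 2, p.2) : ℝ × TX d) := by fun_prop
  have e : ∀ p : ℝ × TX d, Q σ v (p.1 / 2) (Q σ w (p.1 / 2) g) p.2
      = (√(p.1 / 2))⁻¹ * ((√(p.1 / 2))⁻¹ *
        PW σ (ell σ v) (p.1 / 2) (PW σ (ell σ w) (p.1 / 2) g) p.2) := by
    intro p
    unfold Q
    congr 1
    unfold PW
    rw [← integral_const_mul]
    simp only [mul_assoc]
  simp only [e]
  have h3 : ContinuousOn (fun p : ℝ × TX d => (√(p.1 / 2))⁻¹) (Set.Ioi 0 ×ˢ Set.univ) :=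
    ContinuousOn.inv₀ (by fun_prop) fun p hp => (Real.sqrt_pos.2 (half_pos hp.1)).ne'
  exact h3.mul (h3.mul (h1.comp h2).continuousOn)

lemma sub_translate (hg : HB α M g) (v : Fin d → ℝ) (z : TX d) :
    |g (z.1, z.2 + v) - g z| ≤ M * ‖v‖ ^ α := by
  simpa using hg.hol z.1 (z.2 + v) z.2

lemma P_holder (hg : HB α M g) (r t : ℝ) (x y : Fin d → ℝ) :
    |P σ r g (t, x) - P σ r g (t, y)| ≤ M * ‖x - y‖ ^ α := by
  have hc := hg.cont
  have h1 := P_bound σ (fun z => sub_translate hg (x - y) z) r (t, y)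
  unfold P at h1 ⊢
  rw [PW_sub σ (GW.const 1) (by fun_prop) (fun z => hg.bdd _) hg.cont hg.bdd, PW_translate] at h1
  simpa using h1

lemma Q_holder (hg : HB α M g) (v : Fin d → ℝ) (r t : ℝ) (x y : Fin d → ℝ) :
    |Q σ v r g (t, x) - Q σ v r g (t, y)| ≤ cst σ * ‖v‖ * (√r)⁻¹ * (M * ‖x - y‖ ^ α) := by
  have hc := hg.cont
  have h1 := Q_bound σ v (fun z => sub_translate hg (x - y) z) r (t, y)
  rw [Q_sub σ v (by fun_prop) (fun z => hg.bdd _) hg.cont hg.bdd, Q_translate] at h1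
  simpa using h1

lemma inv_sqrt_eq {r : ℝ} (hr : 0 < r) : (√r)⁻¹ = r ^ ((1 : ℝ) / 2 - 1) := by
  rw [Real.sqrt_eq_rpow, ← Real.rpow_neg hr.le]; norm_num

lemma inv_sqrt_mul_eq {r : ℝ} (hr : 0 < r) (α : ℝ) :
    (√r)⁻¹ * √r ^ α = r ^ ((α - 1) / 2) := by
  rw [Real.sqrt_eq_rpow, ← Real.rpow_neg hr.le, ← Real.rpow_mul hr.le, ← Real.rpow_add hr]
  congr 1; ring

lemma QQ_bound (hα : 0 < α) (hα1 : α < 1) (hg : HB α M g) {v w : Fin d → ℝ} (hv : ‖v‖ = 1)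
    (hw : ‖w‖ = 1) {r : ℝ} (hr : 0 < r) (z : TX d) :
    |Q σ v (r / 2) (Q σ w (r / 2) g) z| ≤ 4 * cst σ ^ 2 * M * r ^ (α / 2 - 1) := by
  have hs : 0 < r / 2 := half_pos hr
  have hM := hg.nonneg
  have hc := one_le_cst σ
  have h1 := fun z => Q_bound_holder σ w hg.cont hg.bdd hα hα1.le hg.hol hM (r / 2) z
  have h2 := Q_bound σ v h1 (r / 2) z
  refine h2.trans ?_
  rw [hv, hw, inv_sqrt_mul_eq hs, inv_sqrt_eq hs]
  have e : (r / 2) ^ ((1 : ℝ) / 2 - 1) * (r / 2) ^ ((α - 1) / 2) = (r / 2) ^ (α / 2 - 1) := by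
    rw [← Real.rpow_add hs]; congr 1; ring
  have e2 : (r / 2) ^ (α / 2 - 1) ≤ 4 * r ^ (α / 2 - 1) := by
    rw [Real.div_rpow hr.le zero_le_two, div_eq_mul_inv, ← Real.rpow_neg zero_le_two, mul_comm]
    gcongr
    calc (2 : ℝ) ^ (-(α / 2 - 1)) ≤ 2 ^ (2 : ℝ) :=
          Real.rpow_le_rpow_of_exponent_le one_le_two (by linarith)
      _ = 4 := by norm_num
  calc _ = cst σ ^ 2 * M * ((r / 2) ^ ((1 : ℝ) / 2 - 1) * (r / 2) ^ ((α - 1) / 2)) := by ring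
    _ ≤ cst σ ^ 2 * M * (4 * r ^ (α / 2 - 1)) := by rw [e]; gcongr
    _ = _ := by ring

lemma QQ_lip (hα : 0 < α) (hα1 : α < 1) (hg : HB α M g) {v w : Fin d → ℝ} (hv : ‖v‖ = 1)
    (hw : ‖w‖ = 1) {r : ℝ} (hr : 0 < r) (t : ℝ) (x y : Fin d → ℝ) :
    |Q σ v (r / 2) (Q σ w (r / 2) g) (t, x) - Q σ v (r / 2) (Q σ w (r / 2) g) (t, y)|
      ≤ 8 * cst σ ^ 3 * M * ‖x - y‖ * r ^ ((α - 3) / 2) := by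
  have hs : 0 < r / 4 := by positivity
  have hM := hg.nonneg
  have hc := one_le_cst σ
  have h1 := fun z => Q_bound_holder σ w hg.cont hg.bdd hα hα1.le hg.hol hM (r / 4) z
  have hqc : Continuous (Q σ w (r / 4) g) := Q_continuous σ w hg.cont hg.bdd _
  have h2 := fun z => Q_bound σ v h1 (r / 2) z
  have e : Q σ v (r / 2) (Q σ w (r / 2) g) = P σ (r / 4) (Q σ v (r / 2) (Q σ w (r / 4) g)) := by
    funext z
    rw [PQ_comm σ v hqc h1]
    congr 1
    funext z
    rw [show r / 2 = r / 4 + r / 4 by ring, Q_add σ w hg.cont hg.bdd hs hs.le]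
  have h3 := P_sub_le σ (Q_continuous σ v hqc h1 _) h2 hs t x y
  rw [e]
  refine h3.trans ?_
  have h4 : (√(r / 2))⁻¹ ≤ (√(r / 4))⁻¹ := by
    refine inv_anti₀ (Real.sqrt_pos.2 hs) (Real.sqrt_le_sqrt (by linarith))
  have e2 : (√(r / 4))⁻¹ * (√(r / 4))⁻¹ * (r / 4) ^ ((α - 1) / 2) ≤ 8 * r ^ ((α - 3) / 2) := by
    rw [inv_sqrt_eq hs, ← Real.rpow_add hs, ← Real.rpow_add hs,
      show (1 : ℝ) / 2 - 1 + (1 / 2 - 1) + (α - 1) / 2 = (α - 3) / 2 by ring,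
      Real.div_rpow hr.le (by norm_num), div_eq_mul_inv, ← Real.rpow_neg (by norm_num), mul_comm]
    gcongr
    calc (4 : ℝ) ^ (-((α - 3) / 2)) ≤ 4 ^ (3 / 2 : ℝ) :=
          Real.rpow_le_rpow_of_exponent_le (by norm_num) (by linarith)
      _ = 8 := by
        rw [show (4 : ℝ) = 2 ^ (2 : ℝ) by norm_num, ← Real.rpow_mul (by norm_num)]; norm_num
  rw [hv, hw, inv_sqrt_mul_eq hs]
  calc _ = cst σ ^ 3 * M * ‖x - y‖ * ((√(r / 4))⁻¹ * (√(r / 2))⁻¹ * (r / 4) ^ ((α - 1) / 2)) := by ring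
    _ ≤ cst σ ^ 3 * M * ‖x - y‖ * ((√(r / 4))⁻¹ * (√(r / 4))⁻¹ * (r / 4) ^ ((α - 1) / 2)) := by
        gcongr
    _ ≤ cst σ ^ 3 * M * ‖x - y‖ * (8 * r ^ ((α - 3) / 2)) := by gcongr
    _ = _ := by ring

/-- The integrand of the resolvent. -/
def G0 (l : ℝ) (g : TX d → ℝ) (r : ℝ) (z : TX d) : ℝ := Real.exp (-(l * r)) * P σ r g z

/-- The integrand of the first derivatives of the resolvent. -/
def G1 (i : Fin d) (l : ℝ) (g : TX d → ℝ) (r : ℝ) (z : TX d) : ℝ :=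
  Real.exp (-(l * r)) * Q σ (Pi.single i 1) r g z

/-- The integrand of the second derivatives of the resolvent. -/
def G2 (i j : Fin d) (l : ℝ) (g : TX d → ℝ) (r : ℝ) (z : TX d) : ℝ :=
  Real.exp (-(l * r)) * Q σ (Pi.single i 1) (r / 2) (Q σ (Pi.single j 1) (r / 2) g) z

lemma norm_single (i : Fin d) : ‖(Pi.single i 1 : Fin d → ℝ)‖ = 1 := by
  rw [Pi.norm_single, norm_one]

lemma G0_cont (hg : HB α M g) : ContinuousOn (fun p : ℝ × TX d => G0 σ l g p.1 p.2)
    (Set.Ioi 0 ×ˢ Set.univ) :=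
  ContinuousOn.mul (by fun_prop) (P_continuous σ hg.cont hg.bdd).continuousOn

lemma G1_cont (i : Fin d) (hg : HB α M g) : ContinuousOn (fun p : ℝ × TX d => G1 σ i l g p.1 p.2)
    (Set.Ioi 0 ×ˢ Set.univ) :=
  ContinuousOn.mul (by fun_prop) (Q_continuousOn σ _ hg.cont hg.bdd)

lemma G2_cont (i j : Fin d) (hg : HB α M g) :
    ContinuousOn (fun p : ℝ × TX d => G2 σ i j l g p.1 p.2) (Set.Ioi 0 ×ˢ Set.univ) :=
  ContinuousOn.mul (by fun_prop) (QQ_continuousOn σ _ _ hg.cont hg.bdd)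

lemma G0_bound (hg : HB α M g) (r : ℝ) (_ : 0 < r) (z : TX d) :
    |G0 σ l g r z| ≤ M * (r ^ ((1 : ℝ) - 1) * Real.exp (-(l * r))) := by
  unfold G0
  rw [abs_mul, abs_of_pos (Real.exp_pos _), sub_self, Real.rpow_zero, one_mul, mul_comm]
  gcongr
  exact P_bound σ hg.bdd r z

lemma G1_bound (i : Fin d) (hg : HB α M g) (r : ℝ) (hr : 0 < r) (z : TX d) :
    |G1 σ i l g r z| ≤ cst σ * M * (r ^ ((1 : ℝ) / 2 - 1) * Real.exp (-(l * r))) := by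
  unfold G1
  rw [abs_mul, abs_of_pos (Real.exp_pos _), ← mul_assoc, mul_comm]
  gcongr
  refine (Q_bound σ _ hg.bdd r z).trans (le_of_eq ?_)
  rw [norm_single, inv_sqrt_eq hr]; ring

lemma G2_bound (hα : 0 < α) (hα1 : α < 1) (i j : Fin d) (hg : HB α M g) (r : ℝ) (hr : 0 < r)
    (z : TX d) : |G2 σ i j l g r z|
      ≤ 4 * cst σ ^ 2 * M * (r ^ (α / 2 - 1) * Real.exp (-(l * r))) := by
  unfold G2
  rw [abs_mul, abs_of_pos (Real.exp_pos _), ← mul_assoc, mul_comm]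
  gcongr
  exact QQ_bound σ hα hα1 hg (norm_single _) (norm_single _) hr z

lemma G0_deriv (i : Fin d) (hg : HB α M g) (r : ℝ) (hr : 0 < r) (z : TX d) :
    HasLineDerivAt ℝ (G0 σ l g r) (G1 σ i l g r z) z (ex i) :=
  HasDerivAt.const_mul _ (P_hasLineDerivAt' σ i hg.cont hg.bdd hr z)

lemma G1_deriv (i j : Fin d) (hg : HB α M g) (r : ℝ) (hr : 0 < r) (z : TX d) :
    HasLineDerivAt ℝ (G1 σ j l g r) (G2 σ i j l g r z) z (ex i) := by
  have hs := half_pos hr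
  have e : G1 σ j l g r = fun z => Real.exp (-(l * r)) *
      P σ (r / 2) (Q σ (Pi.single j 1) (r / 2) g) z := by
    funext z
    unfold G1
    nth_rw 2 [show r = r / 2 + r / 2 by ring]
    rw [Q_add σ _ hg.cont hg.bdd hs hs.le]
  rw [e]
  exact HasDerivAt.const_mul _ (P_hasLineDerivAt' σ i (Q_continuous σ _ hg.cont hg.bdd _)
    (fun z => Q_bound σ _ hg.bdd _ z) hs z)

/-- The resolvent. -/
def H (l : ℝ) (g : TX d → ℝ) : TX d → ℝ := J (G0 σ l g)

/-- First derivatives of the resolvent. -/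
def H1 (l : ℝ) (i : Fin d) (g : TX d → ℝ) : TX d → ℝ := J (G1 σ i l g)

/-- Second derivatives of the resolvent. -/
def H2 (l : ℝ) (i j : Fin d) (g : TX d → ℝ) : TX d → ℝ := J (G2 σ i j l g)

lemma H_deriv (hl : 0 < l) (i : Fin d) (hg : HB α M g) (z : TX d) :
    HasLineDerivAt ℝ (H σ l g) (H1 σ l i g z) z (ex i) :=
  J.hasLineDerivAt (G0_cont σ hg) (G0_bound σ hg)
    ((integrableOn_rpow_mul_exp hl one_pos).const_mul _) (G1_cont σ i hg) (G1_bound σ i hg)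
    ((integrableOn_rpow_mul_exp hl (by norm_num)).const_mul _) (G0_deriv σ i hg) z

lemma H1_deriv (hl : 0 < l) (hα : 0 < α) (hα1 : α < 1) (i j : Fin d) (hg : HB α M g) (z : TX d) :
    HasLineDerivAt ℝ (H1 σ l j g) (H2 σ l i j g z) z (ex i) :=
  J.hasLineDerivAt (G1_cont σ j hg) (G1_bound σ j hg)
    ((integrableOn_rpow_mul_exp hl (by norm_num)).const_mul _) (G2_cont σ i j hg)
    (G2_bound σ hα hα1 i j hg)
    ((integrableOn_rpow_mul_exp hl (by positivity)).const_mul _) (G1_deriv σ i j hg) z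

lemma H_BOp (hl : 0 < l) : BOp α (1 / l) (H σ l) := by
  have hi := integrableOn_rpow_mul_exp hl one_pos
  have he := Real.integral_rpow_mul_exp_neg_mul_Ioi one_pos hl
  rw [Real.rpow_one, Real.Gamma_one, mul_one] at he
  refine ⟨fun M g hg => ⟨J.continuous (G0_cont σ hg) (G0_bound σ hg) (hi.const_mul _), fun z => ?_,
    fun t x y => ?_⟩, fun M N g h hg hh => ?_⟩
  · have := J.bound (G0_bound σ hg) (hi.const_mul _) z
    rw [integral_const_mul, he] at this
    exact this.trans (le_of_eq (mul_comm _ _))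
  · have := J.sub_bound (G0_cont σ hg) (G0_bound σ hg) (hi.const_mul _) (x := x) (y := y)
      (b' := fun r => (M * ‖x - y‖ ^ α) * (r ^ ((1 : ℝ) - 1) * Real.exp (-(l * r))))
      (fun r hr t => by
        unfold G0
        rw [← mul_sub, abs_mul, abs_of_pos (Real.exp_pos _), sub_self, Real.rpow_zero, one_mul,
          mul_comm]
        gcongr
        exact P_holder σ hg r t x y) (hi.const_mul _) t
    rw [integral_const_mul, he] at this
    exact this.trans (le_of_eq (by ring))
  · funext z
    unfold H J
    rw [← integral_sub (J.integrableOn (G0_cont σ hg) (G0_bound σ hg) (hi.const_mul _) z)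
      (J.integrableOn (G0_cont σ hh) (G0_bound σ hh) (hi.const_mul _) z)]
    congr 1; ext r
    unfold G0 P
    rw [PW_sub σ (GW.const 1) hg.cont hg.bdd hh.cont hh.bdd, mul_sub]

lemma H1_BOp (hl : 0 < l) (i : Fin d) :
    BOp α (cst σ * Real.Gamma (1 / 2) / √l) (H1 σ l i) := by
  have hi := integrableOn_rpow_mul_exp (a := 1 / 2) hl (by norm_num)
  have he := Real.integral_rpow_mul_exp_neg_mul_Ioi (a := 1 / 2) (by norm_num) hl
  rw [← Real.sqrt_eq_rpow, Real.sqrt_div' _ hl.le, Real.sqrt_one] at he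
  refine ⟨fun M g hg => ⟨J.continuous (G1_cont σ i hg) (G1_bound σ i hg) (hi.const_mul _),
    fun z => ?_, fun t x y => ?_⟩, fun M N g h hg hh => ?_⟩
  · have := J.bound (G1_bound σ i hg) (hi.const_mul _) z
    rw [integral_const_mul, he] at this
    exact this.trans (le_of_eq (by ring))
  · have := J.sub_bound (G1_cont σ i hg) (G1_bound σ i hg) (hi.const_mul _) (x := x) (y := y)
      (b' := fun r => (cst σ * (M * ‖x - y‖ ^ α)) *
        (r ^ ((1 : ℝ) / 2 - 1) * Real.exp (-(l * r))))
      (fun r hr t => by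
        unfold G1
        rw [← mul_sub, abs_mul, abs_of_pos (Real.exp_pos _), ← mul_assoc, mul_comm]
        gcongr
        refine (Q_holder σ hg _ r t x y).trans (le_of_eq ?_)
        rw [norm_single, inv_sqrt_eq hr]; ring) (hi.const_mul _) t
    rw [integral_const_mul, he] at this
    exact this.trans (le_of_eq (by ring))
  · funext z
    unfold H1 J
    rw [← integral_sub (J.integrableOn (G1_cont σ i hg) (G1_bound σ i hg) (hi.const_mul _) z)
      (J.integrableOn (G1_cont σ i hh) (G1_bound σ i hh) (hi.const_mul _) z)]
    congr 1; ext r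
    unfold G1
    rw [Q_sub σ _ hg.cont hg.bdd hh.cont hh.bdd, mul_sub]

/-- The constant of the Schauder estimate. -/
def schauderC (α : ℝ) : ℝ := 4 * cst σ ^ 2 * Real.Gamma (α / 2) +
  (8 * cst σ ^ 2 * (2 / α) + 8 * cst σ ^ 3 * (2 / (1 - α)))

lemma H2_BOp (hl : 1 ≤ l) (hα : 0 < α) (hα1 : α < 1) (i j : Fin d) :
    BOp α (schauderC σ α) (H2 σ l i j) := by
  have hl0 : 0 < l := by linarith
  have hc := one_le_cst σ
  have hG := Real.Gamma_pos_of_pos (half_pos hα)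
  have h1α : 0 < 1 - α := by linarith
  have hi := integrableOn_rpow_mul_exp (a := α / 2) hl0 (by positivity)
  have he := Real.integral_rpow_mul_exp_neg_mul_Ioi (a := α / 2) (by positivity) hl0
  refine ⟨fun M g hg => ⟨J.continuous (G2_cont σ i j hg) (G2_bound σ hα hα1 i j hg)
    (hi.const_mul _), fun z => ?_, fun t x y => ?_⟩, fun M N g h hg hh => ?_⟩
  · have hM := hg.nonneg
    have := J.bound (G2_bound σ hα hα1 i j hg) (hi.const_mul _) z
    rw [integral_const_mul, he] at this
    refine this.trans ?_
    have h1 : (1 / l) ^ (α / 2) ≤ 1 :=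
      Real.rpow_le_one (by positivity) (by rw [div_le_one hl0]; exact hl) (by positivity)
    have h2 : 0 ≤ 8 * cst σ ^ 2 * (2 / α) + 8 * cst σ ^ 3 * (2 / (1 - α)) := by positivity
    calc 4 * cst σ ^ 2 * M * ((1 / l) ^ (α / 2) * Real.Gamma (α / 2))
        ≤ 4 * cst σ ^ 2 * M * (1 * Real.Gamma (α / 2)) := by gcongr
      _ = (4 * cst σ ^ 2 * Real.Gamma (α / 2)) * M := by ring
      _ ≤ schauderC σ α * M := by unfold schauderC; gcongr; linarith
  · have hM := hg.nonneg
    rcases eq_or_ne x y with rfl | hxy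
    · simp [Real.zero_rpow hα.ne']
    have hδ : 0 < ‖x - y‖ := norm_pos_iff.2 (sub_ne_zero.2 hxy)
    obtain ⟨b, hbi, hb1, hb2, hbe⟩ := exists_holder_majorant hα hα1 hδ (8 * cst σ ^ 2 * M)
      (8 * cst σ ^ 3 * M)
    have hexp : ∀ r, 0 < r → Real.exp (-(l * r)) ≤ 1 := fun r hr => by
      rw [Real.exp_le_one_iff]; nlinarith
    have := J.sub_bound (G2_cont σ i j hg) (G2_bound σ hα hα1 i j hg) (hi.const_mul _)
      (x := x) (y := y) (b' := b)
      (fun r hr t => by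
        unfold G2
        rw [← mul_sub, abs_mul, abs_of_pos (Real.exp_pos _)]
        refine (mul_le_of_le_one_left (abs_nonneg _) (hexp r hr)).trans ?_
        rcases le_or_gt r (‖x - y‖ ^ 2) with h | h
        · rw [hb1 r h]
          have q1 := QQ_bound σ hα hα1 hg (norm_single i) (norm_single j) hr (t, x)
          have q2 := QQ_bound σ hα hα1 hg (norm_single i) (norm_single j) hr (t, y)
          refine (abs_sub _ _).trans ?_
          linarith
        · rw [hb2 r h]
          exact QQ_lip σ hα hα1 hg (norm_single i) (norm_single j) hr t x y) hbi t
    refine this.trans ?_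
    rw [hbe]
    gcongr
    unfold schauderC
    have : 0 ≤ 4 * cst σ ^ 2 * Real.Gamma (α / 2) * M := by positivity
    linarith
  · funext z
    unfold H2 J
    rw [← integral_sub (J.integrableOn (G2_cont σ i j hg) (G2_bound σ hα hα1 i j hg)
      (hi.const_mul _) z) (J.integrableOn (G2_cont σ i j hh) (G2_bound σ hα hα1 i j hh)
      (hi.const_mul _) z)]
    congr 1; ext r
    unfold G2
    have e : Q σ (Pi.single j 1) (r / 2) (fun z => g z - h z) = fun z =>
        Q σ (Pi.single j 1) (r / 2) g z - Q σ (Pi.single j 1) (r / 2) h z := by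
      funext z; rw [Q_sub σ _ hg.cont hg.bdd hh.cont hh.bdd]
    rw [e, Q_sub σ _ (Q_continuous σ _ hg.cont hg.bdd _) (fun z => Q_bound σ _ hg.bdd _ z)
      (Q_continuous σ _ hh.cont hh.bdd _) (fun z => Q_bound σ _ hh.bdd _ z), mul_sub]

end GS

lemma taylor_two_le {φ φ1 φ2 : ℝ → ℝ} {B : ℝ} (h1 : ∀ s, HasDerivAt φ (φ1 s) s)
    (h2 : ∀ s, HasDerivAt φ1 (φ2 s) s) (hB : ∀ s, |φ2 s| ≤ B) (s : ℝ) :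
    |φ s - φ 0 - s * φ1 0| ≤ B * s ^ 2 := by
  have hB0 : 0 ≤ B := (abs_nonneg _).trans (hB 0)
  have e1 : ∀ r, |φ1 r - φ1 0| ≤ B * |r| := fun r => by
    have := Convex.norm_image_sub_le_of_norm_hasDerivWithin_le (f := φ1) (s := Set.univ)
      (fun x _ => (h2 x).hasDerivWithinAt) (fun x _ => hB x) convex_univ (Set.mem_univ 0)
      (Set.mem_univ r)
    simpa using this
  have e2 := Convex.norm_image_sub_le_of_norm_hasDerivWithin_le (f := fun r => φ r - r * φ1 0)
    (f' := fun r => φ1 r - φ1 0) (s := Set.uIcc 0 s) (C := B * |s|)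
    (fun x _ => by
      have := (h1 x).fun_sub ((hasDerivAt_id x).mul_const (φ1 0))
      simpa using this.hasDerivWithinAt)
    (fun x hx => (e1 x).trans (by
      have : |x| ≤ |s| := by
        have := Set.abs_sub_left_of_mem_uIcc hx
        simpa using this
      exact mul_le_mul_of_nonneg_left this hB0)) (convex_uIcc _ _) Set.left_mem_uIcc Set.right_mem_uIcc
  simp only [Real.norm_eq_abs, zero_mul, sub_zero] at e2
  rw [mul_assoc, ← sq, sq_abs] at e2
  convert e2 using 2; ring

lemma taylor_two_tendsto {φ φ1 : ℝ → ℝ} {c : ℝ} (h1 : ∀ s, HasDerivAt φ (φ1 s) s)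
    (h2 : HasDerivAt φ1 c 0) :
    Tendsto (fun s => (φ s - φ 0 - s * φ1 0) / s ^ 2) (𝓝[>] 0) (𝓝 (c / 2)) := by
  refine HasDerivAt.lhopital_zero_nhdsGT (f' := fun s => φ1 s - φ1 0) (g' := fun s => 2 * s)
    (Eventually.of_forall fun s => ?_) (Eventually.of_forall fun s => ?_) ?_ ?_ ?_ ?_
  · have := ((h1 s).fun_sub (hasDerivAt_const s (φ 0))).fun_sub
      ((hasDerivAt_id s).mul_const (φ1 0))
    simpa using this
  · simpa using (hasDerivAt_pow 2 s)
  · filter_upwards [self_mem_nhdsWithin] with s hs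
    have := Set.mem_Ioi.1 hs
    positivity
  · have hc : Continuous φ := continuous_iff_continuousAt.2 fun s => (h1 s).continuousAt
    have : Continuous fun s => φ s - φ 0 - s * φ1 0 := by fun_prop
    simpa using (this.tendsto 0).mono_left nhdsWithin_le_nhds
  · have : Continuous fun s : ℝ => s ^ 2 := by fun_prop
    simpa using (this.tendsto 0).mono_left nhdsWithin_le_nhds
  · have h3 := (hasDerivWithinAt_iff_tendsto_slope' (s := Set.Ioi 0) (by simp)).1
      h2.hasDerivWithinAt
    have h4 := h3.div_const 2
    refine h4.congr fun s => ?_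
    simp only [slope_def_field, sub_zero]
    rw [div_div, mul_comm]

lemma hasDerivAt_of_continuous_right {φ w : ℝ → ℝ} (hw : Continuous w)
    (hφ : Continuous φ) (h : ∀ s, HasDerivWithinAt φ (w s) (Set.Ici s) s) :
    HasDerivAt φ (w 0) 0 := by
  have hI : ∀ s, HasDerivAt (fun s => φ (-1) + ∫ r in (-1 : ℝ)..s, w r) (w s) s := fun s =>
    (intervalIntegral.integral_hasDerivAt_right (hw.intervalIntegrable _ _)
      (hw.stronglyMeasurableAtFilter _ _) hw.continuousAt).const_add _
  have hE := eq_of_has_deriv_right_eq (a := -1) (b := 1) (f := φ)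
    (fun s _ => h s) (fun s _ => (hI s).hasDerivWithinAt) hφ.continuousOn
    (continuous_iff_continuousAt.2 fun s => (hI s).continuousAt).continuousOn (by simp)
  refine (hI 0).congr_of_eventuallyEq ?_
  filter_upwards [Icc_mem_nhds (show (-1 : ℝ) < 0 by norm_num) (show (0 : ℝ) < 1 by norm_num)]
    with s hs using hE s hs

namespace GS

variable {d : ℕ} (σ : (Fin d → ℝ) ≃L[ℝ] (Fin d → ℝ))

/-- The covariance matrix of the Gaussian semigroup. -/
def cov (i j : Fin d) : ℝ := ∑ k, σ (Pi.single k 1) i * σ (Pi.single k 1) j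

lemma apply_eq_sum (y : Fin d → ℝ) (i : Fin d) : σ y i = ∑ k, y k * σ (Pi.single k 1) i := by
  conv_lhs => rw [← Finset.univ_sum_single y]
  rw [map_sum, Finset.sum_apply]
  refine Finset.sum_congr rfl fun k _ => ?_
  rw [show (Pi.single k (y k) : Fin d → ℝ) = y k • Pi.single k 1 by
    rw [← Pi.single_smul]; simp, map_smul]
  simp

lemma integrable_apply_mul (i j : Fin d) : Integrable (fun y => σ y i * σ y j) (stdG d) := by
  have : (fun y => σ y i * σ y j) = fun y => ∑ k, ∑ m,
      (y k * y m) * (σ (Pi.single k 1) i * σ (Pi.single m 1) j) := by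
    funext y
    rw [apply_eq_sum σ y i, apply_eq_sum σ y j, Finset.sum_mul_sum]
    exact Finset.sum_congr rfl fun k _ => Finset.sum_congr rfl fun m _ => by ring
  rw [this]
  exact integrable_finsetSum _ fun k _ => integrable_finsetSum _ fun m _ =>
    (stdG.integrable_eval_mul k m).mul_const _

lemma integral_apply_mul (i j : Fin d) : ∫ y, σ y i * σ y j ∂(stdG d) = cov σ i j := by
  have : (fun y => σ y i * σ y j) = fun y => ∑ k, ∑ m,
      (y k * y m) * (σ (Pi.single k 1) i * σ (Pi.single m 1) j) := by
    funext y
    rw [apply_eq_sum σ y i, apply_eq_sum σ y j, Finset.sum_mul_sum]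
    exact Finset.sum_congr rfl fun k _ => Finset.sum_congr rfl fun m _ => by ring
  rw [this, integral_finsetSum _ fun k _ => integrable_finsetSum _ fun m _ =>
    (stdG.integrable_eval_mul k m).mul_const _]
  unfold cov
  refine Finset.sum_congr rfl fun k _ => ?_
  rw [integral_finsetSum _ fun m _ => (stdG.integrable_eval_mul k m).mul_const _]
  simp [integral_mul_const, stdG.integral_eval_mul]

lemma integrable_apply (i : Fin d) : Integrable (fun y => σ y i) (stdG d) := by
  rw [funext fun y => apply_eq_sum σ y i]
  exact integrable_finsetSum _ fun k _ => (stdG.integrable_eval k).mul_const _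

lemma integral_apply (i : Fin d) : ∫ y, σ y i ∂(stdG d) = 0 := by
  rw [funext fun y => apply_eq_sum σ y i]
  rw [integral_finsetSum _ fun k _ => (stdG.integrable_eval k).mul_const _]
  simp [integral_mul_const, stdG.integral_eval]

lemma P_generator {u : TX d → ℝ} {ux : Fin d → TX d → ℝ} {uxx : Fin d → Fin d → TX d → ℝ}
    {N B : ℝ} (hu : Continuous u) (hN : ∀ z, |u z| ≤ N) (hux : ∀ i, Continuous (ux i))
    (huxx : ∀ i j, Continuous (uxx i j)) (hB : ∀ i j z, |uxx i j z| ≤ B)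
    (h1 : ∀ i z, HasLineDerivAt ℝ u (ux i z) z (ex i))
    (h2 : ∀ i j z, HasLineDerivAt ℝ (ux j) (uxx i j z) z (ex i)) (z : TX d) :
    Tendsto (fun h => h⁻¹ * (P σ h u z - u z)) (𝓝[>] 0)
      (𝓝 (1 / 2 * ∑ i, ∑ j, cov σ i j * uxx i j z)) := by
  have d1 : ∀ (y : Fin d → ℝ) (s : ℝ), HasDerivAt (fun s : ℝ => u (z + s • ((0, y) : TX d)))
      (∑ i, y i * ux i (z + s • ((0, y) : TX d))) s := fun y s =>
    (hasDerivAt_space isOpen_univ (fun i => (hux i).continuousOn) (fun i z _ => h1 i z)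
      (Set.mem_univ (z + s • ((0, y) : TX d))) y).shift (u' := fun z => ∑ i, y i * ux i z)
  have d2 : ∀ (y : Fin d → ℝ) (s : ℝ),
      HasDerivAt (fun s : ℝ => ∑ i, y i * ux i (z + s • ((0, y) : TX d)))
      (∑ j, y j * ∑ i, y i * uxx i j (z + s • ((0, y) : TX d))) s := fun y s =>
    HasDerivAt.fun_sum fun j _ =>
      ((hasDerivAt_space isOpen_univ (fun i => (huxx i j).continuousOn) (fun i z _ => h2 i j z)
        (Set.mem_univ (z + s • ((0, y) : TX d))) y).shift
          (u' := fun z => ∑ i, y i * uxx i j z)).const_mul (y j)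
  have hbd : ∀ (y : Fin d → ℝ) (z : TX d),
      |∑ j, y j * ∑ i, y i * uxx i j z| ≤ B * ∑ j, ∑ i, |y j * y i| := fun y z => by
    rw [Finset.mul_sum]
    refine (Finset.abs_sum_le_sum_abs _ _).trans (Finset.sum_le_sum fun j _ => ?_)
    rw [Finset.mul_sum, Finset.mul_sum]
    refine (Finset.abs_sum_le_sum_abs _ _).trans (Finset.sum_le_sum fun i _ => ?_)
    rw [← mul_assoc, abs_mul, mul_comm]
    exact mul_le_mul_of_nonneg_right (hB i j z) (abs_nonneg _)
  set F : ℝ → (Fin d → ℝ) → ℝ := fun h y => h⁻¹ *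
    (u (z + √h • ((0, σ y) : TX d)) - u (z + (0 : ℝ) • ((0, σ y) : TX d)) -
      √h * ∑ i, σ y i * ux i (z + (0 : ℝ) • ((0, σ y) : TX d))) with hF
  have key : Tendsto (fun h => ∫ y, F h y ∂(stdG d)) (𝓝[>] 0)
      (𝓝 (∫ y, (∑ j, σ y j * ∑ i, σ y i * uxx i j z) / 2 ∂(stdG d))) := by
    refine tendsto_integral_filter_of_dominated_convergence
      (fun y => B * ∑ j, ∑ i, |σ y j * σ y i|) ?_ ?_ ?_ ?_
    · refine Eventually.of_forall fun h => Continuous.aestronglyMeasurable ?_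
      have := hux
      simp only [hF]
      fun_prop
    · filter_upwards [self_mem_nhdsWithin] with h hh
      have hh' : 0 < h := Set.mem_Ioi.1 hh
      refine ae_of_all _ fun y => ?_
      have := taylor_two_le (d1 (σ y)) (d2 (σ y)) (fun s => hbd (σ y) _) √h
      rw [Real.sq_sqrt hh'.le] at this
      simp only [hF, norm_mul, Real.norm_eq_abs, abs_inv, abs_of_pos hh']
      rw [inv_mul_le_iff₀ hh', mul_comm h]
      exact this
    · exact (integrable_finsetSum _ fun j _ => integrable_finsetSum _ fun i _ =>
        (integrable_apply_mul σ j i).abs).const_mul _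
    · refine ae_of_all _ fun y => ?_
      have h3 := taylor_two_tendsto (d1 (σ y)) (d2 (σ y) 0)
      have h4 : Tendsto (fun h : ℝ => √h) (𝓝[>] 0) (𝓝[>] 0) := by
        refine tendsto_nhdsWithin_iff.2 ⟨?_, ?_⟩
        · have := (Real.continuous_sqrt.tendsto 0).mono_left (nhdsWithin_le_nhds (s := Set.Ioi 0))
          simpa using this
        · filter_upwards [self_mem_nhdsWithin] with h hh using Real.sqrt_pos.2 hh
      have h5 := h3.comp h4
      simp only [zero_smul, add_zero] at h5
      refine h5.congr' ?_
      filter_upwards [self_mem_nhdsWithin] with h hh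
      have hh' : 0 < h := Set.mem_Ioi.1 hh
      simp only [hF, Function.comp, Real.sq_sqrt hh'.le, zero_smul, add_zero]
      rw [div_eq_inv_mul]
  have e1 : ∫ y, (∑ j, σ y j * ∑ i, σ y i * uxx i j z) / 2 ∂(stdG d)
      = 1 / 2 * ∑ i, ∑ j, cov σ i j * uxx i j z := by
    simp only [Finset.mul_sum, ← mul_assoc]
    rw [integral_div, integral_finsetSum _ fun j _ => integrable_finsetSum _ fun i _ =>
      (integrable_apply_mul σ j i).mul_const _]
    simp only [integral_finsetSum _ fun i _ => (integrable_apply_mul σ _ i).mul_const _,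
      integral_mul_const, integral_apply_mul]
    rw [Finset.sum_comm, Finset.sum_div]
    refine Finset.sum_congr rfl fun i _ => ?_
    rw [Finset.sum_div]
    refine Finset.sum_congr rfl fun j _ => ?_
    have : cov σ j i = cov σ i j := by
      unfold cov; exact Finset.sum_congr rfl fun k _ => mul_comm _ _
    rw [this]; ring
  rw [e1] at key
  refine key.congr fun h => ?_
  simp only [hF, zero_smul, add_zero, integral_const_mul]
  congr 1
  have i1 : Integrable (fun y => u (z + √h • ((0, σ y) : TX d))) (stdG d) := by
    have := integrable_PW σ (GW.const 1) hu hN h z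
    simpa [Prod.ext_iff, Prod.add_def] using this
  have i2 : Integrable (fun y => ∑ i, σ y i * ux i z) (stdG d) :=
    integrable_finsetSum _ fun i _ => (integrable_apply σ i).mul_const _
  have i3 : Integrable (fun y => u (z + √h • ((0, σ y) : TX d)) - u z) (stdG d) :=
    i1.sub (integrable_const _)
  rw [integral_sub i3 (i2.const_mul _), integral_sub i1 (integrable_const _), integral_const_mul,
    integral_finsetSum _ fun i _ => (integrable_apply σ i).mul_const _]
  simp only [integral_mul_const, integral_apply]
  simp [P, PW, Prod.add_def]

variable {α M l : ℝ} {g : TX d → ℝ}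

lemma H_time_split (hl : 0 < l) (hg : HB α M g) (z : TX d) {h : ℝ} (hh : 0 < h) :
    H σ l g (z + h • et) = h * (∫ s in (0 : ℝ)..1, G0 σ l g (h * s) (z.1 + h - h * s, z.2))
      + Real.exp (-(l * h)) * P σ h (H σ l g) z := by
  have hM : ∀ z, |g z| ≤ M := hg.bdd
  have hJint := J.integrableOn (G0_cont σ hg) (G0_bound σ hg)
    ((integrableOn_rpow_mul_exp hl one_pos).const_mul _) (z + h • et)
  have hz1 : (z + h • (et : TX d)).1 = z.1 + h := by simp [et]
  have hz2 : (z + h • (et : TX d)).2 = z.2 := by simp [et]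
  rw [hz1, hz2] at hJint
  have hU : Set.Ioc 0 h ∪ Set.Ioi h = Set.Ioi (0 : ℝ) := Set.Ioc_union_Ioi_eq_Ioi hh.le
  unfold H J
  rw [hz1, hz2]
  rw [← hU, setIntegral_union (Set.Ioc_disjoint_Ioi le_rfl) measurableSet_Ioi
    (hJint.mono_set (by rw [← hU]; exact Set.subset_union_left))
    (hJint.mono_set (by rw [← hU]; exact Set.subset_union_right)), hU]
  congr 1
  · rw [← intervalIntegral.integral_of_le hh.le]
    have := intervalIntegral.mul_integral_comp_mul_left (a := 0) (b := 1)
      (f := fun r => G0 σ l g r (z.1 + h - r, z.2)) h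
    rw [mul_zero, mul_one] at this
    exact this.symm
  · have h1 := (measurePreserving_add_right volume h).setIntegral_preimage_emb
      (measurableEmbedding_addRight h) (fun r => G0 σ l g r (z.1 + h - r, z.2)) (Set.Ioi h)
    rw [Set.preimage_add_const_Ioi, sub_self] at h1
    rw [← h1]
    have h2 : ∀ r ∈ Set.Ioi (0 : ℝ), G0 σ l g (r + h) (z.1 + h - (r + h), z.2)
        = Real.exp (-(l * h)) *
          ∫ y, G0 σ l g r (z.1 - r, z.2 + √h • σ y) ∂(stdG d) := fun r hr => by
      have hr' : 0 < r := Set.mem_Ioi.1 hr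
      unfold G0
      rw [integral_const_mul, ← mul_assoc, ← Real.exp_add, show z.1 + h - (r + h) = z.1 - r by ring,
        add_comm r h, ← P_add σ hg.cont hM hh.le hr'.le]
      congr 1
      · congr 1; ring
      · conv_lhs => rw [P, PW]
        simp only [mul_one]
    rw [setIntegral_congr_fun measurableSet_Ioi h2, integral_const_mul]
    congr 1
    rw [P, PW]
    simp only [mul_one]
    rw [integral_integral_swap]
    have hPc := P_continuous σ hg.cont hM
    have hb : Integrable (fun r => M * Real.exp (-(l * r))) (volume.restrict (Set.Ioi 0)) := by
      have := (integrableOn_rpow_mul_exp hl one_pos).const_mul M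
      simpa using this
    refine Integrable.mono' (hb.comp_fst (stdG d)) (Continuous.aestronglyMeasurable ?_)
      (ae_of_all _ fun p => ?_)
    · unfold Function.uncurry G0
      have : Continuous fun p : ℝ × (Fin d → ℝ) =>
        P σ p.1 g ((z.1 - p.1, z.2 + √h • σ p.2) : TX d) :=
        hPc.comp (g := fun p : ℝ × TX d => P σ p.1 g p.2)
          (f := fun p : ℝ × (Fin d → ℝ) => (p.1, ((z.1 - p.1, z.2 + √h • σ p.2) : TX d)))
          (by fun_prop)
      fun_prop
    · simp only [Function.uncurry, G0, norm_mul, Real.norm_eq_abs, Real.abs_exp]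
      rw [mul_comm]
      exact mul_le_mul_of_nonneg_right (P_bound σ hM _ _) (Real.exp_pos _).le

lemma H_time_right (hl : 1 ≤ l) (hα : 0 < α) (hα1 : α < 1) (hg : HB α M g) (z : TX d) :
    HasDerivWithinAt (fun s : ℝ => H σ l g (z + s • et))
      (g z - l * H σ l g z + 1 / 2 * ∑ i, ∑ j, cov σ i j * H2 σ l i j g z) (Set.Ici 0) 0 := by
  have hl0 : 0 < l := by linarith
  have hM : ∀ z, |g z| ≤ M := hg.bdd
  have hH := (H_BOp σ hl0).bound M g hg
  have hgen := P_generator σ hH.cont hH.bdd (fun i => ((H1_BOp σ hl0 i).bound M g hg).cont)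
    (fun i j => ((H2_BOp σ hl hα hα1 i j).bound M g hg).cont)
    (fun i j => ((H2_BOp σ hl hα hα1 i j).bound M g hg).bdd)
    (fun i z => H_deriv σ hl0 i hg z) (fun i j z => H1_deriv σ hl0 hα hα1 i j hg z) z
  rw [← hasDerivWithinAt_Ioi_iff_Ici, hasDerivWithinAt_iff_tendsto_slope' (by simp)]
  have hPc := P_continuous σ hg.cont hM
  have hK : Continuous fun h : ℝ =>
      ∫ s in (0 : ℝ)..1, G0 σ l g (h * s) (z.1 + h - h * s, z.2) := by
    refine intervalIntegral.continuous_parametric_intervalIntegral_of_continuous' ?_ 0 1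
    unfold Function.uncurry G0
    have : Continuous fun p : ℝ × ℝ =>
        P σ (p.1 * p.2) g ((z.1 + p.1 - p.1 * p.2, z.2) : TX d) :=
      hPc.comp (g := fun p : ℝ × TX d => P σ p.1 g p.2)
        (f := fun p : ℝ × ℝ => (p.1 * p.2, ((z.1 + p.1 - p.1 * p.2, z.2) : TX d)))
        (by fun_prop)
    fun_prop
  have hK0 : Tendsto (fun h : ℝ =>
      ∫ s in (0 : ℝ)..1, G0 σ l g (h * s) (z.1 + h - h * s, z.2)) (𝓝[>] 0) (𝓝 (g z)) := by
    have := (hK.tendsto 0).mono_left (nhdsWithin_le_nhds (s := Set.Ioi 0))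
    simpa [G0, P_zero] using this
  have hE : Tendsto (fun h : ℝ => h⁻¹ * (Real.exp (-(l * h)) - 1)) (𝓝[>] 0) (𝓝 (-l)) := by
    have h1 : HasDerivAt (fun h : ℝ => Real.exp (-(l * h))) (-l) 0 := by
      have := (((hasDerivAt_id (0 : ℝ)).const_mul l).neg).exp
      simpa using this
    have h2 := (hasDerivWithinAt_iff_tendsto_slope' (s := Set.Ioi 0) (by simp)).1
      h1.hasDerivWithinAt
    refine h2.congr fun h => ?_
    simp [slope_def_field, div_eq_inv_mul]
  have hE1 : Tendsto (fun h : ℝ => Real.exp (-(l * h))) (𝓝[>] 0) (𝓝 1) := by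
    have : Continuous fun h : ℝ => Real.exp (-(l * h)) := by fun_prop
    simpa using (this.tendsto 0).mono_left (nhdsWithin_le_nhds (s := Set.Ioi 0))
  have hlim := (hK0.add (hE1.mul hgen)).add (hE.mul_const (H σ l g z))
  convert hlim.congr' ?_ using 2
  · ring
  · filter_upwards [self_mem_nhdsWithin] with h hh
    have hh' : 0 < h := Set.mem_Ioi.1 hh
    rw [slope_def_field, H_time_split σ hl0 hg z hh', zero_smul, add_zero, sub_zero]
    field_simp
    ring

lemma H_time_deriv (hl : 1 ≤ l) (hα : 0 < α) (hα1 : α < 1) (hg : HB α M g) (z : TX d) :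
    HasLineDerivAt ℝ (H σ l g)
      (g z - l * H σ l g z + 1 / 2 * ∑ i, ∑ j, cov σ i j * H2 σ l i j g z) z et := by
  have hl0 : 0 < l := by linarith
  have hH := ((H_BOp σ hl0).bound M g hg).cont
  have h2 := fun i j => ((H2_BOp σ hl hα hα1 i j).bound M g hg).cont
  have hgc := hg.cont
  have := hasDerivAt_of_continuous_right (φ := fun s : ℝ => H σ l g (z + s • et))
    (w := fun s : ℝ => (fun z => g z - l * H σ l g z + 1 / 2 * ∑ i, ∑ j, cov σ i j * H2 σ l i j g z)
      (z + s • et)) (by simp only; fun_prop) (by fun_prop) (fun s => ?_)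
  · simpa [HasLineDerivAt] using this
  · have h3 := H_time_right σ hl hα hα1 hg (z + s • et)
    have h1 : HasDerivWithinAt (fun r : ℝ => r - s) 1 (Set.Ici s) s :=
      ((hasDerivAt_id s).sub_const s).hasDerivWithinAt
    have h4 := HasDerivWithinAt.scomp (h := fun r : ℝ => r - s) (t' := Set.Ici 0) s
      (by rw [sub_self]; exact h3) h1 (fun r hr => by
        simpa using Set.mem_Ici.1 hr)
    simp only [one_smul] at h4
    refine h4.congr_of_eventuallyEq (Eventually.of_forall fun r => ?_) ?_
    · simp only [Function.comp]; congr 1; module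
    · simp only [Function.comp]; congr 1; module

end GS

/-- `S` solves `∂ₜu - ½ ∑ A_ij ∂ᵢⱼu + l u = g` boundedly in spatial Hölder classes, with `Sx`, `Sxx`
the spatial derivatives of the solution. -/
structure IsSolver {d : ℕ} (α l K : ℝ) (A : TX d → Fin d → Fin d → ℝ)
    (S : (TX d → ℝ) → TX d → ℝ) (Sx : Fin d → (TX d → ℝ) → TX d → ℝ)
    (Sxx : Fin d → Fin d → (TX d → ℝ) → TX d → ℝ) : Prop where
  bS : BOp α (K / √l) S
  bSx : ∀ i, BOp α (K / √l) (Sx i)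
  bSxx : ∀ i j, BOp α K (Sxx i j)
  sol : ∀ M g, HB α M g → C12 Set.univ (S g)
    (fun z => g z - l * S g z + 1 / 2 * ∑ i, ∑ j, A z i j * Sxx i j g z)
    (fun i => Sx i g) (fun i j => Sxx i j g)

namespace GS

variable {d : ℕ} (σ : (Fin d → ℝ) ≃L[ℝ] (Fin d → ℝ))

/-- A common bound for the resolvent of the Gaussian semigroup and its derivatives. -/
def solC (α : ℝ) : ℝ := 1 + cst σ * Real.Gamma (1 / 2) + |schauderC σ α|

lemma isSolver {α l : ℝ} (hα : 0 < α) (hα1 : α < 1) (hl : 1 ≤ l) :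
    IsSolver α l (solC σ α) (fun _ => cov σ) (H σ l) (H1 σ l) (H2 σ l) := by
  have hl0 : 0 < l := by linarith
  have hs : 0 < √l := Real.sqrt_pos.2 hl0
  have hs1 : √l ≤ l := by
    rw [Real.sqrt_le_left hl0.le]; nlinarith
  have hc := one_le_cst σ
  have hG := Real.Gamma_pos_of_pos (show (0 : ℝ) < 1 / 2 by norm_num)
  have hp : 0 < cst σ * Real.Gamma (1 / 2) := by positivity
  refine ⟨(H_BOp σ hl0).mono ?_, fun i => (H1_BOp σ hl0 i).mono ?_,
    fun i j => (H2_BOp σ hl hα hα1 i j).mono ?_, fun M g hg => ?_⟩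
  · unfold solC
    have : 1 / l ≤ 1 / √l := one_div_le_one_div_of_le hs hs1
    refine this.trans ?_
    gcongr
    linarith [abs_nonneg (schauderC σ α)]
  · unfold solC
    gcongr
    linarith [abs_nonneg (schauderC σ α)]
  · unfold solC
    linarith [le_abs_self (schauderC σ α)]
  · have hH := ((H_BOp σ hl0).bound M g hg).cont
    have h2 := fun i j => ((H2_BOp σ hl hα hα1 i j).bound M g hg).cont
    have hgc := hg.cont
    exact ⟨hH.continuousOn, Continuous.continuousOn (by fun_prop),
      fun i => ((H1_BOp σ hl0 i).bound M g hg).cont.continuousOn, fun i j => (h2 i j).continuousOn,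
      fun z _ => H_time_deriv σ hl hα hα1 hg z, fun i z _ => H_deriv σ hl0 i hg z,
      fun i j z _ => H1_deriv σ hl0 hα hα1 i j hg z⟩

end GS

/-- Symmetric positive definite families of coefficients. -/
def SPD {d : ℕ} (A : Fin d → Fin d → ℝ) : Prop :=
  (∀ i j, A i j = A j i) ∧ ∀ y : Fin d → ℝ, y ≠ 0 → 0 < ∑ i, ∑ j, A i j * y i * y j

lemma SPD.spsd {d : ℕ} {A : Fin d → Fin d → ℝ} (hA : SPD A) : SPSD A := by
  refine ⟨hA.1, fun y => ?_⟩
  by_cases hy : y = 0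
  · simp [hy]
  · exact (hA.2 y hy).le

lemma SPD.posDef {d : ℕ} {A : Fin d → Fin d → ℝ} (hA : SPD A) : (Matrix.of A).PosDef := by
  refine Matrix.PosDef.of_dotProduct_mulVec_pos hA.spsd.posSemidef.1 fun x hx => ?_
  refine (hA.2 x hx).trans_le (le_of_eq ?_)
  simp only [dotProduct, Matrix.mulVec, Matrix.of_apply, star_trivial, Finset.mul_sum]
  refine Finset.sum_congr rfl fun i _ => Finset.sum_congr rfl fun j _ => ?_
  ring

open scoped MatrixOrder in
lemma SPD.exists_cov {d : ℕ} {A : Fin d → Fin d → ℝ} (hA : SPD A) :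
    ∃ σ : (Fin d → ℝ) ≃L[ℝ] (Fin d → ℝ), GS.cov σ = A := by
  obtain ⟨B, hB⟩ := CStarAlgebra.nonneg_iff_eq_star_mul_self.mp hA.posDef.posSemidef.nonneg
  rw [Matrix.star_eq_conjTranspose] at hB
  have hdet : IsUnit B.det := by
    have h := hA.posDef.det_pos
    rw [hB, Matrix.det_mul] at h
    exact isUnit_iff_ne_zero.2 fun h0 => by simp [h0] at h
  have hu : IsUnit (Matrix.transpose B) := by
    rw [Matrix.isUnit_iff_isUnit_det, Matrix.det_transpose]; exact hdet
  refine ⟨(Matrix.toLinearEquiv' (Matrix.transpose B) hu.invertible).toContinuousLinearEquiv, ?_⟩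
  funext i j
  have h1 := congrFun (congrFun hB i) j
  rw [Matrix.of_apply] at h1
  rw [h1, Matrix.mul_apply]
  unfold GS.cov
  refine Finset.sum_congr rfl fun k _ => ?_
  have h2 : ∀ i, (Matrix.toLinearEquiv' (Matrix.transpose B) hu.invertible).toContinuousLinearEquiv
      (Pi.single k 1) i = B k i := fun i => by
    change (Matrix.toLin' (Matrix.transpose B)) (Pi.single k 1) i = B k i
    simp
  rw [h2, h2]
  simp

lemma IsSolver.perturb {d : ℕ} {α l K ε : ℝ} {A b : TX d → Fin d → Fin d → ℝ}
    {S : (TX d → ℝ) → TX d → ℝ} {Sx : Fin d → (TX d → ℝ) → TX d → ℝ}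
    {Sxx : Fin d → Fin d → (TX d → ℝ) → TX d → ℝ} (hS : IsSolver α l K A S Sx Sxx)
    (hb : ∀ i j, HB α ε (fun z => b z i j)) (hε : d ^ 2 * ε * K ≤ 1 / 2) :
    ∃ S' Sx' Sxx', IsSolver α l (2 * K) (fun z i j => A z i j + b z i j) S' Sx' Sxx' := by
  have hT : BOp α (1 / 2) (fun g z => 1 / 2 * ∑ i, ∑ j, b z i j * Sxx i j g z) := by
    refine ((BOp.sum Finset.univ fun i _ => BOp.sum Finset.univ fun j _ =>
      (hS.bSxx i j).mul_left (hb i j)).const_mul (1 / 2)).mono ?_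
    simp only [Finset.sum_const, Finset.card_univ, Fintype.card_fin, nsmul_eq_mul]
    rw [abs_of_pos (by norm_num)]
    linarith
  obtain ⟨R, hR, hinv⟩ := hT.exists_inverse
  refine ⟨fun g => S (R g), fun i g => Sx i (R g), fun i j g => Sxx i j (R g), ?_, fun i => ?_,
    fun i j => ?_, fun M g hg => ?_⟩
  · exact (hS.bS.comp hR).mono (le_of_eq (by ring))
  · exact ((hS.bSx i).comp hR).mono (le_of_eq (by ring))
  · exact ((hS.bSxx i j).comp hR).mono (le_of_eq (by ring))
  · refine (hS.sol _ _ (hR.bound M g hg)).congr isOpen_univ (fun _ _ => rfl) (fun z _ => ?_)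
      (fun _ _ _ => rfl) (fun _ _ _ _ => rfl)
    have := hinv M g hg z
    simp only [add_mul, Finset.sum_add_distrib, mul_add] at this ⊢
    linarith

/-- The projection onto a box centred at `z₀`. -/
def boxProj {d : ℕ} (z₀ : TX d) (ρ : ℝ) (z : TX d) : TX d :=
  (max (z₀.1 - ρ) (min (z₀.1 + ρ) z.1), fun i => max (z₀.2 i - ρ) (min (z₀.2 i + ρ) (z.2 i)))

namespace boxProj

variable {d : ℕ} (z₀ : TX d) {ρ : ℝ}

lemma clamp_sub_le (a b x y : ℝ) : |max a (min b x) - max a (min b y)| ≤ |x - y| := by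
  rw [max_comm a, max_comm a]
  refine (abs_max_sub_max_le_abs _ _ _).trans ?_
  have := abs_min_sub_min_le_max b x b y
  simpa using this

lemma continuous : Continuous (boxProj z₀ ρ) := by unfold boxProj; fun_prop

lemma dist_le (t : ℝ) (x y : Fin d → ℝ) :
    dist (boxProj z₀ ρ (t, x)) (boxProj z₀ ρ (t, y)) ≤ ‖x - y‖ := by
  rw [Prod.dist_eq]
  refine max_le (by simp [boxProj]) ?_
  refine (dist_pi_le_iff (norm_nonneg _)).2 fun i => ?_
  exact (clamp_sub_le _ _ _ _).trans (norm_le_pi_norm (x - y) i)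

lemma mem (hρ : 0 ≤ ρ) (z : TX d) : boxProj z₀ ρ z ∈ Metric.closedBall z₀ ρ := by
  have h : ∀ a b : ℝ, |max (a - ρ) (min (a + ρ) b) - a| ≤ ρ := fun a b => by
    rw [abs_le]
    constructor
    · have := le_max_left (a - ρ) (min (a + ρ) b); linarith
    · have := max_le (show a - ρ ≤ a + ρ by linarith) (min_le_left (a + ρ) b); linarith
  rw [Metric.mem_closedBall, Prod.dist_eq]
  exact max_le (h _ _) ((dist_pi_le_iff hρ).2 fun i => h _ _)

lemma eq_self {z : TX d} (hz : z ∈ Metric.closedBall z₀ ρ) : boxProj z₀ ρ z = z := by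
  have h : ∀ a b : ℝ, |b - a| ≤ ρ → max (a - ρ) (min (a + ρ) b) = b := fun a b hab => by
    rw [abs_le] at hab
    rw [min_eq_right (by linarith), max_eq_right (by linarith)]
  rw [Metric.mem_closedBall, Prod.dist_eq] at hz
  have h1 := (le_max_left _ _).trans hz
  have h2 := (le_max_right _ _).trans hz
  have hρ : 0 ≤ ρ := dist_nonneg.trans h1
  refine Prod.ext (h _ _ h1) (funext fun i => h _ _ ?_)
  exact (dist_pi_le_iff hρ).1 h2 i

lemma HB_sub {z₀ : TX d} {a : TX d → ℝ} {α β C r : ℝ} (hα : 0 < α) (hαβ : α < β)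
    (hρ : 0 < ρ) (hρr : ρ ≤ r) (hC : 0 ≤ C)
    (h : ∀ z ∈ Metric.closedBall z₀ r, ∀ w ∈ Metric.closedBall z₀ r,
      |a z - a w| ≤ C * dist z w ^ β) :
    HB α (C * (2 * ρ) ^ (β - α) * (1 + (2 * ρ) ^ α))
      (fun z => a (boxProj z₀ ρ z) - a z₀) := by
  have hm : ∀ z, boxProj z₀ ρ z ∈ Metric.closedBall z₀ r := fun z =>
    Metric.closedBall_subset_closedBall hρr (mem z₀ hρ.le z)
  have h0 : z₀ ∈ Metric.closedBall z₀ r := Metric.mem_closedBall_self (hρ.le.trans hρr)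
  have hβ : 0 < β := hα.trans hαβ
  have h2 : (2 * ρ) ^ β = (2 * ρ) ^ (β - α) * (2 * ρ) ^ α := by
    rw [← Real.rpow_add (by positivity)]; congr 1; ring
  have hac : ContinuousOn a (Metric.closedBall z₀ r) := by
    intro w hw
    rw [ContinuousWithinAt, tendsto_iff_dist_tendsto_zero]
    have : Tendsto (fun z => C * dist z w ^ β) (𝓝[Metric.closedBall z₀ r] w) (𝓝 0) := by
      have hc : Continuous fun z : TX d => C * dist z w ^ β :=
        continuous_const.mul ((continuous_id.dist continuous_const).rpow_const
          fun _ => Or.inr hβ.le)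
      have := (hc.tendsto w).mono_left (nhdsWithin_le_nhds (s := Metric.closedBall z₀ r))
      simpa [Real.zero_rpow hβ.ne'] using this
    refine squeeze_zero' (Eventually.of_forall fun _ => dist_nonneg) ?_ this
    filter_upwards [self_mem_nhdsWithin] with z hz
    exact h z hz w hw
  refine ⟨(hac.comp_continuous (continuous z₀) hm).sub continuous_const, fun z => ?_,
    fun t x y => ?_⟩
  · refine (h _ (hm z) _ h0).trans ?_
    have h3 : dist (boxProj z₀ ρ z) z₀ ^ β ≤ (2 * ρ) ^ β := by
      refine Real.rpow_le_rpow dist_nonneg ?_ hβ.le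
      have := Metric.mem_closedBall.1 (mem z₀ hρ.le z)
      linarith
    rw [h2] at h3
    rw [mul_assoc]
    refine mul_le_mul_of_nonneg_left (h3.trans ?_) hC
    have : 0 ≤ (2 * ρ) ^ (β - α) := by positivity
    nlinarith
  · rw [sub_sub_sub_cancel_right]
    refine (h _ (hm _) _ (hm _)).trans ?_
    set D := dist (boxProj z₀ ρ (t, x)) (boxProj z₀ ρ (t, y)) with hD
    have hD0 : 0 ≤ D := dist_nonneg
    have hD1 : D ≤ 2 * ρ := by
      have h1 := Metric.mem_closedBall.1 (mem z₀ hρ.le (t, x))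
      have h2 := Metric.mem_closedBall'.1 (mem z₀ hρ.le (t, y))
      linarith [dist_triangle (boxProj z₀ ρ (t, x)) z₀ (boxProj z₀ ρ (t, y))]
    have h3 : D ^ β = D ^ (β - α) * D ^ α := by
      rw [← Real.rpow_add' hD0 (by rw [sub_add_cancel]; exact hβ.ne')]; congr 1; ring
    have h4 : D ^ (β - α) ≤ (2 * ρ) ^ (β - α) := Real.rpow_le_rpow hD0 hD1 (by linarith)
    have h5 : D ^ α ≤ ‖x - y‖ ^ α := Real.rpow_le_rpow hD0 (dist_le z₀ t x y) hα.le
    rw [h3, mul_assoc, mul_assoc]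
    refine mul_le_mul_of_nonneg_left ?_ hC
    have h6 : (0 : ℝ) ≤ (2 * ρ) ^ (β - α) := by positivity
    have h7 : (0 : ℝ) ≤ (2 * ρ) ^ α := by positivity
    have h8 : 0 ≤ D ^ α := by positivity
    have h9 : 0 ≤ ‖x - y‖ ^ α := by positivity
    calc D ^ (β - α) * D ^ α ≤ (2 * ρ) ^ (β - α) * ‖x - y‖ ^ α := by gcongr
      _ ≤ _ := by nlinarith [mul_nonneg h6 (mul_nonneg h7 h9)]

end boxProj

/-- Local solvability: coefficients that are positive definite at `z₀` and Hölder near `z₀` agree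
near `z₀` with coefficients admitting solvers. -/
lemma exists_local_solver {d : ℕ} {A : TX d → Fin d → Fin d → ℝ} {z₀ : TX d} {α β C r : ℝ}
    (hα : 0 < α) (hα1 : α < 1) (hαβ : α < β) (hr : 0 < r) (hC : 0 ≤ C) (hA : SPD (A z₀))
    (h : ∀ i j, ∀ z ∈ Metric.closedBall z₀ r, ∀ w ∈ Metric.closedBall z₀ r,
      |A z i j - A w i j| ≤ C * dist z w ^ β) :
    ∃ ρ, 0 < ρ ∧ ρ ≤ r ∧ ∃ K, (∃ M, ∀ i j, HB α M (fun z => A (boxProj z₀ ρ z) i j)) ∧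
      ∀ l, 1 ≤ l → ∃ S Sx Sxx,
        IsSolver α l K (fun z => A (boxProj z₀ ρ z)) S Sx Sxx := by
  obtain ⟨σ, hσ⟩ := hA.exists_cov
  set K := GS.solC σ α
  have hlim : Tendsto (fun ρ : ℝ => d ^ 2 * (C * (2 * ρ) ^ (β - α) * (1 + (2 * ρ) ^ α)) * K)
      (𝓝[>] 0) (𝓝 0) := by
    have hc : Continuous fun ρ : ℝ =>
        d ^ 2 * (C * (2 * ρ) ^ (β - α) * (1 + (2 * ρ) ^ α)) * K := by
      have h1 : Continuous fun ρ : ℝ => (2 * ρ) ^ (β - α) :=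
        (continuous_const.mul continuous_id).rpow_const fun _ => Or.inr (by linarith)
      have h2 : Continuous fun ρ : ℝ => (2 * ρ) ^ α :=
        (continuous_const.mul continuous_id).rpow_const fun _ => Or.inr hα.le
      fun_prop
    have := (hc.tendsto 0).mono_left (nhdsWithin_le_nhds (s := Set.Ioi 0))
    simpa [Real.zero_rpow (show β - α ≠ 0 by linarith)] using this
  have hev := (hlim.eventually (Iio_mem_nhds (show (0 : ℝ) < 1 / 2 by norm_num))).and
    (Ioc_mem_nhdsGT hr)
  obtain ⟨ρ, hρ1, hρ2⟩ := hev.exists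
  have hb := fun i j => boxProj.HB_sub (z₀ := z₀) hα hαβ hρ2.1 hρ2.2 hC (h i j)
  have he : ∀ z, (fun i j => GS.cov σ i j + (A (boxProj z₀ ρ z) i j - A z₀ i j))
      = A (boxProj z₀ ρ z) := fun z => by funext i j; rw [hσ]; ring
  refine ⟨ρ, hρ2.1, hρ2.2, 2 * K, ?_, fun l hl => ?_⟩
  · refine ⟨C * (2 * ρ) ^ (β - α) * (1 + (2 * ρ) ^ α) + ∑ i, ∑ j, |A z₀ i j|, fun i j => ?_⟩
    have h1 := (hb i j).add (HB.const (A z₀ i j))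
    simp only [sub_add_cancel] at h1
    refine h1.mono (add_le_add le_rfl ?_)
    refine le_trans ?_ (Finset.single_le_sum (f := fun i => ∑ j, |A z₀ i j|)
      (fun i _ => Finset.sum_nonneg fun j _ => abs_nonneg _) (Finset.mem_univ i))
    exact Finset.single_le_sum (f := fun j => |A z₀ i j|) (fun j _ => abs_nonneg _)
      (Finset.mem_univ j)
  · obtain ⟨S, Sx, Sxx, hS⟩ := (GS.isSolver σ hα hα1 hl).perturb
      (b := fun z i j => A (boxProj z₀ ρ z) i j - A z₀ i j) hb (le_of_lt hρ1)
    refine ⟨S, Sx, Sxx, ?_⟩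
    have : (fun z i j => GS.cov σ i j + (A (boxProj z₀ ρ z) i j - A z₀ i j))
      = fun z => A (boxProj z₀ ρ z) := funext he
    rw [this] at hS
    exact hS

end Gaussian

section Local

open MeasureTheory ProbabilityTheory
open scoped ContDiff

/-- Smooth functions that are constant outside a bounded set. -/
structure BC {d : ℕ} (f : TX d → ℝ) : Prop where
  smooth : ContDiff ℝ ∞ f
  const_out : ∃ c R : ℝ, ∀ z, R < ‖z‖ → f z = c

lemma exists_norm_le_of_const_out {d : ℕ} {F : Type*} [NormedAddCommGroup F] {f : TX d → F}
    (hf : Continuous f) {c : F} {R : ℝ} (h : ∀ z, R < ‖z‖ → f z = c) : ∃ M, ∀ z, ‖f z‖ ≤ M := by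
  obtain ⟨M, hM⟩ := (isCompact_closedBall (0 : TX d) R).exists_bound_of_continuousOn hf.continuousOn
  refine ⟨max M ‖c‖, fun z => ?_⟩
  by_cases hz : R < ‖z‖
  · rw [h z hz]; exact le_max_right _ _
  · exact (hM z (by simpa using hz)).trans (le_max_left _ _)

namespace BC

variable {d : ℕ} {f g : TX d → ℝ} {α : ℝ}

lemma const (c : ℝ) : BC (fun _ : TX d => c) := ⟨contDiff_const, c, 0, fun _ _ => rfl⟩

lemma add (hf : BC f) (hg : BC g) : BC (fun z => f z + g z) := by
  obtain ⟨c, R, h⟩ := hf.const_out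
  obtain ⟨c', R', h'⟩ := hg.const_out
  exact ⟨hf.smooth.add hg.smooth, c + c', max R R', fun z hz => by
    rw [h z ((le_max_left _ _).trans_lt hz), h' z ((le_max_right _ _).trans_lt hz)]⟩

lemma mul (hf : BC f) (hg : BC g) : BC (fun z => f z * g z) := by
  obtain ⟨c, R, h⟩ := hf.const_out
  obtain ⟨c', R', h'⟩ := hg.const_out
  exact ⟨hf.smooth.mul hg.smooth, c * c', max R R', fun z hz => by
    rw [h z ((le_max_left _ _).trans_lt hz), h' z ((le_max_right _ _).trans_lt hz)]⟩

lemma div (hf : BC f) (hg : BC g) (h0 : ∀ z, g z ≠ 0) : BC (fun z => f z / g z) := by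
  obtain ⟨c, R, h⟩ := hf.const_out
  obtain ⟨c', R', h'⟩ := hg.const_out
  exact ⟨hf.smooth.div hg.smooth h0, c / c', max R R', fun z hz => by
    rw [h z ((le_max_left _ _).trans_lt hz), h' z ((le_max_right _ _).trans_lt hz)]⟩

lemma comp (hf : BC f) {θ : ℝ → ℝ} (hθ : ContDiff ℝ ∞ θ) : BC (fun z => θ (f z)) := by
  obtain ⟨c, R, h⟩ := hf.const_out
  exact ⟨hθ.comp hf.smooth, θ c, R, fun z hz => by rw [h z hz]⟩

lemma sum {ι : Type*} (s : Finset ι) {f : ι → TX d → ℝ} (h : ∀ i ∈ s, BC (f i)) :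
    BC (fun z => ∑ i ∈ s, f i z) := by
  classical
  induction s using Finset.induction_on with
  | empty => simpa using BC.const 0
  | insert a s ha ih =>
    simp only [Finset.sum_insert ha]
    exact (h a (Finset.mem_insert_self _ _)).add
      (ih fun i hi => h i (Finset.mem_insert_of_mem hi))

lemma of_hasCompactSupport (hf : ContDiff ℝ ∞ f) (h : HasCompactSupport f) : BC f := by
  obtain ⟨R, hR⟩ := h.isBounded.exists_norm_le
  exact ⟨hf, 0, R, fun z hz => image_eq_zero_of_notMem_tsupport fun h' => hz.not_ge (hR z h')⟩

lemma fderiv_out {c R : ℝ} (h : ∀ z, R < ‖z‖ → f z = c) (z : TX d) (hz : R < ‖z‖) :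
    fderiv ℝ f z = 0 := by
  have : f =ᶠ[𝓝 z] fun _ => c := by
    filter_upwards [(isOpen_lt continuous_const continuous_norm).mem_nhds hz] with w hw
    exact h w hw
  rw [this.fderiv_eq]; simp

lemma deriv (hf : BC f) (v : TX d) : BC (fun z => fderiv ℝ f z v) := by
  obtain ⟨c, R, h⟩ := hf.const_out
  refine ⟨(hf.smooth.fderiv_right (m := ∞) (by simp)).clm_apply contDiff_const, 0, R,
    fun z hz => ?_⟩
  rw [fderiv_out h z hz]; simp

lemma exists_lip (hf : BC f) : ∃ N, ∀ z w, |f z - f w| ≤ N * ‖z - w‖ := by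
  obtain ⟨c, R, h⟩ := hf.const_out
  obtain ⟨N, hN⟩ := exists_norm_le_of_const_out
    (hf.smooth.continuous_fderiv (by simp)) (fderiv_out h)
  exact ⟨N, fun z w => Convex.norm_image_sub_le_of_norm_fderiv_le (s := Set.univ)
    (fun x _ => (hf.smooth.differentiable (by simp)).differentiableAt) (fun x _ => hN x)
    convex_univ (Set.mem_univ w) (Set.mem_univ z)⟩

lemma exists_HB (hf : BC f) (hα : 0 < α) (hα1 : α ≤ 1 / 2) : ∃ M, HB α M f := by
  obtain ⟨c, R, h⟩ := hf.const_out
  obtain ⟨M, hM⟩ := exists_norm_le_of_const_out hf.smooth.continuous h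
  obtain ⟨N, hN⟩ := hf.exists_lip
  refine ⟨_, HB.of_lip (N := N) hα hα1 one_pos le_rfl hf.smooth.continuous hM fun t x y => ?_⟩
  refine (hN _ _).trans (le_of_eq ?_)
  simp [Prod.norm_def]

lemma hasLineDerivAt (hf : BC f) (v z : TX d) : HasLineDerivAt ℝ f (fderiv ℝ f z v) z v :=
  ((hf.smooth.differentiable (by simp)) z).hasFDerivAt.hasLineDerivAt v

lemma c12 (hf : BC f) : C12 Set.univ f (fun z => fderiv ℝ f z et) (fun i z => fderiv ℝ f z (ex i))
    (fun i j z => fderiv ℝ (fun w => fderiv ℝ f w (ex j)) z (ex i)) :=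
  ⟨hf.smooth.continuous.continuousOn, (hf.deriv et).smooth.continuous.continuousOn,
    fun i => (hf.deriv (ex i)).smooth.continuous.continuousOn,
    fun i j => ((hf.deriv (ex j)).deriv (ex i)).smooth.continuous.continuousOn,
    fun z _ => hf.hasLineDerivAt et z, fun i z _ => hf.hasLineDerivAt (ex i) z,
    fun i j z _ => (hf.deriv (ex j)).hasLineDerivAt (ex i) z⟩

end BC

/-- Approximate solvability of `∂ₜu - ½ ∑ A_ij ∂ᵢⱼu + l u = η g` up to an error of order
`l ^ (-1/2)`. -/
def Patch {d : ℕ} (α : ℝ) (A : TX d → Fin d → Fin d → ℝ) (η : TX d → ℝ) : Prop :=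
  ∃ C : ℝ, ∀ l, 1 ≤ l → ∃ E : (TX d → ℝ) → TX d → ℝ, BOp α (C / √l) E ∧
    ∀ M g, HB α M g → ∃ u ut ux uxx, C12 Set.univ u ut ux uxx ∧ (∃ N, ∀ z, |u z| ≤ N) ∧
      ∀ z, ut z = η z * g z + E g z - l * u z + 1 / 2 * ∑ i, ∑ j, A z i j * uxx i j z

namespace Patch

variable {d : ℕ} {α : ℝ} {A : TX d → Fin d → Fin d → ℝ}

lemma zero : Patch α A (fun _ => 0) := by
  refine ⟨0, fun l hl => ⟨fun _ _ => 0, ⟨fun M g hg => ?_, fun _ _ _ _ _ _ => by simp⟩,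
    fun M g hg => ⟨_, _, _, _, C12.zero, ⟨0, by simp⟩, by simp⟩⟩⟩
  simpa using HB.const 0

lemma add {η η' : TX d → ℝ} (h : Patch α A η) (h' : Patch α A η') :
    Patch α A (fun z => η z + η' z) := by
  obtain ⟨C, h⟩ := h
  obtain ⟨C', h'⟩ := h'
  refine ⟨C + C', fun l hl => ?_⟩
  obtain ⟨E, hE, h⟩ := h l hl
  obtain ⟨E', hE', h'⟩ := h' l hl
  refine ⟨_, by simpa [add_div] using hE.add hE', fun M g hg => ?_⟩
  obtain ⟨u, ut, ux, uxx, hu, ⟨N, hN⟩, he⟩ := h M g hg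
  obtain ⟨u', ut', ux', uxx', hu', ⟨N', hN'⟩, he'⟩ := h' M g hg
  refine ⟨_, _, _, _, hu.add hu', ⟨N + N', fun z => (abs_add_le _ _).trans
    (add_le_add (hN z) (hN' z))⟩, fun z => ?_⟩
  simp only [he z, he' z, mul_add, Finset.sum_add_distrib]
  ring

lemma sum {ι : Type*} (s : Finset ι) {η : ι → TX d → ℝ} (h : ∀ i ∈ s, Patch α A (η i)) :
    Patch α A (fun z => ∑ i ∈ s, η i z) := by
  classical
  induction s using Finset.induction_on with
  | empty => simpa using Patch.zero
  | insert a s ha ih =>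
    simp only [Finset.sum_insert ha]
    exact (h a (Finset.mem_insert_self _ _)).add
      (ih fun i hi => h i (Finset.mem_insert_of_mem hi))

lemma of_solver {Ak : TX d → Fin d → Fin d → ℝ} {K : ℝ} {β ψ : TX d → ℝ} (hα : 0 < α)
    (hα1 : α ≤ 1 / 2) (hβ : BC β) (hψ : BC ψ) (hAk : ∃ M, ∀ i j, HB α M (fun z => Ak z i j))
    (hS : ∀ l, 1 ≤ l → ∃ S Sx Sxx, IsSolver α l K Ak S Sx Sxx)
    (hA : ∀ z ∈ tsupport β, A z = Ak z) : Patch α A (fun z => β z * ψ z) := by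
  obtain ⟨MA, hAk⟩ := hAk
  obtain ⟨P, hP⟩ := hψ.exists_HB hα hα1
  obtain ⟨B0, hB0⟩ := (hβ.deriv et).exists_HB hα hα1
  choose B1 hB1 using fun i => (hβ.deriv (ex i)).exists_HB hα hα1
  choose B2 hB2 using fun j i => ((hβ.deriv (ex j)).deriv (ex i)).exists_HB hα hα1
  have hm0 := hB0.sub ((HB.sum Finset.univ fun i _ => HB.sum Finset.univ fun j _ =>
    (hAk i j).mul (hB2 j i)).const_mul (1 / 2))
  set m0 : TX d → ℝ := fun z => fderiv ℝ β z et - 1 / 2 * ∑ i, ∑ j,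
    Ak z i j * fderiv ℝ (fun w => fderiv ℝ β w (ex j)) z (ex i) with hm0def
  set C0 := B0 + |(1 / 2 : ℝ)| * ∑ i, ∑ j, 2 * MA * B2 j i
  refine ⟨(2 * C0 * K + |(1 / 2 : ℝ)| * ∑ i, ∑ j, (2 * (2 * MA * B1 j) * K +
    2 * (2 * MA * B1 i) * K)) * (2 * P), fun l hl => ?_⟩
  obtain ⟨S, Sx, Sxx, hS⟩ := hS l hl
  have hE := ((hS.bS.mul_left hm0).add ((BOp.sum Finset.univ fun i _ =>
    BOp.sum Finset.univ fun j _ =>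
    ((hS.bSx i).mul_left ((hAk i j).mul (hB1 j))).add
    ((hS.bSx j).mul_left ((hAk i j).mul (hB1 i)))).const_mul (-(1 / 2)))).comp
    (BOp.ident.mul_left hP)
  refine ⟨_, hE.mono (le_of_eq ?_), fun M g hg => ?_⟩
  · rw [abs_neg]
    simp only [mul_div_assoc', ← add_div, ← Finset.sum_div, mul_one]
    ring
  · have hh : HB α (2 * P * M) (fun z => ψ z * g z) := hP.mul hg
    have hu := hβ.c12.mul (hS.sol _ _ hh)
    obtain ⟨Bb, hBb⟩ := hβ.exists_HB hα hα1
    refine ⟨_, _, _, _, hu, ⟨_, (hBb.mul (hS.bS.bound _ _ hh)).bdd⟩, fun z => ?_⟩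
    simp only
    by_cases hz : z ∈ tsupport β
    · rw [hA z hz, hm0def]
      simp only [mul_add, sub_mul, Finset.sum_add_distrib, Finset.mul_sum, Finset.sum_mul]
      have e1 : ∀ i j, 1 / 2 * (Ak z i j * (β z * Sxx i j (fun z => ψ z * g z) z))
          = β z * (1 / 2 * (Ak z i j * Sxx i j (fun z => ψ z * g z) z)) := fun i j => by ring
      have e2 : ∀ i j, -(1 / 2) * (Ak z i j * fderiv ℝ β z (ex j) * Sx i (fun z => ψ z * g z) z)
        = - (1 / 2 * (Ak z i j * (fderiv ℝ β z (ex j) * Sx i (fun z => ψ z * g z) z))) :=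
        fun i j => by ring
      have e3 : ∀ i j, -(1 / 2) * (Ak z i j * fderiv ℝ β z (ex i) * Sx j (fun z => ψ z * g z) z)
        = - (1 / 2 * (Ak z i j * (fderiv ℝ β z (ex i) * Sx j (fun z => ψ z * g z) z))) :=
        fun i j => by ring
      have e4 : ∀ i j, 1 / 2 * (Ak z i j * fderiv ℝ (fun w => fderiv ℝ β w (ex j)) z (ex i)) *
        S (fun z => ψ z * g z) z = 1 / 2 * (Ak z i j * (fderiv ℝ (fun w => fderiv ℝ β w (ex j)) z
          (ex i) * S (fun z => ψ z * g z) z)) := fun i j => by ring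
      simp only [e1, e2, e3, e4, Finset.sum_neg_distrib]
      ring
    · have hb : β =ᶠ[𝓝 z] fun _ => 0 := notMem_tsupport_iff_eventuallyEq.1 hz
      have hb1 : fderiv ℝ β =ᶠ[𝓝 z] fun _ => 0 := by
        filter_upwards [hb.eventuallyEq_nhds] with w hw
        rw [hw.fderiv_eq]; simp
      have hb2 : ∀ i j, fderiv ℝ (fun w => fderiv ℝ β w (ex j)) z (ex i) = 0 := fun i j => by
        have : (fun w => fderiv ℝ β w (ex j)) =ᶠ[𝓝 z] fun _ => 0 := by
          filter_upwards [hb1] with w hw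
          rw [hw]; simp
        rw [this.fderiv_eq]; simp
      simp [hm0def, hb.eq_of_nhds, hb1.eq_of_nhds, hb2]

lemma solve (h : Patch α A (fun _ => 1)) : ∃ l, 1 ≤ l ∧ ∀ M g, HB α M g →
    ∃ u ut ux uxx, C12 Set.univ u ut ux uxx ∧ (∃ N, ∀ z, |u z| ≤ N) ∧
      ∀ z, ut z = g z - l * u z + 1 / 2 * ∑ i, ∑ j, A z i j * uxx i j z := by
  obtain ⟨C, h⟩ := h
  set l := max 1 ((2 * C) ^ 2)
  have hl : 1 ≤ l := le_max_left _ _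
  have hs : 0 < √l := Real.sqrt_pos.2 (by linarith)
  have hC : C / √l ≤ 1 / 2 := by
    rw [div_le_iff₀ hs]
    have h1 : √((2 * C) ^ 2) ≤ √l := Real.sqrt_le_sqrt (le_max_right _ _)
    rw [Real.sqrt_sq_eq_abs] at h1
    linarith [le_abs_self (2 * C)]
  obtain ⟨E, hE, h⟩ := h l hl
  obtain ⟨R, hR, hinv⟩ := ((hE.const_mul (-1)).mono (by simpa using hC)).exists_inverse
  refine ⟨l, hl, fun M g hg => ?_⟩
  obtain ⟨u, ut, ux, uxx, hu, hN, he⟩ := h _ _ (hR.bound M g hg)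
  refine ⟨u, ut, ux, uxx, hu, hN, fun z => ?_⟩
  have := hinv M g hg z
  rw [he z]
  linarith

end Patch

/-- Hölder continuity of the coefficients near `z` with some exponent. -/
def HolderAt {d : ℕ} (A : TX d → Fin d → Fin d → ℝ) (z : TX d) : Prop :=
  ∃ r > 0, ∃ β > 0, ∃ C ≥ 0, ∀ i j, ∀ w ∈ Metric.closedBall z r, ∀ w' ∈ Metric.closedBall z r,
    |A w i j - A w' i j| ≤ C * dist w w' ^ (β : ℝ)

lemma HolderAt.exists_uniform {d : ℕ} {A : TX d → Fin d → Fin d → ℝ} {K : Set (TX d)}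
    (hK : IsCompact K) (hA : ∀ z, HolderAt A z) : ∃ β : ℝ, 0 < β ∧ ∀ z ∈ K,
    ∃ r > 0, ∃ C ≥ 0, ∀ i j, ∀ w ∈ Metric.closedBall z r, ∀ w' ∈ Metric.closedBall z r,
    |A w i j - A w' i j| ≤ C * dist w w' ^ β := by
  choose r hr β hβ C hC h using hA
  obtain ⟨t, -, ht⟩ := hK.elim_nhds_subcover (fun z => Metric.ball z (r z))
    fun z _ => Metric.ball_mem_nhds z (hr z)
  obtain ⟨b, hb0, hb⟩ : ∃ b : ℝ, 0 < b ∧ ∀ z ∈ t, b ≤ β z := by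
    by_cases hne : t.Nonempty
    · obtain ⟨z0, hz0, hm⟩ := t.exists_min_image β hne
      exact ⟨β z0, hβ z0, hm⟩
    · exact ⟨1, one_pos, fun z hz => (hne ⟨z, hz⟩).elim⟩
  refine ⟨b, hb0, fun z hz => ?_⟩
  obtain ⟨k, hk, hzk⟩ := Set.mem_iUnion₂.1 (ht hz)
  have hd : dist z k < r k := hzk
  refine ⟨min (r k - dist z k) (1 / 2), lt_min (by linarith) (by norm_num), C k, hC k,
    fun i j w hw w' hw' => ?_⟩
  have hw1 := Metric.mem_closedBall.1 hw
  have hw2 := Metric.mem_closedBall.1 hw'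
  have h1 := hw1.trans (min_le_left _ _)
  have h2 := hw2.trans (min_le_left _ _)
  have h3 := hw1.trans (min_le_right _ _)
  have h4 := hw2.trans (min_le_right _ _)
  refine (h k i j w ?_ w' ?_).trans (mul_le_mul_of_nonneg_left ?_ (hC k))
  · rw [Metric.mem_closedBall]; linarith [dist_triangle w z k]
  · rw [Metric.mem_closedBall]; linarith [dist_triangle w' z k]
  · have h5 : dist w w' ≤ 1 := by linarith [dist_triangle_right w w' z]
    exact Real.rpow_le_rpow_of_exponent_ge' dist_nonneg h5 hb0.le (hb k hk)

lemma SPD.one {d : ℕ} : SPD (fun i j : Fin d => if i = j then (1 : ℝ) else 0) := by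
  refine ⟨fun i j => by simp [eq_comm], fun y hy => ?_⟩
  simp only [ite_mul, one_mul, zero_mul, Finset.sum_ite_eq, Finset.mem_univ, if_true]
  obtain ⟨i, hi⟩ := Function.ne_iff.1 hy
  exact Finset.sum_pos' (fun i _ => mul_self_nonneg _) ⟨i, Finset.mem_univ i,
    mul_self_pos.2 hi⟩

/-- Locally Hölder functions that are constant outside a compact set are globally Hölder. -/
lemma HB.of_local {d : ℕ} {g : TX d → ℝ} {K : Set (TX d)} {c α β : ℝ} (hK : IsCompact K)
    (hα : 0 < α) (hαβ : α ≤ β) (hout : ∀ z ∉ K, g z = c)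
    (h : ∀ z ∈ K, ∃ r > 0, ∃ C ≥ 0, ∀ w ∈ Metric.closedBall z r, ∀ w' ∈ Metric.closedBall z r,
      |g w - g w'| ≤ C * dist w w' ^ β) : ∃ M, HB α M g := by
  have hβ : 0 < β := hα.trans_le hαβ
  have hcont : Continuous g := continuous_iff_continuousAt.2 fun z => by
    by_cases hz : z ∈ K
    · obtain ⟨r, hr, C, hC, hg⟩ := h z hz
      refine tendsto_iff_dist_tendsto_zero.2 ?_
      have hlim : Tendsto (fun w => C * dist w z ^ β) (𝓝 z) (𝓝 0) := by
        have hc : Continuous fun w : TX d => C * dist w z ^ β :=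
          continuous_const.mul ((continuous_id.dist continuous_const).rpow_const
            fun _ => Or.inr hβ.le)
        have := hc.tendsto z
        simpa [Real.zero_rpow hβ.ne'] using this
      refine squeeze_zero' (Eventually.of_forall fun _ => dist_nonneg) ?_ hlim
      filter_upwards [Metric.closedBall_mem_nhds z hr] with w hw
      exact hg w hw z (Metric.mem_closedBall_self hr.le)
    · refine (continuousAt_const (y := c)).congr ?_
      filter_upwards [hK.isClosed.isOpen_compl.mem_nhds hz] with w hw
      exact (hout w hw).symm
  obtain ⟨B, hB⟩ := hK.exists_bound_of_continuousOn hcont.continuousOn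
  have hb : ∀ z, |g z| ≤ |B| + |c| := fun z => by
    by_cases hz : z ∈ K
    · exact (hB z hz).trans ((le_abs_self B).trans (le_add_of_nonneg_right (abs_nonneg _)))
    · rw [hout z hz]; exact le_add_of_nonneg_left (abs_nonneg _)
  choose! r hr C hC hg using h
  obtain ⟨t, htK, ht⟩ := hK.elim_nhds_subcover (fun z => Metric.ball z (r z / 2))
    fun z hz => Metric.ball_mem_nhds z (half_pos (hr z hz))
  obtain ⟨δ, hδ, hδ1, hδr⟩ : ∃ δ : ℝ, 0 < δ ∧ δ ≤ 1 ∧ ∀ z ∈ t, δ ≤ r z / 2 := by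
    by_cases hne : t.Nonempty
    · obtain ⟨z0, hz0, hm⟩ := t.exists_min_image r hne
      exact ⟨min 1 (r z0 / 2), lt_min one_pos (half_pos (hr z0 (htK z0 hz0))), min_le_left _ _,
        fun z hz => (min_le_right _ _).trans (by linarith [hm z hz])⟩
    · exact ⟨1, one_pos, le_rfl, fun z hz => (hne ⟨z, hz⟩).elim⟩
  have hCs : 0 ≤ ∑ z ∈ t, C z := Finset.sum_nonneg fun z hz => hC z (htK z hz)
  have hnear : ∀ w ∈ K, ∀ w', dist w w' ≤ δ → |g w - g w'| ≤ (∑ z ∈ t, C z) * dist w w' ^ α := by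
    intro w hw w' hww
    obtain ⟨k, hk, hwk⟩ := Set.mem_iUnion₂.1 (ht hw)
    have h1 : dist w k < r k / 2 := hwk
    have h2 := hδr k hk
    have h3 := hr k (htK k hk)
    refine (hg k (htK k hk) w (Metric.mem_closedBall.2 (by linarith)) w'
      (Metric.mem_closedBall.2 ?_)).trans ?_
    · linarith [dist_triangle w' w k, dist_comm w w']
    · refine mul_le_mul (Finset.single_le_sum (fun z hz => hC z (htK z hz)) hk) ?_
        (Real.rpow_nonneg dist_nonneg _) hCs
      exact Real.rpow_le_rpow_of_exponent_ge' dist_nonneg (hww.trans hδ1) hα.le hαβ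
  set B' := |B| + |c|
  have hB' : 0 ≤ B' := by positivity
  have hδα : 0 < δ ^ α := Real.rpow_pos_of_pos hδ _
  refine ⟨B' + ∑ z ∈ t, C z + 2 * B' / δ ^ α, hcont, fun z => (hb z).trans ?_, fun τ x y => ?_⟩
  · have : 0 ≤ 2 * B' / δ ^ α := by positivity
    linarith
  · have hd : dist (τ, x) (τ, y) = ‖x - y‖ := by
      rw [Prod.dist_eq, dist_self, dist_eq_norm, max_eq_right (norm_nonneg _)]
    have hp : 0 ≤ ‖x - y‖ ^ α := Real.rpow_nonneg (norm_nonneg _) _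
    have hq : 0 ≤ 2 * B' / δ ^ α := by positivity
    by_cases hs : ‖x - y‖ ≤ δ
    · have hS : |g (τ, x) - g (τ, y)| ≤ (∑ z ∈ t, C z) * ‖x - y‖ ^ α := by
        by_cases hx : (τ, x) ∈ K
        · have := hnear _ hx (τ, y) (by rwa [hd])
          rwa [hd] at this
        by_cases hy : (τ, y) ∈ K
        · have := hnear _ hy (τ, x) (by rwa [dist_comm, hd])
          rwa [dist_comm, hd, abs_sub_comm] at this
        · rw [hout _ hx, hout _ hy, sub_self, abs_zero]; positivity
      nlinarith [mul_nonneg hB' hp, mul_nonneg hq hp]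
    · have h1 : |g (τ, x) - g (τ, y)| ≤ 2 * B' :=
        (abs_sub _ _).trans (by linarith [hb (τ, x), hb (τ, y)])
      have h2 : δ ^ α ≤ ‖x - y‖ ^ α := Real.rpow_le_rpow hδ.le (not_le.1 hs).le hα.le
      have h3 : 2 * B' ≤ 2 * B' / δ ^ α * ‖x - y‖ ^ α := by
        rw [div_mul_eq_mul_div, le_div_iff₀ hδα]
        exact mul_le_mul_of_nonneg_left h2 (by positivity)
      nlinarith [mul_nonneg hB' hp, mul_nonneg hCs hp]

/-- Resolvent solvability for coefficients that are the identity outside a compact set. -/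
theorem exists_global_solver {d : ℕ} {A : TX d → Fin d → Fin d → ℝ} {K : Set (TX d)}
    (hK : IsCompact K) (hA : ∀ z, HolderAt A z) (hpd : ∀ z, SPD (A z))
    (hout : ∀ z ∉ K, A z = fun i j => if i = j then 1 else 0) :
    ∃ α l : ℝ, 0 < α ∧ α ≤ 1 / 2 ∧ 1 ≤ l ∧
    (∃ MA, ∀ i j, HB α MA (fun z => A z i j)) ∧ ∀ M g, HB α M g →
    ∃ u ut ux uxx, C12 Set.univ u ut ux uxx ∧ (∃ N, ∀ z, |u z| ≤ N) ∧
      ∀ z, ut z = g z - l * u z + 1 / 2 * ∑ i, ∑ j, A z i j * uxx i j z := by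
  obtain ⟨b, hb, hH⟩ := HolderAt.exists_uniform hK hA
  set α := min (b / 2) (1 / 2)
  have hα : 0 < α := lt_min (by positivity) (by norm_num)
  have hα2 : α ≤ 1 / 2 := min_le_right _ _
  have hα1 : α < 1 := by linarith
  have hαb : α < b := (min_le_left _ _).trans_lt (by linarith)
  suffices h : Patch α A (fun _ => 1) by
    obtain ⟨l, hl, h⟩ := h.solve
    refine ⟨α, l, hα, hα2, hl, ?_, h⟩
    choose MA hMA using fun (i j : Fin d) => HB.of_local (g := fun z => A z i j)
      (c := if i = j then 1 else 0) hK hα hαb.le (fun z hz => by rw [hout z hz]) (fun z hz => by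
        obtain ⟨r, hr, C, hC, h⟩ := hH z hz
        exact ⟨r, hr, C, hC, h i j⟩)
    refine ⟨∑ i, ∑ j, MA i j, fun i j => (hMA i j).mono ?_⟩
    exact (Finset.single_le_sum (f := fun j => MA i j) (fun j _ => (hMA i j).nonneg)
      (Finset.mem_univ j)).trans (Finset.single_le_sum (f := fun i => ∑ j, MA i j)
        (fun i _ => Finset.sum_nonneg fun j _ => (hMA i j).nonneg) (Finset.mem_univ i))
  have hloc : ∀ z : K, ∃ ρ > 0, ∃ L, (∃ M, ∀ i j, HB α M (fun w => A (boxProj (z : TX d) ρ w) i j)) ∧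
      ∀ l, 1 ≤ l → ∃ S Sx Sxx, IsSolver α l L (fun w => A (boxProj (z : TX d) ρ w)) S Sx Sxx :=
      fun z => by
    obtain ⟨r, hr, C, hC, h⟩ := hH z z.2
    obtain ⟨ρ, hρ, -, L, h1, h2⟩ := exists_local_solver hα hα1 hαb hr hC (hpd z) h
    exact ⟨ρ, hρ, L, h1, h2⟩
  choose ρ hρ L hM hS using hloc
  obtain ⟨t, ht⟩ := hK.elim_nhds_subcover' (fun z hz => Metric.ball z (ρ ⟨z, hz⟩ / 2))
    fun z hz => Metric.ball_mem_nhds z (half_pos (hρ _))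
  let B : (z : K) → ContDiffBump (z : TX d) := fun z =>
    ⟨ρ z / 2, ρ z, half_pos (hρ z), half_lt_self (hρ z)⟩
  have hB : ∀ z, BC (B z) := fun z => BC.of_hasCompactSupport (B z).contDiff (B z).hasCompactSupport
  set s : TX d → ℝ := fun w => ∑ z ∈ t, B z w
  have hs : BC s := BC.sum t fun z _ => hB z
  set Bi : TX d → ℝ := fun w => 1 + -1 * Real.smoothTransition (s w)
  have hBi : BC Bi := (BC.const 1).add ((BC.const (-1)).mul (hs.comp Real.smoothTransition.contDiff))
  set D : TX d → ℝ := fun w => ∑ z ∈ t, B z w * B z w + Bi w * Bi w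
  have hD : BC D := (BC.sum t fun z _ => (hB z).mul (hB z)).add (hBi.mul hBi)
  have hD0 : ∀ w, D w ≠ 0 := fun w h0 => by
    have h1 : 0 ≤ ∑ z ∈ t, B z w * B z w := Finset.sum_nonneg fun z _ => mul_self_nonneg _
    have h2 := mul_self_nonneg (Bi w)
    have h0' : ∑ z ∈ t, B z w * B z w + Bi w * Bi w = 0 := h0
    have h3 : ∑ z ∈ t, B z w * B z w = 0 := by linarith
    have h4 : Bi w = 0 := by
      have : Bi w * Bi w = 0 := by linarith
      simpa using this
    rw [Finset.sum_eq_zero_iff_of_nonneg fun z _ => mul_self_nonneg _] at h3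
    have h5 : s w = 0 := Finset.sum_eq_zero fun z hz => by simpa using h3 z hz
    simp [Bi, h5] at h4
  have hsum : (fun _ => (1 : ℝ)) =
      fun w => (∑ z ∈ t, B z w * (B z w / D w)) + Bi w * (Bi w / D w) := by
    funext w
    simp only [← mul_div_assoc, ← Finset.sum_div, ← add_div]
    exact (div_self (hD0 w)).symm
  rw [hsum]
  refine (Patch.sum t fun z _ => ?_).add ?_
  · refine Patch.of_solver hα hα2 (hB z) ((hB z).div hD hD0) (hM z) (hS z) fun w hw => ?_
    rw [(B z).tsupport_eq] at hw
    rw [boxProj.eq_self _ hw]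
  · obtain ⟨σ, hσ⟩ := (SPD.one (d := d)).exists_cov
    refine Patch.of_solver (Ak := fun _ => GS.cov σ) (K := GS.solC σ α) hα hα2 hBi
      (hBi.div hD hD0) ?_ (fun l hl => ⟨_, _, _, GS.isSolver σ hα hα1 hl⟩) fun w hw => ?_
    · refine ⟨1, fun i j => (HB.const _).mono ?_⟩
      rw [hσ]; simp only; split_ifs <;> simp
    · rw [hσ]
      refine hout w fun hwK => ?_
      obtain ⟨k, hk, hwk⟩ := Set.mem_iUnion₂.1 (ht hwK)
      refine (notMem_tsupport_iff_eventuallyEq.2 ?_) hw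
      filter_upwards [Metric.isOpen_ball.mem_nhds hwk] with v hv
      have h1 : B k v = 1 := (B k).one_of_mem_closedBall (Metric.ball_subset_closedBall hv)
      have h2 : 1 ≤ s v := by
        rw [← h1]
        exact Finset.single_le_sum (f := fun z => B z v) (fun z _ => (B z).nonneg) hk
      simp [Bi, Real.smoothTransition.one_of_one_le h2]

section Interior

variable {d : ℕ} {φ ψ : TX d → ℝ}

lemma fderiv_eq_zero_of_eventually {c : ℝ} {z : TX d} (h : φ =ᶠ[𝓝 z] fun _ => c) :
    (∀ v, fderiv ℝ φ z v = 0) ∧ ∀ v w, fderiv ℝ (fun y => fderiv ℝ φ y v) z w = 0 := by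
  have hb1 : fderiv ℝ φ =ᶠ[𝓝 z] fun _ => 0 := by
    filter_upwards [h.eventuallyEq_nhds] with w hw
    rw [hw.fderiv_eq]; simp
  refine ⟨fun v => by simp [hb1.eq_of_nhds], fun v w => ?_⟩
  have : (fun y => fderiv ℝ φ y v) =ᶠ[𝓝 z] fun _ => 0 := by
    filter_upwards [hb1] with y hy
    rw [hy]; simp
  rw [this.fderiv_eq]; simp

lemma BC.c12_mul (hφ : BC φ) {U : Set (TX d)} (hU : IsOpen U) (hs : tsupport φ ⊆ U)
    {v vt : TX d → ℝ} {vx : Fin d → TX d → ℝ} {vxx : Fin d → Fin d → TX d → ℝ}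
    (hv : C12 U v vt vx vxx) :
    C12 Set.univ (fun z => φ z * v z) (fun z => fderiv ℝ φ z et * v z + φ z * vt z)
      (fun i z => fderiv ℝ φ z (ex i) * v z + φ z * vx i z)
      (fun i j z => (fderiv ℝ (fun w => fderiv ℝ φ w (ex j)) z (ex i) * v z +
        fderiv ℝ φ z (ex j) * vx i z) + (fderiv ℝ φ z (ex i) * vx j z + φ z * vxx i j z)) := by
  refine C12.of_forall fun z _ => ?_
  by_cases hz : z ∈ tsupport φ
  · exact ⟨U, hU.mem_nhds (hs hz), (hφ.c12.mono (Set.subset_univ U)).mul hv⟩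
  · have ho : IsOpen (tsupport φ)ᶜ := (isClosed_tsupport φ).isOpen_compl
    refine ⟨_, ho.mem_nhds hz, (C12.zero.mono (Set.subset_univ _)).congr ho ?_ ?_ ?_ ?_⟩
    all_goals
      intros
      rename_i y hy
      have h0 : φ =ᶠ[𝓝 y] fun _ => 0 := notMem_tsupport_iff_eventuallyEq.1 hy
      have h1 := fderiv_eq_zero_of_eventually h0
      simp [h1.1, h1.2, h0.eq_of_nhds]

/-- A function whose spatial derivatives are bounded is Lipschitz in space. -/
lemma space_lip_of_lineDeriv {M : ℝ} {v : TX d → ℝ} {vx : Fin d → TX d → ℝ}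
    (hc : ∀ i, ContinuousOn (vx i) Set.univ)
    (hx : ∀ i, ∀ z ∈ Set.univ, HasLineDerivAt ℝ v (vx i z) z (ex i))
    (hM : ∀ i z, |vx i z| ≤ M) (t : ℝ) (x y : Fin d → ℝ) :
    |v (t, x) - v (t, y)| ≤ d * M * ‖x - y‖ := by
  have hd : ∀ τ : ℝ, HasDerivAt (fun τ : ℝ => v (t, y + τ • (x - y)))
      (∑ i, (x - y) i * vx i (t, y + τ • (x - y))) τ := fun τ => by
    have h := hasDerivAt_space isOpen_univ hc hx (z := (t, y + τ • (x - y)))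
      (Set.mem_univ _) (x - y)
    have h' : HasDerivAt (fun s : ℝ => v (t, y + τ • (x - y) + s • (x - y)))
        (∑ i, (x - y) i * vx i (t, y + τ • (x - y))) (τ - τ) := by
      have := h
      unfold HasLineDerivAt at this
      simpa using this
    have h2 := HasDerivAt.comp (h := fun s : ℝ => s - τ) τ h' ((hasDerivAt_id τ).sub_const τ)
    refine (h2.congr_deriv (mul_one _)).congr_of_eventuallyEq (Eventually.of_forall fun s => ?_)
    simp only [Function.comp]
    congr 2
    rw [add_assoc, ← add_smul]; ring_nf
  have := Convex.norm_image_sub_le_of_norm_hasDerivWithin_le (s := Set.univ)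
    (C := d * M * ‖x - y‖) (fun τ _ => (hd τ).hasDerivWithinAt) (fun τ _ => ?_) convex_univ
    (Set.mem_univ 0) (Set.mem_univ (1 : ℝ))
  · simpa using this
  · refine (norm_sum_le _ _).trans ?_
    have : ∀ i ∈ (Finset.univ : Finset (Fin d)),
        ‖(x - y) i * vx i (t, y + τ • (x - y))‖ ≤ ‖x - y‖ * M := fun i _ => by
      rw [norm_mul]
      exact mul_le_mul (norm_le_pi_norm _ i) (hM i _) (norm_nonneg _) (norm_nonneg _)
    refine (Finset.sum_le_sum this).trans (le_of_eq ?_)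
    simp; ring

/-- All bounds on a cutoff function that enter the interior estimate. -/
structure CutBound (α B : ℝ) (φ : TX d → ℝ) : Prop where
  bc : BC φ
  le_one : ∀ z, |φ z| ≤ 1
  b : HB α B φ
  bt : HB α B (fun z => fderiv ℝ φ z et)
  bx : ∀ i, HB α B (fun z => fderiv ℝ φ z (ex i))
  bxx : ∀ i j, HB α B (fun z => fderiv ℝ (fun w => fderiv ℝ φ w (ex j)) z (ex i))

/-- The localized equation. -/
lemma cutoff_eq_solver {α l K B MA m N : ℝ} {A : TX d → Fin d → Fin d → ℝ}
    {S : (TX d → ℝ) → TX d → ℝ} {Sx : Fin d → (TX d → ℝ) → TX d → ℝ}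
    {Sxx : Fin d → Fin d → (TX d → ℝ) → TX d → ℝ}
    (hpos : ∀ z, SPSD (A z)) (hA : ∀ i j, HB α MA (fun z => A z i j)) (hl : 1 ≤ l)
    (hS : IsSolver α l K A S Sx Sxx) (hφ : CutBound α B φ)
    {U : Set (TX d)} (hU : IsOpen U) (hs : tsupport φ ⊆ U)
    (hφψ : ∀ z ∈ tsupport φ, ψ =ᶠ[𝓝 z] fun _ => 1)
    {v vt : TX d → ℝ} {vx : Fin d → TX d → ℝ} {vxx : Fin d → Fin d → TX d → ℝ}
    (hv : C12 U v vt vx vxx) (hvm : ∀ z ∈ U, |v z| ≤ m) (hm : 0 ≤ m)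
    (heq : ∀ z ∈ U, vt z = 1 / 2 * ∑ i, ∑ j, A z i j * vxx i j z)
    {W : ℝ} (hW : HB α W (fun z => ψ z * v z))
    (hN : ∀ i, HB α N (fun z => fderiv ℝ ψ z (ex i) * v z + ψ z * vx i z)) :
    ∃ F, HB α (2 * (B + 1 / 2 * ∑ _i : Fin d, ∑ _j : Fin d, 2 * MA * B + l * B) * W +
        1 / 2 * ∑ _i : Fin d, ∑ _j : Fin d,
          (2 * (2 * MA * B) * N + 2 * (2 * MA * B) * N)) F ∧
      (∀ i z, fderiv ℝ φ z (ex i) * v z + φ z * vx i z = Sx i F z) ∧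
      ∀ i j z, (fderiv ℝ (fun w => fderiv ℝ φ w (ex j)) z (ex i) * v z +
        fderiv ℝ φ z (ex j) * vx i z) + (fderiv ℝ φ z (ex i) * vx j z + φ z * vxx i j z) =
        Sxx i j F z := by
  have hw := hφ.bc.c12_mul hU hs hv
  have hq := ((hφ.bt.sub ((HB.sum Finset.univ fun i _ => HB.sum Finset.univ fun j _ =>
    (hA i j).mul (hφ.bxx i j)).const_mul (1 / 2))).add (hφ.b.const_mul l)).mul hW
  have hp := ((HB.sum Finset.univ fun i _ => HB.sum Finset.univ fun j _ =>
    (((hA i j).mul (hφ.bx j)).mul (hN i)).add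
      (((hA i j).mul (hφ.bx i)).mul (hN j))).const_mul (1 / 2))
  have hF := hq.sub hp
  rw [abs_of_pos (show (0 : ℝ) < 1 / 2 by norm_num), abs_of_pos (show 0 < l by linarith)] at hF
  refine ⟨_, hF, ?_⟩
  set F := fun z => ((fderiv ℝ φ z et - 1 / 2 * ∑ i, ∑ j, A z i j *
      fderiv ℝ (fun w => fderiv ℝ φ w (ex j)) z (ex i)) + l * φ z) * (ψ z * v z) -
      1 / 2 * ∑ i, ∑ j, (A z i j * fderiv ℝ φ z (ex j) *
        (fderiv ℝ ψ z (ex i) * v z + ψ z * vx i z) + A z i j * fderiv ℝ φ z (ex i) *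
        (fderiv ℝ ψ z (ex j) * v z + ψ z * vx j z)) with hFdef
  have hu := hS.sol _ _ hF
  have huB := hS.bS.bound _ _ hF
  have key : ∀ z, φ z * v z - S F z = 0 := by
    refine eq_zero_of_solution hpos (fun z i j => (hA i j).bdd z) (show 0 < l by linarith)
      (hw.sub hu) (fun z => (abs_sub _ _).trans (add_le_add (b := m) ?_ (huB.bdd z))) fun z => ?_
    · by_cases hz : z ∈ tsupport φ
      · rw [abs_mul]
        exact (mul_le_mul (hφ.le_one z) (hvm z (hs hz)) (abs_nonneg _) zero_le_one).trans
          (one_mul m).le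
      · rw [image_eq_zero_of_notMem_tsupport hz]; simpa
    · simp only [mul_sub, Finset.sum_sub_distrib]
      rw [sub_sub, eq_comm]
      by_cases hz : z ∈ tsupport φ
      · have h1 := fderiv_eq_zero_of_eventually (hφψ z hz)
        rw [heq z (hs hz), hFdef]
        simp only [h1.1, (hφψ z hz).eq_of_nhds, zero_mul, zero_add, one_mul]
        simp only [mul_add, Finset.sum_add_distrib, Finset.mul_sum, sub_mul, add_mul,
          Finset.sum_mul]
        have e1 : ∀ i j, 1 / 2 * (A z i j *
            (fderiv ℝ (fun w => fderiv ℝ φ w (ex j)) z (ex i) * v z)) =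
            1 / 2 * (A z i j * fderiv ℝ (fun w => fderiv ℝ φ w (ex j)) z (ex i)) * v z :=
          fun i j => by ring
        have e2 : ∀ i j, 1 / 2 * (A z i j * (fderiv ℝ φ z (ex j) * vx i z)) =
          1 / 2 * (A z i j * fderiv ℝ φ z (ex j) * vx i z) := fun i j => by ring
        have e3 : ∀ i j, 1 / 2 * (A z i j * (fderiv ℝ φ z (ex i) * vx j z)) =
          1 / 2 * (A z i j * fderiv ℝ φ z (ex i) * vx j z) := fun i j => by ring
        have e4 : ∀ i j, 1 / 2 * (A z i j * (φ z * vxx i j z)) =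
          φ z * (1 / 2 * (A z i j * vxx i j z)) := fun i j => by ring
        simp only [e1, e2, e3, e4]
        ring
      · have h0 : φ =ᶠ[𝓝 z] fun _ => 0 := notMem_tsupport_iff_eventuallyEq.1 hz
        have h1 := fderiv_eq_zero_of_eventually h0
        simp only [hFdef, h1.1, h1.2, h0.eq_of_nhds]
        simp
        try ring
  have hfun : S F = fun z => φ z * v z := funext fun z => by linarith [key z]
  rw [hfun] at hu
  exact ⟨fun i z => hw.unique_x hu (Set.mem_univ z) i,
    fun i j z => hw.unique_xx isOpen_univ hu (Set.mem_univ z) i j⟩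

/-- One step of the iteration leading to the interior estimate. -/
lemma interior_step {α K MA η : ℝ} {A : TX d → Fin d → Fin d → ℝ} (hα : 0 < α) (hα1 : α ≤ 1 / 2)
    (hpos : ∀ z, SPSD (A z)) (hA : ∀ i j, HB α MA (fun z => A z i j)) (hK : 0 ≤ K)
    (hS : ∀ l, 1 ≤ l → ∃ S Sx Sxx, IsSolver α l K A S Sx Sxx) (hη : 0 < η) :
    ∃ C Q : ℝ, 0 ≤ C ∧ 1 ≤ Q ∧ ∀ B, 1 ≤ B → ∀ φ ψ : TX d → ℝ, CutBound α B φ → BC ψ →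
    (∀ z, |ψ z| ≤ 1) → ∀ U, IsOpen U → tsupport φ ⊆ U → tsupport ψ ⊆ U →
    (∀ z ∈ tsupport φ, ψ =ᶠ[𝓝 z] fun _ => 1) → ∀ v vt vx vxx, C12 U v vt vx vxx →
    ∀ m, 0 ≤ m → (∀ z ∈ U, |v z| ≤ m) →
    (∀ z ∈ U, vt z = 1 / 2 * ∑ i, ∑ j, A z i j * vxx i j z) → ∀ M, 0 ≤ M →
    (∀ i, HB α M (fun z => fderiv ℝ ψ z (ex i) * v z + ψ z * vx i z)) →
    (∀ i, HB α (C * B ^ 4 * m + η * M) (fun z => fderiv ℝ φ z (ex i) * v z + φ z * vx i z)) ∧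
    ∀ i j, HB α (Q * B * (C * B ^ 4 * m + η * M)) (fun z =>
      (fderiv ℝ (fun w => fderiv ℝ φ w (ex j)) z (ex i) * v z +
        fderiv ℝ φ z (ex j) * vx i z) + (fderiv ℝ φ z (ex i) * vx j z + φ z * vxx i j z)) := by
  set C1 : ℝ := 4 + 4 * (d : ℝ) ^ 2 * |MA| with hC1
  have hC1p : 0 < C1 := by positivity
  set Q : ℝ := max 1 (2 * K * C1 / η)
  have hQ1 : 1 ≤ Q := le_max_left _ _
  have hQ0 : 0 < Q := by linarith
  have hQη : K * C1 / Q ≤ η / 2 := by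
    have h1 : 2 * K * C1 / η ≤ Q := le_max_right _ _
    rw [div_le_iff₀ hη] at h1
    rw [div_le_iff₀ hQ0]; linarith
  set c : ℝ := min 1 (η / (2 * (K * C1 * Q * d + 1))) with hc
  have hc0 : 0 < c := lt_min one_pos (by positivity)
  have hc1 : c ≤ 1 := min_le_left _ _
  have hcη : K * C1 * Q * d * c ≤ η / 2 := by
    have h1 : c ≤ η / (2 * (K * C1 * Q * d + 1)) := min_le_right _ _
    rw [le_div_iff₀ (by positivity)] at h1
    nlinarith
  refine ⟨K * C1 * Q * (1 + 2 / c), Q, by positivity, hQ1, fun B hB φ ψ hφ hψ hψ1 U hU hs hsψ hφψ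
    v vt vx vxx hv m hm hvm heq M hM hwM => ?_⟩
  have hB0 : 0 < B := by linarith
  have hQB : 1 ≤ Q * B := one_le_mul_of_one_le_of_one_le hQ1 hB
  have hl : 1 ≤ (Q * B) ^ 2 := one_le_pow₀ hQB
  obtain ⟨S, Sx, Sxx, hSol⟩ := hS _ hl
  have hw := hψ.c12_mul hU hsψ hv
  have hνB : c / B ^ 2 ≤ 1 := by
    rw [div_le_one (by positivity)]
    exact hc1.trans (one_le_pow₀ hB)
  have hW := HB.of_lip hα hα1 (ν := c / B ^ 2) (by positivity) hνB (M := m)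
    (continuousOn_univ.1 hw.cu) (fun z => ?_)
    (space_lip_of_lineDeriv hw.cx hw.dx fun i z => (hwM i).bdd z)
  swap
  · by_cases hz : z ∈ tsupport ψ
    · rw [abs_mul]
      exact (mul_le_mul (hψ1 z) (hvm z (hsψ hz)) (abs_nonneg _) zero_le_one).trans (one_mul m).le
    · rw [image_eq_zero_of_notMem_tsupport hz]; simpa
  set W := m + |d * M| * (c / B ^ 2) + 2 * m / (c / B ^ 2) with hWdef
  obtain ⟨F, hF, h1, h2⟩ := cutoff_eq_solver hpos hA hl hSol hφ hU hs hφψ hv hvm hm heq hW hwM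
  have hW0 : 0 ≤ W := by positivity
  have hF' : HB α (C1 * B * (Q * B) ^ 2 * W + C1 * B * M) F := by
    refine hF.mono ?_
    simp only [Finset.sum_const, Finset.card_univ, Fintype.card_fin, nsmul_eq_mul]
    have hMA := le_abs_self MA
    have hd : (0 : ℝ) ≤ (d : ℝ) ^ 2 := by positivity
    have e1 : 2 * (B + 1 / 2 * (↑d * (↑d * (2 * MA * B))) + (Q * B) ^ 2 * B) ≤
        C1 * B * (Q * B) ^ 2 := by
      have : (d : ℝ) ^ 2 * MA * B ≤ (d : ℝ) ^ 2 * |MA| * B := by gcongr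
      have h4 : (1 + (d : ℝ) ^ 2 * |MA|) * B * 1 ≤ (1 + (d : ℝ) ^ 2 * |MA|) * B * (Q * B) ^ 2 := by
        gcongr
      have h5 : 0 ≤ (d : ℝ) ^ 2 * |MA| * B * (Q * B) ^ 2 := by positivity
      rw [hC1]; nlinarith
    have e2 : (d : ℝ) ^ 2 * MA * (B * M) ≤ (d : ℝ) ^ 2 * |MA| * (B * M) := by gcongr
    have e3 : 0 ≤ B * M := by positivity
    have := mul_le_mul_of_nonneg_right e1 hW0
    rw [hC1]; rw [hC1] at this
    nlinarith
  have hbound : K / √((Q * B) ^ 2) * (C1 * B * (Q * B) ^ 2 * W + C1 * B * M) ≤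
      K * C1 * Q * (1 + 2 / c) * B ^ 4 * m + η * M := by
    rw [Real.sqrt_sq (by positivity), hWdef, abs_of_nonneg (by positivity)]
    have e : K / (Q * B) * (C1 * B * (Q * B) ^ 2 * (m + d * M * (c / B ^ 2) + 2 * m / (c / B ^ 2))
        + C1 * B * M) = K * C1 * Q * B ^ 2 * m + K * C1 * Q * (2 / c) * B ^ 4 * m +
        (K * C1 * Q * d * c) * M + (K * C1 / Q) * M := by
      field_simp
      try ring
    rw [e]
    have h3 := mul_le_mul_of_nonneg_right hcη hM
    have h4 := mul_le_mul_of_nonneg_right hQη hM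
    have h5 : K * C1 * Q * m * B ^ 2 ≤ K * C1 * Q * m * B ^ 4 := by
      gcongr
      norm_num
    nlinarith
  refine ⟨fun i => ?_, fun i j => ?_⟩
  · rw [funext (h1 i)]
    exact ((hSol.bSx i).bound _ _ hF').mono hbound
  · rw [funext (h2 i j)]
    refine ((hSol.bSxx i j).bound _ _ hF').mono ?_
    refine le_trans (le_of_eq ?_) (mul_le_mul_of_nonneg_left hbound (by positivity : 0 ≤ Q * B))
    rw [Real.sqrt_sq (by positivity)]
    field_simp

end Interior

section Interior

variable {d : ℕ} {α : ℝ}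

/-- Smooth functions on `ℝ` that are constant on both sides of the unit interval. -/
structure Step (g : ℝ → ℝ) : Prop where
  smooth : ContDiff ℝ ∞ g
  left : ∃ c, ∀ s < 0, g s = c
  right : ∃ c, ∀ s, 1 < s → g s = c

namespace Step

variable {g : ℝ → ℝ}

lemma smoothTransition : Step Real.smoothTransition :=
  ⟨Real.smoothTransition.contDiff, ⟨0, fun _ hs => Real.smoothTransition.zero_of_nonpos hs.le⟩,
    ⟨1, fun _ hs => Real.smoothTransition.one_of_one_le hs.le⟩⟩

lemma deriv (hg : Step g) : Step (deriv g) := by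
  obtain ⟨h, ⟨c, hc⟩, ⟨c', hc'⟩⟩ := hg
  refine ⟨?_, ⟨0, fun s hs => ?_⟩, ⟨0, fun s hs => ?_⟩⟩
  · exact ((contDiff_infty_iff_deriv).1 h).2
  · have : g =ᶠ[𝓝 s] fun _ => c := Filter.mem_of_superset (Iio_mem_nhds hs) hc
    rw [this.deriv_eq, deriv_const]
  · have : g =ᶠ[𝓝 s] fun _ => c' := Filter.mem_of_superset (Ioi_mem_nhds hs) hc'
    rw [this.deriv_eq, deriv_const]

lemma bounded (hg : Step g) : ∃ M, ∀ s, |g s| ≤ M := by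
  obtain ⟨h, ⟨c, hc⟩, ⟨c', hc'⟩⟩ := hg
  obtain ⟨M, hM⟩ := (isCompact_Icc (a := (0 : ℝ)) (b := 1)).exists_bound_of_continuousOn
    h.continuous.continuousOn
  refine ⟨max M (max |c| |c'|), fun s => ?_⟩
  by_cases h0 : s < 0
  · rw [hc s h0]; exact (le_max_left _ _).trans (le_max_right _ _)
  by_cases h1 : 1 < s
  · rw [hc' s h1]; exact (le_max_right _ _).trans (le_max_right _ _)
  · exact (hM s ⟨not_lt.1 h0, not_lt.1 h1⟩).trans (le_max_left _ _)

lemma exists_lip (hg : Step g) : ∃ C, 0 ≤ C ∧ (∀ s, |g s| ≤ C) ∧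
    ∀ s s', |g s - g s'| ≤ C * |s - s'| := by
  obtain ⟨M, hM⟩ := hg.bounded
  obtain ⟨N, hN⟩ := hg.deriv.bounded
  refine ⟨max M N, ((abs_nonneg _).trans (hM 0)).trans (le_max_left _ _),
    fun s => (hM s).trans (le_max_left _ _), fun s s' => ?_⟩
  exact Convex.norm_image_sub_le_of_norm_deriv_le (s := Set.univ)
    (fun x _ => (hg.smooth.differentiable (by simp)) x)
    (fun x _ => (hN x).trans (le_max_right _ _)) convex_univ (Set.mem_univ s') (Set.mem_univ s)

end Step

lemma exists_cutBound {χ : TX d → ℝ} (hχ : BC χ) (hα : 0 < α) (hα1 : α ≤ 1 / 2) :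
    ∃ C, 1 ≤ C ∧ ∀ b, 1 ≤ b →
      CutBound α (C * b ^ 3) (fun z => Real.smoothTransition (b * χ z + -2)) := by
  obtain ⟨T0, hT0, hb0, hl0⟩ := Step.smoothTransition.exists_lip
  obtain ⟨T1, hT1, hb1, hl1⟩ := Step.smoothTransition.deriv.exists_lip
  obtain ⟨T2, hT2, hb2, hl2⟩ := Step.smoothTransition.deriv.deriv.exists_lip
  obtain ⟨X, hX⟩ := hχ.exists_HB hα hα1
  obtain ⟨Xt, hXt⟩ := (hχ.deriv et).exists_HB hα hα1
  choose Xx hXx using fun i => (hχ.deriv (ex i)).exists_HB hα hα1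
  choose Xxx hXxx using fun i j => ((hχ.deriv (ex j)).deriv (ex i)).exists_HB hα hα1
  obtain ⟨Y, hY1, hYX, hYt, hYx, hYxx⟩ : ∃ Y, 1 ≤ Y ∧ X ≤ Y ∧ Xt ≤ Y ∧ (∀ i, Xx i ≤ Y) ∧
      ∀ i j, Xxx i j ≤ Y := by
    have h1 := hX.nonneg
    have h2 := hXt.nonneg
    have h3 := fun i => (hXx i).nonneg
    have h4 := fun i j => (hXxx i j).nonneg
    have h3s : 0 ≤ ∑ i, Xx i := Finset.sum_nonneg fun i _ => h3 i
    have h4s : 0 ≤ ∑ i, ∑ j, Xxx i j := Finset.sum_nonneg fun i _ => Finset.sum_nonneg fun j _ => h4 i j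
    refine ⟨1 + X + Xt + ∑ i, Xx i + ∑ i, ∑ j, Xxx i j, by linarith, by linarith, by linarith,
      fun i => ?_, fun i j => ?_⟩
    · have := Finset.single_le_sum (f := Xx) (fun i _ => h3 i) (Finset.mem_univ i)
      linarith
    · have e1 := Finset.single_le_sum (f := fun i => ∑ j, Xxx i j)
        (fun i _ => Finset.sum_nonneg fun j _ => h4 i j) (Finset.mem_univ i)
      have e2 := Finset.single_le_sum (f := Xxx i) (fun j _ => h4 i j) (Finset.mem_univ j)
      linarith
  set T := 1 + T0 + T1 + T2
  refine ⟨T * (8 * Y * Y * (1 + Y)), one_le_mul_of_one_le_of_one_le (by linarith)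
    (by nlinarith [mul_nonneg (show 0 ≤ Y - 1 by linarith) (show 0 ≤ Y by linarith)]),
    fun b hb => ?_⟩
  have hb00 : 0 ≤ b := by linarith
  have hTT : 0 ≤ T := by linarith
  have hYY : 0 ≤ Y := by linarith
  set θ := Real.smoothTransition
  have hθ : ContDiff ℝ ∞ θ := Step.smoothTransition.smooth
  have hθ1 : ContDiff ℝ ∞ (deriv θ) := Step.smoothTransition.deriv.smooth
  have hc : ∀ z, HasFDerivAt (fun z => b * χ z + -2) (b • fderiv ℝ χ z) z := fun z =>
    (((hχ.smooth.differentiable (by simp)) z).hasFDerivAt.const_mul b).add_const _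
  have d1 : ∀ z v, fderiv ℝ (fun z => θ (b * χ z + -2)) z v =
      deriv θ (b * χ z + -2) * (b * fderiv ℝ χ z v) := fun z v => by
    have := (((hθ.differentiable (by simp)) _).hasDerivAt.comp_hasFDerivAt z (hc z)).fderiv
    simp only [Function.comp_def] at this
    rw [this]
    simp
  have d2 : ∀ i j z, fderiv ℝ (fun w => fderiv ℝ (fun z => θ (b * χ z + -2)) w (ex j)) z (ex i) =
      (deriv (deriv θ) (b * χ z + -2) * (b * fderiv ℝ χ z (ex i))) * (b * fderiv ℝ χ z (ex j)) +
      deriv θ (b * χ z + -2) * (b * fderiv ℝ (fun w => fderiv ℝ χ w (ex j)) z (ex i)) :=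
    fun i j z => by
    simp only [d1]
    have e1 := (((hθ1.differentiable (by simp)) _).hasDerivAt.comp_hasFDerivAt z (hc z))
    have e2 := ((((hχ.deriv (ex j)).smooth.differentiable (by simp)) z).hasFDerivAt.const_mul b)
    have := (e1.mul e2).fderiv
    simp only [Function.comp_def, Pi.mul_def] at this
    rw [this]
    simp
    ring
  have g0 := (hX.mono hYX).comp_lip hb0 hl0 hθ.continuous hb00 (-2)
  have g1 := (hX.mono hYX).comp_lip hb1 hl1 hθ1.continuous hb00 (-2)
  have g2 := (hX.mono hYX).comp_lip hb2 hl2 Step.smoothTransition.deriv.deriv.smooth.continuous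
    hb00 (-2)
  have hbY : 1 + b * Y ≤ b * (1 + Y) := by nlinarith
  have k1 : b ≤ b ^ 3 := le_self_pow₀ hb (by norm_num)
  have k2 : b ^ 2 ≤ b ^ 3 := pow_le_pow_right₀ hb (by norm_num)
  have n0 : T0 * (1 + b * Y) ≤ T * (b * (1 + Y)) := by gcongr; linarith
  have n1 : T1 * (1 + b * Y) ≤ T * (b * (1 + Y)) := by gcongr; linarith
  have n2 : T2 * (1 + b * Y) ≤ T * (b * (1 + Y)) := by gcongr; linarith
  have fin1 : 2 * (T * (b * (1 + Y))) * (|b| * Y) ≤ T * (8 * Y * Y * (1 + Y)) * b ^ 3 := by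
    rw [abs_of_nonneg hb00]
    calc _ = T * (2 * 1 * Y * (1 + Y)) * b ^ 2 := by ring
      _ ≤ _ := by gcongr; norm_num
  refine ⟨(hχ.comp (θ := fun s => θ (b * s + -2)) (hθ.comp (by fun_prop))), fun z => ?_, g0.mono ?_, ?_,
    fun i => ?_,
    fun i j => ?_⟩
  · rw [abs_of_nonneg (Real.smoothTransition.nonneg _)]
    exact Real.smoothTransition.le_one _
  · refine n0.trans ?_
    calc _ = T * (1 * 1 * 1 * (1 + Y)) * b := by ring
      _ ≤ _ := by gcongr; norm_num
  · rw [funext fun z => d1 z et]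
    exact ((g1.mono n1).mul ((hXt.mono hYt).const_mul b)).mono fin1
  · rw [funext fun z => d1 z (ex i)]
    exact ((g1.mono n1).mul (((hXx i).mono (hYx i)).const_mul b)).mono fin1
  · rw [funext (d2 i j)]
    refine ((((g2.mono n2).mul (((hXx i).mono (hYx i)).const_mul b)).mul
      (((hXx j).mono (hYx j)).const_mul b)).add ((g1.mono n1).mul
      (((hXxx i j).mono (hYxx i j)).const_mul b))).mono ?_
    rw [abs_of_nonneg hb00]
    calc _ = T * (4 * Y * Y * (1 + Y)) * b ^ 3 + T * (2 * 1 * Y * (1 + Y)) * b ^ 2 := by ring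
      _ ≤ T * (4 * Y * Y * (1 + Y)) * b ^ 3 + T * (4 * Y * Y * (1 + Y)) * b ^ 3 := by
        gcongr; norm_num
      _ = _ := by ring

end Interior

section Interior

variable {d : ℕ} {α : ℝ}

lemma HB.of_lineDeriv (hα : 0 < α) (hα1 : α ≤ 1 / 2) {u : TX d → ℝ}
    {ux : Fin d → TX d → ℝ} {R : ℝ} (hR : ∀ z, R < ‖z‖ → u z = 0 ∧ ∀ i, ux i z = 0)
    (hu : Continuous u) (hc : ∀ i, Continuous (ux i))
    (hd : ∀ i z, HasLineDerivAt ℝ u (ux i z) z (ex i)) : ∃ X, HB α X u := by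
  obtain ⟨M, hM⟩ := exists_norm_le_of_const_out (c := (0 : ℝ)) hu fun z hz => (hR z hz).1
  choose N hN using fun i => exists_norm_le_of_const_out (c := (0 : ℝ)) (hc i)
    fun z hz => (hR z hz).2 i
  have hN0 : ∀ i, 0 ≤ N i := fun i => (norm_nonneg _).trans (hN i 0)
  refine ⟨_, HB.of_lip hα hα1 one_pos le_rfl hu hM
    (space_lip_of_lineDeriv (M := ∑ i, N i) (fun i => (hc i).continuousOn) (fun i z _ => hd i z)
    fun i z => (hN i z).trans (Finset.single_le_sum (fun i _ => hN0 i) (Finset.mem_univ i)))⟩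

/-- Interior estimate: spatial derivatives of solutions are controlled by their size. -/
theorem interior_estimate {K MA r : ℝ} {A : TX d → Fin d → Fin d → ℝ} (hα : 0 < α)
    (hα1 : α ≤ 1 / 2) (hpos : ∀ z, SPSD (A z)) (hA : ∀ i j, HB α MA (fun z => A z i j))
    (hS : ∀ l, 1 ≤ l → ∃ S Sx Sxx, IsSolver α l K A S Sx Sxx) (z₀ : TX d) (hr : 0 < r) :
    ∃ C : ℝ, ∀ v vt vx vxx, C12 (Metric.ball z₀ r) v vt vx vxx → ∀ m, 0 ≤ m →
    (∀ z ∈ Metric.ball z₀ r, |v z| ≤ m) →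
    (∀ z ∈ Metric.ball z₀ r, vt z = 1 / 2 * ∑ i, ∑ j, A z i j * vxx i j z) →
    ∀ z ∈ Metric.ball z₀ (r / 4), (∀ i, |vx i z| ≤ C * m) ∧ ∀ i j, |vxx i j z| ≤ C * m := by
  have hK : 0 ≤ K := by
    obtain ⟨S, Sx, Sxx, h⟩ := hS 1 le_rfl
    have := h.bS.nonneg
    simpa using this
  obtain ⟨C, Q, hC, hQ, hstep⟩ := interior_step hα hα1 hpos hA hK hS
    (show (0 : ℝ) < 1 / 8192 by norm_num)
  let χ : ContDiffBump z₀ := ⟨r / 4, r / 2, by positivity, by linarith⟩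
  let χ' : ContDiffBump z₀ := ⟨5 * r / 8, 3 * r / 4, by positivity, by linarith⟩
  have hχ : BC χ := BC.of_hasCompactSupport χ.contDiff χ.hasCompactSupport
  have hχ' : BC χ' := BC.of_hasCompactSupport χ'.contDiff χ'.hasCompactSupport
  obtain ⟨Cφ, hCφ, hcut⟩ := exists_cutBound hχ hα hα1
  set θ := Real.smoothTransition
  set b : ℕ → ℝ := fun k => 2 ^ (k + 2) with hbdef
  have hb1 : ∀ k, 1 ≤ b k := fun k => one_le_pow₀ (by norm_num)
  set φ : ℕ → TX d → ℝ := fun k z => θ (b k * χ z + -2) with hφdef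
  have hφ : ∀ k, CutBound α (Cφ * b k ^ 3) (φ k) := fun k => hcut _ (hb1 k)
  have hsub : ∀ k, tsupport (φ k) ⊆ Metric.closedBall z₀ (r / 2) := fun k => by
    have h : tsupport (χ : TX d → ℝ) = Metric.closedBall z₀ (r / 2) := χ.tsupport_eq
    rw [← h]
    refine closure_mono fun z hz hz' => hz ?_
    simp only [hφdef, hz', mul_zero, zero_add]
    exact Real.smoothTransition.zero_of_nonpos (by norm_num)
  have hballs : Metric.closedBall z₀ (r / 2) ⊆ Metric.ball z₀ r :=
    Metric.closedBall_subset_ball (by linarith)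
  have hnext : ∀ k, ∀ z ∈ tsupport (φ k), φ (k + 1) =ᶠ[𝓝 z] fun _ => 1 := fun k z hz => by
    have hcl : tsupport (φ k) ⊆ {z | 2 ≤ b k * χ z} := by
      refine closure_minimal (fun z hz => ?_)
        (isClosed_le continuous_const (continuous_const.mul χ.continuous))
      by_contra hlt
      exact hz (Real.smoothTransition.zero_of_nonpos (by
        have : ¬ 2 ≤ b k * χ z := hlt
        linarith))
    have h2 : 2 ≤ b k * χ z := hcl hz
    have hbk : ∀ z, b (k + 1) * χ z = 2 * (b k * χ z) := fun z => by
      simp only [hbdef, pow_succ]; ring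
    have ho : IsOpen {z | 3 < b (k + 1) * χ z} :=
      isOpen_lt continuous_const (continuous_const.mul χ.continuous)
    filter_upwards [ho.mem_nhds (show 3 < b (k + 1) * χ z by rw [hbk]; linarith)] with w hw
    refine Real.smoothTransition.one_of_one_le ?_
    have : 3 < b (k + 1) * χ w := hw
    linarith
  have hnext' : ∀ k, ∀ z ∈ tsupport (φ k), χ' =ᶠ[𝓝 z] fun _ => 1 := fun k z hz => by
    refine χ'.eventuallyEq_one_of_mem_ball ?_
    have := Metric.mem_closedBall.1 (hsub k hz)
    rw [Metric.mem_ball]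
    show dist z z₀ < 5 * r / 8
    linarith
  set C' := C * (64 * Cφ) ^ 4
  have hpow : ∀ k : ℕ, C * (Cφ * b k ^ 3) ^ 4 = C' * 4096 ^ k := fun k => by
    have h1 : b k = 4 * 2 ^ k := by simp only [hbdef]; ring
    have h2 : (4096 : ℝ) ^ k = (2 ^ k) ^ 12 := by
      rw [← pow_mul, mul_comm, pow_mul]; norm_num
    rw [h1, h2]; ring
  have hCB : ∀ k, 1 ≤ Cφ * b k ^ 3 := fun k =>
    one_le_mul_of_one_le_of_one_le hCφ (one_le_pow₀ (hb1 k))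
  refine ⟨max (2 * C') (Q * (Cφ * b 0 ^ 3) * (2 * C')), fun v vt vx vxx hv m hm hvm heq => ?_⟩
  have hC' : 0 ≤ C' := by positivity
  have hU : IsOpen (Metric.ball z₀ r) := Metric.isOpen_ball
  have step : ∀ k M, 0 ≤ M →
      (∀ i, HB α M (fun z => fderiv ℝ (φ (k + 1)) z (ex i) * v z + φ (k + 1) z * vx i z)) →
      (∀ i, HB α (C' * 4096 ^ k * m + 1 / 8192 * M)
        (fun z => fderiv ℝ (φ k) z (ex i) * v z + φ k z * vx i z)) ∧
      ∀ i j, HB α (Q * (Cφ * b k ^ 3) * (C' * 4096 ^ k * m + 1 / 8192 * M)) (fun z =>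
      (fderiv ℝ (fun w => fderiv ℝ (φ k) w (ex j)) z (ex i) * v z +
        fderiv ℝ (φ k) z (ex j) * vx i z) +
        (fderiv ℝ (φ k) z (ex i) * vx j z + φ k z * vxx i j z)) := fun k M hM h => by
    have := hstep _ (hCB k) (φ k) (φ (k + 1)) (hφ k) (hφ (k + 1)).bc (hφ (k + 1)).le_one
      _ hU ((hsub k).trans hballs) ((hsub (k + 1)).trans hballs) (hnext k) v vt vx vxx hv m hm hvm
      heq M hM h
    rwa [hpow] at this
  have hsχ' : tsupport (χ' : TX d → ℝ) ⊆ Metric.ball z₀ r := by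
    rw [χ'.tsupport_eq]
    exact Metric.closedBall_subset_ball (by show 3 * r / 4 < r; linarith)
  have hw := hχ'.c12_mul hU hsχ' hv
  obtain ⟨R, hR⟩ := χ'.hasCompactSupport.isBounded.exists_norm_le
  have hout : ∀ z, R < ‖z‖ → (χ' : TX d → ℝ) =ᶠ[𝓝 z] fun _ => 0 := fun z hz =>
    notMem_tsupport_iff_eventuallyEq.1 fun h => hz.not_ge (hR z h)
  obtain ⟨X, hX⟩ := HB.of_lineDeriv hα hα1 (R := R) (fun z hz => by
    have h := fderiv_eq_zero_of_eventually (hout z hz)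
    simp [(hout z hz).eq_of_nhds, h.1]) (continuousOn_univ.1 hw.cu)
    (fun i => continuousOn_univ.1 (hw.cx i)) (fun i z => hw.dx i z (Set.mem_univ z))
  choose Y hY using fun j => HB.of_lineDeriv hα hα1 (R := R) (fun z hz => by
    have h := fderiv_eq_zero_of_eventually (hout z hz)
    simp [(hout z hz).eq_of_nhds, h.1, h.2]) (continuousOn_univ.1 (hw.cx j))
    (fun i => continuousOn_univ.1 (hw.cxx i j)) (fun i z => hw.dxx i j z (Set.mem_univ z))
  have hX0 := hX.nonneg
  have hY0 := fun j => (hY j).nonneg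
  have hYs : 0 ≤ ∑ j, Y j := Finset.sum_nonneg fun j _ => hY0 j
  set Cv := 128 * Cφ * (X + ∑ j, Y j)
  have hCv : 0 ≤ Cv := by positivity
  have hinit : ∀ k i, HB α (Cv * 4096 ^ k)
      (fun z => fderiv ℝ (φ k) z (ex i) * v z + φ k z * vx i z) := fun k i => by
    have e : (fun z => fderiv ℝ (φ k) z (ex i) * v z + φ k z * vx i z) = fun z =>
        fderiv ℝ (φ k) z (ex i) * (χ' z * v z) +
        φ k z * (fderiv ℝ χ' z (ex i) * v z + χ' z * vx i z) := by
      funext z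
      by_cases hz : z ∈ tsupport (φ k)
      · have h := fderiv_eq_zero_of_eventually (hnext' k z hz)
        simp [(hnext' k z hz).eq_of_nhds, h.1]
      · have h0 : φ k =ᶠ[𝓝 z] fun _ => 0 := notMem_tsupport_iff_eventuallyEq.1 hz
        have h := fderiv_eq_zero_of_eventually h0
        simp [h0.eq_of_nhds, h.1]
    rw [e]
    refine ((((hφ k).bx i).mul hX).add ((hφ k).b.mul (hY i))).mono ?_
    have h1 : b k = 4 * 2 ^ k := by simp only [hbdef]; ring
    have h2 : b k ^ 3 ≤ 64 * 4096 ^ k := by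
      have : b k ^ 3 = 64 * 8 ^ k := by
        rw [h1, mul_pow, ← pow_mul, mul_comm k 3, pow_mul]; norm_num
      rw [this]; gcongr; norm_num
    have h3 : Y i ≤ ∑ j, Y j := Finset.single_le_sum (fun i _ => hY0 i) (Finset.mem_univ i)
    calc _ = 2 * Cφ * (X + Y i) * b k ^ 3 := by ring
      _ ≤ 2 * Cφ * (X + ∑ j, Y j) * (64 * 4096 ^ k) := by gcongr
      _ = _ := by ring
  have hiter : ∀ n k i, HB α (2 * C' * 4096 ^ k * m + Cv * 4096 ^ k * (1 / 2) ^ n)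
      (fun z => fderiv ℝ (φ k) z (ex i) * v z + φ k z * vx i z) := by
    intro n
    induction n with
    | zero => exact fun k i => (hinit k i).mono (by simp; positivity)
    | succ n ih =>
      intro k i
      refine ((step k _ (by positivity) (ih (k + 1))).1 i).mono (le_of_eq ?_)
      ring
  have hlim : ∀ k i, HB α (2 * C' * 4096 ^ k * m)
      (fun z => fderiv ℝ (φ k) z (ex i) * v z + φ k z * vx i z) := fun k i => by
    refine HB.of_tendsto (l := atTop)
      (f := fun n : ℕ => 2 * C' * 4096 ^ k * m + Cv * 4096 ^ k * (1 / 2) ^ n) ?_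
      fun n => hiter n k i
    have := ((tendsto_pow_atTop_nhds_zero_of_lt_one (r := (1 / 2 : ℝ)) (by norm_num)
      (by norm_num)).const_mul (Cv * 4096 ^ k)).const_add (2 * C' * 4096 ^ k * m)
    simpa using this
  intro z hz
  have hone : φ 0 =ᶠ[𝓝 z] fun _ => 1 := by
    filter_upwards [χ.eventuallyEq_one_of_mem_ball hz] with w hw
    refine Real.smoothTransition.one_of_one_le ?_
    rw [hw]; simp only [hbdef, Pi.one_apply]; norm_num
  have hd := fderiv_eq_zero_of_eventually hone
  refine ⟨fun i => ?_, fun i j => ?_⟩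
  · have := (hlim 0 i).bdd z
    simp only [hd.1, hone.eq_of_nhds, zero_mul, zero_add, one_mul, pow_zero, mul_one] at this
    exact this.trans (mul_le_mul_of_nonneg_right (le_max_left _ _) hm)
  · have := ((step 0 _ (by positivity) (hlim 1)).2 i j).bdd z
    simp only [hd.1, hd.2, hone.eq_of_nhds, zero_mul, zero_add, one_mul, add_zero] at this
    refine this.trans (le_trans (le_of_eq ?_) (mul_le_mul_of_nonneg_right (le_max_right _ _) hm))
    ring

end Interior

end Local

section Cauchy

open MeasureTheory ProbabilityTheory
open scoped ContDiff

variable {d : ℕ}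

/-- Partial derivative in time. -/
def Dt (v : TX d → ℝ) (z : TX d) : ℝ := lineDeriv ℝ v z et

/-- Partial derivatives in space. -/
def Dx (v : TX d → ℝ) (i : Fin d) (z : TX d) : ℝ := lineDeriv ℝ v z (ex i)

/-- Second partial derivatives in space. -/
def Dxx (v : TX d → ℝ) (i j : Fin d) (z : TX d) : ℝ := lineDeriv ℝ (Dx v j) z (ex i)

/-- Classical solutions of `∂ₜv = ½ ∑ A_ij ∂ᵢⱼv`. -/
structure IsSol (U : Set (TX d)) (A : TX d → Fin d → Fin d → ℝ) (v : TX d → ℝ) : Prop where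
  c12 : C12 U v (Dt v) (Dx v) (Dxx v)
  eq : ∀ z ∈ U, Dt v z = 1 / 2 * ∑ i, ∑ j, A z i j * Dxx v i j z

lemma C12.canonical {U : Set (TX d)} (hU : IsOpen U) {v vt : TX d → ℝ} {vx : Fin d → TX d → ℝ}
    {vxx : Fin d → Fin d → TX d → ℝ} (h : C12 U v vt vx vxx) :
    (∀ z ∈ U, Dt v z = vt z) ∧ (∀ i, ∀ z ∈ U, Dx v i z = vx i z) ∧
      ∀ i j, ∀ z ∈ U, Dxx v i j z = vxx i j z := by
  have hx : ∀ i, ∀ z ∈ U, Dx v i z = vx i z := fun i z hz => (h.dx i z hz).lineDeriv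
  refine ⟨fun z hz => (h.dt z hz).lineDeriv, hx, fun i j z hz => ?_⟩
  exact ((h.dxx i j z hz).congr_of_eventuallyEq
    (Filter.mem_of_superset (hU.mem_nhds hz) fun y hy => hx j y hy)).lineDeriv

lemma IsSol.of_C12 {U : Set (TX d)} (hU : IsOpen U) {A : TX d → Fin d → Fin d → ℝ}
    {v vt : TX d → ℝ} {vx : Fin d → TX d → ℝ}
    {vxx : Fin d → Fin d → TX d → ℝ} (h : C12 U v vt vx vxx)
    (heq : ∀ z ∈ U, vt z = 1 / 2 * ∑ i, ∑ j, A z i j * vxx i j z) : IsSol U A v := by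
  obtain ⟨h1, h2, h3⟩ := h.canonical hU
  refine ⟨h.congr hU (fun _ _ => rfl) h1 h2 h3, fun z hz => ?_⟩
  rw [h1 z hz, heq z hz]
  simp only [h3 _ _ z hz]

lemma IsSol.mono {U V : Set (TX d)} {A : TX d → Fin d → Fin d → ℝ} {v : TX d → ℝ}
    (h : IsSol U A v) (hVU : V ⊆ U) : IsSol V A v :=
  ⟨h.c12.mono hVU, fun z hz => h.eq z (hVU hz)⟩

lemma IsSol.congr_coeff {U : Set (TX d)} {A A' : TX d → Fin d → Fin d → ℝ} {v : TX d → ℝ}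
    (h : IsSol U A v) (hA : ∀ z ∈ U, A' z = A z) : IsSol U A' v :=
  ⟨h.c12, fun z hz => by rw [h.eq z hz, hA z hz]⟩

lemma IsSol.of_forall {U : Set (TX d)} {A : TX d → Fin d → Fin d → ℝ} {v : TX d → ℝ}
    (h : ∀ z ∈ U, ∃ W ∈ 𝓝 z, IsSol W A v) : IsSol U A v :=
  ⟨C12.of_forall fun z hz => let ⟨W, hW, hs⟩ := h z hz; ⟨W, hW, hs.c12⟩,
    fun z hz => let ⟨_, hW, hs⟩ := h z hz; hs.eq z (mem_of_mem_nhds hW)⟩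

lemma IsSol.sub {U : Set (TX d)} (hU : IsOpen U) {A : TX d → Fin d → Fin d → ℝ}
    {v w : TX d → ℝ} (h : IsSol U A v) (h' : IsSol U A w) : IsSol U A (fun z => v z - w z) := by
  refine IsSol.of_C12 hU (h.c12.sub h'.c12) fun z hz => ?_
  rw [h.eq z hz, h'.eq z hz]
  simp only [mul_sub, Finset.sum_sub_distrib]

lemma exists_uniform_limit {B : Set (TX d)} {g : ℕ → TX d → ℝ}
    (h : ∀ ε > 0, ∃ N, ∀ n ≥ N, ∀ k ≥ N, ∀ z ∈ B, |g n z - g k z| ≤ ε) :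
    ∃ G, TendstoUniformlyOn g G atTop B := by
  have hc : UniformCauchySeqOn g atTop B := by
    rw [Metric.uniformCauchySeqOn_iff]
    intro ε hε
    obtain ⟨N, hN⟩ := h (ε / 2) (by positivity)
    exact ⟨N, fun n hn k hk z hz => by
      rw [Real.dist_eq]; linarith [hN n hn k hk z hz]⟩
  have hp : ∀ z, ∃ l, z ∈ B → Tendsto (fun n => g n z) atTop (𝓝 l) := fun z => by
    by_cases hz : z ∈ B
    · obtain ⟨l, hl⟩ := cauchySeq_tendsto_of_complete (hc.cauchySeq hz)
      exact ⟨l, fun _ => hl⟩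
    · exact ⟨0, fun h => (hz h).elim⟩
  choose G hG using hp
  exact ⟨G, hc.tendstoUniformlyOn_of_tendsto hG⟩

/-- Locally uniform limits of classical solutions are classical solutions. -/
theorem IsSol.of_tendsto {U : Set (TX d)} (hU : IsOpen U) {A : TX d → Fin d → Fin d → ℝ}
    (hH : ∀ z ∈ U, HolderAt A z) (hpd : ∀ z ∈ U, SPD (A z)) {u : ℕ → TX d → ℝ} {v : TX d → ℝ}
    (hsol : ∀ z ∈ U, ∃ W ∈ 𝓝 z, ∀ᶠ n in atTop, IsSol W A (u n))
    (hlim : TendstoLocallyUniformlyOn u v atTop U) : IsSol U A v := by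
  refine IsSol.of_forall fun z₀ hz₀ => ?_
  obtain ⟨r₁, hr₁, β, hβ, C, hC, hAr₁⟩ := hH z₀ hz₀
  obtain ⟨W, hW, hWs⟩ := hsol z₀ hz₀
  obtain ⟨N₀, hN₀⟩ := eventually_atTop.1 hWs
  obtain ⟨r, hr, hball⟩ := Metric.nhds_basis_closedBall.mem_iff.1
    (Filter.inter_mem hW (Filter.inter_mem (hU.mem_nhds hz₀) (Metric.closedBall_mem_nhds z₀ hr₁)))
  have hAr : ∀ i j, ∀ z ∈ Metric.closedBall z₀ r, ∀ w ∈ Metric.closedBall z₀ r,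
      |A z i j - A w i j| ≤ C * dist z w ^ β := fun i j z hz w hw =>
    hAr₁ i j z (hball hz).2.2 w (hball hw).2.2
  have hα : 0 < min (β / 2) (1 / 2) := lt_min (by positivity) (by norm_num)
  set α := min (β / 2) (1 / 2)
  have hα2 : α ≤ 1 / 2 := min_le_right _ _
  have hαβ : α < β := (min_le_left _ _).trans_lt (by linarith)
  obtain ⟨ρ, hρ, hρr, K, ⟨MA, hMA⟩, hS⟩ := exists_local_solver hα (by linarith) hαβ hr hC
    (hpd z₀ hz₀) hAr
  have hρsub := Metric.closedBall_subset_closedBall (x := z₀) hρr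
  obtain ⟨C₁, hC₁⟩ := interior_estimate hα hα2 (fun z => (hpd _ (hball (hρsub
    (boxProj.mem z₀ hρ.le z))).2.1).spsd) hMA hS z₀ hρ
  have hbb : Metric.ball z₀ ρ ⊆ Metric.closedBall z₀ r :=
    Metric.ball_subset_closedBall.trans hρsub
  have hb4 : Metric.ball z₀ (ρ / 4) ⊆ Metric.ball z₀ ρ := Metric.ball_subset_ball (by linarith)
  have hAb : ∀ z ∈ Metric.ball z₀ ρ, A (boxProj z₀ ρ z) = A z := fun z hz => by
    rw [boxProj.eq_self _ (Metric.ball_subset_closedBall hz)]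
  have hun : TendstoUniformlyOn u v atTop (Metric.closedBall z₀ r) :=
    (tendstoLocallyUniformlyOn_iff_forall_isCompact hU).1 hlim _ (fun z hz => (hball hz).2.1)
      (isCompact_closedBall z₀ r)
  have hn : ∀ n ≥ N₀, IsSol (Metric.ball z₀ ρ) A (u n) := fun n hn =>
    (hN₀ n hn).mono fun z hz => (hball (hbb hz)).1
  have hcau : ∀ ε > 0, ∃ N ≥ N₀, ∀ n ≥ N, ∀ k ≥ N, ∀ z ∈ Metric.ball z₀ (ρ / 4),
      (∀ i, |Dx (u n) i z - Dx (u k) i z| ≤ ε) ∧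
      ∀ i j, |Dxx (u n) i j z - Dxx (u k) i j z| ≤ ε := fun ε hε => by
    obtain ⟨N, hN⟩ := eventually_atTop.1 (Metric.tendstoUniformlyOn_iff.1 hun
      (ε / (2 * (|C₁| + 1))) (by positivity))
    refine ⟨max N N₀, le_max_right _ _, fun n hnN k hkN z hz => ?_⟩
    have s1 := hn n ((le_max_right _ _).trans hnN)
    have s2 := hn k ((le_max_right _ _).trans hkN)
    have h := hC₁ _ _ _ _ (s1.c12.sub s2.c12) (ε / (|C₁| + 1)) (by positivity)
      (fun w hw => ?_) (fun w hw => ?_) z hz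
    · have hle : C₁ * (ε / (|C₁| + 1)) ≤ ε := by
        rw [mul_div_assoc', div_le_iff₀ (by positivity)]
        nlinarith [le_abs_self C₁]
      exact ⟨fun i => (h.1 i).trans hle, fun i j => (h.2 i j).trans hle⟩
    · have h1 := hN n ((le_max_left _ _).trans hnN) w (hbb hw)
      have h2 := hN k ((le_max_left _ _).trans hkN) w (hbb hw)
      have h3 := dist_triangle_left (u n w) (u k w) (v w)
      rw [Real.dist_eq (u n w)] at h3
      have h4 : ε / (|C₁| + 1) = ε / (2 * (|C₁| + 1)) + ε / (2 * (|C₁| + 1)) := by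
        field_simp; ring
      rw [h4]; linarith
    · rw [s1.eq w hw, s2.eq w hw, hAb w hw]
      simp only [mul_sub, Finset.sum_sub_distrib]
  choose gx hgx using fun i => exists_uniform_limit (B := Metric.ball z₀ (ρ / 4))
    (g := fun n => Dx (u n) i) fun ε hε => by
      obtain ⟨N, -, hN⟩ := hcau ε hε
      exact ⟨N, fun n hn k hk z hz => (hN n hn k hk z hz).1 i⟩
  choose gxx hgxx using fun i j => exists_uniform_limit (B := Metric.ball z₀ (ρ / 4))
    (g := fun n => Dxx (u n) i j) fun ε hε => by
      obtain ⟨N, -, hN⟩ := hcau ε hε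
      exact ⟨N, fun n hn k hk z hz => (hN n hn k hk z hz).2 i j⟩
  obtain ⟨gt, hgt⟩ := exists_uniform_limit (B := Metric.ball z₀ (ρ / 4))
    (g := fun n => Dt (u n)) fun ε hε => by
      obtain ⟨N, hN0, hN⟩ := hcau (ε / (d * d * |MA| + 1)) (by positivity)
      refine ⟨N, fun n hnN k hkN z hz => ?_⟩
      rw [(hn n (hN0.trans hnN)).eq z (hb4 hz), (hn k (hN0.trans hkN)).eq z (hb4 hz), ← mul_sub]
      simp only [← Finset.sum_sub_distrib, ← mul_sub]
      rw [abs_mul, abs_of_pos (show (0 : ℝ) < 1 / 2 by norm_num)]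
      have h1 : |∑ i, ∑ j, A z i j * (Dxx (u n) i j z - Dxx (u k) i j z)| ≤
          ∑ _i : Fin d, ∑ _j : Fin d, |MA| * (ε / (d * d * |MA| + 1)) := by
        refine (Finset.abs_sum_le_sum_abs _ _).trans (Finset.sum_le_sum fun i _ => ?_)
        refine (Finset.abs_sum_le_sum_abs _ _).trans (Finset.sum_le_sum fun j _ => ?_)
        rw [abs_mul]
        have h2 := (hMA i j).bdd z
        rw [hAb z (hb4 hz)] at h2
        exact mul_le_mul (h2.trans (le_abs_self _)) ((hN n hnN k hkN z hz).2 i j) (abs_nonneg _)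
          (abs_nonneg _)
      simp only [Finset.sum_const, Finset.card_univ, Fintype.card_fin, nsmul_eq_mul] at h1
      have h3 : (d : ℝ) * (d * (|MA| * (ε / (d * d * |MA| + 1)))) ≤ ε := by
        rw [mul_div_assoc', mul_div_assoc', mul_div_assoc', div_le_iff₀ (by positivity)]
        nlinarith
      have h4 : 0 ≤ |∑ i, ∑ j, A z i j * (Dxx (u n) i j z - Dxx (u k) i j z)| := abs_nonneg _
      linarith
  refine ⟨Metric.ball z₀ (ρ / 4), Metric.ball_mem_nhds _ (by positivity), ?_⟩
  have hshift := tendsto_add_atTop_nat N₀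
  have htu : ∀ {g : ℕ → TX d → ℝ} {G : TX d → ℝ},
      TendstoUniformlyOn g G atTop (Metric.ball z₀ (ρ / 4)) →
      TendstoLocallyUniformlyOn (fun n => g (n + N₀)) G atTop (Metric.ball z₀ (ρ / 4)) :=
    fun h => TendstoUniformlyOn.tendstoLocallyUniformlyOn fun s hs => hshift.eventually (h s hs)
  have hC12 : C12 (Metric.ball z₀ (ρ / 4)) v gt gx gxx :=
    C12.of_tendsto Metric.isOpen_ball
      (fun n => ((hn (n + N₀) (Nat.le_add_left _ _)).mono hb4).c12)
      (htu (hun.mono (hb4.trans hbb))) (htu hgt) (fun i => htu (hgx i)) fun i j => htu (hgxx i j)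
  refine IsSol.of_C12 Metric.isOpen_ball hC12 fun z hz => ?_
  have l1 := hgt.tendsto_at hz
  have l2 : Tendsto (fun n => 1 / 2 * ∑ i, ∑ j, A z i j * Dxx (u n) i j z) atTop
      (𝓝 (1 / 2 * ∑ i, ∑ j, A z i j * gxx i j z)) :=
    (tendsto_finsetSum _ fun i _ => tendsto_finsetSum _ fun j _ =>
      ((hgxx i j).tendsto_at hz).const_mul _).const_mul _
  refine tendsto_nhds_unique l1 (l2.congr' ?_)
  filter_upwards [eventually_ge_atTop N₀] with n hnN
  exact ((hn n hnN).eq z (hb4 hz)).symm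

lemma C12.of_time {b b' : ℝ → ℝ} (hb : ∀ s, HasDerivAt b (b' s) s) (hb' : Continuous b') :
    C12 (d := d) univ (fun z => b z.1) (fun z => b' z.1) (fun _ _ => 0) (fun _ _ _ => 0) := by
  have hc : Continuous b := continuous_iff_continuousAt.2 fun s => (hb s).continuousAt
  refine ⟨by fun_prop, by fun_prop, fun _ => continuousOn_const, fun _ _ => continuousOn_const,
    fun z _ => ?_, fun i z _ => ?_, fun i j z _ => ?_⟩
  · simp only [HasLineDerivAt, et, Prod.fst_add, Prod.smul_fst, smul_eq_mul, mul_one]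
    exact HasDerivAt.comp_const_add z.1 0 (by simpa using hb z.1)
  · simpa [HasLineDerivAt, ex] using hasDerivAt_const (0 : ℝ) (b z.1)
  · simpa [HasLineDerivAt] using hasDerivAt_const (0 : ℝ) (0 : ℝ)

lemma ContDiff.pd1 {f : (Fin d → ℝ) → ℝ} (hf : ContDiff ℝ ∞ f) (i : Fin d) :
    ContDiff ℝ ∞ (pd1 f i) :=
  (hf.fderiv_right (m := ∞) (by simp)).clm_apply contDiff_const

lemma ContDiff.pd2 {f : (Fin d → ℝ) → ℝ} (hf : ContDiff ℝ ∞ f) (i j : Fin d) :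
    ContDiff ℝ ∞ (pd2 f i j) := (hf.pd1 j).pd1 i

lemma HasCompactSupport.pd1 {f : (Fin d → ℝ) → ℝ} (hf : HasCompactSupport f) (i : Fin d) :
    HasCompactSupport (pd1 f i) := hf.fderiv_apply (𝕜 := ℝ) _

lemma HasCompactSupport.pd2 {f : (Fin d → ℝ) → ℝ} (hf : HasCompactSupport f) (i j : Fin d) :
    HasCompactSupport (pd2 f i j) := (hf.pd1 j).pd1 i

lemma hasLineDerivAt_snd {f : (Fin d → ℝ) → ℝ} (hf : Differentiable ℝ f) (i : Fin d) (z : TX d) :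
    HasLineDerivAt ℝ (fun z : TX d => f z.2) (pd1 f i z.2) z (ex i) := by
  have := (hf z.2).hasFDerivAt.hasLineDerivAt (Pi.single i 1)
  exact this

lemma C12.of_space {f : (Fin d → ℝ) → ℝ} (hf : ContDiff ℝ ∞ f) :
    C12 univ (fun z => f z.2) (fun _ => 0) (fun i z => pd1 f i z.2) (fun i j z => pd2 f i j z.2) := by
  refine ⟨(hf.continuous.comp continuous_snd).continuousOn, continuousOn_const,
    fun i => ((hf.pd1 i).continuous.comp continuous_snd).continuousOn,
    fun i j => ((hf.pd2 i j).continuous.comp continuous_snd).continuousOn, fun z _ => ?_,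
    fun i z _ => hasLineDerivAt_snd (hf.differentiable (by simp)) i z,
    fun i j z _ => hasLineDerivAt_snd ((hf.pd1 j).differentiable (by simp)) i z⟩
  simpa [HasLineDerivAt, et] using hasDerivAt_const (0 : ℝ) (f z.2)

lemma HB.of_time {c : ℝ → ℝ} {α M : ℝ} (hc : Continuous c) (hM : ∀ s, |c s| ≤ M) :
    HB (d := d) α M (fun z => c z.1) := by
  have hM0 : 0 ≤ M := (abs_nonneg _).trans (hM 0)
  exact ⟨by fun_prop, fun z => hM _, fun t x y => by simp; positivity⟩

lemma HB.exists_of_space {f : (Fin d → ℝ) → ℝ} {α : ℝ} (hα : 0 < α) (hα1 : α ≤ 1 / 2)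
    (hf : ContDiff ℝ ∞ f) (hc : HasCompactSupport f) : ∃ M, HB α M (fun z : TX d => f z.2) := by
  obtain ⟨M, hM⟩ := hc.exists_bound_of_continuous hf.continuous
  obtain ⟨N, hN⟩ := hf.lipschitzWith_of_hasCompactSupport hc (by simp)
  exact ⟨_, HB.of_lip (N := N) hα hα1 one_pos le_rfl (hf.continuous.comp continuous_snd)
    (fun z => hM z.2) fun t x y => by simpa [dist_eq_norm] using hN.dist_le_mul x y⟩

/-- The Cauchy problem with smooth compactly supported data, with the source switched off for
small times. -/
theorem exists_approx_solution {A : TX d → Fin d → Fin d → ℝ} {K : Set (TX d)} (hK : IsCompact K)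
    (hA : ∀ z, HolderAt A z) (hpd : ∀ z, SPD (A z))
    (hout : ∀ z ∉ K, A z = fun i j => if i = j then 1 else 0) {f : (Fin d → ℝ) → ℝ}
    (hf : ContDiff ℝ ∞ f) (hfc : HasCompactSupport f) {C₀ : ℝ}
    (hC₀ : ∀ z, |1 / 2 * ∑ i, ∑ j, A z i j * pd2 f i j z.2| ≤ C₀) {ε : ℝ} (hε : 0 < ε) :
    ∃ v, IsSol {z | ε < z.1} A v ∧ Continuous v ∧ ∀ z : TX d, 0 ≤ z.1 → |v z - f z.2| ≤ C₀ * z.1 := by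
  obtain ⟨α, l, hα, hα1, hl, ⟨MA, hMA⟩, hS⟩ := exists_global_solver hK hA hpd hout
  have hC₀0 : 0 ≤ C₀ := (abs_nonneg _).trans (hC₀ 0)
  set θ : ℝ → ℝ := fun s => Real.smoothTransition (s / ε)
  have hθc : Continuous θ := Real.smoothTransition.continuous.comp (continuous_id.div_const ε)
  have hθ0 : ∀ s ≤ 0, θ s = 0 := fun s hs =>
    Real.smoothTransition.zero_of_nonpos (div_nonpos_of_nonpos_of_nonneg hs hε.le)
  have hθ1 : ∀ s, ε < s → θ s = 1 := fun s hs =>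
    Real.smoothTransition.one_of_one_le ((one_le_div hε).2 hs.le)
  have hθn : ∀ s, 0 ≤ θ s := fun s => Real.smoothTransition.nonneg _
  have hθl : ∀ s, θ s ≤ 1 := fun s => Real.smoothTransition.le_one _
  set G : TX d → ℝ := fun z => 1 / 2 * ∑ i, ∑ j, A z i j * pd2 f i j z.2
  choose M₂ hM₂ using fun i j => HB.exists_of_space hα hα1 (hf.pd2 i j) (hfc.pd2 i j)
  have hG := (HB.sum Finset.univ fun i _ => HB.sum Finset.univ fun j _ =>
    (hMA i j).mul (hM₂ i j)).const_mul (1 / 2)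
  have hτ : HB (d := d) α 1 (fun z => Real.exp (-l * max z.1 0) * θ z.1) := by
    refine HB.of_time (c := fun s => Real.exp (-l * max s 0) * θ s) (by fun_prop) fun s => ?_
    have h1 : Real.exp (-l * max s 0) ≤ 1 := by
      rw [Real.exp_le_one_iff]; nlinarith [le_max_right s 0]
    rw [abs_of_nonneg (mul_nonneg (Real.exp_pos _).le (hθn s))]
    nlinarith [hθn s, hθl s, Real.exp_pos (-l * max s 0)]
  obtain ⟨u, ut, ux, uxx, hu, ⟨N, hN⟩, heq⟩ := hS _ _ (hτ.mul hG)
  set b : ℝ → ℝ := fun s => Real.exp (-l * s) * ∫ x in (0 : ℝ)..s, θ x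
  have hI : ∀ s, HasDerivAt (fun s => ∫ x in (0 : ℝ)..s, θ x) (θ s) s := fun s =>
    intervalIntegral.integral_hasDerivAt_right (hθc.intervalIntegrable _ _)
      (hθc.stronglyMeasurableAtFilter _ _) hθc.continuousAt
  have hE : ∀ c s : ℝ, HasDerivAt (fun s => Real.exp (c * s)) (c * Real.exp (c * s)) s := fun c s => by
    have := ((hasDerivAt_id s).const_mul c).exp
    simpa [mul_comm] using this
  have hbd : ∀ s, HasDerivAt b (-l * b s + Real.exp (-l * s) * θ s) s := fun s => by
    refine ((hE (-l) s).mul (hI s)).congr_deriv ?_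
    change _ = -l * (Real.exp (-l * s) * ∫ x in (0 : ℝ)..s, θ x) + _
    ring
  have hbc : Continuous b := continuous_iff_continuousAt.2 fun s => (hbd s).continuousAt
  have hI0 : ∀ s ≤ 0, ∫ x in (0 : ℝ)..s, θ x = 0 := fun s hs => by
    rw [intervalIntegral.integral_symm, intervalIntegral.integral_congr (g := fun _ => 0),
      intervalIntegral.integral_zero, neg_zero]
    intro x hx
    rw [uIcc_of_le hs] at hx
    exact hθ0 x hx.2
  have hI1 : ∀ s, 0 ≤ s → 0 ≤ ∫ x in (0 : ℝ)..s, θ x := fun s hs =>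
    intervalIntegral.integral_nonneg hs fun x _ => hθn x
  have hI2 : ∀ s, 0 ≤ s → ∫ x in (0 : ℝ)..s, θ x ≤ s := fun s hs => by
    have := intervalIntegral.integral_mono_on hs (hθc.intervalIntegrable _ _)
      (continuous_const.intervalIntegrable (μ := volume) 0 s) fun x _ => hθl x
    simpa using this
  have hb0 : ∀ s, 0 ≤ b s := fun s => by
    refine mul_nonneg (Real.exp_pos _).le ?_
    rcases le_total s 0 with h | h
    · rw [hI0 s h]
    · exact hI1 s h
  have hτb : ∀ z : TX d, |Real.exp (-l * max z.1 0) * θ z.1 * G z| ≤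
      C₀ * (Real.exp (-l * z.1) * θ z.1) := fun z => by
    rcases le_total z.1 0 with h | h
    · rw [hθ0 _ h]; simp
    · rw [max_eq_left h, abs_mul, abs_of_nonneg (mul_nonneg (Real.exp_pos _).le (hθn _)), mul_comm]
      exact mul_le_mul_of_nonneg_right (hC₀ z) (mul_nonneg (Real.exp_pos _).le (hθn _))
  have hbC : C12 (d := d) univ _ _ _ _ := (C12.of_time hbd (by fun_prop)).const_mul C₀
  have key : ∀ σ : ℝ, |σ| ≤ 1 → ∀ z, σ * u z ≤ C₀ * b z.1 := fun σ hσ z => by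
    have hsp : ∀ z, SPSD (A z) := fun z => (hpd z).spsd
    have h := nonpos_of_subsolution (S := z.1) (N := N) hsp (fun z i j => (hMA i j).bdd z)
      (one_pos.trans_le hl) ((hu.const_mul σ).sub hbC) (fun w _ => ?_) (fun w _ _ => ?_) z le_rfl
    · linarith
    · have h1 := mul_nonneg hC₀0 (hb0 w.1)
      have h2 : σ * u w ≤ N := (le_abs_self _).trans (by
        rw [abs_mul]; nlinarith [hN w, abs_nonneg (u w), abs_nonneg σ])
      linarith
    · have h1 := hτb w
      have h2 : σ * (Real.exp (-l * max w.1 0) * θ w.1 * G w) ≤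
          C₀ * (Real.exp (-l * w.1) * θ w.1) := (le_abs_self _).trans (by
        rw [abs_mul]
        nlinarith [abs_nonneg (Real.exp (-l * max w.1 0) * θ w.1 * G w), abs_nonneg σ])
      have h3 : ∑ i, ∑ j, A w i j * (σ * uxx i j w - C₀ * 0) =
          σ * ∑ i, ∑ j, A w i j * uxx i j w := by
        simp only [Finset.mul_sum]
        exact Finset.sum_congr rfl fun i _ => Finset.sum_congr rfl fun j _ => by ring
      simp only [G] at h2
      simp only [h3, heq w]
      linarith
  have hv := (C12.of_space hf).add ((C12.of_time (d := d) (hE l) (by fun_prop)).mul hu)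
  refine ⟨_, IsSol.of_C12 (isOpen_lt continuous_const continuous_fst) (hv.mono (subset_univ _))
    fun z hz => ?_, continuousOn_univ.1 hv.cu, fun z hz => ?_⟩
  · have hz : ε < z.1 := hz
    have e1 : Real.exp (l * z.1) * Real.exp (-l * z.1) = 1 := by
      rw [← Real.exp_add]; simp
    simp only [heq z, hθ1 _ hz, max_eq_left (hε.le.trans hz.le), mul_add, zero_mul,
      zero_add, add_zero, Finset.sum_add_distrib]
    have e2 : ∑ i, ∑ j, A z i j * (Real.exp (l * z.1) * uxx i j z) =
        Real.exp (l * z.1) * ∑ i, ∑ j, A z i j * uxx i j z := by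
      simp only [Finset.mul_sum]
      exact Finset.sum_congr rfl fun i _ => Finset.sum_congr rfl fun j _ => by ring
    rw [e2]
    linear_combination (1 / 2 * ∑ i, ∑ j, A z i j * pd2 f i j z.2) * e1
  · have e1 : Real.exp (l * z.1) * Real.exp (-l * z.1) = 1 := by
      rw [← Real.exp_add]; simp
    have e2 : Real.exp (l * z.1) * b z.1 ≤ z.1 := by
      simp only [b]
      rw [← mul_assoc, e1, one_mul]; exact hI2 _ hz
    have hp := Real.exp_pos (l * z.1)
    have k1 := key 1 (by simp) z
    have k2 := key (-1) (by simp) z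
    rw [add_sub_cancel_left, abs_mul, abs_of_pos hp]
    have k3 : |u z| ≤ C₀ * b z.1 := abs_le.2 ⟨by linarith, by linarith⟩
    calc _ ≤ Real.exp (l * z.1) * (C₀ * b z.1) := by gcongr
      _ = C₀ * (Real.exp (l * z.1) * b z.1) := by ring
      _ ≤ _ := by gcongr

lemma exists_lipschitz_cutoff {X : Type*} [MetricSpace X] [ProperSpace X] {K Ω : Set X}
    (hK : IsCompact K) (hne : K.Nonempty) (hΩ : IsOpen Ω) (hKΩ : K ⊆ Ω) :
    ∃ (χ : X → ℝ) (K' : Set X) (L : ℝ), IsCompact K' ∧ K' ⊆ Ω ∧ 0 ≤ L ∧ (∀ z, 0 ≤ χ z ∧ χ z ≤ 1) ∧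
      (∀ z ∈ K, χ z = 1) ∧ (∀ z ∉ K', χ z = 0) ∧ ∀ z w, |χ z - χ w| ≤ L * dist z w := by
  obtain ⟨δ, hδ, hsub⟩ := hK.exists_cthickening_subset_open hΩ hKΩ
  refine ⟨fun z => max 0 (1 - Metric.infDist z K / δ), Metric.cthickening δ K, 1 / δ,
    hK.cthickening, hsub, by positivity, fun z => ⟨le_max_left _ _, max_le zero_le_one ?_⟩,
    fun z hz => ?_, fun z hz => ?_, fun z w => ?_⟩
  · have : 0 ≤ Metric.infDist z K / δ := div_nonneg Metric.infDist_nonneg hδ.le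
    linarith
  · simp [Metric.infDist_zero_of_mem hz]
  · refine max_eq_left ?_
    have h : ¬ Metric.infDist z K < δ := fun h => hz (Metric.thickening_subset_cthickening _ _
      ((Metric.mem_thickening_iff_infDist_lt hne).2 h))
    have := (one_le_div hδ).2 (not_lt.1 h)
    linarith
  · refine (abs_max_sub_max_le_max _ _ _ _).trans (max_le ?_ ?_)
    · simp only [sub_self, abs_zero]; positivity
    · have h1 := Metric.infDist_le_infDist_add_dist (s := K) (x := z) (y := w)
      have h2 := Metric.infDist_le_infDist_add_dist (s := K) (x := w) (y := z)
      rw [dist_comm w z] at h2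
      rw [show 1 - Metric.infDist z K / δ - (1 - Metric.infDist w K / δ) =
        1 / δ * (Metric.infDist w K - Metric.infDist z K) by ring, abs_mul,
        abs_of_pos (by positivity : 0 < 1 / δ)]
      gcongr
      exact abs_le.2 ⟨by linarith, by linarith⟩

lemma SPD.interp {A : Fin d → Fin d → ℝ} {c : ℝ} (h0 : 0 ≤ c) (h1 : c ≤ 1)
    (hA : c ≠ 0 → SPD A) : SPD (fun i j => c * A i j + (1 - c) * if i = j then 1 else 0) := by
  rcases h0.eq_or_lt with h | h
  · simpa [← h] using SPD.one (d := d)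
  · have hA := hA h.ne'
    refine ⟨fun i j => by simp only [hA.1 i j, eq_comm], fun y hy => ?_⟩
    have e1 := hA.2 y hy
    have e2 := (SPD.one (d := d)).2 y hy
    have : ∑ i, ∑ j, (c * A i j + (1 - c) * if i = j then 1 else 0) * y i * y j =
        c * ∑ i, ∑ j, A i j * y i * y j +
        (1 - c) * ∑ i, ∑ j, (if i = j then (1 : ℝ) else 0) * y i * y j := by
      simp only [Finset.mul_sum, ← Finset.sum_add_distrib]
      exact Finset.sum_congr rfl fun i _ => Finset.sum_congr rfl fun j _ => by ring
    rw [this]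
    nlinarith [mul_pos h e1, mul_nonneg (sub_nonneg.2 h1) e2.le]

lemma HolderAt.interp {A : TX d → Fin d → Fin d → ℝ} {z : TX d} {χ : TX d → ℝ} {L : ℝ}
    (hA : HolderAt A z) (hL : 0 ≤ L) (hχ : ∀ w, 0 ≤ χ w ∧ χ w ≤ 1)
    (hχL : ∀ w w', |χ w - χ w'| ≤ L * dist w w') :
    HolderAt (fun z i j => χ z * A z i j + (1 - χ z) * if i = j then 1 else 0) z := by
  obtain ⟨r, hr, β, hβ, C, hC, h⟩ := hA
  set r' := min r (1 / 2)
  have hr' : 0 < r' := lt_min hr (by norm_num)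
  set N := ∑ i, ∑ j, |A z i j|
  have hN : ∀ i j, |A z i j| ≤ N := fun i j =>
    (Finset.single_le_sum (f := fun j => |A z i j|) (fun j _ => abs_nonneg _)
      (Finset.mem_univ j)).trans (Finset.single_le_sum (f := fun i => ∑ j, |A z i j|)
        (fun i _ => Finset.sum_nonneg fun j _ => abs_nonneg _) (Finset.mem_univ i))
  have hN0 : 0 ≤ N := Finset.sum_nonneg fun i _ => Finset.sum_nonneg fun j _ => abs_nonneg _
  have hsub : Metric.closedBall z r' ⊆ Metric.closedBall z r :=
    Metric.closedBall_subset_closedBall (min_le_left _ _)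
  have hd1 : ∀ w ∈ Metric.closedBall z r', ∀ w' ∈ Metric.closedBall z r', dist w w' ≤ 1 :=
    fun w hw w' hw' => by
      have h1 := dist_triangle_right w w' z
      have h2 : r' ≤ 1 / 2 := min_le_right _ _
      rw [Metric.mem_closedBall] at hw hw'
      linarith
  have hm : 0 < min β 1 := lt_min hβ one_pos
  refine ⟨r', hr', min β 1, hm, L * (N + C + 1) + C, by positivity,
    fun i j w hw w' hw' => ?_⟩
  have hd := hd1 w hw w' hw'
  have hd0 : 0 ≤ dist w w' := dist_nonneg
  have p1 : dist w w' ≤ dist w w' ^ min β 1 := by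
    have := Real.rpow_le_rpow_of_exponent_ge' hd0 hd hm.le (min_le_right β 1)
    rwa [Real.rpow_one] at this
  have p2 : dist w w' ^ β ≤ dist w w' ^ min β 1 :=
    Real.rpow_le_rpow_of_exponent_ge' hd0 hd hm.le (min_le_left β 1)
  set D := dist w w' ^ min β 1
  have hA1 := h i j w (hsub hw) w' (hsub hw')
  have hAz : |A w i j| ≤ N + C := by
    have h1 := h i j w (hsub hw) z (Metric.mem_closedBall_self hr.le)
    have h2 : dist w z ^ β ≤ 1 := Real.rpow_le_one dist_nonneg
      (hd1 w hw z (Metric.mem_closedBall_self hr'.le)) hβ.le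
    have h3 := abs_sub_abs_le_abs_sub (A w i j) (A z i j)
    nlinarith [hN i j]
  set e : ℝ := if i = j then 1 else 0
  have he : |e| ≤ 1 := by simp only [e]; split_ifs <;> simp
  have hx := hχL w w'
  have hx' := abs_le.2 ⟨by linarith [(hχ w').1], (hχ w').2⟩
  rw [show χ w * A w i j + (1 - χ w) * e - (χ w' * A w' i j + (1 - χ w') * e) =
    (χ w - χ w') * (A w i j - e) + χ w' * (A w i j - A w' i j) by ring]
  refine (abs_add_le _ _).trans ?_
  rw [abs_mul, abs_mul]
  have q1 : |A w i j - e| ≤ N + C + 1 := (abs_sub _ _).trans (by linarith)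
  calc _ ≤ L * D * (N + C + 1) + 1 * (C * D) := by
        gcongr
        · exact hx.trans (by gcongr)
        · exact hA1.trans (by gcongr)
    _ = _ := by ring

/-- Coefficients modified to be the identity outside a compact set. -/
lemma exists_coeff_extension {A : TX d → Fin d → Fin d → ℝ} {K Ω : Set (TX d)}
    (hK : IsCompact K) (hne : K.Nonempty) (hΩ : IsOpen Ω) (hKΩ : K ⊆ Ω)
    (hH : ∀ z ∈ Ω, HolderAt A z) (hpd : ∀ z ∈ Ω, SPD (A z)) :
    ∃ (A' : TX d → Fin d → Fin d → ℝ) (K' : Set (TX d)), IsCompact K' ∧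
      (∀ z, HolderAt A' z) ∧ (∀ z, SPD (A' z)) ∧
      (∀ z ∉ K', A' z = fun i j => if i = j then 1 else 0) ∧ (∀ z ∈ K, A' z = A z) ∧
      ∀ z i j, |A' z i j| ≤ 1 ∨ z ∈ Ω ∧ |A' z i j| ≤ |A z i j| + 1 := by
  obtain ⟨χ, K', L, hK', hK'Ω, hL, hχ, hχ1, hχ0, hχL⟩ := exists_lipschitz_cutoff hK hne hΩ hKΩ
  have hout : ∀ z ∉ K', (fun i j => χ z * A z i j + (1 - χ z) * if i = j then 1 else 0) =
      fun i j => if i = j then 1 else 0 := fun z hz => by simp [hχ0 z hz]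
  refine ⟨fun z i j => χ z * A z i j + (1 - χ z) * if i = j then 1 else 0, K', hK', fun z => ?_,
    fun z => SPD.interp (hχ z).1 (hχ z).2 fun hz => ?_, hout, fun z hz => by simp [hχ1 z hz],
    fun z i j => ?_⟩
  · by_cases hz : z ∈ Ω
    · exact (hH z hz).interp hL hχ hχL
    · have hz' : z ∉ K' := fun h => hz (hK'Ω h)
      obtain ⟨r, hr, hball⟩ := Metric.nhds_basis_closedBall.mem_iff.1
        (hK'.isClosed.isOpen_compl.mem_nhds hz')
      refine ⟨r, hr, 1, one_pos, 0, le_rfl, fun i j w hw w' hw' => ?_⟩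
      simp only [hχ0 w (hball hw), hχ0 w' (hball hw')]
      simp
  · by_contra h
    exact hz (hχ0 z fun hK => h (hpd z (hK'Ω hK)))
  · by_cases hz : z ∈ K'
    · refine Or.inr ⟨hK'Ω hz, (abs_add_le _ _).trans ?_⟩
      rw [abs_mul, abs_mul, abs_of_nonneg (hχ z).1, abs_of_nonneg (sub_nonneg.2 (hχ z).2)]
      have he : |(if i = j then 1 else 0 : ℝ)| ≤ 1 := by split_ifs <;> simp
      nlinarith [abs_nonneg (A z i j), (hχ z).1, (hχ z).2]
    · left
      have := congrFun (congrFun (hout z hz) i) j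
      simp only [this]
      split_ifs <;> simp

/-- Strict comparison of a solution with a strict supersolution, up to the time `S`. -/
lemma IsSol.lt_of_super {Ω K : Set (TX d)} (hΩ : IsOpen Ω) {A : TX d → Fin d → Fin d → ℝ}
    (hA : ∀ z ∈ Ω, SPSD (A z)) {w b bt : TX d → ℝ} {bx : Fin d → TX d → ℝ}
    {bxx : Fin d → Fin d → TX d → ℝ} {S : ℝ} (hw : IsSol Ω A w) (hb : C12 Ω b bt bx bxx)
    (hbs : ∀ z ∈ Ω, 1 / 2 * ∑ i, ∑ j, A z i j * bxx i j z < bt z) (hK : IsCompact K)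
    (hwK : ContinuousOn w K) (hbK : ContinuousOn b K)
    (hout : ∀ z ∈ Ω, z.1 ≤ S → z ∈ K ∨ w z < b z) (hbdry : ∀ z ∈ K, z ∉ Ω → w z < b z) :
    ∀ z ∈ Ω, z.1 ≤ S → w z < b z := by
  have hc : IsCompact (K ∩ (fun z => w z - b z) ⁻¹' Ici 0) :=
    hK.of_isClosed_subset ((hwK.sub hbK).preimage_isClosed_of_isClosed hK.isClosed isClosed_Ici)
      inter_subset_left
  have := max_principle hΩ (hw.c12.sub hb) hA (S := S) (fun z hz _ _ => ?_) hc ?_ ?_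
  · exact fun z hz hS => sub_neg.1 (this z hz hS)
  · have h1 := hw.eq z hz
    have h2 := hbs z hz
    simp only [mul_sub, Finset.sum_sub_distrib]
    linarith
  · rintro z ⟨hz, hz'⟩
    by_contra h
    have h1 := hbdry z hz h
    have h2 : 0 ≤ w z - b z := hz'
    linarith
  · intro z hz hS h0
    rcases hout z hz hS with h | h
    · exact ⟨h, h0⟩
    · linarith

lemma isOpen_posOrth : IsOpen (posOrth d) := by
  have : posOrth d = ⋂ i, {x : Fin d → ℝ | 0 < x i} := by ext; simp [posOrth]
  rw [this]
  exact isOpen_iInter_of_finite fun i => isOpen_lt continuous_const (continuous_apply i)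

/-- Weights on the positive orthant. -/
def growth (m : ℕ) (β : ℝ) (x : Fin d → ℝ) : ℝ := 1 + ∑ i, (x i ^ m + β * (x i ^ m)⁻¹)

/-- Weights growing exponentially in time. -/
def barrier (κ : ℝ) (m : ℕ) (β : ℝ) (z : TX d) : ℝ := Real.exp (κ * z.1) * growth m β z.2

lemma term_nonneg {m : ℕ} {β : ℝ} (hβ : 0 ≤ β) {x : Fin d → ℝ} (hx : x ∈ posOrth d) (i : Fin d) :
    0 ≤ x i ^ m + β * (x i ^ m)⁻¹ := by
  have : 0 < x i := hx i
  positivity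

lemma one_le_growth {m : ℕ} {β : ℝ} (hβ : 0 ≤ β) {x : Fin d → ℝ} (hx : x ∈ posOrth d) :
    1 ≤ growth m β x := by
  have := Finset.sum_nonneg fun i (_ : i ∈ Finset.univ) => term_nonneg (m := m) hβ hx i
  unfold growth; linarith

lemma term_le_growth {m : ℕ} {β : ℝ} (hβ : 0 ≤ β) {x : Fin d → ℝ} (hx : x ∈ posOrth d)
    (i : Fin d) : x i ^ m + β * (x i ^ m)⁻¹ ≤ growth m β x := by
  have := Finset.single_le_sum (fun j _ => term_nonneg (m := m) hβ hx j) (Finset.mem_univ i)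
  unfold growth; linarith

lemma growth_le_barrier {κ : ℝ} {m : ℕ} {β : ℝ} (hκ : 0 ≤ κ) (hβ : 0 ≤ β) {z : TX d} (h0 : 0 ≤ z.1)
    (hx : z.2 ∈ posOrth d) : growth m β z.2 ≤ barrier κ m β z :=
  le_mul_of_one_le_left (zero_le_one.trans (one_le_growth hβ hx))
    (Real.one_le_exp (mul_nonneg hκ h0))

/-- The rate at which the barriers grow in time. -/
def rate (C : ℝ) (m : ℕ) : ℝ := 1 / 2 * C * (m * (m + 1)) + 1

lemma rate_pos {C : ℝ} (hC : 0 ≤ C) (m : ℕ) : 0 < rate C m := by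
  unfold rate; positivity

lemma hasDerivAt_pow_add_inv (m : ℕ) (β : ℝ) {y : ℝ} (hy : 0 < y) :
    HasDerivAt (fun y => y ^ m + β * (y ^ m)⁻¹)
      ((m * y ^ m - β * (m * (y ^ m)⁻¹)) * y⁻¹) y := by
  have h := hasDerivAt_zpow (m : ℤ) y (Or.inl hy.ne')
  have h' := hasDerivAt_zpow (-m : ℤ) y (Or.inl hy.ne')
  have := h.add (h'.const_mul β)
  simp only [zpow_sub₀ hy.ne', zpow_natCast, zpow_neg] at this
  refine this.congr_deriv ?_
  push_cast
  field_simp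
  ring

lemma hasDerivAt_pow_add_inv' (m : ℕ) (β : ℝ) {y : ℝ} (hy : 0 < y) :
    HasDerivAt (fun y => (m * y ^ m - β * (m * (y ^ m)⁻¹)) * y⁻¹)
      ((m * (m - 1) * y ^ m + β * (m * (m + 1) * (y ^ m)⁻¹)) * (y ^ 2)⁻¹) y := by
  have h := hasDerivAt_zpow (m : ℤ) y (Or.inl hy.ne')
  have h' := hasDerivAt_zpow (-m : ℤ) y (Or.inl hy.ne')
  have := ((h.const_mul (m : ℝ)).sub ((h'.const_mul (m : ℝ)).const_mul β)).mul (hasDerivAt_inv hy.ne')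
  simp only [zpow_sub₀ hy.ne', zpow_natCast, zpow_neg] at this
  refine this.congr_deriv ?_
  simp only [Pi.sub_apply]
  push_cast
  field_simp
  ring

lemma exists_barrier (κ : ℝ) (m : ℕ) (β : ℝ) :
    ∃ bx, C12 {z : TX d | z.2 ∈ posOrth d} (barrier κ m β) (fun z => κ * barrier κ m β z) bx
      (fun i j z => if i = j then Real.exp (κ * z.1) * ((m * (m - 1) * z.2 i ^ m + β *
        (m * (m + 1) * (z.2 i ^ m)⁻¹)) * (z.2 i ^ 2)⁻¹) else 0) := by
  have hne : ∀ i, ∀ z ∈ {z : TX d | z.2 ∈ posOrth d}, z.2 i ≠ 0 := fun i z hz => (hz i).ne'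
  have hc : ∀ i, ContinuousOn (fun z : TX d => z.2 i) {z : TX d | z.2 ∈ posOrth d} :=
    fun i => by fun_prop
  have he : ContinuousOn (fun z : TX d => Real.exp (κ * z.1)) {z : TX d | z.2 ∈ posOrth d} := by
    fun_prop
  have hb : ContinuousOn (barrier (d := d) κ m β) {z | z.2 ∈ posOrth d} := by
    refine he.mul (continuousOn_const.add (continuousOn_finsetSum _ fun i _ =>
      ((hc i).pow m).add (continuousOn_const.mul (((hc i).pow m).inv₀ fun z hz =>
        pow_ne_zero m (hne i z hz)))))
  have hcoord : ∀ (i j : Fin d) (z : TX d), HasDerivAt (fun t : ℝ => (z + t • ex i).2 j)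
      (if i = j then 1 else 0) 0 := fun i j z => by
    have := ((hasDerivAt_id (0 : ℝ)).mul_const
      ((Pi.single i (1 : ℝ) : Fin d → ℝ) j)).const_add (z.2 j)
    simpa [ex, Pi.single_apply, eq_comm] using this
  refine ⟨fun i z => Real.exp (κ * z.1) * ((m * z.2 i ^ m - β * (m * (z.2 i ^ m)⁻¹)) * (z.2 i)⁻¹),
    hb, continuousOn_const.mul hb, fun i => ?_, fun i j => ?_, fun z hz => ?_, fun i z hz => ?_,
    fun i j z hz => ?_⟩
  · exact he.mul (((continuousOn_const.mul ((hc i).pow m)).sub (continuousOn_const.mul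
      (continuousOn_const.mul (((hc i).pow m).inv₀ fun z hz => pow_ne_zero m (hne i z hz))))).mul
      ((hc i).inv₀ (hne i)))
  · by_cases hij : i = j
    · simp only [hij, if_true]
      exact he.mul (((continuousOn_const.mul ((hc j).pow m)).add (continuousOn_const.mul
        (continuousOn_const.mul (((hc j).pow m).inv₀ fun z hz =>
        pow_ne_zero m (hne j z hz))))).mul
        (((hc j).pow 2).inv₀ fun z hz => pow_ne_zero 2 (hne j z hz)))
    · simp only [hij, if_false]; exact continuousOn_const
  · have h1 : HasDerivAt (fun t : ℝ => κ * (z.1 + t)) κ 0 := by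
      simpa using ((hasDerivAt_id (0 : ℝ)).const_add z.1).const_mul κ
    have := h1.exp.mul_const (growth m β z.2)
    simp only [add_zero] at this
    have h2 : HasDerivAt (fun t : ℝ => barrier κ m β (z + t • et))
        (Real.exp (κ * z.1) * κ * growth m β z.2) 0 := by
      simpa [barrier, et] using this
    refine h2.congr_deriv ?_
    unfold barrier; ring
  · have h1 : ∀ j, HasDerivAt (fun t : ℝ => (z + t • ex i).2 j ^ m +
        β * ((z + t • ex i).2 j ^ m)⁻¹)
        ((m * z.2 j ^ m - β * (m * (z.2 j ^ m)⁻¹)) * (z.2 j)⁻¹ * if i = j then 1 else 0) 0 :=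
      fun j => by
      have := hasDerivAt_pow_add_inv m β (y := (z + (0 : ℝ) • ex i).2 j) (by simpa using hz j)
      simpa [Function.comp_def] using this.comp (0 : ℝ) (hcoord i j z)
    have h2 := ((HasDerivAt.fun_sum fun j (_ : j ∈ Finset.univ) => h1 j).const_add 1).const_mul
      (Real.exp (κ * z.1))
    simp only [mul_ite, mul_one, mul_zero, Finset.sum_ite_eq, Finset.mem_univ, if_true] at h2
    simpa [HasLineDerivAt, barrier, growth, ex] using h2
  · have := hasDerivAt_pow_add_inv' m β (y := (z + (0 : ℝ) • ex i).2 j) (by simpa using hz j)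
    have h1 := (this.comp (0 : ℝ) (hcoord i j z)).const_mul (Real.exp (κ * z.1))
    have h2 := h1.congr_of_eventuallyEq (f₁ := fun t : ℝ => Real.exp (κ * (z + t • ex i).1) *
      ((m * (z + t • ex i).2 j ^ m - β * (m * ((z + t • ex i).2 j ^ m)⁻¹)) *
        ((z + t • ex i).2 j)⁻¹)) (Eventually.of_forall fun t => by simp [ex])
    refine h2.congr_deriv ?_
    split_ifs with h
    · subst h; simp
    · simp

lemma barrier_super {A : TX d → Fin d → Fin d → ℝ} {C : ℝ} (hC : 0 ≤ C) {z : TX d}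
    (hx : z.2 ∈ posOrth d) (hA0 : ∀ i, 0 ≤ A z i i) (hA : ∀ i, A z i i ≤ C * z.2 i ^ 2)
    (m : ℕ) {β : ℝ} (hβ : 0 ≤ β) :
    1 / 2 * ∑ i, ∑ j, A z i j * (if i = j then Real.exp (rate C m * z.1) *
      ((m * (m - 1) * z.2 i ^ m + β * (m * (m + 1) * (z.2 i ^ m)⁻¹)) * (z.2 i ^ 2)⁻¹) else 0)
      < rate C m * barrier (rate C m) m β z := by
  simp only [mul_ite, mul_zero, Finset.sum_ite_eq, Finset.mem_univ, if_true]
  set E := Real.exp (rate C m * z.1)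
  have hE : 0 < E := Real.exp_pos _
  have h : ∀ i ∈ Finset.univ, A z i i * (E * ((m * (m - 1) * z.2 i ^ m +
      β * (m * (m + 1) * (z.2 i ^ m)⁻¹)) * (z.2 i ^ 2)⁻¹)) ≤
      E * (C * (m * (m + 1))) * (z.2 i ^ m + β * (z.2 i ^ m)⁻¹) := fun i _ => by
    have hp : 0 < z.2 i := hx i
    have e1 : A z i i * (z.2 i ^ 2)⁻¹ ≤ C := by
      rw [← div_eq_mul_inv, div_le_iff₀ (by positivity)]; exact hA i
    have e0 : 0 ≤ A z i i * (z.2 i ^ 2)⁻¹ := mul_nonneg (hA0 i) (by positivity)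
    have e2 : m * (m - 1) * z.2 i ^ m + β * (m * (m + 1) * (z.2 i ^ m)⁻¹) ≤
        m * (m + 1) * (z.2 i ^ m + β * (z.2 i ^ m)⁻¹) := by
      have : (0 : ℝ) ≤ m * z.2 i ^ m := by positivity
      nlinarith
    have e3 : 0 ≤ m * (m + 1) * (z.2 i ^ m + β * (z.2 i ^ m)⁻¹) := by positivity
    calc _ = E * ((A z i i * (z.2 i ^ 2)⁻¹) *
          (m * (m - 1) * z.2 i ^ m + β * (m * (m + 1) * (z.2 i ^ m)⁻¹))) := by ring
      _ ≤ E * ((A z i i * (z.2 i ^ 2)⁻¹) * (m * (m + 1) * (z.2 i ^ m + β * (z.2 i ^ m)⁻¹))) := by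
        gcongr
      _ ≤ E * (C * (m * (m + 1) * (z.2 i ^ m + β * (z.2 i ^ m)⁻¹))) := by gcongr
      _ = _ := by ring
  have hs := Finset.sum_le_sum h
  rw [← Finset.mul_sum] at hs
  have hg : ∑ i, (z.2 i ^ m + β * (z.2 i ^ m)⁻¹) = growth m β z.2 - 1 := by unfold growth; ring
  rw [hg] at hs
  have h1 := one_le_growth (m := m) hβ hx
  have : rate C m * barrier (rate C m) m β z =
      1 / 2 * (E * (C * (m * (m + 1))) * growth m β z.2) + E * growth m β z.2 := by
    unfold barrier; simp only [E]; nth_rewrite 1 [rate]; ring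
  rw [this]
  have h2 : 0 < E * growth m β z.2 := mul_pos hE (by linarith)
  have h3 : 0 ≤ E * (C * (m * (m + 1))) := by positivity
  nlinarith

lemma IsSol.neg {U : Set (TX d)} (hU : IsOpen U) {A : TX d → Fin d → Fin d → ℝ} {v : TX d → ℝ}
    (h : IsSol U A v) : IsSol U A (fun z => -1 * v z) := by
  refine IsSol.of_C12 hU (h.c12.const_mul (-1)) fun z hz => ?_
  rw [h.eq z hz]
  simp only [Finset.mul_sum]
  exact Finset.sum_congr rfl fun i _ => Finset.sum_congr rfl fun j _ => by ring

lemma norm_pow_le_growth (m : ℕ) {β : ℝ} (hβ : 0 ≤ β) {x : Fin d → ℝ} (hx : x ∈ posOrth d) :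
    ‖x‖ ^ m ≤ growth m β x := by
  rcases Nat.eq_zero_or_pos d with h | h
  · subst h
    have : x = 0 := Subsingleton.elim _ _
    rw [this, norm_zero, ← this]
    exact (pow_le_one₀ le_rfl zero_le_one).trans (one_le_growth hβ hx)
  · have : Nonempty (Fin d) := ⟨⟨0, h⟩⟩
    obtain ⟨i, hi⟩ := Finite.exists_max x
    have h1 : ‖x‖ ≤ x i := (pi_norm_le_iff_of_nonneg (hx i).le).2 fun j => by
      rw [Real.norm_of_nonneg (hx j).le]; exact hi j
    have h2 : 0 ≤ β * (x i ^ m)⁻¹ := mul_nonneg hβ (inv_nonneg.2 (pow_nonneg (hx i).le m))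
    calc _ ≤ x i ^ m := by gcongr
      _ ≤ x i ^ m + β * (x i ^ m)⁻¹ := by linarith
      _ ≤ _ := term_le_growth hβ hx i

lemma one_add_norm_rpow_le_growth {m : ℕ} {q : ℝ} (hq : 0 < q) (hm : q ≤ m) {β : ℝ} (hβ : 0 ≤ β)
    {x : Fin d → ℝ} (hx : x ∈ posOrth d) : 1 + ‖x‖ ^ q ≤ 2 * growth m β x := by
  have h1 := one_le_growth (m := m) hβ hx
  have h2 := norm_pow_le_growth m hβ hx
  rcases le_total ‖x‖ 1 with h | h
  · have := Real.rpow_le_one (norm_nonneg x) h hq.le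
    linarith
  · have := Real.rpow_le_rpow_of_exponent_le h hm
    rw [Real.rpow_natCast] at this
    linarith

lemma growth_zero_le (m : ℕ) {x : Fin d → ℝ} (hx : x ∈ posOrth d) :
    growth m 0 x ≤ (1 + d) * (1 + ‖x‖ ^ m) := by
  have : ∑ i, (x i ^ m + 0 * (x i ^ m)⁻¹) ≤ ∑ _i : Fin d, ‖x‖ ^ m := by
    refine Finset.sum_le_sum fun i _ => ?_
    rw [zero_mul, add_zero]
    exact pow_le_pow_left₀ (hx i).le ((le_abs_self _).trans (norm_le_pi_norm x i)) m
  simp only [Finset.sum_const, Finset.card_univ, Fintype.card_fin, nsmul_eq_mul] at this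
  have h0 : 0 ≤ ‖x‖ ^ m := by positivity
  have hd : (0 : ℝ) ≤ d := by positivity
  unfold growth
  nlinarith

/-- Near the boundary of the orthant the weights dominate functions of polynomial growth. -/
lemma growth_dominates {q : ℝ} (hq : 0 < q) {C : ℝ} (hC : 0 ≤ C) {m : ℕ} (hm : q + 1 ≤ m) {ε : ℝ}
    (hε : 0 < ε) : ∃ R : ℝ, 1 ≤ R ∧ ∀ x ∈ posOrth d, (∃ i, x i < R⁻¹ ∨ R < x i) →
      C * (1 + ‖x‖ ^ q) < ε * growth m 1 x := by
  set ρ := max 1 (2 * C / ε)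
  have hρ1 : 1 ≤ ρ := le_max_left _ _
  have hρ2 : C ≤ ε / 2 * ρ := by
    have : 2 * C / ε ≤ ρ := le_max_right _ _
    rw [div_le_iff₀ hε] at this
    linarith
  set B := C * (1 + ρ ^ q)
  have hB : 0 ≤ B := by positivity
  have hm0 : m ≠ 0 := by
    rintro rfl
    simp only [Nat.cast_zero] at hm
    linarith
  refine ⟨max 1 (2 * B / ε), le_max_left _ _, fun x hx ⟨i, hi⟩ => ?_⟩
  set R := max 1 (2 * B / ε)
  have hR1 : 1 ≤ R := le_max_left _ _
  have hR2 : B ≤ ε / 2 * R := by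
    have : 2 * B / ε ≤ R := le_max_right _ _
    rw [div_le_iff₀ hε] at this
    linarith
  have hx0 : 0 < x i := hx i
  have hg : R < growth m 1 x := by
    refine lt_of_lt_of_le ?_ (term_le_growth zero_le_one hx i)
    rcases hi with hi | hi
    · have h1 : R < (x i)⁻¹ := by rwa [lt_inv_comm₀ (by linarith) hx0]
      have h2 : (x i)⁻¹ ≤ (x i)⁻¹ ^ m := le_self_pow₀ (by linarith) hm0
      have h3 : 0 < x i ^ m := by positivity
      rw [one_mul, ← inv_pow]; linarith
    · have h2 : x i ≤ x i ^ m := le_self_pow₀ (by linarith) hm0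
      have h3 : 0 < (x i ^ m)⁻¹ := by positivity
      linarith
  have hn : C * (1 + ‖x‖ ^ q) ≤ B + ε / 2 * ‖x‖ ^ m := by
    rcases le_total ‖x‖ ρ with h | h
    · have h1 : C * (1 + ‖x‖ ^ q) ≤ B := by simp only [B]; gcongr
      have h2 : 0 ≤ ε / 2 * ‖x‖ ^ m := by positivity
      linarith
    · have h0 : 0 < ‖x‖ := by linarith
      have h1 : ‖x‖ ^ q * ‖x‖ ≤ ‖x‖ ^ m := by
        rw [← Real.rpow_natCast]
        calc _ = ‖x‖ ^ (q + 1) := by rw [Real.rpow_add h0, Real.rpow_one]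
          _ ≤ _ := Real.rpow_le_rpow_of_exponent_le (hρ1.trans h) hm
      have h2 : C ≤ B := by
        have : 0 ≤ ρ ^ q := by positivity
        simp only [B]; nlinarith
      have h3 : 0 ≤ ‖x‖ ^ q := by positivity
      have h4 : C * ‖x‖ ^ q ≤ ε / 2 * (‖x‖ ^ q * ‖x‖) := by
        calc _ ≤ ε / 2 * ρ * ‖x‖ ^ q := by gcongr
          _ ≤ ε / 2 * ‖x‖ * ‖x‖ ^ q := by gcongr
          _ = _ := by ring
      nlinarith
  have h5 := norm_pow_le_growth m zero_le_one hx
  nlinarith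

/-- The admissible coefficients on the orthant, in forward time. -/
structure Coeff (A : TX d → Fin d → Fin d → ℝ) (C : ℝ) : Prop where
  nonneg : 0 ≤ C
  holder : ∀ z : TX d, 0 < z.1 → z.2 ∈ posOrth d → HolderAt A z
  pd : ∀ z : TX d, 0 < z.1 → z.2 ∈ posOrth d → SPD (A z)
  bdd : ∀ z : TX d, 0 < z.1 → z.2 ∈ posOrth d → ∀ i j, |A z i j| ≤ C * (z.2 i * z.2 j)

lemma Coeff.super {A : TX d → Fin d → Fin d → ℝ} {C : ℝ} (hA : Coeff A C) {z : TX d}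
    (h0 : 0 < z.1) (hx : z.2 ∈ posOrth d) (m : ℕ) {β : ℝ} (hβ : 0 ≤ β) :
    1 / 2 * ∑ i, ∑ j, A z i j * (if i = j then Real.exp (rate C m * z.1) *
      ((m * (m - 1) * z.2 i ^ m + β * (m * (m + 1) * (z.2 i ^ m)⁻¹)) * (z.2 i ^ 2)⁻¹) else 0)
      < rate C m * barrier (rate C m) m β z :=
  barrier_super hA.nonneg hx (fun i => (hA.pd z h0 hx).spsd.diag_nonneg i) (fun i => by
    rw [sq]; exact (le_abs_self _).trans (hA.bdd z h0 hx i i)) m hβ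

lemma isOpen_slab (S : ℝ) : IsOpen {z : TX d | 0 < z.1 ∧ z.1 < S ∧ z.2 ∈ posOrth d} :=
  (isOpen_lt continuous_const continuous_fst).inter
    ((isOpen_lt continuous_fst continuous_const).inter (isOpen_posOrth.preimage continuous_snd))

lemma barrier_zero (κ : ℝ) (m : ℕ) (β : ℝ) (x : Fin d → ℝ) :
    barrier κ m β (0, x) = growth m β x := by simp [barrier]

lemma barrier_pos (κ : ℝ) (m : ℕ) {β : ℝ} (hβ : 0 ≤ β) {z : TX d} (hx : z.2 ∈ posOrth d) :
    0 < barrier κ m β z :=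
  mul_pos (Real.exp_pos _) (zero_lt_one.trans_le (one_le_growth hβ hx))

lemma IsSol.le_barrier {A : TX d → Fin d → Fin d → ℝ} {C : ℝ} (hA : Coeff A C) {w : TX d → ℝ}
    {S S' : ℝ} (hS : S < S') (hw : IsSol {z : TX d | 0 < z.1 ∧ z.1 < S' ∧ z.2 ∈ posOrth d} A w)
    (hc : ContinuousOn w {z : TX d | 0 ≤ z.1 ∧ z.1 ≤ S ∧ z.2 ∈ posOrth d}) {B q : ℝ} (hB : 0 ≤ B)
    (hq : 0 < q) (hg : ∀ z : TX d, 0 ≤ z.1 → z.1 ≤ S → z.2 ∈ posOrth d → w z ≤ B * (1 + ‖z.2‖ ^ q))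
    {M β : ℝ} {m : ℕ} (hM : 0 ≤ M) (hβ : 0 ≤ β) (h0 : ∀ x ∈ posOrth d, w (0, x) ≤ M * growth m β x)
    (z : TX d) (hz0 : 0 ≤ z.1) (hzS : z.1 ≤ S) (hx : z.2 ∈ posOrth d) :
    w z ≤ M * barrier (rate C m) m β z := by
  rcases hz0.eq_or_lt with hz0 | hz0
  · have : z = (0, z.2) := Prod.ext hz0.symm rfl
    rw [this, barrier_zero]; exact h0 _ hx
  obtain ⟨m', hm'⟩ := exists_nat_ge (q + 1)
  refine le_of_forall_pos_le_add fun η hη => ?_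
  have hbz := barrier_pos (rate C m') m' zero_le_one hx
  set ε := η / barrier (rate C m') m' 1 z
  have hε : 0 < ε := by positivity
  obtain ⟨R, hR, hdom⟩ := growth_dominates (d := d) hq hB hm' hε
  obtain ⟨bx, hb⟩ := exists_barrier (d := d) (rate C m) m β
  obtain ⟨bx', hb'⟩ := exists_barrier (d := d) (rate C m') m' 1
  have hbb := (hb.const_mul M).add (hb'.const_mul ε)
  set K : Set (TX d) := Icc 0 S ×ˢ Icc (fun _ => R⁻¹) (fun _ => R)
  have hR0 : 0 < R⁻¹ := by positivity
  have hKp : ∀ y ∈ K, y.2 ∈ posOrth d := fun y hy i => hR0.trans_le (hy.2.1 i)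
  have key := IsSol.lt_of_super (K := K) (S := S) (isOpen_slab S')
    (fun y hy => (hA.pd y hy.1 hy.2.2).spsd) hw (hbb.mono fun y hy => hy.2.2) (fun y hy => ?_)
    (isCompact_Icc.prod isCompact_Icc) (hc.mono fun y hy => ⟨hy.1.1, hy.1.2, hKp y hy⟩)
    (hbb.cu.mono fun y hy => hKp y hy) (fun y hy hyS => ?_) (fun y hy hy' => ?_) z
    ⟨hz0, hzS.trans_lt hS, hx⟩ hzS
  · have : ε * barrier (rate C m') m' 1 z = η := by simp only [ε]; field_simp
    linarith
  · have h1 := hA.super hy.1 hy.2.2 m hβ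
    have h2 := hA.super hy.1 hy.2.2 m' zero_le_one
    simp only [mul_add, Finset.sum_add_distrib, mul_left_comm _ M, mul_left_comm _ ε,
      ← Finset.mul_sum] at h1 h2 ⊢
    nlinarith
  · by_cases hyK : y ∈ K
    · exact Or.inl hyK
    · right
      have : ∃ i, y.2 i < R⁻¹ ∨ R < y.2 i := by
        by_contra! h
        exact hyK ⟨⟨hy.1.le, hyS⟩, fun i => (h i).1, fun i => (h i).2⟩
      have h1 := hdom y.2 hy.2.2 this
      have h2 := hg y hy.1.le hyS hy.2.2
      have h3 := growth_le_barrier (m := m') (rate_pos hA.nonneg m').le zero_le_one hy.1.le hy.2.2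
      have h4 := mul_nonneg hM (barrier_pos (rate C m) m hβ hy.2.2).le
      have h5 := mul_le_mul_of_nonneg_left h3 hε.le
      linarith
  · have hy0 : y.1 = 0 := by
      by_contra h
      exact hy' ⟨lt_of_le_of_ne hy.1.1 (Ne.symm h), hy.1.2.trans_lt hS, hKp y hy⟩
    have e : y = (0, y.2) := Prod.ext hy0 rfl
    have h1 := h0 y.2 (hKp y hy)
    have h2 := mul_pos hε (barrier_pos (rate C m') m' zero_le_one (hKp y hy))
    rw [e] at h2 ⊢
    rw [barrier_zero (rate C m)]
    linarith

/-- Comparison for solutions of polynomial growth. -/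
theorem IsSol.abs_le_barrier {A : TX d → Fin d → Fin d → ℝ} {C : ℝ} (hA : Coeff A C) {w : TX d → ℝ}
    {S S' : ℝ} (hS : S < S') (hw : IsSol {z : TX d | 0 < z.1 ∧ z.1 < S' ∧ z.2 ∈ posOrth d} A w)
    (hc : ContinuousOn w {z : TX d | 0 ≤ z.1 ∧ z.1 ≤ S ∧ z.2 ∈ posOrth d}) {B q : ℝ} (hB : 0 ≤ B)
    (hq : 0 < q)
    (hg : ∀ z : TX d, 0 ≤ z.1 → z.1 ≤ S → z.2 ∈ posOrth d → |w z| ≤ B * (1 + ‖z.2‖ ^ q))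
    {M β : ℝ} {m : ℕ} (hM : 0 ≤ M) (hβ : 0 ≤ β)
    (h0 : ∀ x ∈ posOrth d, |w (0, x)| ≤ M * growth m β x)
    (z : TX d) (hz0 : 0 ≤ z.1) (hzS : z.1 ≤ S) (hx : z.2 ∈ posOrth d) :
    |w z| ≤ M * barrier (rate C m) m β z := by
  have h1 := IsSol.le_barrier hA hS hw hc hB hq
    (fun z a b c => (le_abs_self _).trans (hg z a b c)) hM hβ
    (fun x hx => (le_abs_self _).trans (h0 x hx)) z hz0 hzS hx
  have h2 := IsSol.le_barrier hA hS (hw.neg (isOpen_slab S')) (continuousOn_const.mul hc) hB hq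
    (fun z a b c => by
      rw [neg_one_mul]; exact (neg_le_abs _).trans (hg z a b c)) hM hβ
    (fun x hx => by rw [neg_one_mul]; exact (neg_le_abs _).trans (h0 x hx)) z hz0 hzS hx
  exact abs_le.2 ⟨by linarith, h1⟩

lemma exists_locally_uniform_limit {D : Set (TX d)} {g : ℕ → TX d → ℝ}
    (h : ∀ z₀ ∈ D, ∃ W ∈ 𝓝 z₀, ∀ ε > 0, ∃ N, ∀ n ≥ N, ∀ k ≥ N, ∀ z ∈ W ∩ D,
      |g n z - g k z| ≤ ε) : ∃ G, TendstoLocallyUniformlyOn g G atTop D := by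
  choose! W hW hg using h
  choose! G hG using fun z₀ (hz₀ : z₀ ∈ D) => exists_uniform_limit (hg z₀ hz₀)
  have hG' : ∀ z₀ ∈ D, TendstoUniformlyOn g (fun z => G z z) atTop (W z₀ ∩ D) := fun z₀ hz₀ =>
    (hG z₀ hz₀).congr_right fun z hz => tendsto_nhds_unique ((hG z₀ hz₀).tendsto_at hz)
      ((hG z hz.2).tendsto_at ⟨mem_of_mem_nhds (hW z hz.2), hz.2⟩)
  refine ⟨fun z => G z z, fun u hu z hz => ⟨W z ∩ D, ?_, hG' z hz u hu⟩⟩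
  exact Filter.inter_mem (mem_nhdsWithin_of_mem_nhds (hW z hz)) self_mem_nhdsWithin

lemma continuousOn_barrier (κ : ℝ) (m : ℕ) (β : ℝ) :
    ContinuousOn (barrier κ m β) {z : TX d | z.2 ∈ posOrth d} := by
  obtain ⟨_, h⟩ := exists_barrier (d := d) κ m β
  exact h.cu

lemma isOpen_interior_domain : IsOpen {z : TX d | 0 < z.1 ∧ z.2 ∈ posOrth d} :=
  (isOpen_lt continuous_const continuous_fst).inter (isOpen_posOrth.preimage continuous_snd)

/-- Limits of solutions which are Cauchy in a weighted norm. -/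
lemma Coeff.exists_limit {A : TX d → Fin d → Fin d → ℝ} {C : ℝ} (hA : Coeff A C)
    {g : ℕ → TX d → ℝ} {κ : ℝ} {m : ℕ}
    (hg : ∀ S : ℝ, 0 ≤ S → ∃ M : ℝ, 0 ≤ M ∧ ∀ n k : ℕ, n ≤ k → S < n + 1 → ∀ z : TX d, 0 ≤ z.1 →
      z.1 ≤ S → z.2 ∈ posOrth d → |g n z - g k z| ≤ M / (n + 1) * barrier κ m 1 z)
    (hc : ∀ n, ContinuousOn (g n) {z : TX d | 0 ≤ z.1 ∧ z.2 ∈ posOrth d})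
    (hsol : ∀ z ∈ {z : TX d | 0 < z.1 ∧ z.2 ∈ posOrth d}, ∃ W ∈ 𝓝 z,
      ∀ᶠ n in atTop, IsSol W A (g n)) :
    ∃ v, IsSol {z : TX d | 0 < z.1 ∧ z.2 ∈ posOrth d} A v ∧
      ContinuousOn v {z : TX d | 0 ≤ z.1 ∧ z.2 ∈ posOrth d} ∧
      ∀ z : TX d, 0 ≤ z.1 → z.2 ∈ posOrth d → Tendsto (fun n => g n z) atTop (𝓝 (v z)) := by
  have H := exists_locally_uniform_limit (D := {z : TX d | 0 ≤ z.1 ∧ z.2 ∈ posOrth d})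
    (g := g) fun z₀ hz₀ => ?_
  · obtain ⟨v, hv⟩ := H
    refine ⟨v, IsSol.of_tendsto isOpen_interior_domain (fun z hz => hA.holder z hz.1 hz.2)
      (fun z hz => hA.pd z hz.1 hz.2) hsol (hv.mono fun z hz => ⟨hz.1.le, hz.2⟩),
      hv.continuousOn (Frequently.of_forall hc), fun z h0 hx => hv.tendsto_at ⟨h0, hx⟩⟩
  · have hbc : ContinuousAt (barrier κ m 1) z₀ := (continuousOn_barrier κ m 1).continuousAt
      ((isOpen_posOrth.preimage continuous_snd).mem_nhds hz₀.2)
    obtain ⟨M, hM0, hM⟩ := hg (z₀.1 + 1) (by linarith [hz₀.1])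
    have hb0 := barrier_pos κ m zero_le_one hz₀.2
    refine ⟨{z | barrier κ m 1 z < barrier κ m 1 z₀ + 1} ∩ {z | z.1 < z₀.1 + 1},
      Filter.inter_mem (hbc.eventually_lt_const (lt_add_one _))
      ((isOpen_lt continuous_fst continuous_const).mem_nhds (lt_add_one z₀.1)), fun ε hε => ?_⟩
    obtain ⟨N, hN⟩ := exists_nat_gt (max (z₀.1 + 1) (M * (barrier κ m 1 z₀ + 1) / ε))
    have key : ∀ n ≥ N, ∀ k ≥ n, ∀ z ∈ ({z | barrier κ m 1 z < barrier κ m 1 z₀ + 1} ∩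
        {z | z.1 < z₀.1 + 1}) ∩ {z : TX d | 0 ≤ z.1 ∧ z.2 ∈ posOrth d},
        |g n z - g k z| ≤ ε := fun n hn k hk z hz => by
      have hn' : (N : ℝ) ≤ n := by exact_mod_cast hn
      have h1 := (le_max_left _ _).trans_lt hN
      have h2 := (le_max_right _ _).trans_lt hN
      rw [div_lt_iff₀ hε] at h2
      refine (hM n k hk (by linarith) z hz.2.1 hz.1.2.le hz.2.2).trans ?_
      rw [div_mul_eq_mul_div, div_le_iff₀ (by positivity)]
      have h3 := mul_le_mul_of_nonneg_left (le_of_lt hz.1.1) hM0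
      have h4 := mul_le_mul_of_nonneg_right hn' hε.le
      linarith
    refine ⟨N, fun n hn k hk z hz => ?_⟩
    rcases le_total n k with h | h
    · exact key n hn k h z hz
    · rw [abs_sub_comm]; exact key k hk n h z hz

lemma exists_source_bound {f : (Fin d → ℝ) → ℝ} (hf : ContDiff ℝ ∞ f) (hfc : HasCompactSupport f)
    (C : ℝ) : ∃ C₀ : ℝ, ∀ (α : Fin d → Fin d → ℝ) (x : Fin d → ℝ),
      (∀ i j, |α i j| ≤ 1 + C * ‖x‖ ^ 2) → |1 / 2 * ∑ i, ∑ j, α i j * pd2 f i j x| ≤ C₀ := by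
  have hb : ∀ i j, ∃ b, ∀ x, ‖(1 + C * ‖x‖ ^ 2) * pd2 f i j x‖ ≤ b := fun i j =>
    ((hfc.pd2 i j).mul_left (f := fun x => 1 + C * ‖x‖ ^ 2)).exists_bound_of_continuous
      (by have := (hf.pd2 i j).continuous; fun_prop)
  choose b hb using hb
  refine ⟨1 / 2 * ∑ i, ∑ j, b i j, fun α x hα => ?_⟩
  rw [abs_mul, abs_of_nonneg (by norm_num : (0 : ℝ) ≤ 1 / 2)]
  refine mul_le_mul_of_nonneg_left ?_ (by norm_num)
  refine (Finset.abs_sum_le_sum_abs _ _).trans (Finset.sum_le_sum fun i _ => ?_)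
  refine (Finset.abs_sum_le_sum_abs _ _).trans (Finset.sum_le_sum fun j _ => ?_)
  refine le_trans ?_ (hb i j x)
  rw [Real.norm_eq_abs, abs_mul, abs_mul]
  exact mul_le_mul_of_nonneg_right ((hα i j).trans (le_abs_self _)) (abs_nonneg _)

/-- Open boxes exhausting the domain. -/
def cell (d : ℕ) (R : ℝ) : Set (TX d) :=
  {z | R⁻¹ < z.1 ∧ z.1 < R ∧ ∀ i, R⁻¹ < z.2 i ∧ z.2 i < R}

lemma isOpen_cell (R : ℝ) : IsOpen (cell d R) := by
  have : cell d R = {z : TX d | R⁻¹ < z.1} ∩ ({z | z.1 < R} ∩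
      ⋂ i, ({z : TX d | R⁻¹ < z.2 i} ∩ {z | z.2 i < R})) := by
    ext z; simp [cell]
  rw [this]
  refine (isOpen_lt continuous_const continuous_fst).inter
    ((isOpen_lt continuous_fst continuous_const).inter (isOpen_iInter_of_finite fun i => ?_))
  exact (isOpen_lt (by fun_prop) (by fun_prop)).inter (isOpen_lt (by fun_prop) (by fun_prop))

lemma cell_mono {R R' : ℝ} (hR : 0 < R) (h : R ≤ R') : cell d R ⊆ cell d R' := fun z hz => by
  have := inv_anti₀ hR h
  exact ⟨this.trans_lt hz.1, hz.2.1.trans_le h, fun i =>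
    ⟨this.trans_lt (hz.2.2 i).1, (hz.2.2 i).2.trans_le h⟩⟩

lemma cell_pos {R : ℝ} (hR : 0 < R) {z : TX d} (hz : z ∈ cell d R) :
    0 < z.1 ∧ z.2 ∈ posOrth d :=
  ⟨(inv_pos.2 hR).trans hz.1, fun i => (inv_pos.2 hR).trans (hz.2.2 i).1⟩

lemma exists_mem_cell {z : TX d} (h0 : 0 < z.1) (hx : z.2 ∈ posOrth d) :
    ∃ N : ℕ, ∀ n ≥ N, z ∈ cell d (n + 1) := by
  have h : ∀ᶠ n : ℕ in atTop, z ∈ cell d (n + 1) := by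
    have hinf : Tendsto (fun n : ℕ => (n : ℝ) + 1) atTop atTop :=
      tendsto_atTop_add_const_right _ _ tendsto_natCast_atTop_atTop
    have hinv := tendsto_inv_atTop_zero.comp hinf
    have hi : ∀ i, ∀ᶠ n : ℕ in atTop, ((n : ℝ) + 1)⁻¹ < z.2 i ∧ z.2 i < n + 1 := fun i =>
      (hinv.eventually_lt_const (hx i)).and (hinf.eventually_gt_atTop _)
    filter_upwards [hinv.eventually_lt_const h0, hinf.eventually_gt_atTop z.1,
      eventually_all.2 hi] with n a b c
    exact ⟨a, b, c⟩
  exact eventually_atTop.1 h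

lemma Coeff.abs_le_of_cell {A : TX d → Fin d → Fin d → ℝ} {C : ℝ} (hA : Coeff A C) {w : TX d → ℝ}
    {R S L : ℝ} (hR : 0 < R) (hSR : S < R) (hS : 0 ≤ S) (hL : 0 ≤ L) (hw : IsSol (cell d R) A w)
    (hc : Continuous w) (hwL : ∀ z : TX d, 0 ≤ z.1 → |w z| ≤ L * z.1) (z : TX d) (hz0 : 0 ≤ z.1)
    (hzS : z.1 ≤ S) (hx : z.2 ∈ posOrth d) :
    |w z| ≤ (L * (1 + S) + 1) / R * barrier (rate C 1) 1 1 z := by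
  set M := L * (1 + S) + 1 with hMdef
  have hLS : 0 ≤ L * S := mul_nonneg hL hS
  have hM : 0 < M := by rw [hMdef]; nlinarith
  have hRi : 0 < R⁻¹ := inv_pos.2 hR
  have hoff : ∀ y : TX d, 0 ≤ y.1 → y.1 ≤ S → y.2 ∈ posOrth d → y ∉ cell d R →
      |w y| < M / R * barrier (rate C 1) 1 1 y := fun y hy0 hyS hy hyc => by
    have h1 := growth_le_barrier (m := 1) (rate_pos hA.nonneg 1).le zero_le_one hy0 hy
    have h2 := hwL y hy0
    have h3 := one_le_growth (m := 1) zero_le_one hy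
    have hMR : 0 < M / R := by positivity
    by_cases hy1 : y.1 ≤ R⁻¹
    · calc |w y| ≤ L * R⁻¹ := h2.trans (mul_le_mul_of_nonneg_left hy1 hL)
        _ < M * R⁻¹ := mul_lt_mul_of_pos_right (by rw [hMdef]; nlinarith) hRi
        _ = M / R * 1 := by rw [mul_one, div_eq_mul_inv]
        _ ≤ _ := mul_le_mul_of_nonneg_left (h3.trans h1) hMR.le
    · have h4 : ∃ i, y.2 i ≤ R⁻¹ ∨ R ≤ y.2 i := by
        by_contra! h
        exact hyc ⟨not_le.1 hy1, hyS.trans_lt hSR, h⟩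
      obtain ⟨i, hi⟩ := h4
      have h5 := term_le_growth (m := 1) zero_le_one hy i
      have hyi : 0 < y.2 i := hy i
      simp only [pow_one, one_mul] at h5
      have h6 : R ≤ growth 1 1 y.2 := by
        have : 0 < (y.2 i)⁻¹ := inv_pos.2 hyi
        rcases hi with hi | hi
        · have := inv_anti₀ hyi hi
          rw [inv_inv] at this
          linarith
        · linarith
      calc |w y| ≤ L * S := h2.trans (mul_le_mul_of_nonneg_left hyS hL)
        _ < M := by rw [hMdef]; nlinarith
        _ = M / R * R := by field_simp
        _ ≤ _ := mul_le_mul_of_nonneg_left (h6.trans h1) hMR.le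
  by_cases hzc : z ∈ cell d R
  swap
  · exact (hoff z hz0 hzS hx hzc).le
  obtain ⟨bx, hb⟩ := exists_barrier (d := d) (rate C 1) 1 1
  have hb' := hb.const_mul (M / R)
  have hbs : ∀ y ∈ cell d R, 1 / 2 * ∑ i, ∑ j, A y i j * (M / R * (if i = j then
      Real.exp (rate C 1 * y.1) * (((1 : ℕ) * ((1 : ℕ) - 1) * y.2 i ^ 1 + 1 *
        ((1 : ℕ) * ((1 : ℕ) + 1) * (y.2 i ^ 1)⁻¹)) * (y.2 i ^ 2)⁻¹) else 0)) <
      M / R * (rate C 1 * barrier (rate C 1) 1 1 y) := fun y hy => by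
    have h1 := hA.super (cell_pos hR hy).1 (cell_pos hR hy).2 1 zero_le_one
    have hMR : 0 < M / R := by positivity
    have := mul_lt_mul_of_pos_left h1 hMR
    refine lt_of_eq_of_lt ?_ this
    simp only [mul_left_comm _ (M / R), ← Finset.mul_sum]
  set K : Set (TX d) := Icc R⁻¹ S ×ˢ Icc (fun _ => R⁻¹) (fun _ => R)
  have hKp : ∀ y ∈ K, y.2 ∈ posOrth d := fun y hy i => hRi.trans_le (hy.2.1 i)
  have key : ∀ u : TX d → ℝ, IsSol (cell d R) A u → Continuous u → (∀ y, u y ≤ |w y|) →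
      u z < M / R * barrier (rate C 1) 1 1 z := fun u hu huc huw =>
    IsSol.lt_of_super (K := K) (isOpen_cell R)
      (fun y hy => (hA.pd y (cell_pos hR hy).1 (cell_pos hR hy).2).spsd) hu
      (hb'.mono fun y hy => (cell_pos hR hy).2) hbs
      (isCompact_Icc.prod isCompact_Icc) huc.continuousOn (hb'.cu.mono fun y hy => hKp y hy)
      (fun y hy hyS => Or.inl ⟨⟨hy.1.le, hyS⟩, fun i => (hy.2.2 i).1.le, fun i => (hy.2.2 i).2.le⟩)
      (fun y hy hyc => (huw y).trans_lt
        (hoff y (hRi.le.trans hy.1.1) hy.1.2 (hKp y hy) hyc)) z hzc hzS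
  have h1 := key w hw hc fun y => le_abs_self _
  have h2 := key _ (hw.neg (isOpen_cell R)) (by fun_prop) fun y => by
    rw [neg_one_mul]; exact neg_le_abs _
  exact abs_le.2 ⟨by linarith, h1.le⟩

/-- Solvability of the initial value problem on the orthant for smooth compactly supported data. -/
theorem Coeff.exists_solution_of_smooth {A : TX d → Fin d → Fin d → ℝ} {C : ℝ} (hA : Coeff A C)
    {f : (Fin d → ℝ) → ℝ} (hf : ContDiff ℝ ∞ f) (hfc : HasCompactSupport f) :
    ∃ v, IsSol {z : TX d | 0 < z.1 ∧ z.2 ∈ posOrth d} A v ∧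
      ContinuousOn v {z : TX d | 0 ≤ z.1 ∧ z.2 ∈ posOrth d} ∧
      ∃ C₀ : ℝ, 0 ≤ C₀ ∧ ∀ z : TX d, 0 ≤ z.1 → z.2 ∈ posOrth d → |v z - f z.2| ≤ C₀ * z.1 := by
  obtain ⟨C₀, hC₀⟩ := exists_source_bound hf hfc C
  have hC₀0 : 0 ≤ C₀ := (abs_nonneg _).trans (hC₀ 0 0 fun i j => by simp)
  have hv : ∀ n : ℕ, ∃ v, IsSol (cell d (n + 1)) A v ∧ Continuous v ∧
      ∀ z : TX d, 0 ≤ z.1 → |v z - f z.2| ≤ C₀ * z.1 := fun n => by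
    have hn : (1 : ℝ) ≤ n + 1 := by simp
    have hn0 : (0 : ℝ) < n + 1 := by positivity
    have hni : ((n : ℝ) + 1)⁻¹ ≤ n + 1 := (inv_le_one_of_one_le₀ hn).trans hn
    have hni0 : 0 < ((n : ℝ) + 1)⁻¹ := by positivity
    obtain ⟨A', K', hK', hH', hpd', hout', heq', hbd'⟩ := exists_coeff_extension
      (K := Icc ((n : ℝ) + 1)⁻¹ (n + 1) ×ˢ Icc (fun _ => ((n : ℝ) + 1)⁻¹) (fun _ => n + 1))
      (isCompact_Icc.prod isCompact_Icc)
      ⟨(1, fun _ => 1), ⟨inv_le_one_of_one_le₀ hn, hn⟩, fun _ => inv_le_one_of_one_le₀ hn,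
        fun _ => hn⟩ isOpen_interior_domain
      (fun z hz => ⟨hni0.trans_le hz.1.1, fun i => hni0.trans_le (hz.2.1 i)⟩)
      (fun z hz => hA.holder z hz.1 hz.2) (fun z hz => hA.pd z hz.1 hz.2)
    have H := exists_approx_solution hK' hH' hpd' hout' hf hfc
      (C₀ := C₀) (fun z => hC₀ _ _ fun i j => ?_) hni0
    · obtain ⟨v, hv, hvc, hvf⟩ := H
      refine ⟨v, (hv.mono fun z hz => hz.1).congr_coeff fun z hz => ?_, hvc, hvf⟩
      exact (heq' z ⟨⟨hz.1.le, hz.2.1.le⟩, fun i => (hz.2.2 i).1.le, fun i => (hz.2.2 i).2.le⟩).symm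
    · have hCx := mul_nonneg hA.nonneg (sq_nonneg ‖z.2‖)
      rcases hbd' z i j with h | ⟨hz, h⟩
      · linarith
      · have h1 := hA.bdd z hz.1 hz.2 i j
        have h2 : z.2 i ≤ ‖z.2‖ := (le_abs_self _).trans (norm_le_pi_norm z.2 i)
        have h3 : z.2 j ≤ ‖z.2‖ := (le_abs_self _).trans (norm_le_pi_norm z.2 j)
        have h4 : z.2 i * z.2 j ≤ ‖z.2‖ ^ 2 := by
          rw [sq]; exact mul_le_mul h2 h3 (hz.2 j).le (norm_nonneg _)
        have h5 := mul_le_mul_of_nonneg_left h4 hA.nonneg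
        linarith
  choose v hv hvc hvf using hv
  have H := hA.exists_limit (g := v) (κ := rate C 1) (m := 1)
    (fun S hS => ⟨2 * C₀ * (1 + S) + 1, by positivity, fun n k hnk hSn z hz0 hzS hx => ?_⟩)
    (fun n => (hvc n).continuousOn) (fun z hz => ?_)
  · obtain ⟨u, hu, huc, hut⟩ := H
    refine ⟨u, hu, huc, C₀, hC₀0, fun z hz0 hx => ?_⟩
    exact le_of_tendsto ((hut z hz0 hx).sub_const _).abs (Eventually.of_forall fun n => hvf n z hz0)
  · have hkn : (n : ℝ) + 1 ≤ k + 1 := by simpa using hnk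
    refine hA.abs_le_of_cell (by positivity) hSn hS (by positivity)
      ((hv n).sub (isOpen_cell _) ((hv k).mono (cell_mono (by positivity) hkn)))
      ((hvc n).sub (hvc k)) (fun y hy => ?_) z hz0 hzS hx
    have h1 := abs_le.1 (hvf n y hy)
    have h2 := abs_le.1 (hvf k y hy)
    exact abs_le.2 ⟨by linarith, by linarith⟩
  · obtain ⟨N, hN⟩ := exists_mem_cell hz.1 hz.2
    refine ⟨cell d (N + 1), (isOpen_cell _).mem_nhds (hN N le_rfl), ?_⟩
    filter_upwards [eventually_ge_atTop N] with n hn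
    exact (hv n).mono (cell_mono (by positivity) (by simpa using hn))

lemma exists_smooth_approx {g : (Fin d → ℝ) → ℝ} (hg : Continuous g) (hgc : HasCompactSupport g)
    {ε : ℝ} (hε : 0 < ε) : ∃ h : (Fin d → ℝ) → ℝ, ContDiff ℝ ∞ h ∧ HasCompactSupport h ∧
      ∀ x, |h x - g x| ≤ ε := by
  obtain ⟨δ, hδ, hgδ⟩ := Metric.uniformContinuous_iff.1
    (hgc.uniformContinuous_of_continuous hg) ε hε
  obtain ⟨h, hh, hhg⟩ := hg.exists_contDiff_dist_le_of_forall_mem_ball_dist_le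
    (lt_min hδ one_pos)
  refine ⟨h, hh, HasCompactSupport.intro (hgc.isCompact.cthickening (r := 1)) fun x hx => ?_,
    fun x => ?_⟩
  · have h0 : ∀ y ∈ Metric.ball x (min δ 1), g y = 0 := fun y hy => by
      by_contra hne
      refine hx (Metric.mem_cthickening_of_dist_le x y 1 _ (subset_tsupport _ hne) ?_)
      rw [dist_comm]
      exact (Metric.mem_ball.1 hy).le.trans (min_le_right _ _)
    have hx0 := h0 x (Metric.mem_ball_self (lt_min hδ one_pos))
    have := hhg x 0 fun y hy => by rw [h0 y hy, hx0, dist_self]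
    rw [hx0] at this
    exact dist_le_zero.1 this
  · rw [← Real.dist_eq]
    exact hhg x ε fun y hy => (hgδ ((Metric.mem_ball.1 hy).trans_le (min_le_left _ _))).le

lemma exists_data_approx {f : (Fin d → ℝ) → ℝ} (hf : ContinuousOn f (posOrth d)) {c₀ p : ℝ}
    (hc₀ : 0 ≤ c₀) (hp : 0 < p) (hfg : ∀ x ∈ posOrth d, |f x| ≤ c₀ * (1 + ‖x‖ ^ p)) {m : ℕ}
    (hm : p + 1 ≤ m) {ε : ℝ} (hε : 0 < ε) (hε1 : ε ≤ 1) :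
    ∃ h : (Fin d → ℝ) → ℝ, ContDiff ℝ ∞ h ∧ HasCompactSupport h ∧
      ∀ x ∈ posOrth d, |h x - f x| ≤ ε * growth m 1 x ∧ |h x| ≤ |f x| + 1 := by
  obtain ⟨R, hR, hdom⟩ := growth_dominates (d := d) hp hc₀ hm (half_pos hε)
  have hR0 : 0 < R⁻¹ := by positivity
  obtain ⟨χ, K', L, hK', hK'Ω, hL, hχ, hχ1, hχ0, hχL⟩ := exists_lipschitz_cutoff
    (K := Icc (fun _ : Fin d => R⁻¹) (fun _ => R)) isCompact_Icc
    ⟨fun _ => 1, fun _ => inv_le_one_of_one_le₀ hR, fun _ => hR⟩ isOpen_posOrth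
    fun x hx i => hR0.trans_le (hx.1 i)
  have hχc : Continuous χ := (LipschitzWith.of_dist_le_mul (K := ⟨L, hL⟩) fun x y => by
    rw [Real.dist_eq]; exact hχL x y).continuous
  have hgc : Continuous fun x => χ x * f x := by
    refine continuous_iff_continuousAt.2 fun x => ?_
    by_cases hx : x ∈ posOrth d
    · exact hχc.continuousAt.mul (hf.continuousAt (isOpen_posOrth.mem_nhds hx))
    · have hx' : x ∈ K'ᶜ := fun h => hx (hK'Ω h)
      refine (continuousAt_const (y := (0 : ℝ))).congr ?_
      filter_upwards [hK'.isClosed.isOpen_compl.mem_nhds hx'] with y hy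
      rw [hχ0 y hy, zero_mul]
  obtain ⟨h, hh, hhc, hhg⟩ := exists_smooth_approx hgc
    (HasCompactSupport.intro hK' fun x hx => by rw [hχ0 x hx, zero_mul]) (half_pos hε)
  refine ⟨h, hh, hhc, fun x hx => ⟨?_, ?_⟩⟩
  · have h1 : |χ x * f x - f x| ≤ ε / 2 * growth m 1 x := by
      have h0 := one_le_growth (m := m) zero_le_one hx
      by_cases hxK : x ∈ Icc (fun _ : Fin d => R⁻¹) (fun _ => R)
      · rw [hχ1 x hxK, one_mul, sub_self, abs_zero]; positivity
      · have : ∃ i, x i < R⁻¹ ∨ R < x i := by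
          by_contra! h
          exact hxK ⟨fun i => (h i).1, fun i => (h i).2⟩
        have h2 := hdom x hx this
        have h3 : χ x * f x - f x = -((1 - χ x) * f x) := by ring
        rw [h3, abs_neg, abs_mul, abs_of_nonneg (by linarith [(hχ x).2])]
        have h4 : (1 - χ x) * |f x| ≤ 1 * |f x| :=
          mul_le_mul_of_nonneg_right (by linarith [(hχ x).1]) (abs_nonneg _)
        linarith [hfg x hx]
    have h0 := one_le_growth (m := m) zero_le_one hx
    have h2 := abs_sub_le (h x) (χ x * f x) (f x)
    have h3 := hhg x
    nlinarith
  · have h1 : |χ x * f x| ≤ 1 * |f x| := by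
      rw [abs_mul, abs_of_nonneg (hχ x).1]
      exact mul_le_mul_of_nonneg_right (hχ x).2 (abs_nonneg _)
    have h2 := abs_sub_abs_le_abs_sub (h x) (χ x * f x)
    linarith [hhg x]

/-- Solvability of the initial value problem on the orthant for data of polynomial growth. -/
theorem Coeff.exists_solution {A : TX d → Fin d → Fin d → ℝ} {C : ℝ} (hA : Coeff A C)
    {f : (Fin d → ℝ) → ℝ} (hf : ContinuousOn f (posOrth d)) {c₀ p : ℝ}
    (hc₀ : 0 ≤ c₀) (hp : 0 < p) (hfg : ∀ x ∈ posOrth d, |f x| ≤ c₀ * (1 + ‖x‖ ^ p)) :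
    ∃ v, IsSol {z : TX d | 0 < z.1 ∧ z.2 ∈ posOrth d} A v ∧
      ContinuousOn v {z : TX d | 0 ≤ z.1 ∧ z.2 ∈ posOrth d} ∧ (∀ x ∈ posOrth d, v (0, x) = f x) ∧
      ∀ S : ℝ, ∃ B q : ℝ, 0 < B ∧ 0 < q ∧ ∀ z : TX d, 0 ≤ z.1 → z.1 ≤ S → z.2 ∈ posOrth d →
        |v z| ≤ B * (1 + ‖z.2‖ ^ q) := by
  obtain ⟨m, hm⟩ := exists_nat_ge (p + 1)
  have hε : ∀ n : ℕ, (0 : ℝ) < 1 / (n + 1) ∧ (1 : ℝ) / (n + 1) ≤ 1 := fun n =>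
    ⟨by positivity, by rw [div_le_one (by positivity)]; simp⟩
  choose h hh hhc hhf using fun n : ℕ =>
    exists_data_approx hf hc₀ hp hfg hm (hε n).1 (hε n).2
  choose v hv hvc L hL hvL using fun n : ℕ => hA.exists_solution_of_smooth (hh n) (hhc n)
  have hv0 : ∀ n, ∀ x ∈ posOrth d, v n (0, x) = h n x := fun n x hx => by
    have := hvL n (0, x) le_rfl hx
    simp only [mul_zero] at this
    exact sub_eq_zero.1 (abs_nonpos_iff.1 this)
  have hbd : ∀ n S, ∃ B : ℝ, 0 ≤ B ∧ ∀ z : TX d, 0 ≤ z.1 → z.1 ≤ S → z.2 ∈ posOrth d →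
      |v n z| ≤ B := fun n S => by
    obtain ⟨b, hb⟩ := (hhc n).exists_bound_of_continuous (hh n).continuous
    refine ⟨b + L n * |S|, add_nonneg ((norm_nonneg _).trans (hb 0))
      (mul_nonneg (hL n) (abs_nonneg _)), fun z h0 hS hx => ?_⟩
    have h1 := hb z.2
    rw [Real.norm_eq_abs] at h1
    have h2 := (hvL n z h0 hx).trans
      (mul_le_mul_of_nonneg_left (hS.trans (le_abs_self S)) (hL n))
    have h3 := abs_sub_abs_le_abs_sub (v n z) (h n z.2)
    linarith
  have hslab : ∀ S : ℝ, {z : TX d | 0 < z.1 ∧ z.1 < S ∧ z.2 ∈ posOrth d} ⊆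
      {z | 0 < z.1 ∧ z.2 ∈ posOrth d} := fun S z hz => ⟨hz.1, hz.2.2⟩
  have hslab' : ∀ S : ℝ, {z : TX d | 0 ≤ z.1 ∧ z.1 ≤ S ∧ z.2 ∈ posOrth d} ⊆
      {z | 0 ≤ z.1 ∧ z.2 ∈ posOrth d} := fun S z hz => ⟨hz.1, hz.2.2⟩
  have hrpow : ∀ (B : ℝ) (z : TX d), 0 ≤ B → B ≤ B * (1 + ‖z.2‖ ^ (1 : ℝ)) := fun B z hB => by
    rw [Real.rpow_one]; nlinarith [norm_nonneg z.2]
  have H := hA.exists_limit (g := v) (κ := rate C m) (m := m)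
    (fun S hS => ⟨2, by norm_num, fun n k hnk _ z hz0 hzS hx => ?_⟩) hvc
    (fun z hz => ⟨_, isOpen_interior_domain.mem_nhds hz, Eventually.of_forall hv⟩)
  · obtain ⟨u, hu, huc, hut⟩ := H
    have hhn : ∀ x ∈ posOrth d, Tendsto (fun n => h n x) atTop (𝓝 (f x)) := fun x hx => by
      refine tendsto_iff_dist_tendsto_zero.2 (squeeze_zero (fun _ => dist_nonneg)
        (fun n => (hhf n x hx).1) ?_)
      simpa using tendsto_one_div_add_atTop_nhds_zero_nat.mul_const (growth m 1 x)
    refine ⟨u, hu, huc, fun x hx => tendsto_nhds_unique (hut (0, x) le_rfl hx) ?_, fun S => ?_⟩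
    · simpa only [hv0 _ x hx] using hhn x hx
    · have hmp : p ≤ m := by linarith
      have hm0 : (0 : ℝ) < m := by linarith
      refine ⟨(2 * c₀ + 1) * (Real.exp (rate C m * S) * (1 + d)), m, by positivity, hm0,
        fun z hz0 hzS hx => le_of_tendsto (hut z hz0 hx).abs (Eventually.of_forall fun n => ?_)⟩
      obtain ⟨B, hB, hvB⟩ := hbd n S
      have h1 := IsSol.abs_le_barrier (M := 2 * c₀ + 1) (β := 0) (m := m) hA (lt_add_one S)
        ((hv n).mono (hslab _)) ((hvc n).mono (hslab' _)) hB one_pos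
        (fun z a b c => (hvB z a b c).trans (hrpow B z hB)) (by positivity) le_rfl
        (fun x hx => ?_) z hz0 hzS hx
      · rw [Real.rpow_natCast]
        refine h1.trans ?_
        rw [mul_assoc, mul_assoc]
        refine mul_le_mul_of_nonneg_left ?_ (by positivity)
        unfold barrier
        have h2 := growth_zero_le m hx
        have h3 : Real.exp (rate C m * z.1) ≤ Real.exp (rate C m * S) :=
          Real.exp_le_exp.2 (mul_le_mul_of_nonneg_left hzS (rate_pos hA.nonneg m).le)
        exact mul_le_mul h3 h2 (zero_le_one.trans (one_le_growth le_rfl hx)) (Real.exp_pos _).le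
      · rw [hv0 n x hx]
        have h1 := (hhf n x hx).2
        have h2 := mul_le_mul_of_nonneg_left
          (one_add_norm_rpow_le_growth hp hmp le_rfl hx) hc₀
        have h3 := one_le_growth (m := m) le_rfl hx
        linarith [hfg x hx]
  · obtain ⟨B, hB, hvB⟩ := hbd n S
    obtain ⟨B', hB', hvB'⟩ := hbd k S
    refine IsSol.abs_le_barrier hA (lt_add_one S)
      (((hv n).sub isOpen_interior_domain (hv k)).mono (hslab _))
      (((hvc n).sub (hvc k)).mono (hslab' _)) (add_nonneg hB hB') one_pos
      (fun z a b c => ?_) (by positivity) zero_le_one (fun x hx => ?_) z hz0 hzS hx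
    · refine le_trans ?_ (hrpow (B + B') z (add_nonneg hB hB'))
      linarith [abs_sub (v n z) (v k z), hvB z a b c, hvB' z a b c]
    · rw [hv0 n x hx, hv0 k x hx]
      have h1 := (hhf n x hx).1
      have h2 := (hhf k x hx).1
      have h3 : (1 : ℝ) / (k + 1) ≤ 1 / (n + 1) :=
        one_div_le_one_div_of_le (by positivity) (by simpa using hnk)
      have h4 := mul_le_mul_of_nonneg_right h3
        (zero_le_one.trans (one_le_growth (m := m) zero_le_one hx))
      have h5 := abs_sub_le (h n x) (f x) (h k x)
      rw [abs_sub_comm (f x)] at h5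
      have h6 : (2 : ℝ) / (n + 1) * growth m 1 x =
        1 / (n + 1) * growth m 1 x + 1 / (n + 1) * growth m 1 x := by ring
      linarith

lemma dist_rpow_isBigO {z : TX d} {α β : ℝ} (hβ : 0 ≤ β) (h : β ≤ α) :
    (fun p : TX d × TX d => dist p.1 p.2 ^ α) =O[𝓝 (z, z)] fun p => dist p.1 p.2 ^ β := by
  have hc : Tendsto (fun p : TX d × TX d => dist p.1 p.2) (𝓝 (z, z)) (𝓝 0) := by
    have : Continuous fun p : TX d × TX d => dist p.1 p.2 := by fun_prop
    simpa using this.tendsto (z, z)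
  refine Asymptotics.IsBigO.of_bound 1 ?_
  filter_upwards [hc.eventually_le_const one_pos] with p hp
  rw [Real.norm_of_nonneg (by positivity), Real.norm_of_nonneg (by positivity), one_mul]
  exact Real.rpow_le_rpow_of_exponent_ge' dist_nonneg hp hβ h

lemma HolderAt.of_isBigO {A : TX d → Fin d → Fin d → ℝ} {z : TX d}
    (h : ∀ i j, ∃ β : ℝ, 0 < β ∧ (fun p : TX d × TX d => A p.1 i j - A p.2 i j) =O[𝓝 (z, z)]
      fun p => dist p.1 p.2 ^ β) : HolderAt A z := by
  choose α hα h using h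
  obtain ⟨β, hβ, hβ0⟩ : ∃ β, (∀ i j, β ≤ α i j) ∧ β ∈ Ioi (0 : ℝ) := by
    refine Eventually.exists (f := 𝓝[>] 0) (Eventually.and ?_ self_mem_nhdsWithin)
    refine nhdsWithin_le_nhds (eventually_all.2 fun i => eventually_all.2 fun j => ?_)
    exact eventually_le_nhds (hα i j)
  have h' : ∀ i j, ∃ C, 0 ≤ C ∧ ∀ᶠ p : TX d × TX d in 𝓝 (z, z),
      |A p.1 i j - A p.2 i j| ≤ C * dist p.1 p.2 ^ β := fun i j => by
    obtain ⟨C, hC, hb⟩ := ((h i j).trans (dist_rpow_isBigO (le_of_lt hβ0) (hβ i j))).exists_nonneg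
    refine ⟨C, hC, hb.bound.mono fun p hp => ?_⟩
    rwa [Real.norm_eq_abs, Real.norm_of_nonneg (by positivity)] at hp
  choose C hC hb using h'
  have hall := eventually_all.2 fun i => eventually_all.2 fun j => hb i j
  obtain ⟨r, hr, hball⟩ := Metric.nhds_basis_closedBall.mem_iff.1 hall
  refine ⟨r, hr, β, hβ0, ∑ i, ∑ j, C i j,
    Finset.sum_nonneg fun i _ => Finset.sum_nonneg fun j _ => hC i j,
    fun i j w hw w' hw' => ?_⟩
  have hmem : (w, w') ∈ Metric.closedBall (z, z) r := by
    rw [← closedBall_prod_same]; exact ⟨hw, hw'⟩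
  refine (hball hmem i j).trans (mul_le_mul_of_nonneg_right ?_ (by positivity))
  calc C i j ≤ ∑ j, C i j :=
        Finset.single_le_sum (f := fun j => C i j) (fun j _ => hC i j) (Finset.mem_univ j)
    _ ≤ _ := Finset.single_le_sum (f := fun i => ∑ j, C i j)
        (fun i _ => Finset.sum_nonneg fun j _ => hC i j) (Finset.mem_univ i)

lemma isBigO_sub_mul {g h : TX d → ℝ} {z : TX d} {β : ℝ}
    (hg : (fun p : TX d × TX d => g p.1 - g p.2) =O[𝓝 (z, z)] fun p => dist p.1 p.2 ^ β)
    (hh : (fun p : TX d × TX d => h p.1 - h p.2) =O[𝓝 (z, z)] fun p => dist p.1 p.2 ^ β)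
    (hgc : ContinuousAt g z) (hhc : ContinuousAt h z) :
    (fun p : TX d × TX d => g p.1 * h p.1 - g p.2 * h p.2) =O[𝓝 (z, z)]
      fun p => dist p.1 p.2 ^ β := by
  have h1 : (fun p : TX d × TX d => h p.1) =O[𝓝 (z, z)] fun _ => (1 : ℝ) :=
    (hhc.comp_of_eq continuousAt_fst rfl : ContinuousAt (fun p : TX d × TX d => h p.1)
      (z, z)).tendsto.isBigO_one ℝ
  have h2 : (fun p : TX d × TX d => g p.2) =O[𝓝 (z, z)] fun _ => (1 : ℝ) :=
    (hgc.comp_of_eq continuousAt_snd rfl : ContinuousAt (fun p : TX d × TX d => g p.2)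
      (z, z)).tendsto.isBigO_one ℝ
  have h3 := hg.mul h1
  have h4 := h2.mul hh
  simp only [mul_one, one_mul] at h3 h4
  exact (h3.add h4).congr_left fun p => by ring

/-- The coefficients of the forward equation obtained by reversing time. -/
def reversed (T : ℝ) (a : ℝ → (Fin d → ℝ) → Fin d → Fin d → ℝ) (z : TX d) (i j : Fin d) : ℝ :=
  a (max (T - z.1) 0) z.2 i j * z.2 i * z.2 j

lemma reversed_coeff {T : ℝ} (hT : 0 < T) {a : ℝ → (Fin d → ℝ) → Fin d → Fin d → ℝ}
    (ha_symm : ∀ t ∈ Set.Icc (0 : ℝ) T, ∀ x ∈ posOrth d, ∀ i j, a t x i j = a t x j i)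
    (ha_pd : ∀ t ∈ Set.Icc (0 : ℝ) T, ∀ x ∈ posOrth d, ∀ y : Fin d → ℝ, y ≠ 0 →
      0 < ∑ i, ∑ j, a t x i j * y i * y j)
    (ha_bdd : ∃ Cb : ℝ, ∀ t ∈ Set.Icc (0 : ℝ) T, ∀ x ∈ posOrth d, ∀ i j, |a t x i j| ≤ Cb)
    (ha_holder : ∀ i j, LocallyHolderOn (fun p : ℝ × (Fin d → ℝ) => a p.1 p.2 i j)
      (Set.Ico 0 T ×ˢ posOrth d)) : ∃ C, Coeff (reversed T a) C := by
  obtain ⟨Cb, hCb⟩ := ha_bdd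
  have hmem : ∀ z : TX d, 0 < z.1 → max (T - z.1) 0 ∈ Ico 0 T := fun z hz =>
    ⟨le_max_right _ _, max_lt (by linarith) hT⟩
  have hmem' : ∀ z : TX d, 0 < z.1 → max (T - z.1) 0 ∈ Icc 0 T := fun z hz =>
    Ico_subset_Icc_self (hmem z hz)
  refine ⟨|Cb|, abs_nonneg _, fun z hz hx => HolderAt.of_isBigO fun i j => ?_, fun z hz hx => ?_,
    fun z hz hx i j => ?_⟩
  · set φ : TX d → TX d := fun w => (max (T - w.1) 0, w.2) with hφ
    have hφc : Continuous φ := by fun_prop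
    have hφd : ∀ w w', dist (φ w) (φ w') ≤ dist w w' := fun w w' => by
      refine max_le_max ?_ le_rfl
      rw [Real.dist_eq, Real.dist_eq]
      refine (abs_max_sub_max_le_abs _ _ _).trans_eq ?_
      rw [sub_sub_sub_cancel_left, abs_sub_comm]
    obtain ⟨U, hU, α, C, hα, hα1, hC, hUC⟩ := ha_holder i j (φ z) ⟨hmem z hz, hx⟩
    have hφt : Tendsto φ (𝓝 z) (𝓝[Ico 0 T ×ˢ posOrth d] φ z) := by
      refine tendsto_nhdsWithin_iff.2 ⟨hφc.tendsto z, ?_⟩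
      filter_upwards [isOpen_interior_domain.mem_nhds (⟨hz, hx⟩ : z ∈ {z : TX d | _ ∧ _})] with w hw
      exact ⟨hmem w hw.1, hw.2⟩
    have hev : ∀ᶠ w in 𝓝 z, φ w ∈ U := hφt hU
    have hev2 : ∀ᶠ p : TX d × TX d in 𝓝 (z, z), φ p.1 ∈ U ∧ φ p.2 ∈ U :=
      ((continuous_fst.tendsto (z, z)).eventually hev).and
        ((continuous_snd.tendsto (z, z)).eventually hev)
    have hb : (fun p : TX d × TX d => a (max (T - p.1.1) 0) p.1.2 i j -
        a (max (T - p.2.1) 0) p.2.2 i j) =O[𝓝 (z, z)] fun p => dist p.1 p.2 ^ α := by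
      refine Asymptotics.IsBigO.of_bound C ?_
      filter_upwards [hev2] with p hp
      rw [Real.norm_eq_abs, Real.norm_of_nonneg (by positivity)]
      exact (hUC _ hp.1 _ hp.2).trans (mul_le_mul_of_nonneg_left
        (Real.rpow_le_rpow dist_nonneg (hφd _ _) hα.le) hC)
    have hcoord : ∀ k : Fin d, (fun p : TX d × TX d => p.1.2 k - p.2.2 k) =O[𝓝 (z, z)]
        fun p => dist p.1 p.2 ^ α := fun k => by
      refine Asymptotics.IsBigO.trans ?_ (dist_rpow_isBigO hα.le hα1)
      refine Asymptotics.IsBigO.of_bound 1 (Eventually.of_forall fun p => ?_)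
      rw [Real.rpow_one, one_mul, Real.norm_of_nonneg dist_nonneg, ← dist_eq_norm]
      exact (dist_le_pi_dist _ _ k).trans (le_max_right _ _)
    have hbc : ContinuousAt (fun w : TX d => a (max (T - w.1) 0) w.2 i j) z := by
      have hd : Tendsto (fun w : TX d => (w, z)) (𝓝 z) (𝓝 (z, z)) :=
        (by fun_prop : Continuous fun w : TX d => (w, z)).tendsto z
      have h0 : Tendsto (fun p : TX d × TX d => dist p.1 p.2 ^ α) (𝓝 (z, z)) (𝓝 0) := by
        have : Continuous fun p : TX d × TX d => dist p.1 p.2 ^ α :=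
          Continuous.rpow_const (by fun_prop) fun _ => Or.inr hα.le
        simpa [Real.zero_rpow hα.ne'] using this.tendsto (z, z)
      have h1 := (hb.trans_tendsto h0).comp hd
      exact tendsto_sub_nhds_zero_iff.1 h1
    have hcc : ∀ k : Fin d, ContinuousAt (fun w : TX d => w.2 k) z := fun k => by fun_prop
    exact ⟨α, hα, isBigO_sub_mul (isBigO_sub_mul hb (hcoord i) hbc (hcc i)) (hcoord j)
      (hbc.mul (hcc i)) (hcc j)⟩
  · refine ⟨fun i j => ?_, fun y hy => ?_⟩
    · simp only [reversed]
      rw [ha_symm _ (hmem' z hz) _ hx i j]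
      ring
    · have hy' : (fun i => z.2 i * y i) ≠ 0 := fun h => hy <| funext fun i =>
        (mul_eq_zero.1 (congrFun h i)).resolve_left (hx i).ne'
      refine (ha_pd _ (hmem' z hz) _ hx _ hy').trans_eq ?_
      refine Finset.sum_congr rfl fun i _ => Finset.sum_congr rfl fun j _ => ?_
      simp only [reversed]
      ring
  · simp only [reversed]
    rw [mul_assoc, abs_mul, abs_of_pos (mul_pos (hx i) (hx j))]
    exact mul_le_mul_of_nonneg_right ((hCb _ (hmem' z hz) _ hx i j).trans (le_abs_self _))
      (mul_pos (hx i) (hx j)).le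

lemma pd1_eq_of_lineDeriv {U : Set (TX d)} (hU : IsOpen U) {u : TX d → ℝ}
    {ux : Fin d → TX d → ℝ} (hx : ∀ i, ContinuousOn (ux i) U)
    (hd : ∀ i, ∀ z ∈ U, HasLineDerivAt ℝ u (ux i z) z (ex i)) {z : TX d} (hz : z ∈ U) (i : Fin d) :
    pd1 (fun w => u (z.1, w)) i z.2 = ux i z := by
  rw [pd1, (hasFDerivAt_space hU hx hd hz).fderiv]
  simp [Pi.single_apply]

section

variable {U : Set (TX d)} {u ut : TX d → ℝ} {ux : Fin d → TX d → ℝ} {uxx : Fin d → Fin d → TX d → ℝ}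

lemma C12.pd1_eventuallyEq (hU : IsOpen U) (h : C12 U u ut ux uxx) {z : TX d} (hz : z ∈ U)
    (j : Fin d) : pd1 (fun w => u (z.1, w)) j =ᶠ[𝓝 z.2] fun w => ux j (z.1, w) := by
  have hcont : Continuous fun w : Fin d → ℝ => ((z.1, w) : TX d) := by fun_prop
  filter_upwards [hcont.continuousAt.preimage_mem_nhds (hU.mem_nhds hz)] with w hw
  exact pd1_eq_of_lineDeriv hU h.cx h.dx hw j

lemma C12.differentiableAt_pd1 (hU : IsOpen U) (h : C12 U u ut ux uxx) {z : TX d} (hz : z ∈ U)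
    (j : Fin d) : DifferentiableAt ℝ (pd1 (fun w => u (z.1, w)) j) z.2 :=
  (h.pd1_eventuallyEq hU hz j).differentiableAt_iff.2 (hasFDerivAt_space hU (fun i => h.cxx i j)
    (fun i => h.dxx i j) hz).differentiableAt

lemma C12.pd2_eq (hU : IsOpen U) (h : C12 U u ut ux uxx) {z : TX d} (hz : z ∈ U) (i j : Fin d) :
    pd2 (fun w => u (z.1, w)) i j z.2 = uxx i j z := by
  rw [pd2, (h.pd1_eventuallyEq hU hz j).fderiv_eq]
  exact pd1_eq_of_lineDeriv hU (fun i => h.cxx i j) (fun i => h.dxx i j) hz i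

lemma C12.hasDerivAt_time (h : C12 U u ut ux uxx) {z : TX d} (hz : z ∈ U) :
    HasDerivAt (fun τ => u (τ, z.2)) (ut z) z.1 := by
  have h1 : HasDerivAt (fun t : ℝ => u (z + t • et)) (ut z) (z.1 - z.1) := by
    rw [sub_self]; exact h.dt z hz
  have := h1.comp_sub_const z.1 z.1
  refine this.congr_of_eventuallyEq (Eventually.of_forall fun τ => ?_)
  simp only [et]
  congr 1
  ext <;> simp

end

/-- Solutions of the terminal value problem of at most polynomial growth. -/
def IsTVPSol (T : ℝ) (a : ℝ → (Fin d → ℝ) → Fin d → Fin d → ℝ) (f : (Fin d → ℝ) → ℝ)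
    (v : ℝ → (Fin d → ℝ) → ℝ) : Prop :=
  ContinuousOn (fun q : ℝ × (Fin d → ℝ) => v q.1 q.2) (Set.Icc 0 T ×ˢ posOrth d) ∧
    IsC12 (Set.Ico 0 T) (posOrth d) v ∧
    (∀ t ∈ Set.Ico (0 : ℝ) T, ∀ x ∈ posOrth d,
      tderiv (Set.Icc 0 T) v t x
        + (1 / 2) * ∑ i, ∑ j, a t x i j * x i * x j * pd2 (v t) i j x = 0) ∧
    (∀ x ∈ posOrth d, v T x = f x) ∧
    (∃ C q : ℝ, 0 < C ∧ 0 < q ∧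
      ∀ t ∈ Set.Icc (0 : ℝ) T, ∀ x ∈ posOrth d, |v t x| ≤ C * (1 + ‖x‖ ^ q))

lemma reversed_apply {T t : ℝ} (ht : 0 ≤ t) (a : ℝ → (Fin d → ℝ) → Fin d → Fin d → ℝ)
    (x : Fin d → ℝ) (i j : Fin d) : reversed T a (T - t, x) i j = a t x i j * x i * x j := by
  simp only [reversed, sub_sub_cancel, max_eq_left ht]

theorem exists_isTVPSol {T : ℝ} (hT : 0 < T) {a : ℝ → (Fin d → ℝ) → Fin d → Fin d → ℝ} {C : ℝ}
    (hA : Coeff (reversed T a) C) {f : (Fin d → ℝ) → ℝ} (hf : ContinuousOn f (posOrth d))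
    {c₀ p : ℝ} (hc₀ : 0 ≤ c₀) (hp : 0 < p)
    (hfg : ∀ x ∈ posOrth d, |f x| ≤ c₀ * (1 + ‖x‖ ^ p)) : ∃ v, IsTVPSol T a f v := by
  obtain ⟨v, hv, hvc, hv0, hvg⟩ := hA.exists_solution hf hc₀ hp hfg
  obtain ⟨B, q, hB, hq, hBq⟩ := hvg T
  have hrev : Continuous fun z : TX d => ((T - z.1, z.2) : TX d) := by fun_prop
  have hc : ContinuousOn (fun z : TX d => v (T - z.1, z.2)) (Icc 0 T ×ˢ posOrth d) :=
    hvc.comp hrev.continuousOn fun z hz => ⟨sub_nonneg.2 hz.1.2, hz.2⟩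
  have hmaps : MapsTo (fun z : TX d => ((T - z.1, z.2) : TX d)) (Ico 0 T ×ˢ posOrth d)
      {z : TX d | 0 < z.1 ∧ z.2 ∈ posOrth d} := fun z hz => ⟨sub_pos.2 hz.1.2, hz.2⟩
  have hmem : ∀ t ∈ Ico 0 T, ∀ x ∈ posOrth d,
      ((T - t, x) : TX d) ∈ {z : TX d | 0 < z.1 ∧ z.2 ∈ posOrth d} := fun t ht x hx =>
    ⟨sub_pos.2 ht.2, hx⟩
  have htime : ∀ t ∈ Ico 0 T, ∀ x ∈ posOrth d,
      HasDerivAt (fun τ => v (T - τ, x)) (-Dt v (T - t, x)) t := fun t ht x hx =>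
    (hv.c12.hasDerivAt_time (hmem t ht x hx)).comp_const_sub T t
  have hpd2 : ∀ t ∈ Ico 0 T, ∀ x ∈ posOrth d, ∀ i j,
      pd2 (fun y => v (T - t, y)) i j x = Dxx v i j (T - t, x) := fun t ht x hx =>
    hv.c12.pd2_eq isOpen_interior_domain (hmem t ht x hx)
  refine ⟨fun t x => v (T - t, x), hc, ⟨hc.mono (prod_mono_left Ico_subset_Icc_self), ?_, ?_, ?_⟩,
    fun t ht x hx => ?_, fun x hx => ?_, B, q, hB, hq, fun t ht x hx => ?_⟩
  · intro t ht x hx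
    have h1 := hv.c12.hasFDerivAt isOpen_interior_domain (hmem t (interior_subset ht) x hx)
    exact DifferentiableAt.comp (g := v) (f := fun z : TX d => ((T - z.1, z.2) : TX d)) (t, x) h1
      (by fun_prop)
  · exact fun t ht x hx j => hv.c12.differentiableAt_pd1 isOpen_interior_domain
      (hmem t (interior_subset ht) x hx) j
  · refine ⟨fun z => -Dt v (T - z.1, z.2), fun i z => Dx v i (T - z.1, z.2),
      fun i j z => Dxx v i j (T - z.1, z.2), (hv.c12.ct.comp hrev.continuousOn hmaps).neg,
      fun i => (hv.c12.cx i).comp hrev.continuousOn hmaps,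
      fun i j => (hv.c12.cxx i j).comp hrev.continuousOn hmaps, fun t ht x hx => ?_⟩
    have ht' := interior_subset ht
    exact ⟨(htime t ht' x hx).deriv.symm, fun i => (pd1_eq_of_lineDeriv isOpen_interior_domain
      hv.c12.cx hv.c12.dx (hmem t ht' x hx) i).symm, fun i j => (hpd2 t ht' x hx i j).symm⟩
  · rw [tderiv, (htime t ht x hx).hasDerivWithinAt.derivWithin
      (uniqueDiffOn_Icc hT t (Ico_subset_Icc_self ht)), hv.eq _ (hmem t ht x hx)]
    simp only [reversed_apply ht.1, hpd2 t ht x hx]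
    ring
  · simpa using hv0 x hx
  · exact hBq (T - t, x) (sub_nonneg.2 ht.2) (by simpa using ht.1) hx

lemma IsTVPSol.isSol {T : ℝ} {a : ℝ → (Fin d → ℝ) → Fin d → Fin d → ℝ}
    {f : (Fin d → ℝ) → ℝ} {v : ℝ → (Fin d → ℝ) → ℝ} (h : IsTVPSol T a f v) :
    IsSol {z : TX d | 0 < z.1 ∧ z.1 < T ∧ z.2 ∈ posOrth d} (reversed T a)
      (fun z => v (T - z.1) z.2) := by
  obtain ⟨-, hC, heq, -, -⟩ := h
  obtain ⟨gt, gx, gxx, hgt, hgx, hgxx, hg⟩ := hC.derivs_extend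
  rw [interior_Ico] at hg
  set V : Set (TX d) := {z : TX d | 0 < z.1 ∧ z.1 < T ∧ z.2 ∈ posOrth d}
  have hrev : Continuous fun z : TX d => ((T - z.1, z.2) : TX d) := by fun_prop
  have hIoo : ∀ z ∈ V, T - z.1 ∈ Ioo 0 T := fun z hz => ⟨by linarith [hz.2.1], by linarith [hz.1]⟩
  have hmaps : MapsTo (fun z : TX d => ((T - z.1, z.2) : TX d)) V (Ico 0 T ×ˢ posOrth d) :=
    fun z hz => ⟨Ioo_subset_Ico_self (hIoo z hz), hz.2.2⟩
  have hdiff : ∀ z ∈ V, DifferentiableAt ℝ (fun q : TX d => v q.1 q.2) (T - z.1, z.2) :=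
    fun z hz => hC.diff _ (by rw [interior_Ico]; exact hIoo z hz) _ hz.2.2
  have hspace : ∀ z ∈ V, DifferentiableAt ℝ (v (T - z.1)) z.2 := fun z hz =>
    (hdiff z hz).comp z.2 (f := fun y => ((T - z.1, y) : TX d)) (by fun_prop)
  have hline : ∀ (z : TX d) (t : ℝ) (i : Fin d), z + t • ex i = (z.1, z.2 + t • Pi.single i 1) :=
    fun z t i => by simp [ex, Prod.ext_iff]
  refine IsSol.of_C12 (isOpen_slab T) (vt := fun z => -deriv (fun τ => v τ z.2) (T - z.1))
    (vx := fun i z => pd1 (v (T - z.1)) i z.2) (vxx := fun i j z => pd2 (v (T - z.1)) i j z.2)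
    ⟨hC.cont.comp hrev.continuousOn hmaps, ?_, fun i => ?_, fun i j => ?_, fun z hz => ?_,
      fun i z hz => ?_, fun i j z hz => ?_⟩ fun z hz => ?_
  · exact (hgt.comp hrev.continuousOn hmaps).neg.congr fun z hz =>
      congrArg Neg.neg (hg _ (hIoo z hz) _ hz.2.2).1.symm
  · exact ((hgx i).comp hrev.continuousOn hmaps).congr fun z hz =>
      ((hg _ (hIoo z hz) _ hz.2.2).2.1 i).symm
  · exact ((hgxx i j).comp hrev.continuousOn hmaps).congr fun z hz =>
      ((hg _ (hIoo z hz) _ hz.2.2).2.2 i j).symm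
  · have h1 : HasDerivAt (fun τ => v τ z.2) (deriv (fun τ => v τ z.2) (T - z.1)) (T - z.1) :=
      DifferentiableAt.hasDerivAt ((hdiff z hz).comp (T - z.1)
        (f := fun τ => ((τ, z.2) : TX d)) (by fun_prop))
    have h2 : HasDerivAt (fun t : ℝ => v (T - z.1 - t) z.2) (-deriv (fun τ => v τ z.2) (T - z.1))
        0 := HasDerivAt.comp_const_sub (T - z.1) 0 (by rw [sub_zero]; exact h1)
    simpa [HasLineDerivAt, et, sub_sub] using h2
  · have := (hspace z hz).hasFDerivAt.hasLineDerivAt (Pi.single i 1)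
    simpa only [HasLineDerivAt, hline, pd1] using this
  · have := (hC.diff2 _ (by rw [interior_Ico]; exact hIoo z hz) _ hz.2.2 j).hasFDerivAt.hasLineDerivAt
      (Pi.single i 1)
    simpa only [HasLineDerivAt, hline, pd2] using this
  · have h1 := heq _ (Ioo_subset_Ico_self (hIoo z hz)) _ hz.2.2
    rw [tderiv, derivWithin_of_mem_nhds (Icc_mem_nhds (hIoo z hz).1 (hIoo z hz).2)] at h1
    have h2 : ∀ i j, reversed T a z i j = a (T - z.1) z.2 i j * z.2 i * z.2 j := fun i j => by
      simp only [reversed, max_eq_left (hIoo z hz).1.le]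
    simp only [h2]
    linarith

theorem IsTVPSol.unique {T : ℝ} (hT : 0 < T) {a : ℝ → (Fin d → ℝ) → Fin d → Fin d → ℝ} {C : ℝ}
    (hA : Coeff (reversed T a) C) {f : (Fin d → ℝ) → ℝ} {v w : ℝ → (Fin d → ℝ) → ℝ}
    (hv : IsTVPSol T a f v) (hw : IsTVPSol T a f w) :
    ∀ t ∈ Set.Icc (0 : ℝ) T, ∀ x ∈ posOrth d, w t x = v t x := by
  have hsol := hw.isSol.sub (isOpen_slab T) hv.isSol
  obtain ⟨hvc, -, -, hvT, B, q, hB, hq, hvB⟩ := hv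
  obtain ⟨hwc, -, -, hwT, B', q', hB', hq', hwB⟩ := hw
  have hrev : Continuous fun z : TX d => ((T - z.1, z.2) : TX d) := by fun_prop
  have hpow : ∀ (x : Fin d → ℝ) (r s : ℝ), 0 < r → r ≤ s →
      1 + ‖x‖ ^ r ≤ 2 * (1 + ‖x‖ ^ s) := fun x r s hr hrs => by
    have h0 : 0 ≤ ‖x‖ ^ s := by positivity
    rcases le_total ‖x‖ 1 with h | h
    · linarith [Real.rpow_le_one (norm_nonneg x) h hr.le]
    · linarith [Real.rpow_le_rpow_of_exponent_le h hrs]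
  have hpos : ∀ t ∈ Ioc 0 T, ∀ x ∈ posOrth d, w t x = v t x := fun t ht x hx => by
    have hmaps : MapsTo (fun z : TX d => ((T - z.1, z.2) : TX d))
        {z : TX d | 0 ≤ z.1 ∧ z.1 ≤ T - t ∧ z.2 ∈ posOrth d} (Icc 0 T ×ˢ posOrth d) :=
      fun z hz => ⟨⟨by linarith [hz.2.1, ht.1], by linarith [hz.1]⟩, hz.2.2⟩
    have := IsSol.abs_le_barrier (S := T - t) (B := 2 * B' + 2 * B) (q := max q' q) (M := 0)
      (β := 0) (m := 0) hA (by linarith [ht.1]) hsol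
      ((hwc.comp hrev.continuousOn hmaps).sub (hvc.comp hrev.continuousOn hmaps)) (by positivity)
      (lt_max_of_lt_left hq') (fun z h0 hS hz => ?_) le_rfl le_rfl (fun y hy => ?_) (T - t, x)
      (sub_nonneg.2 ht.2) le_rfl hx
    · rw [zero_mul, abs_nonpos_iff, sub_eq_zero] at this
      simpa using this
    · have hz' := hmaps (x := z) ⟨h0, hS, hz⟩
      have h1 := hwB _ hz'.1 _ hz'.2
      have h2 := hvB _ hz'.1 _ hz'.2
      have h3 := mul_le_mul_of_nonneg_left (hpow z.2 q' _ hq' (le_max_left q' q)) hB'.le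
      have h4 := mul_le_mul_of_nonneg_left (hpow z.2 q _ hq (le_max_right q' q)) hB.le
      have h5 := abs_sub (w (T - z.1) z.2) (v (T - z.1) z.2)
      simp only at h1 h2
      linarith
    · simp [hwT y hy, hvT y hy]
  intro t ht x hx
  rcases ht.1.eq_or_lt with rfl | h0
  · have hlim : ∀ u : ℝ → (Fin d → ℝ) → ℝ,
        ContinuousOn (fun q : ℝ × (Fin d → ℝ) => u q.1 q.2) (Icc 0 T ×ˢ posOrth d) →
        Tendsto (fun τ => u τ x) (𝓝[Ioc 0 T] 0) (𝓝 (u 0 x)) := fun u hu => by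
      have h1 : ContinuousOn (fun τ => u τ x) (Icc 0 T) :=
        hu.comp (f := fun τ => ((τ, x) : TX d)) (by fun_prop) fun τ hτ => ⟨hτ, hx⟩
      exact (h1 0 ht).mono Ioc_subset_Icc_self
    have : (𝓝[Ioc 0 T] (0 : ℝ)).NeBot := by
      rw [nhdsWithin_Ioc_eq_nhdsGT hT]; infer_instance
    refine tendsto_nhds_unique (hlim w hwc) ((hlim v hvc).congr' ?_)
    filter_upwards [self_mem_nhdsWithin] with τ hτ
    exact (hpos τ hτ x hx).symm
  · exact hpos t ⟨h0, ht.2⟩ x hx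

end Cauchy

/-- Theorem 2.5 (b): existence and uniqueness, in the class of functions of at most polynomial
growth uniformly in `t`, of solutions of the terminal-value problem (TVP⁺) on `ℝ₊^d`. -/
theorem stmt5 (T : ℝ) (hT : 0 < T) (d : ℕ)
    (a : ℝ → (Fin d → ℝ) → Fin d → Fin d → ℝ)
    (ha_cont : ∀ i j, ContinuousOn (fun p : ℝ × (Fin d → ℝ) => a p.1 p.2 i j)
      (Set.Icc 0 T ×ˢ posOrth d))
    (ha_symm : ∀ t ∈ Set.Icc (0 : ℝ) T, ∀ x ∈ posOrth d, ∀ i j, a t x i j = a t x j i)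
    (ha_pd : ∀ t ∈ Set.Icc (0 : ℝ) T, ∀ x ∈ posOrth d, ∀ y : Fin d → ℝ, y ≠ 0 →
      0 < ∑ i, ∑ j, a t x i j * y i * y j)
    (ha_bdd : ∃ Cb : ℝ, ∀ t ∈ Set.Icc (0 : ℝ) T, ∀ x ∈ posOrth d, ∀ i j, |a t x i j| ≤ Cb)
    (ha_holder : ∀ i j, LocallyHolderOn (fun p : ℝ × (Fin d → ℝ) => a p.1 p.2 i j)
      (Set.Ico 0 T ×ˢ posOrth d))
    (f : (Fin d → ℝ) → ℝ) (hf : ContinuousOn f (posOrth d))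
    (c₀ p : ℝ) (hc₀ : 0 < c₀) (hp : 0 < p)
    (hfg : ∀ x ∈ posOrth d, |f x| ≤ c₀ * (1 + ‖x‖ ^ p)) :
    ∃ v : ℝ → (Fin d → ℝ) → ℝ,
      (ContinuousOn (fun q : ℝ × (Fin d → ℝ) => v q.1 q.2) (Set.Icc 0 T ×ˢ posOrth d) ∧
        IsC12 (Set.Ico 0 T) (posOrth d) v ∧
        (∀ t ∈ Set.Ico (0 : ℝ) T, ∀ x ∈ posOrth d,
          tderiv (Set.Icc 0 T) v t x
            + (1 / 2) * ∑ i, ∑ j, a t x i j * x i * x j * pd2 (v t) i j x = 0) ∧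
        (∀ x ∈ posOrth d, v T x = f x) ∧
        (∃ C q : ℝ, 0 < C ∧ 0 < q ∧
          ∀ t ∈ Set.Icc (0 : ℝ) T, ∀ x ∈ posOrth d, |v t x| ≤ C * (1 + ‖x‖ ^ q))) ∧
      ∀ w : ℝ → (Fin d → ℝ) → ℝ,
        (ContinuousOn (fun q : ℝ × (Fin d → ℝ) => w q.1 q.2) (Set.Icc 0 T ×ˢ posOrth d) ∧
          IsC12 (Set.Ico 0 T) (posOrth d) w ∧
          (∀ t ∈ Set.Ico (0 : ℝ) T, ∀ x ∈ posOrth d,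
            tderiv (Set.Icc 0 T) w t x
              + (1 / 2) * ∑ i, ∑ j, a t x i j * x i * x j * pd2 (w t) i j x = 0) ∧
          (∀ x ∈ posOrth d, w T x = f x) ∧
          (∃ C q : ℝ, 0 < C ∧ 0 < q ∧
            ∀ t ∈ Set.Icc (0 : ℝ) T, ∀ x ∈ posOrth d, |w t x| ≤ C * (1 + ‖x‖ ^ q))) →
        ∀ t ∈ Set.Icc (0 : ℝ) T, ∀ x ∈ posOrth d, w t x = v t x := by
  obtain ⟨C, hA⟩ := reversed_coeff hT ha_symm ha_pd ha_bdd ha_holder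
  obtain ⟨v, hv⟩ := exists_isTVPSol hT hA hf hc₀.le hp hfg
  exact ⟨v, hv, fun w hw => IsTVPSol.unique hT hA hv hw⟩
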